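/- Let R > 0, 1 < r, s < ∞, 0 < θ ≤ ∞, and suppose u ∈ W^{1,s}(B_R; Λ^k ℝ^n ⊗ ℝ^N) solves the boundary value problem du = f and δu = g in B_R with ν ∧ u = 0 on ∂B_R. If f ∈ L^{(r,θ)}(B_R; Λ^{k+1}) and g ∈ L^{(r,θ)}(B_R; Λ^{k−1}), then u ∈ W^{1,(r,θ)}(B_R) and there is a constant c = c(n,N,k,θ) > 0 with ‖∇u‖_{L^{(r,θ)}(B_R)} ≤ c ( ‖f‖_{L^{(r,θ)}(B_R)} + ‖g‖_{L^{(r,θ)}(B_R)} ), with no term in u on the right-hand side. -/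

import Mathlib

open MeasureTheory Metric Filter
open scoped ENNReal NNReal

noncomputable section

/-- Euclidean space `ℝ^n`. -/
abbrev En (n : ℕ) : Type := EuclideanSpace ℝ (Fin n)

/-- Index set for the coefficients of a `k`-form on `ℝ^n`: increasing multi-indices,
identified with `k`-element subsets of `Fin n`. -/
abbrev FormIdx (n k : ℕ) : Type := {s : Finset (Fin n) // s.card = k}

/-- An `ℝ^N`-valued `k`-covector on `ℝ^n`, described by its coefficients. -/
abbrev Form (n N k : ℕ) : Type := FormIdx n k × Fin N → ℝ

variable {n N k : ℕ}

/-- Euclidean inner product of two (vector-valued) forms. -/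
def finner (v w : Form n N k) : ℝ := ∑ q, v q * w q

/-- Euclidean norm of a (vector-valued) form. -/
def fnorm (v : Form n N k) : ℝ := Real.sqrt (∑ q, v q ^ 2)

/-- Euclidean norm of a full array of partial derivatives (a gradient). -/
def gnorm (H : Fin n → Form n N k) : ℝ := Real.sqrt (∑ i, ∑ q, H i q ^ 2)

/-- The pointwise exterior derivative of a `k`-form, assembled from the array
`G i = ∂_i u` of its partial derivatives. -/
def extD (G : Fin n → Form n N k) : Form n N (k + 1) := fun q =>
  ∑ i : Fin n,
    if h : i ∈ q.1.1 then
      (-1 : ℝ) ^ (q.1.1.filter (fun j => j < i)).card *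
        G i (⟨q.1.1.erase i, by simp [Finset.card_erase_of_mem h, q.1.2]⟩, q.2)
    else 0

/-- The pointwise codifferential of a `(k+1)`-form, assembled from the array
`G i = ∂_i u` of its partial derivatives. -/
def codiff (G : Fin n → Form n N (k + 1)) : Form n N k := fun q =>
  -∑ i : Fin n,
      if h : i ∈ q.1.1 then 0
      else
        (-1 : ℝ) ^ (q.1.1.filter (fun j => j < i)).card *
          G i (⟨insert i q.1.1, by simp [Finset.card_insert_of_notMem h, q.1.2]⟩, q.2)

/-- The nonlinearity `z ↦ t |z|^{p-2} z`. -/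
def nl (p t : ℝ) (z : Form n N k) : Form n N k := fun q => t * fnorm z ^ (p - 2) * z q

/-- The auxiliary map `V(z) = |z|^{(p-2)/2} z`. -/
def Vform (p : ℝ) (z : Form n N k) : Form n N k := fun q => fnorm z ^ ((p - 2) / 2) * z q

/-- The `i`-th standard basis vector of `ℝ^n`. -/
def basisVec (i : Fin n) : En n := EuclideanSpace.single i 1

/-- Scalar test functions: smooth and compactly supported inside `Ω`. -/
def IsTestFun (Ω : Set (En n)) (φ : En n → ℝ) : Prop :=
  ContDiff ℝ (⊤ : ℕ∞) φ ∧ HasCompactSupport φ ∧ tsupport φ ⊆ Ω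

/-- Test `k`-forms: componentwise smooth and compactly supported inside `Ω`. -/
def IsTestForm (Ω : Set (En n)) (φ : En n → Form n N k) : Prop :=
  (∀ q, ContDiff ℝ (⊤ : ℕ∞) fun x => φ x q) ∧ HasCompactSupport φ ∧ tsupport φ ⊆ Ω

/-- The (classical) array of partial derivatives of a form-valued map. -/
def smoothGrad (φ : En n → Form n N k) (x : En n) : Fin n → Form n N k := fun i q =>
  fderiv ℝ (fun y => φ y q) x (basisVec i)

/-- `g` is the weak (distributional) `i`-th partial derivative of `u` on `Ω`. -/
def HasWeakPartial (Ω : Set (En n)) (u g : En n → ℝ) (i : Fin n) : Prop :=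
  ∀ φ : En n → ℝ, IsTestFun Ω φ →
    ∫ x in Ω, u x * fderiv ℝ φ x (basisVec i) = -∫ x in Ω, g x * φ x

/-- `G` is the weak gradient (array of weak partial derivatives) of the form `u` on `Ω`. -/
def HasWeakGrad (Ω : Set (En n)) (u : En n → Form n N k)
    (G : En n → Fin n → Form n N k) : Prop :=
  ∀ i q, HasWeakPartial Ω (fun x => u x q) (fun x => G x i q) i

/-- Membership in `W^{1,p}(Ω)` for a form `u` with weak gradient `G`. -/
def MemW1p (Ω : Set (En n)) (p : ℝ) (u : En n → Form n N k)
    (G : En n → Fin n → Form n N k) : Prop :=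
  HasWeakGrad Ω u G ∧
    (∀ q, AEStronglyMeasurable (fun x => u x q) (volume.restrict Ω)) ∧
    (∀ i q, AEStronglyMeasurable (fun x => G x i q) (volume.restrict Ω)) ∧
    IntegrableOn (fun x => fnorm (u x) ^ p) Ω volume ∧
    IntegrableOn (fun x => gnorm (G x) ^ p) Ω volume

/-- Membership in `W^{1,p}_loc(Ω)` for a form `u` with weak gradient `G`. -/
def MemW1pLoc (Ω : Set (En n)) (p : ℝ) (u : En n → Form n N k)
    (G : En n → Fin n → Form n N k) : Prop :=
  HasWeakGrad Ω u G ∧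
    (∀ q, AEStronglyMeasurable (fun x => u x q) (volume.restrict Ω)) ∧
    (∀ i q, AEStronglyMeasurable (fun x => G x i q) (volume.restrict Ω)) ∧
    ∀ K, K ⊆ Ω → IsCompact K →
      IntegrableOn (fun x => fnorm (u x) ^ p) K volume ∧
      IntegrableOn (fun x => gnorm (G x) ^ p) K volume

/-- `δ f = 0` on `Ω` in the sense of distributions: `∫ ⟨f, dψ⟩ = 0` for every smooth
compactly supported form `ψ` of degree one less. (Vacuous for `0`-forms.) -/
def WeaklyCoclosed (Ω : Set (En n)) (f : En n → Form n N k) : Prop :=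
  ∀ (j : ℕ) (h : j + 1 = k) (ψ : En n → Form n N j), IsTestForm Ω ψ →
    ∫ x in Ω, finner (f x) (cast (congrArg (Form n N) h) (extD (smoothGrad ψ x))) = 0

/-- Weak formulation of the vanishing of the tangential part `ν ∧ u = 0` on `∂B`:
the integration-by-parts formula `∫_B ⟨du, ψ⟩ = ∫_B ⟨u, δψ⟩` holds without boundary
contribution for every smooth `(k+1)`-form `ψ`. -/
def TangentialZero (B : Set (En n)) (u : En n → Form n N k)
    (G : En n → Fin n → Form n N k) : Prop :=
  ∀ ψ : En n → Form n N (k + 1), (∀ q, ContDiff ℝ (⊤ : ℕ∞) fun x => ψ x q) →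
    ∫ x in B, finner (extD (G x)) (ψ x) = ∫ x in B, finner (u x) (codiff (smoothGrad ψ x))

/-- The space `W^{1,p}_{δ,T}(B)`: `W^{1,p}` forms which are weakly coclosed in `B` and
have vanishing tangential part on `∂B`. -/
def MemWdeltaT (B : Set (En n)) (p : ℝ) (u : En n → Form n N k)
    (G : En n → Fin n → Form n N k) : Prop :=
  MemW1p B p u G ∧ WeaklyCoclosed B u ∧ TangentialZero B u G

/-- `u` (with weak gradient `G`) is a local weak solution of
`δ(a(x) |du|^{p-2} du) = f` on `Ω`. -/
def IsLocalWeakSolution (Ω : Set (En n)) (p : ℝ) (a : En n → ℝ)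
    (u : En n → Form n N k) (G : En n → Fin n → Form n N k)
    (f : En n → Form n N k) : Prop :=
  ∀ φ : En n → Form n N k, IsTestForm Ω φ →
    ∫ x in Ω, finner (nl p (a x) (extD (G x))) (extD (smoothGrad φ x)) =
      ∫ x in Ω, finner (f x) (φ x)

/-- The Lorentz (quasi-)norm `‖g‖_{L^{(p,θ)}(μ)}`. -/
def lorentzNorm {α : Type*} [MeasurableSpace α] (μ : Measure α) (p : ℝ) (θ : ℝ≥0∞)
    (g : α → ℝ) : ℝ≥0∞ :=
  if θ = ⊤ then
    (⨆ t : ℝ, if 0 < t then ENNReal.ofReal (t ^ p) * μ {x | t < |g x|} else 0) ^ (1 / p)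
  else
    (∫⁻ t in Set.Ioi (0 : ℝ),
        (ENNReal.ofReal (t ^ p) * μ {x | t < |g x|}) ^ (θ.toReal / p) / ENNReal.ofReal t) ^
      (1 / θ.toReal)

/-- Membership in the Lorentz space `L^{(p,θ)}(s)`. -/
def MemLorentzOn {α : Type*} [MeasurableSpace α] (μ : Measure α) (p : ℝ) (θ : ℝ≥0∞)
    (g : α → ℝ) (s : Set α) : Prop :=
  AEStronglyMeasurable g (μ.restrict s) ∧ lorentzNorm (μ.restrict s) p θ g ≠ ⊤

/-- Local membership in the Lorentz space `L^{(p,θ)}` on the open set `Ω`. -/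
def MemLorentzLoc (p : ℝ) (θ : ℝ≥0∞) (g : En n → ℝ) (Ω : Set (En n)) : Prop :=
  ∀ K, K ⊆ Ω → IsCompact K → MemLorentzOn volume p θ g K

/-- The `L^s` norm of a scalar function on a set, valued in `ℝ≥0∞`. -/
def lpNormOn (s : ℝ) (g : En n → ℝ) (A : Set (En n)) : ℝ≥0∞ :=
  (∫⁻ x in A, ENNReal.ofReal (|g x| ^ s)) ^ (1 / s)

/-- A Dini modulus of continuity. -/
def IsDiniModulus (ω : ℝ → ℝ) : Prop :=
  (∀ t, 0 ≤ ω t) ∧ MonotoneOn ω (Set.Ici 0) ∧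
    IntegrableOn (fun t => ω t / t) (Set.Ioc 0 1) volume ∧
    Tendsto ω (nhdsWithin 0 (Set.Ioi 0)) (nhds 0)

/-- `ω` is a modulus of continuity for `a` on `Ω`. -/
def IsModulusFor (ω : ℝ → ℝ) (a : En n → ℝ) (Ω : Set (En n)) : Prop :=
  ∀ x ∈ Ω, ∀ y ∈ Ω, |a x - a y| ≤ ω ‖x - y‖

/-- Dini continuity on `Ω`. -/
def DiniContinuousOn (a : En n → ℝ) (Ω : Set (En n)) : Prop :=
  ∃ ω, IsDiniModulus ω ∧ IsModulusFor ω a Ω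

/-- `a` is `α`-Hölder with constant `C` on `s`. -/
def HolderOn (α C : ℝ) (a : En n → ℝ) (s : Set (En n)) : Prop :=
  ∀ x ∈ s, ∀ y ∈ s, |a x - a y| ≤ C * ‖x - y‖ ^ α

/-- `g` agrees a.e. on `Ω` with a function continuous on `Ω`. -/
def HasContinuousRepOn {V : Type*} [TopologicalSpace V] (Ω : Set (En n)) (g : En n → V) :
    Prop :=
  ∃ v : En n → V, ContinuousOn v Ω ∧ ∀ᵐ x ∂volume.restrict Ω, g x = v x

/-- `g` has locally vanishing mean oscillation in `Ω`. -/
def LocallyVMOOn {V : Type*} [NormedAddCommGroup V] [NormedSpace ℝ V] (Ω : Set (En n))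
    (g : En n → V) : Prop :=
  ∀ K, K ⊆ Ω → IsCompact K → ∀ ε > 0, ∃ r₀ > 0, ∀ x ∈ K, ∀ r, 0 < r → r ≤ r₀ →
    (⨍ y in ball x r, ‖g y - ⨍ z in ball x r, g z‖) ≤ ε

/-- `g` has locally bounded mean oscillation in `Ω`. -/
def LocallyBMOOn {V : Type*} [NormedAddCommGroup V] [NormedSpace ℝ V] (Ω : Set (En n))
    (g : En n → V) : Prop :=
  ∀ K, K ⊆ Ω → IsCompact K → ∃ C : ℝ, ∃ r₀ > 0, ∀ x ∈ K, ∀ r, 0 < r → r ≤ r₀ →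
    (⨍ y in ball x r, ‖g y - ⨍ z in ball x r, g z‖) ≤ C

/-- The `p`-th power of the Campanato seminorm `[u]^p_{𝓛^{p,λ}(s)}`, valued in `ℝ≥0∞`. -/
def campanatoSemi {V : Type*} [NormedAddCommGroup V] [NormedSpace ℝ V] (p lam : ℝ)
    (s : Set (En n)) (u : En n → V) : ℝ≥0∞ :=
  ⨆ (x₀ : En n) (_ : x₀ ∈ closure s) (ρ : ℝ) (_ : 0 < ρ),
    ENNReal.ofReal
      (ρ ^ (-lam) * ∫ y in ball x₀ ρ ∩ s, ‖u y - ⨍ z in ball x₀ ρ ∩ s, u z‖ ^ p)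

/-- The Campanato norm `‖u‖_{𝓛^{p,λ}(s)} = ‖u‖_{L^p(s)} + [u]_{𝓛^{p,λ}(s)}`. -/
def campanatoNorm {V : Type*} [NormedAddCommGroup V] [NormedSpace ℝ V] (p lam : ℝ)
    (s : Set (En n)) (u : En n → V) : ℝ≥0∞ :=
  (∫⁻ y in s, ENNReal.ofReal (‖u y‖ ^ p)) ^ (1 / p) + campanatoSemi p lam s u ^ (1 / p)

/-- Membership in the Campanato space `𝓛^{p,λ}(s)`. -/
def MemCampanatoOn {V : Type*} [NormedAddCommGroup V] [NormedSpace ℝ V] (p lam : ℝ)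
    (s : Set (En n)) (u : En n → V) : Prop :=
  AEStronglyMeasurable u (volume.restrict s) ∧
    IntegrableOn (fun y => ‖u y‖ ^ p) s volume ∧ campanatoSemi p lam s u ≠ ⊤

/-- Local membership in the Campanato space `𝓛^{p,λ}` on `Ω`. -/
def MemCampanatoLoc {V : Type*} [NormedAddCommGroup V] [NormedSpace ℝ V] (p lam : ℝ)
    (Ω : Set (En n)) (u : En n → V) : Prop :=
  ∀ K, K ⊆ Ω → IsCompact K → MemCampanatoOn p lam K u

/-- `v` is of class `C^{1,θ}` locally on `Ω`. -/
def C1HolderLocOn {V : Type*} [NormedAddCommGroup V] [NormedSpace ℝ V] (θ : ℝ)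
    (Ω : Set (En n)) (v : En n → V) : Prop :=
  ∃ Dv : En n → En n →L[ℝ] V, (∀ x ∈ Ω, HasFDerivAt v (Dv x) x) ∧
    ∀ K, K ⊆ Ω → IsCompact K →
      ∃ C : ℝ, 0 ≤ C ∧ ∀ x ∈ K, ∀ y ∈ K, ‖Dv x - Dv y‖ ≤ C * ‖x - y‖ ^ θ

/-- Local membership in `L^q` for a form-valued map. -/
def MemLqLoc (q : ℝ) (f : En n → Form n N k) (Ω : Set (En n)) : Prop :=
  (∀ r, AEStronglyMeasurable (fun x => f x r) (volume.restrict Ω)) ∧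
    ∀ K, K ⊆ Ω → IsCompact K → IntegrableOn (fun x => fnorm (f x) ^ q) K volume

/-- `x` is a Lebesgue point of the form-valued map `g`. -/
def IsLebesguePoint (g : En n → Form n N k) (x : En n) : Prop :=
  Tendsto (fun r => ⨍ y in ball x r, fnorm (g y - g x)) (nhdsWithin 0 (Set.Ioi 0)) (nhds 0)

/-- dyadic weights -/
def wt (σ : ℝ) (k : ℤ) : ℝ≥0∞ := (2 : ℝ≥0∞) ^ (-(σ * |(k : ℝ)|))

lemma two_rpow_ne_top (x : ℝ) : (2 : ℝ≥0∞) ^ x ≠ ⊤ :=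
  ENNReal.rpow_ne_top_of_ne_zero (by norm_num) (by norm_num)

lemma two_rpow_ne_zero (x : ℝ) : (2 : ℝ≥0∞) ^ x ≠ 0 := by
  simp [ENNReal.rpow_eq_zero_iff]

lemma two_rpow_add (x y : ℝ) : (2 : ℝ≥0∞) ^ (x + y) = 2 ^ x * 2 ^ y :=
  ENNReal.rpow_add _ _ (by norm_num) (by norm_num)

lemma wt_neg (σ : ℝ) (k : ℤ) : wt σ (-k) = wt σ k := by
  simp [wt]

lemma wt_sum (σ : ℝ) (hσ : 0 < σ) : ∑' k : ℤ, wt σ k ≠ ⊤ := by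
  have h1 : Summable (fun k : ℤ => (2 : ℝ) ^ (-(σ * |(k : ℝ)|))) := by
    have hg : Summable (fun k : ℕ => (2 : ℝ) ^ (-(σ * (k : ℝ)))) := by
      have : ∀ k : ℕ, (2 : ℝ) ^ (-(σ * (k : ℝ))) = ((2 : ℝ) ^ (-σ)) ^ k := by
        intro k
        rw [← Real.rpow_natCast, ← Real.rpow_mul (by norm_num)]
        congr 1; ring
      simp_rw [this]
      apply summable_geometric_of_lt_one (by positivity)
      exact Real.rpow_lt_one_of_one_lt_of_neg (by norm_num) (by linarith)
    apply Summable.of_nat_of_neg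
    · simpa using hg
    · simpa using hg
  have h2 : ∀ k : ℤ, wt σ k = ENNReal.ofReal ((2 : ℝ) ^ (-(σ * |(k : ℝ)|))) := by
    intro k
    rw [wt, ← ENNReal.ofReal_rpow_of_pos (by norm_num)]
    simp
  simp_rw [h2]
  exact h1.tsum_ofReal_ne_top

lemma wt_sum_shift (σ : ℝ) (j : ℤ) : ∑' i : ℤ, wt σ (i - j) = ∑' k : ℤ, wt σ k := by
  exact (Equiv.subRight j).tsum_eq (fun k => wt σ k)

lemma wt_sum_shift' (σ : ℝ) (i : ℤ) : ∑' j : ℤ, wt σ (i - j) = ∑' k : ℤ, wt σ k := by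
  exact (Equiv.subLeft i).tsum_eq (fun k => wt σ k)

lemma wt_rpow (σ q : ℝ) (k : ℤ) : wt σ k ^ q = wt (σ * q) k := by
  rw [wt, wt, ← ENNReal.rpow_mul]; congr 1; ring

lemma wt_half (σ : ℝ) (k : ℤ) : wt σ k = wt (σ/2) k * wt (σ/2) k := by
  rw [wt, wt, ← two_rpow_add]; congr 1; ring

/-- discrete convolution bound, sum form -/
lemma disc_conv (σ q : ℝ) (hσ : 0 < σ) (hq : 0 < q) (C : ℝ≥0∞) (hC : C ≠ ⊤) :
    ∃ C' : ℝ≥0∞, C' ≠ ⊤ ∧ ∀ A B : ℤ → ℝ≥0∞,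
      (∀ j, A j ≤ C * ∑' i, wt σ (i - j) * B i) → ∑' j, A j ^ q ≤ C' * ∑' i, B i ^ q := by
  set W := ∑' k : ℤ, wt (σ/2) k
  have hW : W ≠ ⊤ := wt_sum _ (by linarith)
  refine ⟨(C * W) ^ q * ∑' k : ℤ, wt (σ/2*q) k,
    ENNReal.mul_ne_top (ENNReal.rpow_ne_top_of_nonneg hq.le (ENNReal.mul_ne_top hC hW))
      (wt_sum _ (by positivity)), ?_⟩
  intro A B h
  have h1 : ∀ j, A j ^ q ≤ (C * W) ^ q * ∑' i, wt (σ/2*q) (i-j) * B i ^ q := by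
    intro j
    have h2 : ∑' i, wt σ (i - j) * B i ≤ W * ⨆ i, (wt (σ/2) (i-j) * B i) := by
      rw [show W = _ from (wt_sum_shift (σ/2) j).symm, ← ENNReal.tsum_mul_right]
      refine ENNReal.tsum_le_tsum fun i => ?_
      rw [wt_half, mul_assoc]
      gcongr
      exact le_iSup (fun i => wt (σ/2) (i-j) * B i) i
    calc A j ^ q ≤ (C * (W * ⨆ i, (wt (σ/2) (i-j) * B i))) ^ q := by
          gcongr
          exact (h j).trans (by gcongr)
      _ = (C * W) ^ q * (⨆ i, (wt (σ/2) (i-j) * B i)) ^ q := by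
          rw [← mul_assoc, ENNReal.mul_rpow_of_nonneg _ _ hq.le]
      _ = (C * W) ^ q * (⨆ i, (wt (σ/2) (i-j) * B i) ^ q) := by
          congr 1
          exact (ENNReal.orderIsoRpow q hq).map_iSup _
      _ ≤ _ := by
          gcongr
          refine iSup_le fun i => ?_
          refine le_trans ?_ (ENNReal.le_tsum i)
          rw [ENNReal.mul_rpow_of_nonneg _ _ hq.le, wt_rpow]
  calc ∑' j, A j ^ q ≤ ∑' j, (C * W) ^ q * ∑' i, wt (σ/2*q) (i-j) * B i ^ q :=
        ENNReal.tsum_le_tsum h1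
    _ = (C * W) ^ q * ∑' i, ∑' j, wt (σ/2*q) (i-j) * B i ^ q := by
        rw [ENNReal.tsum_mul_left, ENNReal.tsum_comm]
    _ = _ := by
        simp_rw [ENNReal.tsum_mul_right, wt_sum_shift', ENNReal.tsum_mul_left]
        rw [mul_assoc]

/-- discrete convolution bound, sup form -/
lemma disc_conv_sup (σ : ℝ) (hσ : 0 < σ) (C : ℝ≥0∞) (hC : C ≠ ⊤) :
    ∃ C' : ℝ≥0∞, C' ≠ ⊤ ∧ ∀ A B : ℤ → ℝ≥0∞,
      (∀ j, A j ≤ C * ∑' i, wt σ (i - j) * B i) → ⨆ j, A j ≤ C' * ⨆ i, B i := by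
  refine ⟨C * ∑' k : ℤ, wt σ k, ENNReal.mul_ne_top hC (wt_sum _ hσ), ?_⟩
  intro A B h
  refine iSup_le fun j => (h j).trans ?_
  rw [mul_assoc]
  gcongr
  rw [← wt_sum_shift _ j, ← ENNReal.tsum_mul_right]
  refine ENNReal.tsum_le_tsum fun i => ?_
  gcongr
  exact le_iSup B i

section
variable {α : Type*} [MeasurableSpace α]

/-- dyadic distribution sequence -/
def dd (μ : Measure α) (r : ℝ) (F : α → ℝ) (j : ℤ) : ℝ≥0∞ :=
  ENNReal.ofReal (((2 : ℝ) ^ j) ^ r) * μ {x | (2 : ℝ) ^ j < |F x|}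

lemma iUnion_Ioc : Set.Ioi (0 : ℝ) = ⋃ j : ℤ, Set.Ioc ((2:ℝ)^j) ((2:ℝ)^(j+1)) := by
  ext t
  simp only [Set.mem_Ioi, Set.mem_iUnion]
  constructor
  · intro h; exact exists_mem_Ioc_zpow h (by norm_num)
  · rintro ⟨j, hj⟩; exact lt_trans (by positivity) hj.1

lemma disj_Ioc : Pairwise (Function.onFun Disjoint
    fun j : ℤ => Set.Ioc ((2:ℝ)^j) ((2:ℝ)^(j+1))) := by
  have : Monotone (fun j : ℤ => (2:ℝ)^j) := fun a b h => zpow_le_zpow_right₀ (by norm_num) h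
  exact this.pairwise_disjoint_on_Ioc_succ

lemma vol_Ioc (j : ℤ) : volume (Set.Ioc ((2:ℝ)^j) ((2:ℝ)^(j+1))) = ENNReal.ofReal ((2:ℝ)^j) := by
  rw [Real.volume_Ioc, zpow_add_one₀ (by norm_num)]; congr 1; ring

lemma upper_point (μ : Measure α) (r : ℝ) (hr : 0 < r) (F : α → ℝ) (j : ℤ) (t : ℝ)
    (ht : t ∈ Set.Ioc ((2:ℝ)^j) ((2:ℝ)^(j+1))) :
    ENNReal.ofReal (t ^ r) * μ {x | t < |F x|} ≤ ENNReal.ofReal (2 ^ r) * dd μ r F j := by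
  have h0 : (0:ℝ) < 2 ^ j := by positivity
  rw [dd, ← mul_assoc, ← ENNReal.ofReal_mul (by positivity), ← Real.mul_rpow (by norm_num) h0.le]
  gcongr
  · exact (h0.trans ht.1).le
  · have := ht.2; rw [zpow_add_one₀ (by norm_num)] at this; linarith
  · exact ht.1.le

lemma lower_point (μ : Measure α) (r : ℝ) (hr : 0 < r) (F : α → ℝ) (j : ℤ) (t : ℝ)
    (ht : t ∈ Set.Ioc ((2:ℝ)^j) ((2:ℝ)^(j+1))) :
    dd μ r F (j+1) ≤ ENNReal.ofReal (2 ^ r) * (ENNReal.ofReal (t ^ r) * μ {x | t < |F x|}) := by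
  have h0 : (0:ℝ) < 2 ^ j := by positivity
  have ht0 := h0.trans ht.1
  rw [dd, ← mul_assoc, ← ENNReal.ofReal_mul (by positivity), ← Real.mul_rpow (by norm_num) ht0.le]
  gcongr
  · rw [zpow_add_one₀ (by norm_num)]; linarith [ht.1]
  · exact ht.2

lemma lorentz_le_dd (μ : Measure α) (r q : ℝ) (hr : 0 < r) (hq : 0 < q) (F : α → ℝ) :
    ∫⁻ t in Set.Ioi (0 : ℝ),
        (ENNReal.ofReal (t ^ r) * μ {x | t < |F x|}) ^ q / ENNReal.ofReal t ≤
      ENNReal.ofReal (2 ^ r) ^ q * ∑' j, dd μ r F j ^ q := by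
  rw [iUnion_Ioc, lintegral_iUnion (fun _ => measurableSet_Ioc) disj_Ioc, ← ENNReal.tsum_mul_left]
  refine ENNReal.tsum_le_tsum fun j => ?_
  have h0 : (0:ℝ) < 2 ^ j := by positivity
  calc _ ≤ ∫⁻ t in Set.Ioc ((2:ℝ)^j) ((2:ℝ)^(j+1)),
        (ENNReal.ofReal (2 ^ r) * dd μ r F j) ^ q / ENNReal.ofReal ((2:ℝ)^j) := by
        refine setLIntegral_mono' measurableSet_Ioc fun t ht => ?_
        have := upper_point μ r hr F j t ht
        have := ht.1.le
        apply ENNReal.div_le_div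
        · gcongr
        · gcongr
    _ = _ := by
        rw [setLIntegral_const, vol_Ioc, ENNReal.div_mul_cancel,
          ENNReal.mul_rpow_of_nonneg _ _ hq.le]
        · simpa using h0
        · simp

lemma dd_le_lorentz (μ : Measure α) (r q : ℝ) (hr : 0 < r) (hq : 0 < q) (F : α → ℝ) :
    ∑' j, dd μ r F j ^ q ≤ (2 * ENNReal.ofReal (2 ^ r) ^ q) *
    ∫⁻ t in Set.Ioi (0 : ℝ),
        (ENNReal.ofReal (t ^ r) * μ {x | t < |F x|}) ^ q / ENNReal.ofReal t := by
  rw [iUnion_Ioc, lintegral_iUnion (fun _ => measurableSet_Ioc) disj_Ioc, ← ENNReal.tsum_mul_left,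
    ← (Equiv.addRight (1:ℤ)).tsum_eq (fun j => dd μ r F j ^ q)]
  refine ENNReal.tsum_le_tsum fun j => ?_
  have h0 : (0:ℝ) < 2 ^ j := by positivity
  have h1 : (0:ℝ) < 2 ^ (j+1) := by positivity
  have hne : (2 * ENNReal.ofReal (2 ^ r) ^ q) ≠ ⊤ :=
    ENNReal.mul_ne_top (by norm_num) (ENNReal.rpow_ne_top_of_nonneg hq.le (by simp))
  calc dd μ r F (j+1) ^ q = ∫⁻ t in Set.Ioc ((2:ℝ)^j) ((2:ℝ)^(j+1)),
          dd μ r F (j+1) ^ q / ENNReal.ofReal ((2:ℝ)^j) := by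
        rw [setLIntegral_const, vol_Ioc, ENNReal.div_mul_cancel]
        · simpa using h0
        · simp
    _ ≤ ∫⁻ t in Set.Ioc ((2:ℝ)^j) ((2:ℝ)^(j+1)), (2 * ENNReal.ofReal (2 ^ r) ^ q) *
        ((ENNReal.ofReal (t ^ r) * μ {x | t < |F x|}) ^ q / ENNReal.ofReal t) := by
        refine setLIntegral_mono' measurableSet_Ioc fun t ht => ?_
        have ht0 := h0.trans ht.1
        have e1 := lower_point μ r hr F j t ht
        have e2 : (ENNReal.ofReal ((2:ℝ)^j))⁻¹ ≤ 2 * (ENNReal.ofReal t)⁻¹ := by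
          rw [← ENNReal.ofReal_inv_of_pos h0, ← ENNReal.ofReal_inv_of_pos ht0]
          have : (2:ℝ≥0∞) = ENNReal.ofReal 2 := by simp
          rw [this, ← ENNReal.ofReal_mul (by norm_num)]
          apply ENNReal.ofReal_le_ofReal
          have := ht.2
          rw [zpow_add_one₀ (by norm_num)] at this
          rw [← div_eq_mul_inv, inv_eq_one_div, div_le_div_iff₀ h0 ht0]; linarith
        rw [div_eq_mul_inv, div_eq_mul_inv]
        calc _ ≤ (ENNReal.ofReal (2 ^ r) * (ENNReal.ofReal (t ^ r) * μ {x | t < |F x|})) ^ q *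
              (2 * (ENNReal.ofReal t)⁻¹) := by gcongr
          _ = _ := by rw [ENNReal.mul_rpow_of_nonneg _ _ hq.le]; ring
    _ = _ := by rw [lintegral_const_mul' _ _ hne]

lemma add_rpow_le (a b : ℝ≥0∞) (q : ℝ) (hq : 0 < q) :
    (a + b) ^ q ≤ 2 ^ q * (a ^ q + b ^ q) := by
  rcases le_total a b with h | h
  · calc (a + b) ^ q ≤ (2 * b) ^ q := by gcongr; rw [two_mul]; gcongr
      _ = 2 ^ q * b ^ q := ENNReal.mul_rpow_of_nonneg _ _ hq.le
      _ ≤ _ := by gcongr; exact le_add_self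
  · calc (a + b) ^ q ≤ (2 * a) ^ q := by gcongr; rw [two_mul]; gcongr
      _ = 2 ^ q * a ^ q := ENNReal.mul_rpow_of_nonneg _ _ hq.le
      _ ≤ _ := by gcongr; exact le_self_add

/-- the abstract Lorentz transfer from the dyadic inequality -/
lemma lorentz_transfer (r σ : ℝ) (hr : 0 < r) (hσ : 0 < σ) (θ : ℝ≥0∞) (hθ : 0 < θ) (C : ℝ≥0∞)
    (hC : C ≠ ⊤) : ∃ C' : ℝ≥0∞, C' ≠ ⊤ ∧ ∀ {α : Type} [MeasurableSpace α] (μ : Measure α)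
      (F f g : α → ℝ),
      (∀ j, dd μ r F j ≤ C * ∑' i, wt σ (i - j) * (dd μ r f i + dd μ r g i)) →
      lorentzNorm μ r θ F ≤ C' * (lorentzNorm μ r θ f + lorentzNorm μ r θ g) := by
  by_cases hT : θ = ⊤
  · subst hT
    obtain ⟨C1, hC1, h1⟩ := disc_conv_sup σ hσ C hC
    have hr' : 0 < 1 / r := by positivity
    refine ⟨(ENNReal.ofReal (2 ^ r) * C1 * 2) ^ (1 / r) * (2:ℝ≥0∞) ^ (1 / r),
      ENNReal.mul_ne_top (ENNReal.rpow_ne_top_of_nonneg hr'.le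
        (ENNReal.mul_ne_top (ENNReal.mul_ne_top (by simp) hC1) (by norm_num))) (two_rpow_ne_top _), ?_⟩
    intro α _ μ F f g h
    have h2 := h1 _ _ h
    have hlow : ∀ f : α → ℝ, ∀ j, dd μ r f j ≤ (⨆ t : ℝ, if 0 < t then ENNReal.ofReal (t ^ r) * μ {x | t < |f x|} else 0) := by
      intro f j
      refine le_trans ?_ (le_iSup _ ((2:ℝ)^j))
      rw [if_pos (by positivity)]; rfl
    have hup : (⨆ t : ℝ, if 0 < t then ENNReal.ofReal (t ^ r) * μ {x | t < |F x|} else 0) ≤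
        ENNReal.ofReal (2 ^ r) * ⨆ j, dd μ r F j := by
      refine iSup_le fun t => ?_
      split_ifs with ht
      · obtain ⟨j, hj⟩ := exists_mem_Ioc_zpow ht (by norm_num : (1:ℝ) < 2)
        refine (upper_point μ r hr F j t hj).trans ?_
        gcongr
        exact le_iSup (dd μ r F) j
      · simp
    simp only [lorentzNorm, if_true]
    set SF := (⨆ t : ℝ, if 0 < t then ENNReal.ofReal (t ^ r) * μ {x | t < |F x|} else 0)
    set Sf := (⨆ t : ℝ, if 0 < t then ENNReal.ofReal (t ^ r) * μ {x | t < |f x|} else 0) with hSf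
    set Sg := (⨆ t : ℝ, if 0 < t then ENNReal.ofReal (t ^ r) * μ {x | t < |g x|} else 0) with hSg
    have e : SF ≤ (ENNReal.ofReal (2 ^ r) * C1 * 2) * (Sf + Sg) := by
      calc SF ≤ ENNReal.ofReal (2 ^ r) * ⨆ j, dd μ r F j := hup
        _ ≤ ENNReal.ofReal (2 ^ r) * (C1 * ⨆ i, (dd μ r f i + dd μ r g i)) := by gcongr
        _ ≤ ENNReal.ofReal (2 ^ r) * (C1 * (Sf + Sg)) := by
            gcongr
            refine iSup_le fun i => ?_
            gcongr
            · exact hlow f i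
            · exact hlow g i
        _ ≤ ENNReal.ofReal (2 ^ r) * (C1 * (Sf + Sg)) * 2 := le_mul_of_one_le_right' (by norm_num)
        _ = _ := by ring
    calc SF ^ (1/r) ≤ ((ENNReal.ofReal (2 ^ r) * C1 * 2) * (Sf + Sg)) ^ (1/r) := by gcongr
      _ = (ENNReal.ofReal (2 ^ r) * C1 * 2) ^ (1/r) * (Sf + Sg) ^ (1/r) :=
          ENNReal.mul_rpow_of_nonneg _ _ hr'.le
      _ ≤ (ENNReal.ofReal (2 ^ r) * C1 * 2) ^ (1/r) * (2 ^ (1/r) * (Sf ^ (1/r) + Sg ^ (1/r))) := by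
          gcongr; exact add_rpow_le _ _ _ hr'
      _ = _ := by ring
  · have hθ' : 0 < θ.toReal := ENNReal.toReal_pos hθ.ne' hT
    set q := θ.toReal / r with hqdef
    have hq : 0 < q := by positivity
    obtain ⟨C1, hC1, h1⟩ := disc_conv σ q hσ hq C hC
    set X := ENNReal.ofReal (2 ^ r) ^ q with hX
    have hXt : X ≠ ⊤ := ENNReal.rpow_ne_top_of_nonneg hq.le (by simp)
    have hr' : 0 < 1 / θ.toReal := by positivity
    refine ⟨(X * C1 * 2 ^ q * (2 * X)) ^ (1 / θ.toReal) * (2:ℝ≥0∞) ^ (1 / θ.toReal),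
      ENNReal.mul_ne_top (ENNReal.rpow_ne_top_of_nonneg hr'.le
        (ENNReal.mul_ne_top (ENNReal.mul_ne_top (ENNReal.mul_ne_top hXt hC1) (two_rpow_ne_top _))
          (ENNReal.mul_ne_top (by norm_num) hXt))) (two_rpow_ne_top _), ?_⟩
    intro α _ μ F f g h
    have h2 := h1 _ _ h
    simp only [lorentzNorm, if_neg hT]
    set SF := ∫⁻ t in Set.Ioi (0 : ℝ), (ENNReal.ofReal (t ^ r) * μ {x | t < |F x|}) ^ (θ.toReal / r) / ENNReal.ofReal t
    set Sf := ∫⁻ t in Set.Ioi (0 : ℝ), (ENNReal.ofReal (t ^ r) * μ {x | t < |f x|}) ^ (θ.toReal / r) / ENNReal.ofReal t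
    set Sg := ∫⁻ t in Set.Ioi (0 : ℝ), (ENNReal.ofReal (t ^ r) * μ {x | t < |g x|}) ^ (θ.toReal / r) / ENNReal.ofReal t
    have e : SF ≤ (X * C1 * 2 ^ q * (2 * X)) * (Sf + Sg) := by
      calc SF ≤ X * ∑' j, dd μ r F j ^ q := lorentz_le_dd μ r q hr hq F
        _ ≤ X * (C1 * ∑' i, (dd μ r f i + dd μ r g i) ^ q) := by gcongr
        _ ≤ X * (C1 * ∑' i, 2 ^ q * ((dd μ r f i) ^ q + (dd μ r g i) ^ q)) := by
            gcongr with i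
            exact add_rpow_le _ _ _ hq
        _ = X * (C1 * (2 ^ q * (∑' i, dd μ r f i ^ q + ∑' i, dd μ r g i ^ q))) := by
            rw [ENNReal.tsum_mul_left, ENNReal.tsum_add]
        _ ≤ X * (C1 * (2 ^ q * (2 * X * Sf + 2 * X * Sg))) := by
            gcongr
            · exact dd_le_lorentz μ r q hr hq f
            · exact dd_le_lorentz μ r q hr hq g
        _ = _ := by ring
    calc SF ^ (1/θ.toReal) ≤ ((X * C1 * 2 ^ q * (2 * X)) * (Sf + Sg)) ^ (1/θ.toReal) := by gcongr
      _ = (X * C1 * 2 ^ q * (2 * X)) ^ (1/θ.toReal) * (Sf + Sg) ^ (1/θ.toReal) :=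
          ENNReal.mul_rpow_of_nonneg _ _ hr'.le
      _ ≤ (X * C1 * 2 ^ q * (2 * X)) ^ (1/θ.toReal) * (2 ^ (1/θ.toReal) * (Sf ^ (1/θ.toReal) + Sg ^ (1/θ.toReal))) := by
          gcongr; exact add_rpow_le _ _ _ hr'
      _ = _ := by ring
end

/-- the K-functional type quantity -/
def KI {α : Type*} [MeasurableSpace α] (μ : Measure α) (p0 p1 : ℝ) (Φ : α → ℝ) (t : ℝ) : ℝ≥0∞ :=
  ∫⁻ x, ENNReal.ofReal (min ((|Φ x| / t) ^ p0) ((|Φ x| / t) ^ p1)) ∂μ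

lemma min_wt (p0 p1 r σ : ℝ) (h0 : 0 < p0) (h0r : p0 + σ ≤ r) (hr1 : r + σ ≤ p1) (hσ : 0 < σ)
    (i j : ℤ) :
    ENNReal.ofReal (((2 : ℝ) ^ j) ^ r) *
      ENNReal.ofReal (min (((2:ℝ) ^ (i + 1) / 2 ^ j) ^ p0) (((2:ℝ) ^ (i + 1) / 2 ^ j) ^ p1))
    ≤ ENNReal.ofReal (2 ^ p1) * (wt σ (i - j) * ENNReal.ofReal (((2 : ℝ) ^ i) ^ r)) := by
  have e2 : wt σ (i - j) = ENNReal.ofReal ((2 : ℝ) ^ (-(σ * |((i - j : ℤ) : ℝ)|))) := by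
    rw [wt, ← ENNReal.ofReal_rpow_of_pos (by norm_num)]
    simp
  rw [e2, ← ENNReal.ofReal_mul (by positivity), ← ENNReal.ofReal_mul (by positivity),
    ← ENNReal.ofReal_mul (by positivity)]
  apply ENNReal.ofReal_le_ofReal
  have z : ∀ (m : ℤ) (p : ℝ), ((2:ℝ) ^ m) ^ p = (2:ℝ) ^ ((m:ℝ) * p) := by
    intro m p
    rw [← Real.rpow_intCast, ← Real.rpow_mul (by norm_num)]
  have d : (2:ℝ) ^ (i + 1) / 2 ^ j = 2 ^ (i + 1 - j) := by rw [zpow_sub₀ (by norm_num)]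
  rw [d]
  simp only [z]
  have key : ∀ p, (2:ℝ) ^ ((j:ℝ) * r) * (2:ℝ) ^ (((i + 1 - j : ℤ) : ℝ) * p) =
     2 ^ ((j:ℝ) * r + ((i + 1 - j : ℤ) : ℝ) * p) := fun p => by rw [Real.rpow_add (by norm_num)]
  rw [← Real.rpow_add (by norm_num), ← Real.rpow_add (by norm_num)]
  rcases le_or_gt j i with h | h
  · calc _ ≤ (2:ℝ) ^ ((j:ℝ) * r) * (2:ℝ) ^ (((i + 1 - j : ℤ) : ℝ) * p0) := by
          gcongr; exact min_le_left _ _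
      _ ≤ _ := by
        rw [key]
        apply Real.rpow_le_rpow_of_exponent_le (by norm_num)
        have h' : (0:ℝ) ≤ ((i - j : ℤ) : ℝ) := by exact_mod_cast (by omega)
        rw [abs_of_nonneg h']
        push_cast at *
        nlinarith
  · calc _ ≤ (2:ℝ) ^ ((j:ℝ) * r) * (2:ℝ) ^ (((i + 1 - j : ℤ) : ℝ) * p1) := by
          gcongr; exact min_le_right _ _
      _ ≤ _ := by
        rw [key]
        apply Real.rpow_le_rpow_of_exponent_le (by norm_num)
        have h' : ((i - j : ℤ) : ℝ) ≤ 0 := by exact_mod_cast (by omega)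
        rw [abs_of_nonpos h']
        push_cast at *
        nlinarith

lemma KI_le {α : Type*} [MeasurableSpace α] (μ : Measure α) (p0 p1 r σ : ℝ) (h0 : 0 < p0)
    (h0r : p0 + σ ≤ r) (hr1 : r + σ ≤ p1) (hσ : 0 < σ) (Φ : α → ℝ) (hΦ : AEMeasurable Φ μ) (j : ℤ) :
    ENNReal.ofReal (((2 : ℝ) ^ j) ^ r) * KI μ p0 p1 Φ (2 ^ j) ≤
      ENNReal.ofReal (2 ^ p1) * ∑' i, wt σ (i - j) * dd μ r Φ i := by
  have hp1 : 0 < p1 := by linarith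
  have hset : ∀ i : ℤ, NullMeasurableSet {x | (2:ℝ) ^ i < |Φ x|} μ := fun i =>
    nullMeasurableSet_lt aemeasurable_const (hΦ.norm)
  set c : ℤ → ℝ≥0∞ := fun i =>
    ENNReal.ofReal (min (((2:ℝ) ^ (i + 1) / 2 ^ j) ^ p0) (((2:ℝ) ^ (i + 1) / 2 ^ j) ^ p1)) with hc
  have h1 : KI μ p0 p1 Φ (2 ^ j) ≤ ∑' i, c i * μ {x | (2:ℝ) ^ i < |Φ x|} := by
    calc KI μ p0 p1 Φ (2 ^ j) ≤
        ∫⁻ x, ∑' i, ({x | (2:ℝ) ^ i < |Φ x|}.indicator (fun _ => c i) x) ∂μ := by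
          refine lintegral_mono fun x => ?_
          rcases (abs_nonneg (Φ x)).eq_or_lt with h | h
          · rw [← h]; simp [Real.zero_rpow h0.ne']
          · obtain ⟨i, hi⟩ := exists_mem_Ioc_zpow h (by norm_num : (1:ℝ) < 2)
            refine le_trans ?_ (ENNReal.le_tsum i)
            rw [Set.indicator_of_mem (by exact hi.1)]
            simp only [hc]
            have := hi.2
            gcongr
      _ = _ := by
          rw [lintegral_tsum]
          · congr 1; ext i
            rw [lintegral_indicator_const₀ (hset i)]
          · intro i
            exact (aemeasurable_const).indicator₀ (hset i)
  calc _ ≤ ENNReal.ofReal (((2 : ℝ) ^ j) ^ r) * ∑' i, c i * μ {x | (2:ℝ) ^ i < |Φ x|} := by gcongr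
    _ ≤ _ := by
      rw [← ENNReal.tsum_mul_left, ← ENNReal.tsum_mul_left]
      refine ENNReal.tsum_le_tsum fun i => ?_
      have := min_wt p0 p1 r σ h0 h0r hr1 hσ i j
      calc _ = (ENNReal.ofReal (((2 : ℝ) ^ j) ^ r) * c i) * μ {x | (2:ℝ) ^ i < |Φ x|} := by ring
        _ ≤ (ENNReal.ofReal (2 ^ p1) * (wt σ (i - j) * ENNReal.ofReal (((2 : ℝ) ^ i) ^ r))) *
            μ {x | (2:ℝ) ^ i < |Φ x|} := by gcongr
        _ = _ := by rw [dd]; ring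

/-- Lorentz interpolation -/
theorem lorentz_interp (p0 p1 r : ℝ) (h0 : 0 < p0) (h0r : p0 < r) (hr1 : r < p1)
    (θ : ℝ≥0∞) (hθ : 0 < θ) (C : ℝ≥0∞) (hC : C ≠ ⊤) :
    ∃ C' : ℝ≥0∞, C' ≠ ⊤ ∧ ∀ {α : Type} [MeasurableSpace α] (μ : Measure α)
      (F f g : α → ℝ), AEMeasurable f μ → AEMeasurable g μ →
      (∀ t : ℝ, 0 < t → μ {x | t < |F x|} ≤ C * (KI μ p0 p1 f t + KI μ p0 p1 g t)) →
      lorentzNorm μ r θ F ≤ C' * (lorentzNorm μ r θ f + lorentzNorm μ r θ g) := by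
  set σ := min (r - p0) (p1 - r)
  have hσ : 0 < σ := lt_min (by linarith) (by linarith)
  have s1 : p0 + σ ≤ r := by have : σ ≤ r - p0 := min_le_left _ _
                             linarith
  have s2 : r + σ ≤ p1 := by have : σ ≤ p1 - r := min_le_right _ _
                             linarith
  obtain ⟨C', hC', H⟩ := lorentz_transfer r σ (by linarith) hσ θ hθ (C * ENNReal.ofReal (2 ^ p1))
    (ENNReal.mul_ne_top hC (by simp))
  refine ⟨C', hC', ?_⟩
  intro α _ μ F f g hf hg h
  apply H
  intro j
  have := h (2 ^ j) (by positivity)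
  have a1 := KI_le μ p0 p1 r σ h0 s1 s2 hσ f hf j
  have a2 := KI_le μ p0 p1 r σ h0 s1 s2 hσ g hg j
  calc dd μ r F j ≤ ENNReal.ofReal (((2 : ℝ) ^ j) ^ r) * (C * (KI μ p0 p1 f (2^j) + KI μ p0 p1 g (2^j))) := by
        rw [dd]; gcongr
    _ = C * (ENNReal.ofReal (((2 : ℝ) ^ j) ^ r) * KI μ p0 p1 f (2^j) + ENNReal.ofReal (((2 : ℝ) ^ j) ^ r) * KI μ p0 p1 g (2^j)) := by ring
    _ ≤ C * (ENNReal.ofReal (2 ^ p1) * ∑' i, wt σ (i - j) * dd μ r f i + ENNReal.ofReal (2 ^ p1) * ∑' i, wt σ (i - j) * dd μ r g i) := by gcongr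
    _ = _ := by
      simp_rw [mul_add, ENNReal.tsum_add]; ring

lemma vol_cb (x : En n) {r : ℝ} (hr : 0 ≤ r) :
    volume (closedBall x r) = ENNReal.ofReal (r ^ n) * volume (closedBall (0 : En n) 1) := by
  have := Measure.addHaar_closedBall' (volume : Measure (En n)) x hr
  simpa using this

lemma vol_cb_pos (x : En n) {r : ℝ} (hr : 0 < r) : volume (closedBall x r) ≠ 0 :=
  (measure_closedBall_pos _ _ hr).ne'

lemma vol_cb_top (x : En n) (r : ℝ) : volume (closedBall x r) ≠ ⊤ :=
  measure_closedBall_lt_top.ne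

/-- the stopping radius -/
lemma stop_radius (hn : 0 < n) (h : En n → ℝ) (hc : Continuous h)
    (hI : ∫⁻ x, ENNReal.ofReal (h x) ≠ ⊤) (s : ℝ) (hs : 0 < s) :
    ∃ R : ℝ, ∀ x, s < h x → ∃ ρ, 0 < ρ ∧ ρ ≤ R ∧
      ENNReal.ofReal s * volume (closedBall x ρ) ≤ ∫⁻ y in closedBall x ρ, ENNReal.ofReal (h y) ∧
      ∀ ρ', 2 * ρ ≤ ρ' → ∫⁻ y in closedBall x ρ', ENNReal.ofReal (h y) ≤
        ENNReal.ofReal s * volume (closedBall x ρ') := by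
  set I := ∫⁻ x, ENNReal.ofReal (h x)
  set w := volume (closedBall (0 : En n) 1)
  have hw0 : w ≠ 0 := vol_cb_pos _ one_pos
  have hwt : w ≠ ⊤ := vol_cb_top _ _
  have hs' : ENNReal.ofReal s ≠ 0 := by simpa using hs
  set R : ℝ := max 1 (I / (ENNReal.ofReal s * w)).toReal
  have hQ : I / (ENNReal.ofReal s * w) ≠ ⊤ := ENNReal.div_ne_top hI (mul_ne_zero hs' hw0)
  refine ⟨R, fun x hx => ?_⟩
  set S : Set ℝ := {ρ | 0 < ρ ∧ ENNReal.ofReal s * volume (closedBall x ρ) ≤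
    ∫⁻ y in closedBall x ρ, ENNReal.ofReal (h y)} with hS
  have hbd : ∀ ρ ∈ S, ρ ≤ R := by
    rintro ρ ⟨h0, h1⟩
    by_contra! hlt
    have h1' : 1 < ρ := (le_max_left _ _).trans_lt hlt
    have h2 : (I / (ENNReal.ofReal s * w)).toReal < ρ := (le_max_right _ _).trans_lt hlt
    have h3 : ENNReal.ofReal s * (ENNReal.ofReal (ρ^n) * w) ≤ I := by
      rw [← vol_cb x h0.le]
      exact h1.trans (setLIntegral_le_lintegral _ _)
    have h4 : ENNReal.ofReal (ρ ^ n) ≤ I / (ENNReal.ofReal s * w) := by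
      rw [ENNReal.le_div_iff_mul_le (Or.inl (mul_ne_zero hs' hw0))
        (Or.inl (ENNReal.mul_ne_top (by simp) hwt))]
      calc _ = _ := by ring
        _ ≤ I := h3
    have h5 : ρ ^ n ≤ (I / (ENNReal.ofReal s * w)).toReal := by
      have := ENNReal.toReal_mono hQ h4
      rwa [ENNReal.toReal_ofReal (by positivity)] at this
    have h6 : ρ ≤ ρ ^ n := le_self_pow₀ h1'.le hn.ne'
    linarith
  have hne : S.Nonempty := by
    have : ∀ᶠ y in nhds x, s < h y := hc.continuousAt.eventually (lt_mem_nhds hx)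
    obtain ⟨ε, he, hb⟩ := Metric.nhds_basis_closedBall.mem_iff.1 this
    refine ⟨ε, he, ?_⟩
    rw [← setLIntegral_const]
    refine setLIntegral_mono' measurableSet_closedBall fun y hy => ?_
    exact ENNReal.ofReal_le_ofReal (hb hy).le
  have hbdd : BddAbove S := ⟨R, hbd⟩
  obtain ⟨ρ0, hρ0⟩ := hne
  have hsup : 0 < sSup S := lt_of_lt_of_le hρ0.1 (le_csSup hbdd hρ0)
  obtain ⟨ρ, hρ, hlt⟩ := exists_lt_of_lt_csSup ⟨ρ0, hρ0⟩ (half_lt_self hsup)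
  refine ⟨ρ, hρ.1, hbd ρ hρ, hρ.2, ?_⟩
  intro ρ' hρ'
  by_contra! hcon
  have : ρ' ∈ S := ⟨by linarith [hρ.1], hcon.le⟩
  linarith [le_csSup hbdd this]

/-- stopping time covering argument -/
lemma cover_lemma (hn : 0 < n) (h : En n → ℝ) (hc : Continuous h)
    (hI : ∫⁻ x, ENNReal.ofReal (h x) ≠ ⊤) (s : ℝ) (hs : 0 < s) (Bd : Set (En n))
    (hBd : ∀ x ∈ Bd, s < h x) (κ : ℝ≥0∞)
    (hloc : ∀ x ρ, 0 < ρ → (∀ ρ', 2 * ρ ≤ ρ' → ∫⁻ y in closedBall x ρ', ENNReal.ofReal (h y) ≤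
        ENNReal.ofReal s * volume (closedBall x ρ')) →
        volume (closedBall x (5 * ρ) ∩ Bd) ≤ κ * volume (closedBall x ρ)) :
    ENNReal.ofReal s * volume Bd ≤ 2 * κ * ∫⁻ x in {x | s / 2 < h x}, ENNReal.ofReal (h x) := by
  obtain ⟨R, hR⟩ := stop_radius hn h hc hI s hs
  have hR' : ∀ x ∈ Bd, ∃ ρ, 0 < ρ ∧ ρ ≤ R ∧
      ENNReal.ofReal s * volume (closedBall x ρ) ≤ ∫⁻ y in closedBall x ρ, ENNReal.ofReal (h y) ∧
      ∀ ρ', 2 * ρ ≤ ρ' → ∫⁻ y in closedBall x ρ', ENNReal.ofReal (h y) ≤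
        ENNReal.ofReal s * volume (closedBall x ρ') := fun x hx => hR x (hBd x hx)
  choose! ρ hρ0 hρR hρ1 hρ2 using hR'
  obtain ⟨u, hut, hdisj, hcov⟩ := Vitali.exists_disjoint_subfamily_covering_enlargement_closedBall
    Bd id ρ R hρR 5 (by norm_num)
  have hcnt : u.Countable := by
    refine hdisj.countable_of_nonempty_interior fun a ha => ?_
    exact ⟨a, ball_subset_interior_closedBall (mem_ball_self (hρ0 a (hut ha)))⟩
  have hms : MeasurableSet {x | s / 2 < h x} := measurableSet_lt measurable_const hc.measurable
  have hball : ∀ a ∈ u, ENNReal.ofReal s * volume (closedBall a (ρ a)) ≤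
      2 * ∫⁻ y in closedBall a (ρ a) ∩ {x | s / 2 < h x}, ENNReal.ofReal (h y) := by
    intro a ha
    have h1 := hρ1 a (hut ha)
    set B := closedBall a (ρ a)
    have h2 : ∫⁻ y in B, ENNReal.ofReal (h y) ≤
        (∫⁻ y in B ∩ {x | s / 2 < h x}, ENNReal.ofReal (h y)) + ENNReal.ofReal (s/2) * volume B := by
      rw [← lintegral_inter_add_sdiff _ B hms]
      gcongr
      calc _ ≤ ∫⁻ y in B \ {x | s / 2 < h x}, ENNReal.ofReal (s/2) := by
            refine setLIntegral_mono' (measurableSet_closedBall.diff hms) fun y hy => ?_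
            exact ENNReal.ofReal_le_ofReal (not_lt.1 hy.2)
        _ ≤ _ := by
            rw [setLIntegral_const]
            gcongr
            exact Set.diff_subset
    have h3 : ENNReal.ofReal s = ENNReal.ofReal (s/2) + ENNReal.ofReal (s/2) := by
      rw [← ENNReal.ofReal_add (by positivity) (by positivity)]; ring_nf
    have h4 : ENNReal.ofReal (s/2) * volume B ≤
        ∫⁻ y in B ∩ {x | s / 2 < h x}, ENNReal.ofReal (h y) := by
      have := h1.trans h2
      rw [h3, add_mul] at this
      exact (ENNReal.add_le_add_iff_right (ENNReal.mul_ne_top ENNReal.ofReal_ne_top (vol_cb_top _ _))).1 this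
    rw [h3, add_mul, two_mul]
    gcongr
  have hsub : Bd ⊆ ⋃ a ∈ u, (closedBall a (5 * ρ a) ∩ Bd) := by
    intro x hx
    obtain ⟨b, hb, hxb⟩ := hcov x hx
    simp only [Set.mem_iUnion]
    exact ⟨b, hb, hxb (mem_closedBall_self (hρ0 x hx).le), hx⟩
  have : Countable u := hcnt
  calc ENNReal.ofReal s * volume Bd ≤ ENNReal.ofReal s * ∑' a : u, volume (closedBall (a : En n) (5 * ρ a) ∩ Bd) := by
        gcongr
        exact (measure_mono hsub).trans (measure_biUnion_le _ hcnt _)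
    _ ≤ ∑' a : u, κ * (ENNReal.ofReal s * volume (closedBall (a : En n) (ρ a))) := by
        rw [← ENNReal.tsum_mul_left]
        refine ENNReal.tsum_le_tsum fun a => ?_
        calc _ ≤ ENNReal.ofReal s * (κ * volume (closedBall (a : En n) (ρ a))) := by
              gcongr
              exact hloc _ _ (hρ0 a (hut a.2)) (hρ2 a (hut a.2))
          _ = _ := by ring
    _ ≤ ∑' a : u, κ * (2 * ∫⁻ y in closedBall (a : En n) (ρ a) ∩ {x | s / 2 < h x}, ENNReal.ofReal (h y)) := by
        refine ENNReal.tsum_le_tsum fun a => ?_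
        exact mul_le_mul_right (hball a a.2) κ
    _ = 2 * κ * ∑' a : u, ∫⁻ y in closedBall (a : En n) (ρ a) ∩ {x | s / 2 < h x}, ENNReal.ofReal (h y) := by
        rw [← ENNReal.tsum_mul_left]; congr 1; ext a; ring
    _ ≤ _ := by
        gcongr
        rw [← lintegral_iUnion]
        · apply lintegral_mono_set
          exact Set.iUnion_subset fun a => Set.inter_subset_right
        · intro a; exact measurableSet_closedBall.inter hms
        · intro a b hab
          have := hdisj a.2 b.2 (fun h => hab (Subtype.ext h))
          exact this.mono Set.inter_subset_left Set.inter_subset_left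

/-- integrate the level set inequality -/
lemma integrate_levels (p Λ : ℝ) (hp : 2 < p) (hΛ : 0 < Λ) : ∃ C : ℝ≥0∞, C ≠ ⊤ ∧
    ∀ (κ : ℝ≥0∞) (a h : En n → ℝ), κ ≠ ⊤ → Measurable a → Measurable h → (∀ x, 0 ≤ a x) →
    (∀ x, 0 ≤ h x) →
    (∀ l : ℝ, 0 < l → ENNReal.ofReal (l ^ 2) * volume {x | Λ * l < a x} ≤
      κ * ∫⁻ x in {x | l ^ 2 / 2 < h x}, ENNReal.ofReal (h x)) →
    ∫⁻ x, ENNReal.ofReal (a x ^ p) ≤ C * κ * ∫⁻ x, ENNReal.ofReal (h x ^ (p / 2)) := by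
  refine ⟨ENNReal.ofReal p * ENNReal.ofReal (Λ ^ p) * ((ENNReal.ofReal (p - 2))⁻¹ * ENNReal.ofReal (2 ^ ((p-2)/2))),
    ?_, ?_⟩
  · refine ENNReal.mul_ne_top (ENNReal.mul_ne_top (by simp) (by simp))
      (ENNReal.mul_ne_top ?_ (by simp))
    simp only [ne_eq, ENNReal.inv_eq_top, ENNReal.ofReal_eq_zero, not_le]
    linarith
  intro κ a h hκ hma hmh ha hh H
  set ν : Measure (En n) := volume.withDensity (fun x => ENNReal.ofReal (h x))
  have hb : ∀ x, 0 ≤ a x / Λ := fun x => div_nonneg (ha x) hΛ.le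
  have e1 : ∫⁻ x, ENNReal.ofReal (a x ^ p) = ENNReal.ofReal (Λ ^ p) * ∫⁻ x, ENNReal.ofReal ((a x / Λ) ^ p) := by
    rw [← lintegral_const_mul' _ _ (by simp)]
    congr 1; ext x
    rw [← ENNReal.ofReal_mul (by positivity), ← Real.mul_rpow hΛ.le (hb x), mul_div_cancel₀ _ hΛ.ne']
  have e2 := lintegral_rpow_eq_lintegral_meas_lt_mul (volume : Measure (En n)) (f := fun x => a x / Λ)
    (Eventually.of_forall hb) (hma.div_const _).aemeasurable (p := p) (by linarith)
  have hg0 : ∀ x, 0 ≤ Real.sqrt (2 * h x) := fun x => Real.sqrt_nonneg _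
  have e3 := lintegral_rpow_eq_lintegral_meas_lt_mul ν (f := fun x => Real.sqrt (2 * h x))
    (Eventually.of_forall hg0) (by fun_prop) (p := p - 2) (by linarith)
  have hpt : ∀ t ∈ Set.Ioi (0:ℝ), volume {x | t < a x / Λ} * ENNReal.ofReal (t ^ (p - 1)) ≤
      κ * (ν {x | t < Real.sqrt (2 * h x)} * ENNReal.ofReal (t ^ (p - 2 - 1))) := by
    intro t ht
    have ht : 0 < t := ht
    have s1 : {x | t < a x / Λ} = {x | Λ * t < a x} := by
      ext x; simp only [Set.mem_ofPred_eq]; rw [lt_div_iff₀ hΛ, mul_comm]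
    have s2 : {x | t < Real.sqrt (2 * h x)} = {x | t ^ 2 / 2 < h x} := by
      ext x; simp only [Set.mem_ofPred_eq]; rw [Real.lt_sqrt ht.le]
      constructor <;> intro h <;> linarith
    have s3 : MeasurableSet {x | t ^ 2 / 2 < h x} := measurableSet_lt measurable_const hmh
    rw [s1, s2, withDensity_apply _ s3]
    have s4 : t ^ (p - 1) = t ^ 2 * t ^ (p - 2 - 1) := by
      rw [← Real.rpow_natCast, ← Real.rpow_add ht]; congr 1; push_cast; ring
    rw [s4, ENNReal.ofReal_mul (by positivity), ← mul_assoc, ← mul_assoc, mul_comm (volume _)]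
    exact mul_le_mul_left (H t ht) _
  have hp2 : ENNReal.ofReal (p - 2) ≠ 0 := by simp; linarith
  have e4 : ∫⁻ x, ENNReal.ofReal (Real.sqrt (2 * h x) ^ (p - 2)) ∂ν =
      ENNReal.ofReal (2 ^ ((p-2)/2)) * ∫⁻ x, ENNReal.ofReal (h x ^ (p / 2)) := by
    rw [lintegral_withDensity_eq_lintegral_mul _ (by fun_prop) (by fun_prop),
      ← lintegral_const_mul' _ _ (by simp)]
    congr 1; ext x
    simp only [Pi.mul_apply]
    rw [← ENNReal.ofReal_mul (hh x), ← ENNReal.ofReal_mul (by positivity)]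
    congr 1
    rw [Real.sqrt_eq_rpow, ← Real.rpow_mul (by have := hh x; positivity), Real.mul_rpow (by norm_num) (hh x)]
    have : p / 2 = 1 + (1/2) * (p - 2) := by ring
    rcases (hh x).eq_or_lt with h0 | h0
    · rw [← h0]; simp; rw [Real.zero_rpow (by linarith)]; simp
    · rw [this, Real.rpow_add h0, Real.rpow_one, show (p-2)/2 = 1/2*(p-2) by ring]; ring
  calc ∫⁻ x, ENNReal.ofReal (a x ^ p)
      = ENNReal.ofReal (Λ ^ p) * (ENNReal.ofReal p * ∫⁻ t in Set.Ioi 0, volume {x | t < a x / Λ} * ENNReal.ofReal (t ^ (p - 1))) := by rw [e1, e2]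
    _ ≤ ENNReal.ofReal (Λ ^ p) * (ENNReal.ofReal p * ∫⁻ t in Set.Ioi 0, κ * (ν {x | t < Real.sqrt (2 * h x)} * ENNReal.ofReal (t ^ (p - 2 - 1)))) := by
        refine mul_le_mul_right (mul_le_mul_right ?_ _) _
        exact setLIntegral_mono' measurableSet_Ioi hpt
    _ = ENNReal.ofReal (Λ ^ p) * (ENNReal.ofReal p * (κ * ((ENNReal.ofReal (p-2))⁻¹ * ∫⁻ x, ENNReal.ofReal (Real.sqrt (2 * h x) ^ (p - 2)) ∂ν))) := by
        rw [lintegral_const_mul' _ _ hκ, e3, ← mul_assoc (ENNReal.ofReal (p-2))⁻¹, ENNReal.inv_mul_cancel hp2 (by simp), one_mul]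
    _ = _ := by rw [e4]; ring

/-- the convolution operator -/
def cz (K f : En n → ℝ) (x : En n) : ℝ := ∫ y, K (x - y) * f y

/-- regularised Calderon-Zygmund kernels -/
structure CZK (K : En n → ℝ) (A : ℝ) : Prop where
  cont : Continuous K
  bdd : ∃ M, ∀ x, |K x| ≤ M
  even : ∀ x, K (-x) = K x
  reg : ∀ x h, 2 * ‖h‖ ≤ ‖x‖ → x ≠ 0 → |K (x + h) - K x| ≤ A * (‖h‖ / ‖x‖ ^ (n + 1))
  l2 : ∀ f : En n → ℝ, Continuous f → HasCompactSupport f →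
    ∫⁻ x, ENNReal.ofReal (cz K f x ^ 2) ≤ ENNReal.ofReal A * ∫⁻ x, ENNReal.ofReal (f x ^ 2)

lemma cz_integrable {K f : En n → ℝ} (hK : Continuous K) (hf : Continuous f)
    (hs : HasCompactSupport f) (x : En n) : Integrable (fun y => K (x - y) * f y) := by
  apply Continuous.integrable_of_hasCompactSupport (by fun_prop)
  exact hs.mul_left

lemma cz_cont {K f : En n → ℝ} (hK : Continuous K) (hf : Continuous f)
    (hs : HasCompactSupport f) : Continuous (cz K f) := by
  have := hs.continuous_convolution_left (ContinuousLinearMap.mul ℝ ℝ) hf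
    (hK.locallyIntegrable (μ := volume))
  convert this using 1
  ext x
  simp only [cz, convolution, ContinuousLinearMap.mul_apply']
  congr 1; ext y; ring

lemma cz_add {K f g : En n → ℝ} (hK : Continuous K) (hf : Continuous f)
    (hs : HasCompactSupport f) (hg : Continuous g) (hgs : HasCompactSupport g) (x : En n) :
    cz K (fun y => f y + g y) x = cz K f x + cz K g x := by
  simp only [cz, mul_add]
  exact integral_add (cz_integrable hK hf hs x) (cz_integrable hK hg hgs x)

lemma tail_lemma (x0 : En n) (R β : ℝ) (hR : 0 < R) (hβ : 0 ≤ β) (F : En n → ℝ≥0∞)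
    (h : ∀ ρ', R ≤ ρ' → ∫⁻ y in closedBall x0 ρ', F y ≤ ENNReal.ofReal β * volume (closedBall x0 ρ')) :
    ∫⁻ y in {y | R ≤ ‖y - x0‖}, ENNReal.ofReal (R / ‖y - x0‖ ^ (n + 1)) * F y ≤
      ENNReal.ofReal (2 ^ (n + 1) * β) * volume (closedBall (0 : En n) 1) := by
  have hsub : {y | R ≤ ‖y - x0‖} ⊆ ⋃ k : ℕ, {y : En n | 2 ^ k * R ≤ ‖y - x0‖ ∧ ‖y - x0‖ ≤ 2 ^ (k + 1) * R} := by
    intro y hy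
    have hy : R ≤ ‖y - x0‖ := hy
    obtain ⟨k, hk1, hk2⟩ := exists_nat_pow_near (x := ‖y - x0‖ / R) (y := (2:ℝ))
      ((one_le_div hR).2 hy) (by norm_num)
    simp only [Set.mem_iUnion]
    refine ⟨k, ?_, ?_⟩
    · rwa [le_div_iff₀ hR] at hk1
    · rw [div_lt_iff₀ hR] at hk2; exact hk2.le
  have hmeas : ∀ k : ℕ, MeasurableSet {y : En n | 2 ^ k * R ≤ ‖y - x0‖ ∧ ‖y - x0‖ ≤ 2 ^ (k + 1) * R} := by
    intro k
    have hm : Measurable (fun y : En n => ‖y - x0‖) := by fun_prop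
    exact (measurableSet_le measurable_const hm).inter (measurableSet_le hm measurable_const)
  set w := volume (closedBall (0 : En n) 1)
  have hk : ∀ k : ℕ, ∫⁻ y in {y : En n | 2 ^ k * R ≤ ‖y - x0‖ ∧ ‖y - x0‖ ≤ 2 ^ (k + 1) * R},
      ENNReal.ofReal (R / ‖y - x0‖ ^ (n + 1)) * F y ≤ ENNReal.ofReal (2 ^ n * β * (1/2) ^ k) * w := by
    intro k
    have p1 : (0:ℝ) < 2 ^ k * R := by positivity
    calc _ ≤ ∫⁻ y in {y : En n | 2 ^ k * R ≤ ‖y - x0‖ ∧ ‖y - x0‖ ≤ 2 ^ (k + 1) * R},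
          ENNReal.ofReal (R / (2 ^ k * R) ^ (n + 1)) * F y := by
          refine setLIntegral_mono' (hmeas k) fun y hy => ?_
          have := hy.1
          gcongr
      _ = ENNReal.ofReal (R / (2 ^ k * R) ^ (n + 1)) * ∫⁻ y in {y : En n | 2 ^ k * R ≤ ‖y - x0‖ ∧ ‖y - x0‖ ≤ 2 ^ (k + 1) * R}, F y := by
          rw [lintegral_const_mul' _ _ (by simp)]
      _ ≤ ENNReal.ofReal (R / (2 ^ k * R) ^ (n + 1)) * ∫⁻ y in closedBall x0 (2 ^ (k + 1) * R), F y := by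
          gcongr
          intro y hy
          rw [mem_closedBall, dist_eq_norm]; exact hy.2
      _ ≤ ENNReal.ofReal (R / (2 ^ k * R) ^ (n + 1)) * (ENNReal.ofReal β * (ENNReal.ofReal ((2 ^ (k+1) * R) ^ n) * w)) := by
          gcongr
          rw [← vol_cb x0 (by positivity)]
          apply h
          have : (1:ℝ) ≤ 2 ^ (k+1) := one_le_pow₀ (by norm_num)
          nlinarith
      _ = _ := by
          rw [← mul_assoc, ← mul_assoc, ← ENNReal.ofReal_mul (by positivity), ← ENNReal.ofReal_mul (by positivity)]
          congr 2
          rw [one_div, inv_pow]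
          field_simp
          ring
  calc _ ≤ ∫⁻ y in ⋃ k : ℕ, {y : En n | 2 ^ k * R ≤ ‖y - x0‖ ∧ ‖y - x0‖ ≤ 2 ^ (k + 1) * R},
      ENNReal.ofReal (R / ‖y - x0‖ ^ (n + 1)) * F y := lintegral_mono_set hsub
    _ ≤ ∑' k : ℕ, ENNReal.ofReal (2 ^ n * β * (1/2) ^ k) * w :=
        (lintegral_iUnion_le _ _).trans (ENNReal.tsum_le_tsum hk)
    _ = _ := by
        rw [ENNReal.tsum_mul_right, ← ENNReal.ofReal_tsum_of_nonneg (fun k => by positivity)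
          (summable_geometric_two.mul_left _), tsum_mul_left, tsum_geometric_two]
        congr 2; ring

/-- cutoff -/
def cutf (x0 : En n) (R : ℝ) (y : En n) : ℝ := max 0 (min 1 (7 - ‖y - x0‖ / R))

lemma cutf_cont (x0 : En n) (R : ℝ) : Continuous (cutf x0 R) := by
  unfold cutf; fun_prop

lemma cutf_nonneg (x0 : En n) (R : ℝ) (y) : 0 ≤ cutf x0 R y := le_max_left _ _
lemma cutf_le (x0 : En n) (R : ℝ) (y) : cutf x0 R y ≤ 1 :=
  max_le (by norm_num) (min_le_left _ _)
lemma cutf_one (x0 : En n) (R : ℝ) (hR : 0 < R) (y) (hy : ‖y - x0‖ ≤ 6 * R) : cutf x0 R y = 1 := by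
  have : ‖y - x0‖ / R ≤ 6 := by rwa [div_le_iff₀ hR]
  rw [cutf, min_eq_left (by linarith)]; norm_num
lemma cutf_zero (x0 : En n) (R : ℝ) (hR : 0 < R) (y) (hy : 7 * R < ‖y - x0‖) : cutf x0 R y = 0 := by
  have : 7 < ‖y - x0‖ / R := by rwa [lt_div_iff₀ hR]
  rw [cutf, max_eq_left]
  exact (min_le_right _ _).trans (by linarith)

/-- oscillation of the far part -/
lemma osc_far {K : En n → ℝ} {A : ℝ} (hA : 0 ≤ A) (hK : CZK K A) {f : En n → ℝ} (hf : Continuous f)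
    (hs : HasCompactSupport f) (x0 : En n) (R β : ℝ) (hR : 0 < R) (hβ : 0 ≤ β)
    (h : ∀ ρ', R ≤ ρ' → ∫⁻ y in closedBall x0 ρ', ENNReal.ofReal |f y| ≤ ENNReal.ofReal β * volume (closedBall x0 ρ'))
    (hfar : ∀ y, ‖y - x0‖ ≤ 6 * R → f y = 0) (x x' : En n) (hx : ‖x - x0‖ ≤ R) (hx' : ‖x' - x0‖ ≤ R) :
    |cz K f x - cz K f x'| ≤ A * 2 ^ (n + 2) * (2 ^ (n + 1) * β) * (volume (closedBall (0 : En n) 1)).toReal := by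
  have hintegr : cz K f x - cz K f x' = ∫ y, (K (x - y) - K (x' - y)) * f y := by
    rw [cz, cz, ← integral_sub (cz_integrable hK.cont hf hs x) (cz_integrable hK.cont hf hs x')]
    congr 1; ext y; ring
  have hpt : ∀ y, ENNReal.ofReal |(K (x - y) - K (x' - y)) * f y| ≤
      {y | R ≤ ‖y - x0‖}.indicator (fun y => ENNReal.ofReal (A * 2 ^ (n + 2)) * (ENNReal.ofReal (R / ‖y - x0‖ ^ (n + 1)) *
        ENNReal.ofReal |f y|)) y := by
    intro y
    by_cases hy : ‖y - x0‖ ≤ 6 * R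
    · rw [hfar y hy]; simp
    · push Not at hy
      rw [Set.indicator_of_mem (by show R ≤ _; linarith), ← ENNReal.ofReal_mul (by positivity),
        ← ENNReal.ofReal_mul (by positivity)]
      apply ENNReal.ofReal_le_ofReal
      have hd : ‖y - x0‖ / 2 ≤ ‖x' - y‖ := by
        have : ‖y - x0‖ ≤ ‖x' - y‖ + ‖x' - x0‖ := by
          calc ‖y - x0‖ = ‖(x' - x0) - (x' - y)‖ := by congr 1; abel
            _ ≤ _ := by rw [add_comm]; exact norm_sub_le _ _
        linarith
      have hd2 : 4 * R ≤ ‖x' - y‖ := by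
        have : ‖y - x0‖ ≤ ‖x' - y‖ + ‖x' - x0‖ := by
          calc ‖y - x0‖ = ‖(x' - x0) - (x' - y)‖ := by congr 1; abel
            _ ≤ _ := by rw [add_comm]; exact norm_sub_le _ _
        linarith
      have hxx : ‖x - x'‖ ≤ 2 * R := by
        calc ‖x - x'‖ = ‖(x - x0) - (x' - x0)‖ := by congr 1; abel
          _ ≤ _ := (norm_sub_le _ _).trans (by linarith)
      have hpos : 0 < ‖y - x0‖ := by linarith
      have hreg := hK.reg (x' - y) (x - x') (by linarith) (by
        intro h0; rw [h0, norm_zero] at hd2; linarith)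
      rw [show x' - y + (x - x') = x - y by abel] at hreg
      rw [abs_mul]
      calc _ ≤ A * (‖x - x'‖ / ‖x' - y‖ ^ (n + 1)) * |f y| := by gcongr
        _ ≤ A * (2 * R / (‖y - x0‖ / 2) ^ (n + 1)) * |f y| := by gcongr
        _ = _ := by rw [div_pow]; field_simp; ring
  have htail := tail_lemma x0 R β hR hβ (fun y => ENNReal.ofReal |f y|) h
  have hw := vol_cb_top (0 : En n) 1
  rw [hintegr, ← ENNReal.ofReal_le_ofReal_iff (by positivity), ← Real.norm_eq_abs, ofReal_norm]
  calc _ ≤ ∫⁻ y, ‖(K (x - y) - K (x' - y)) * f y‖ₑ := enorm_integral_le_lintegral_enorm _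
    _ = ∫⁻ y, ENNReal.ofReal |(K (x - y) - K (x' - y)) * f y| := by
        simp_rw [← Real.norm_eq_abs, ofReal_norm]
    _ ≤ _ := lintegral_mono hpt
    _ = ENNReal.ofReal (A * 2 ^ (n + 2)) * ∫⁻ y in {y | R ≤ ‖y - x0‖}, ENNReal.ofReal (R / ‖y - x0‖ ^ (n + 1)) * ENNReal.ofReal |f y| := by
        rw [lintegral_indicator (measurableSet_le measurable_const (by fun_prop)),
          lintegral_const_mul' _ _ (by simp)]
    _ ≤ ENNReal.ofReal (A * 2 ^ (n + 2)) * (ENNReal.ofReal (2 ^ (n + 1) * β) * volume (closedBall (0 : En n) 1)) := by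
        gcongr
    _ = _ := by
        rw [ENNReal.ofReal_mul (p := A * 2 ^ (n + 2) * (2 ^ (n + 1) * β)) (by positivity),
          ENNReal.ofReal_toReal hw, ENNReal.ofReal_mul (p := A * 2 ^ (n + 2)) (by positivity), mul_assoc]

lemma sq_add_le (a b : ℝ) : (a + b) ^ 2 ≤ 2 * a ^ 2 + 2 * b ^ 2 := by nlinarith [sq_nonneg (a - b)]

/-- local estimate -/
lemma local_est (n : ℕ) (A : ℝ) (hA : 0 ≤ A) : ∃ Λ C : ℝ, 1 ≤ Λ ∧ 0 ≤ C ∧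
    ∀ K : En n → ℝ, CZK K A → ∀ f : En n → ℝ, Continuous f → HasCompactSupport f →
    ∀ (x0 : En n) (ρ l M : ℝ), 0 < ρ → 0 < l → 1 ≤ M →
    (∀ ρ', 2 * ρ ≤ ρ' → ∫⁻ y in closedBall x0 ρ', ENNReal.ofReal (cz K f y ^ 2 + M ^ 2 * f y ^ 2) ≤
        ENNReal.ofReal (l ^ 2) * volume (closedBall x0 ρ')) →
    volume (closedBall x0 (5 * ρ) ∩ {x | Λ * l < |cz K f x|}) ≤
      ENNReal.ofReal (C / M ^ 2) * volume (closedBall x0 ρ) := by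
  set w := (volume (closedBall (0 : En n) 1)).toReal with hw
  set C1 := A * 2 ^ (n + 2) * (2 ^ (n + 1) * 2) * w with hC1
  have hC10 : 0 ≤ C1 := by positivity
  set L2 : ℝ := 4 + 4 * (A * 7 ^ n) + 2 * C1 ^ 2 with hL2
  have hL20 : 4 ≤ L2 := by rw [hL2]; nlinarith [mul_nonneg hA (pow_nonneg (by norm_num : (0:ℝ) ≤ 7) n)]
  set L0 := Real.sqrt L2 with hL0
  have hL01 : 2 ≤ L0 := by rw [hL0]; exact Real.le_sqrt_of_sq_le (by linarith)
  have hL0sq : L0 ^ 2 = L2 := Real.sq_sqrt (by linarith)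
  refine ⟨2 * L0, A * 35 ^ n, by linarith, by positivity, ?_⟩
  intro K hK f hf hs x0 ρ l M hρ hl hM hyp
  set R := 5 * ρ with hR
  have hR0 : 0 < R := by positivity
  have hM0 : 0 < M := by linarith
  -- consequences
  have cT : ∀ ρ', 2 * ρ ≤ ρ' → ∫⁻ y in closedBall x0 ρ', ENNReal.ofReal (cz K f y ^ 2) ≤
      ENNReal.ofReal (l ^ 2) * volume (closedBall x0 ρ') := by
    intro ρ' h'
    refine (lintegral_mono fun y => ?_).trans (hyp ρ' h')
    apply ENNReal.ofReal_le_ofReal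
    nlinarith [mul_nonneg (sq_nonneg M) (sq_nonneg (f y))]
  have cf2 : ∀ ρ', 2 * ρ ≤ ρ' → ∫⁻ y in closedBall x0 ρ', ENNReal.ofReal (f y ^ 2) ≤
      ENNReal.ofReal (l ^ 2 / M ^ 2) * volume (closedBall x0 ρ') := by
    intro ρ' h'
    calc _ ≤ ∫⁻ y in closedBall x0 ρ', ENNReal.ofReal (1 / M ^ 2) * ENNReal.ofReal (cz K f y ^ 2 + M ^ 2 * f y ^ 2) := by
          refine lintegral_mono fun y => ?_
          rw [← ENNReal.ofReal_mul (by positivity)]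
          apply ENNReal.ofReal_le_ofReal
          rw [mul_add]
          have : 1 / M ^ 2 * (M ^ 2 * f y ^ 2) = f y ^ 2 := by field_simp
          rw [this]
          have : 0 ≤ 1 / M ^ 2 * cz K f y ^ 2 := by positivity
          linarith
      _ ≤ ENNReal.ofReal (1 / M ^ 2) * (ENNReal.ofReal (l ^ 2) * volume (closedBall x0 ρ')) := by
          rw [lintegral_const_mul' _ _ (by simp)]
          gcongr
          exact hyp ρ' h'
      _ = _ := by
          rw [← mul_assoc, ← ENNReal.ofReal_mul (by positivity)]; congr 2; ring
  have cf1 : ∀ ρ', 2 * ρ ≤ ρ' → ∫⁻ y in closedBall x0 ρ', ENNReal.ofReal |f y| ≤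
      ENNReal.ofReal (2 * l) * volume (closedBall x0 ρ') := by
    intro ρ' h'
    calc _ ≤ ∫⁻ y in closedBall x0 ρ', (ENNReal.ofReal (1 / l) * ENNReal.ofReal (f y ^ 2) + ENNReal.ofReal l) := by
          refine lintegral_mono fun y => ?_
          rw [← ENNReal.ofReal_mul (by positivity), ← ENNReal.ofReal_add (by positivity) hl.le]
          apply ENNReal.ofReal_le_ofReal
          have : |f y| ^ 2 = f y ^ 2 := sq_abs _
          rw [← this, ← mul_le_mul_iff_of_pos_left hl]
          have e : l * (1 / l * |f y| ^ 2 + l) = |f y| ^ 2 + l ^ 2 := by field_simp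
          rw [e]
          nlinarith [sq_nonneg (|f y| - l), abs_nonneg (f y)]
      _ = ENNReal.ofReal (1 / l) * (∫⁻ y in closedBall x0 ρ', ENNReal.ofReal (f y ^ 2)) + ENNReal.ofReal l * volume (closedBall x0 ρ') := by
          rw [lintegral_add_right _ measurable_const, lintegral_const_mul' _ _ (by simp), setLIntegral_const]
      _ ≤ ENNReal.ofReal (1 / l) * (ENNReal.ofReal (l ^ 2) * volume (closedBall x0 ρ')) + ENNReal.ofReal l * volume (closedBall x0 ρ') := by
          gcongr
          refine (cf2 ρ' h').trans ?_
          gcongr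
          apply div_le_self (by positivity)
          exact one_le_pow₀ hM
      _ = _ := by
          rw [← mul_assoc, ← ENNReal.ofReal_mul (by positivity), ← add_mul, ← ENNReal.ofReal_add (by positivity) hl.le]
          congr 2; field_simp; ring
  -- splitting
  set f1 : En n → ℝ := fun y => cutf x0 R y * f y with hf1
  set f2 : En n → ℝ := fun y => (1 - cutf x0 R y) * f y with hf2
  have cc := cutf_cont x0 R
  have f1c : Continuous f1 := by rw [hf1]; fun_prop
  have f2c : Continuous f2 := by rw [hf2]; fun_prop
  have f1s : HasCompactSupport f1 := hs.mul_left
  have f2s : HasCompactSupport f2 := hs.mul_left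
  have hsum : ∀ x, cz K f x = cz K f1 x + cz K f2 x := by
    intro x
    rw [← cz_add hK.cont f1c f1s f2c f2s]
    congr 1; ext y; simp only [hf1, hf2]; ring
  have hf1int : ∫⁻ y, ENNReal.ofReal (f1 y ^ 2) ≤ ENNReal.ofReal (l ^ 2 / M ^ 2) * volume (closedBall x0 (7 * R)) := by
    calc _ ≤ ∫⁻ y, (closedBall x0 (7 * R)).indicator (fun y => ENNReal.ofReal (f y ^ 2)) y := by
          refine lintegral_mono fun y => ?_
          by_cases hy : y ∈ closedBall x0 (7 * R)
          · rw [Set.indicator_of_mem hy]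
            apply ENNReal.ofReal_le_ofReal
            simp only [hf1]
            rw [mul_pow]
            have h1 := cutf_nonneg x0 R y
            have h2 := cutf_le x0 R y
            have : cutf x0 R y ^ 2 ≤ 1 := by nlinarith
            nlinarith [sq_nonneg (f y)]
          · rw [mem_closedBall, dist_eq_norm, not_le] at hy
            simp [hf1, cutf_zero x0 R hR0 y hy]
      _ = ∫⁻ y in closedBall x0 (7 * R), ENNReal.ofReal (f y ^ 2) := lintegral_indicator measurableSet_closedBall _
      _ ≤ _ := cf2 _ (by rw [hR]; linarith)
  have hT1 : ∫⁻ y, ENNReal.ofReal (cz K f1 y ^ 2) ≤ ENNReal.ofReal (A * (l ^ 2 / M ^ 2)) * volume (closedBall x0 (7 * R)) := by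
    refine (hK.l2 f1 f1c f1s).trans ?_
    rw [ENNReal.ofReal_mul hA, mul_assoc]
    gcongr
  have v7 : volume (closedBall x0 (7 * R)) = ENNReal.ofReal (7 ^ n) * volume (closedBall x0 R) := by
    rw [vol_cb x0 (by positivity : (0:ℝ) ≤ 7 * R), vol_cb x0 hR0.le, mul_pow, ENNReal.ofReal_mul (by positivity), mul_assoc]
  have v35 : volume (closedBall x0 (7 * R)) = ENNReal.ofReal (35 ^ n) * volume (closedBall x0 ρ) := by
    have e : (7 * R) ^ n = 35 ^ n * ρ ^ n := by rw [← mul_pow]; congr 1; rw [hR]; ring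
    rw [vol_cb x0 (by positivity : (0:ℝ) ≤ 7 * R), vol_cb x0 hρ.le, e, ENNReal.ofReal_mul (by positivity), mul_assoc]
  have hosc : ∀ x x', ‖x - x0‖ ≤ R → ‖x' - x0‖ ≤ R → |cz K f2 x - cz K f2 x'| ≤ C1 * l := by
    intro x x' hx hx'
    have := osc_far hA hK f2c f2s x0 R (2 * l) hR0 (by positivity) (fun ρ' h' => by
      refine le_trans (lintegral_mono fun y => ?_) (cf1 ρ' (by rw [hR] at h'; linarith))
      apply ENNReal.ofReal_le_ofReal
      simp only [hf2, abs_mul]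
      have h1 := cutf_nonneg x0 R y
      have h2 := cutf_le x0 R y
      rw [abs_of_nonneg (by linarith)]
      exact mul_le_of_le_one_left (abs_nonneg _) (by linarith)) (fun y hy => by
        simp [hf2, cutf_one x0 R hR0 y hy]) x x' hx hx'
    refine this.trans (le_of_eq ?_)
    rw [hC1]; ring
  have hfar : ∀ x, ‖x - x0‖ ≤ R → |cz K f2 x| ≤ L0 * l := by
    intro x hx
    have key : ENNReal.ofReal (cz K f2 x ^ 2) * volume (closedBall x0 R) ≤ ENNReal.ofReal (L2 * l ^ 2) * volume (closedBall x0 R) := by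
      calc _ = ∫⁻ y in closedBall x0 R, ENNReal.ofReal (cz K f2 x ^ 2) := by rw [setLIntegral_const]
        _ ≤ ∫⁻ y in closedBall x0 R, (ENNReal.ofReal 4 * ENNReal.ofReal (cz K f y ^ 2) + (ENNReal.ofReal 4 * ENNReal.ofReal (cz K f1 y ^ 2) + ENNReal.ofReal (2 * (C1 * l) ^ 2))) := by
            refine setLIntegral_mono' measurableSet_closedBall fun y hy => ?_
            rw [mem_closedBall, dist_eq_norm] at hy
            rw [← ENNReal.ofReal_mul (by norm_num), ← ENNReal.ofReal_mul (by norm_num), ← ENNReal.ofReal_add (by positivity) (by positivity), ← ENNReal.ofReal_add (by positivity) (by positivity)]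
            apply ENNReal.ofReal_le_ofReal
            have h1 := sq_le_sq' (abs_le.1 (hosc x y hx hy)).1 (abs_le.1 (hosc x y hx hy)).2
            have h2 := sq_add_le (cz K f2 y) (cz K f2 x - cz K f2 y)
            have h3 := sq_add_le (cz K f y) (- cz K f1 y)
            have h4 : cz K f2 y = cz K f y + - cz K f1 y := by rw [hsum y]; ring
            rw [← h4] at h3
            have h5 : cz K f2 y + (cz K f2 x - cz K f2 y) = cz K f2 x := by ring
            rw [h5] at h2
            nlinarith
        _ = ENNReal.ofReal 4 * (∫⁻ y in closedBall x0 R, ENNReal.ofReal (cz K f y ^ 2)) + (ENNReal.ofReal 4 * (∫⁻ y in closedBall x0 R, ENNReal.ofReal (cz K f1 y ^ 2)) + ENNReal.ofReal (2 * (C1 * l) ^ 2) * volume (closedBall x0 R)) := by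
            have m1 : Measurable (fun y => ENNReal.ofReal 4 * ENNReal.ofReal (cz K f y ^ 2)) := by
              have := (cz_cont hK.cont hf hs).measurable; fun_prop
            have m2 : Measurable (fun y => ENNReal.ofReal 4 * ENNReal.ofReal (cz K f1 y ^ 2)) := by
              have := (cz_cont hK.cont f1c f1s).measurable; fun_prop
            rw [lintegral_add_left m1, lintegral_add_left m2, lintegral_const_mul' _ _ (by simp), lintegral_const_mul' _ _ (by simp), setLIntegral_const]
        _ ≤ ENNReal.ofReal 4 * (ENNReal.ofReal (l ^ 2) * volume (closedBall x0 R)) + (ENNReal.ofReal 4 * (ENNReal.ofReal (A * l ^ 2) * (ENNReal.ofReal (7 ^ n) * volume (closedBall x0 R))) + ENNReal.ofReal (2 * (C1 * l) ^ 2) * volume (closedBall x0 R)) := by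
            gcongr
            · exact cT R (by rw [hR]; linarith)
            · rw [← v7]
              refine (setLIntegral_le_lintegral _ _).trans (hT1.trans ?_)
              gcongr
              exact div_le_self (by positivity) (one_le_pow₀ hM)
        _ = _ := by
            simp only [← mul_assoc]
            rw [← ENNReal.ofReal_mul (by positivity), ← ENNReal.ofReal_mul (by positivity), ← ENNReal.ofReal_mul (by positivity), ← add_mul, ← add_mul, ← ENNReal.ofReal_add (by positivity) (by positivity), ← ENNReal.ofReal_add (by positivity) (by positivity)]
            congr 2; rw [hL2]; ring
    have k2 := (ENNReal.mul_le_mul_iff_left (vol_cb_pos x0 hR0) (vol_cb_top x0 R)).1 key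
    rw [ENNReal.ofReal_le_ofReal_iff (by positivity)] at k2
    apply abs_le_of_sq_le_sq _ (by positivity)
    rw [mul_pow, hL0sq]; exact k2
  -- conclusion
  have hsub : closedBall x0 R ∩ {x | 2 * L0 * l < |cz K f x|} ⊆ {x | ENNReal.ofReal (L0 ^ 2 * l ^ 2) ≤ ENNReal.ofReal (cz K f1 x ^ 2)} := by
    rintro x ⟨hx, hx2⟩
    rw [mem_closedBall, dist_eq_norm] at hx
    have hx2 : 2 * L0 * l < |cz K f x| := hx2
    have h1 := hfar x hx
    rw [hsum x] at hx2
    have h2 := abs_add_le (cz K f1 x) (cz K f2 x)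
    have h3 : L0 * l < |cz K f1 x| := by linarith
    apply ENNReal.ofReal_le_ofReal
    rw [← mul_pow, ← sq_abs (cz K f1 x)]
    have : 0 < L0 * l := by positivity
    gcongr
  have hmk := mul_meas_ge_le_lintegral₀ (μ := (volume : Measure (En n))) (f := fun x => ENNReal.ofReal (cz K f1 x ^ 2)) (by
    have := (cz_cont hK.cont f1c f1s).measurable; fun_prop) (ENNReal.ofReal (L0 ^ 2 * l ^ 2))
  have hle : ENNReal.ofReal (l ^ 2) * volume (closedBall x0 R ∩ {x | 2 * L0 * l < |cz K f x|}) ≤ ENNReal.ofReal (l ^ 2) * (ENNReal.ofReal (A * 35 ^ n / M ^ 2) * volume (closedBall x0 ρ)) := by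
    calc _ ≤ ENNReal.ofReal (L0 ^ 2 * l ^ 2) * volume {x | ENNReal.ofReal (L0 ^ 2 * l ^ 2) ≤ ENNReal.ofReal (cz K f1 x ^ 2)} := by
          have : l ^ 2 ≤ L0 ^ 2 * l ^ 2 := le_mul_of_one_le_left (by positivity) (one_le_pow₀ (by linarith))
          gcongr
      _ ≤ ENNReal.ofReal (A * (l ^ 2 / M ^ 2)) * volume (closedBall x0 (7 * R)) := hmk.trans hT1
      _ = _ := by
          rw [v35, ← mul_assoc, ← mul_assoc, ← ENNReal.ofReal_mul (by positivity), ← ENNReal.ofReal_mul (by positivity)]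
          congr 2; ring
  exact (ENNReal.mul_le_mul_iff_right (by simp; positivity) (by simp)).1 hle

lemma fatou_rpow {q : ℝ} (hq : 0 < q) {α : Type*} [MeasurableSpace α] (μ : Measure α) (F : ℕ → α → ℝ)
    (G : α → ℝ) (hF : ∀ m, Measurable (F m)) (hlim : ∀ x, Tendsto (fun m => F m x) atTop (nhds (G x)))
    (B : ℝ≥0∞) (hB : ∀ m, ∫⁻ x, ENNReal.ofReal (|F m x| ^ q) ∂μ ≤ B) :
    ∫⁻ x, ENNReal.ofReal (|G x| ^ q) ∂μ ≤ B := by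
  have e : ∀ x, ENNReal.ofReal (|G x| ^ q) = liminf (fun m => ENNReal.ofReal (|F m x| ^ q)) atTop := by
    intro x
    symm
    apply Tendsto.liminf_eq
    refine (ENNReal.continuous_ofReal.tendsto _).comp ?_
    exact ((hlim x).abs).rpow_const (Or.inr hq.le)
  simp_rw [e]
  refine (lintegral_liminf_le fun m => ?_).trans ?_
  · have := hF m
    exact ENNReal.measurable_ofReal.comp ((continuous_abs.measurable.comp this).pow_const q)
  · refine liminf_le_of_frequently_le' (Frequently.of_forall hB)

lemma rpow_le_self' {c s : ℝ} (h0 : 0 ≤ c) (h1 : c ≤ 1) (hs : 1 ≤ s) : c ^ s ≤ c := by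
  have := Real.rpow_le_rpow_of_exponent_ge' h0 h1 zero_le_one hs
  rwa [Real.rpow_one] at this

lemma cz_bdd {K f : En n → ℝ} (hK : Continuous K) (hb : ∃ M, ∀ x, |K x| ≤ M) (hf : Continuous f)
    (hs : HasCompactSupport f) : ∃ S, 0 ≤ S ∧ ∀ x, |cz K f x| ≤ S := by
  obtain ⟨M, hM⟩ := hb
  have hM0 : 0 ≤ M := (abs_nonneg _).trans (hM 0)
  have hi : Integrable f := hf.integrable_of_hasCompactSupport hs
  refine ⟨M * ∫ y, |f y|, mul_nonneg hM0 (integral_nonneg fun _ => abs_nonneg _), fun x => ?_⟩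
  rw [← Real.norm_eq_abs, cz]
  refine (norm_integral_le_integral_norm _).trans ?_
  rw [← integral_const_mul]
  refine integral_mono (cz_integrable hK hf hs x).norm (hi.abs.const_mul M) fun y => ?_
  simp only [norm_mul, Real.norm_eq_abs]
  gcongr
  exact hM _

/-- Lp bound for p > 2 -/
lemma cz_Lp (n : ℕ) (hn : 0 < n) (A : ℝ) (hA : 0 ≤ A) (p : ℝ) (hp : 2 < p) : ∃ C : ℝ≥0∞, C ≠ ⊤ ∧
    ∀ K : En n → ℝ, CZK K A → ∀ f : En n → ℝ, Continuous f → HasCompactSupport f →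
    ∫⁻ x, ENNReal.ofReal (|cz K f x| ^ p) ≤ C * ∫⁻ x, ENNReal.ofReal (|f x| ^ p) := by
  obtain ⟨Λ, C0, hΛ, hC0, hloc⟩ := local_est n A hA
  obtain ⟨Cp, hCp, hlev⟩ := integrate_levels (n := n) p Λ hp (by linarith)
  set D : ℝ≥0∞ := Cp * (2 * ENNReal.ofReal C0) * 2 ^ (p / 2) with hD
  have hDt : D ≠ ⊤ := by
    refine ENNReal.mul_ne_top (ENNReal.mul_ne_top hCp (ENNReal.mul_ne_top (by simp) (by simp))) ?_
    exact ENNReal.rpow_ne_top_of_nonneg (by linarith) (by simp)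
  set M : ℝ := 1 + 2 * D.toReal with hM
  have hM1 : 1 ≤ M := by rw [hM]; linarith [ENNReal.toReal_nonneg (a := D)]
  have hM0 : 0 < M := by linarith
  have hDM : D * ENNReal.ofReal (1 / M ^ 2) ≤ 1 / 2 := by
    rw [← ENNReal.ofReal_toReal hDt, ← ENNReal.ofReal_mul ENNReal.toReal_nonneg,
      show (1:ℝ≥0∞) / 2 = ENNReal.ofReal (1 / 2) by rw [ENNReal.ofReal_div_of_pos] <;> simp]
    apply ENNReal.ofReal_le_ofReal
    rw [mul_one_div, div_le_div_iff₀ (by positivity) (by norm_num)]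
    rw [hM]; nlinarith [ENNReal.toReal_nonneg (a := D)]
  refine ⟨ENNReal.ofReal (M ^ p), by simp, ?_⟩
  intro K hK f hf hs
  have hTc := cz_cont hK.cont hf hs
  set h : En n → ℝ := fun x => cz K f x ^ 2 + M ^ 2 * f x ^ 2 with hh
  have hhc : Continuous h := by rw [hh]; fun_prop
  have hf2 : ∫⁻ x, ENNReal.ofReal (f x ^ 2) ≠ ⊤ := by
    have hi : Integrable (fun x => f x ^ 2) := by
      apply Continuous.integrable_of_hasCompactSupport (by fun_prop)
      have := hs.mul_left (f := f)
      simp only [sq]; exact this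
    exact hi.lintegral_lt_top.ne
  have hT2 : ∫⁻ x, ENNReal.ofReal (cz K f x ^ 2) ≠ ⊤ :=
    ((hK.l2 f hf hs).trans_lt (ENNReal.mul_lt_top (by simp) hf2.lt_top)).ne
  have hhI : ∫⁻ x, ENNReal.ofReal (h x) ≠ ⊤ := by
    have : ∫⁻ x, ENNReal.ofReal (h x) = ∫⁻ x, (ENNReal.ofReal (cz K f x ^ 2) + ENNReal.ofReal (M ^ 2) * ENNReal.ofReal (f x ^ 2)) := by
      congr 1; ext x
      rw [hh, ← ENNReal.ofReal_mul (by positivity), ← ENNReal.ofReal_add (by positivity) (by positivity)]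
    rw [this, lintegral_add_left (by have := hTc.measurable; fun_prop), lintegral_const_mul' _ _ (by simp)]
    exact ENNReal.add_ne_top.2 ⟨hT2, ENNReal.mul_ne_top (by simp) hf2⟩
  have hmain := hlev (2 * ENNReal.ofReal (C0 / M ^ 2)) (fun x => |cz K f x|) h
    (ENNReal.mul_ne_top (by simp) (by simp)) (by fun_prop) hhc.measurable (fun x => abs_nonneg _)
    (fun x => by rw [hh]; positivity) (by
      intro l hl
      refine cover_lemma hn h hhc hhI (l ^ 2) (by positivity) _ ?_ _ ?_
      · intro x hx
        have hx : Λ * l < |cz K f x| := hx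
        have h1 : l < |cz K f x| := lt_of_le_of_lt (by nlinarith) hx
        have h2 : l ^ 2 < |cz K f x| ^ 2 := by gcongr
        rw [sq_abs] at h2
        have h3 : 0 ≤ M ^ 2 * f x ^ 2 := by positivity
        simp only [hh]; linarith
      · intro x ρ hρ hav
        exact hloc K hK f hf hs x ρ l M hρ hl hM1 hav)
  set I := ∫⁻ x, ENNReal.ofReal (|cz K f x| ^ p)
  set J := ∫⁻ x, ENNReal.ofReal (|f x| ^ p)
  have hfin : I ≠ ⊤ := by
    obtain ⟨S, hS0, hS⟩ := cz_bdd hK.cont hK.bdd hf hs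
    refine ne_top_of_le_ne_top (ENNReal.mul_ne_top (a := ENNReal.ofReal (S ^ (p - 2))) (by simp) hT2) ?_
    rw [← lintegral_const_mul' _ _ (by simp)]
    refine lintegral_mono fun x => ?_
    rw [← ENNReal.ofReal_mul (by positivity)]
    apply ENNReal.ofReal_le_ofReal
    have : |cz K f x| ^ p = |cz K f x| ^ (p - 2) * cz K f x ^ 2 := by
      rcases eq_or_ne (cz K f x) 0 with h0 | h0
      · rw [h0]; simp; rw [Real.zero_rpow (by linarith)]
      · rw [← sq_abs (cz K f x), ← Real.rpow_natCast |cz K f x| 2, ← Real.rpow_add (abs_pos.2 h0)]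
        norm_num
    rw [this]
    have h1 := hS x
    have : |cz K f x| ^ (p - 2) ≤ S ^ (p - 2) := Real.rpow_le_rpow (abs_nonneg _) h1 (by linarith)
    gcongr
  have hhp : ∫⁻ x, ENNReal.ofReal (h x ^ (p / 2)) ≤ 2 ^ (p / 2) * (I + ENNReal.ofReal (M ^ p) * J) := by
    have : 2 ^ (p / 2) * (I + ENNReal.ofReal (M ^ p) * J) = ∫⁻ x, 2 ^ (p / 2) * (ENNReal.ofReal (|cz K f x| ^ p) + ENNReal.ofReal (M ^ p) * ENNReal.ofReal (|f x| ^ p)) := by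
      rw [lintegral_const_mul' _ _ (ENNReal.rpow_ne_top_of_nonneg (by linarith) (by simp)),
        lintegral_add_left (show Measurable (fun x => ENNReal.ofReal (|cz K f x| ^ p)) from ENNReal.measurable_ofReal.comp (hTc.abs.measurable.pow_const p)), lintegral_const_mul' _ _ (by simp)]
    rw [this]
    refine lintegral_mono fun x => ?_
    have e1 : ∀ t : ℝ, ENNReal.ofReal (t ^ 2) ^ (p / 2) = ENNReal.ofReal (|t| ^ p) := by
      intro t
      rw [ENNReal.ofReal_rpow_of_nonneg (by positivity) (by linarith), ← sq_abs, ← Real.rpow_natCast, ← Real.rpow_mul (abs_nonneg _)]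
      congr 2; push_cast; ring
    have := add_rpow_le (ENNReal.ofReal (cz K f x ^ 2)) (ENNReal.ofReal (M ^ 2 * f x ^ 2)) (p / 2) (by linarith)
    rw [e1, ← mul_pow, e1, abs_mul, abs_of_pos hM0, Real.mul_rpow hM0.le (abs_nonneg _), ENNReal.ofReal_mul (by positivity),
      ← ENNReal.ofReal_add (by positivity) (by positivity), ENNReal.ofReal_rpow_of_nonneg (by positivity) (by linarith)] at this
    simpa [hh, mul_pow] using this
  have hI2 : I ≤ 1 / 2 * (I + ENNReal.ofReal (M ^ p) * J) := by
    calc I ≤ Cp * (2 * ENNReal.ofReal (C0 / M ^ 2)) * (2 ^ (p / 2) * (I + ENNReal.ofReal (M ^ p) * J)) :=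
          hmain.trans (mul_le_mul_right hhp _)
      _ = D * ENNReal.ofReal (1 / M ^ 2) * (I + ENNReal.ofReal (M ^ p) * J) := by
          rw [hD, show C0 / M ^ 2 = C0 * (1 / M ^ 2) by ring, ENNReal.ofReal_mul hC0]; ring
      _ ≤ _ := mul_le_mul_left hDM _
  have h2 : 2 * I ≤ I + ENNReal.ofReal (M ^ p) * J := by
    calc 2 * I ≤ 2 * (1 / 2 * (I + ENNReal.ofReal (M ^ p) * J)) := mul_le_mul_right hI2 _
      _ = _ := by rw [← mul_assoc, one_div, ENNReal.mul_inv_cancel (by simp) (by simp), one_mul]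
  rw [two_mul] at h2
  exact (ENNReal.add_le_add_iff_left hfin).1 h2

/-- signed power -/
def sgp (s t : ℝ) : ℝ := (max t 0) ^ s - (max (-t) 0) ^ s

lemma sgp_cont {s : ℝ} (hs : 0 < s) : Continuous (sgp s) := by
  unfold sgp
  exact ((continuous_id.max continuous_const).rpow_const fun _ => Or.inr hs.le).sub
    ((continuous_neg.max continuous_const).rpow_const fun _ => Or.inr hs.le)

lemma sgp_mul {s : ℝ} (hs : 0 < s) (t : ℝ) : t * sgp s t = |t| ^ (s + 1) := by
  unfold sgp
  rcases lt_trichotomy t 0 with h | h | h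
  · rw [max_eq_right h.le, max_eq_left (by linarith), Real.zero_rpow hs.ne', abs_of_neg h, Real.rpow_add (by linarith), Real.rpow_one]; ring
  · subst h; simp; rw [Real.zero_rpow (by linarith)]
  · rw [max_eq_left h.le, max_eq_right (by linarith), Real.zero_rpow hs.ne', abs_of_pos h, Real.rpow_add (by linarith), Real.rpow_one]; ring

lemma sgp_abs {s : ℝ} (hs : 0 < s) (t : ℝ) : |sgp s t| = |t| ^ s := by
  unfold sgp
  rcases le_total t 0 with h | h
  · rw [max_eq_right h, max_eq_left (by linarith), Real.zero_rpow hs.ne', abs_of_nonpos h, zero_sub, abs_neg, abs_of_nonneg (Real.rpow_nonneg (by linarith) _)]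
  · rw [max_eq_left h, max_eq_right (by linarith), Real.zero_rpow hs.ne', abs_of_nonneg h, sub_zero, abs_of_nonneg (Real.rpow_nonneg (by linarith) _)]

lemma cz_adj {K f g : En n → ℝ} (hK : Continuous K) (he : ∀ x, K (-x) = K x) (hf : Continuous f)
    (hs : HasCompactSupport f) (hg : Continuous g) (hgs : HasCompactSupport g) :
    ∫ x, cz K f x * g x = ∫ x, f x * cz K g x := by
  have e1 : ∀ x, cz K f x * g x = ∫ y, K (x - y) * f y * g x := fun x => by
    rw [cz, integral_mul_const]
  have e2 : ∀ y, f y * cz K g y = ∫ x, K (x - y) * f y * g x := fun y => by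
    rw [cz, ← integral_const_mul]; congr 1; ext x
    rw [← he (y - x), neg_sub]; ring
  simp_rw [e1, e2]
  apply integral_integral_swap
  have hc : Continuous (Function.uncurry fun x y => K (x - y) * f y * g x) := by
    simp only [Function.uncurry_def]; fun_prop
  apply hc.integrable_of_hasCompactSupport
  apply HasCompactSupport.intro (hgs.isCompact.prod hs.isCompact)
  rintro ⟨x, y⟩ hxy
  simp only [Set.mem_prod, not_and_or] at hxy
  rcases hxy with h | h
  · simp [Function.uncurry, image_eq_zero_of_notMem_tsupport h]
  · simp [Function.uncurry, image_eq_zero_of_notMem_tsupport h]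

/-- Lq bound for the dual exponent -/
lemma cz_Lq (n : ℕ) (hn : 0 < n) (A : ℝ) (hA : 0 ≤ A) (p q : ℝ) (hp : 2 < p) (hpq : q.HolderConjugate p) : ∃ C : ℝ≥0∞, C ≠ ⊤ ∧
    ∀ K : En n → ℝ, CZK K A → ∀ f : En n → ℝ, Continuous f → HasCompactSupport f →
    ∫⁻ x, ENNReal.ofReal (|cz K f x| ^ q) ≤ C * ∫⁻ x, ENNReal.ofReal (|f x| ^ q) := by
  obtain ⟨C, hC, hLp⟩ := cz_Lp n hn A hA p hp
  have hp0 : 0 < p := by linarith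
  have hq1 : 1 < q := hpq.lt
  have hq0 : 0 < q := by linarith
  refine ⟨C ^ (q / p), ENNReal.rpow_ne_top_of_nonneg (by positivity) hC, ?_⟩
  intro K hK f hf hs
  have hTc := cz_cont hK.cont hf hs
  set F := cz K f with hF
  refine fatou_rpow hq0 volume (fun m x => cutf 0 (m + 1) x * F x) F (fun m => ?_) (fun x => ?_) _ fun m => ?_
  · have := cutf_cont (0 : En n) (m + 1); fun_prop
  · apply tendsto_const_nhds.congr'
    filter_upwards [eventually_ge_atTop (Nat.ceil ‖x‖)] with m hm
    rw [cutf_one 0 _ (by positivity), one_mul]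
    have : ‖x‖ ≤ m := (Nat.le_ceil _).trans (by exact_mod_cast hm)
    rw [sub_zero]; linarith
  · have hR : (0:ℝ) < m + 1 := by positivity
    have hcc := cutf_cont (0 : En n) (m + 1)
    set χ := cutf (0 : En n) (m + 1) with hχ
    have hχ0 : ∀ x, 0 ≤ χ x := cutf_nonneg _ _
    have hχ1 : ∀ x, χ x ≤ 1 := cutf_le _ _
    have hχs : HasCompactSupport χ := by
      apply HasCompactSupport.intro (isCompact_closedBall (0 : En n) (7 * (m + 1)))
      intro x hx
      apply cutf_zero _ _ hR
      rw [mem_closedBall, dist_eq_norm, not_le] at hx; exact hx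
    set φ : En n → ℝ := fun x => χ x * sgp (q - 1) (F x) with hφ
    have hsc := sgp_cont (s := q - 1) (by linarith)
    have hφc : Continuous φ := by rw [hφ]; fun_prop
    have hφs : HasCompactSupport φ := hχs.mul_right
    set I := ∫⁻ x, ENNReal.ofReal (χ x * |F x| ^ q) with hI
    have hIc : Continuous (fun x => χ x * |F x| ^ q) :=
      hcc.mul (hTc.abs.rpow_const fun _ => Or.inr hq0.le)
    have hIi : Integrable (fun x => χ x * |F x| ^ q) := hIc.integrable_of_hasCompactSupport hχs.mul_right
    have hIt : I ≠ ⊤ := hIi.lintegral_lt_top.ne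
    have e1 : ∀ x, F x * φ x = χ x * |F x| ^ q := by
      intro x
      rw [hφ]; simp only
      rw [mul_left_comm, sgp_mul (by linarith)]; congr 2; ring
    have hφp : ∫⁻ x, ENNReal.ofReal (|φ x| ^ p) ≤ I := by
      refine lintegral_mono fun x => ?_
      apply ENNReal.ofReal_le_ofReal
      rw [hφ]; simp only
      rw [abs_mul, sgp_abs (by linarith), abs_of_nonneg (hχ0 x), Real.mul_rpow (hχ0 x) (by positivity), ← Real.rpow_mul (abs_nonneg _)]
      have : (q - 1) * p = q := by
        have := hpq.symm.sub_one_mul_conj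
        have h3 := hpq.mul_eq_add
        nlinarith
      rw [this]
      gcongr
      exact rpow_le_self' (hχ0 x) (hχ1 x) (by linarith)
    have hI1 : I = ENNReal.ofReal (∫ x, f x * cz K φ x) := by
      rw [← cz_adj hK.cont hK.even hf hs hφc hφs]
      simp_rw [← hF, e1]
      rw [ofReal_integral_eq_lintegral_ofReal hIi (Eventually.of_forall fun x => mul_nonneg (hχ0 x) (by positivity))]
    have hTφ := cz_cont hK.cont hφc hφs
    have hI2 : I ≤ (∫⁻ x, ENNReal.ofReal (|f x| ^ q)) ^ (1 / q) * (C * I) ^ (1 / p) := by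
      calc I ≤ ∫⁻ x, ‖f x * cz K φ x‖ₑ := by
            rw [hI1]
            refine le_trans ?_ (enorm_integral_le_lintegral_enorm _)
            rw [← ofReal_norm]; exact ENNReal.ofReal_le_ofReal (le_abs_self _)
        _ = ∫⁻ x, (fun x => ‖f x‖ₑ) x * (fun x => ‖cz K φ x‖ₑ) x := by simp [enorm_mul]
        _ ≤ (∫⁻ x, ‖f x‖ₑ ^ q) ^ (1 / q) * (∫⁻ x, ‖cz K φ x‖ₑ ^ p) ^ (1 / p) :=
            ENNReal.lintegral_mul_le_Lp_mul_Lq volume hpq (by fun_prop) (by fun_prop)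
        _ ≤ _ := by
            have e2 : ∀ (t s : ℝ), 0 < s → ‖t‖ₑ ^ s = ENNReal.ofReal (|t| ^ s) := by
              intro t s hs
              rw [← ofReal_norm, ENNReal.ofReal_rpow_of_nonneg (norm_nonneg _) hs.le, Real.norm_eq_abs]
            simp_rw [e2 _ q hq0, e2 _ p hp0]
            gcongr
            exact (hLp K hK φ hφc hφs).trans (by gcongr)
    have hle : ∫⁻ x, ENNReal.ofReal (|χ x * F x| ^ q) ≤ I := by
      refine lintegral_mono fun x => ?_
      apply ENNReal.ofReal_le_ofReal
      rw [abs_mul, abs_of_nonneg (hχ0 x), Real.mul_rpow (hχ0 x) (abs_nonneg _)]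
      gcongr
      exact rpow_le_self' (hχ0 x) (hχ1 x) (by linarith)
    refine hle.trans ?_
    rcases eq_or_ne I 0 with h0 | h0
    · rw [h0]; exact zero_le
    set J := ∫⁻ x, ENNReal.ofReal (|f x| ^ q)
    rw [ENNReal.mul_rpow_of_nonneg _ _ (by positivity), ← mul_assoc] at hI2
    have hs1 : 1 / p + 1 / q = 1 := by have := hpq.inv_add_inv_eq_one; rw [one_div, one_div]; linarith
    have hI3 : I ^ (1 / q) * I ^ (1 / p) ≤ J ^ (1 / q) * C ^ (1 / p) * I ^ (1 / p) := by
      rw [← ENNReal.rpow_add _ _ h0 hIt, add_comm, hs1, ENNReal.rpow_one]; exact hI2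
    have hI4 : I ^ (1 / q) ≤ J ^ (1 / q) * C ^ (1 / p) := by
      refine (ENNReal.mul_le_mul_iff_left ?_ ?_).1 hI3
      · exact (ENNReal.rpow_pos h0.bot_lt hIt).ne'
      · exact ENNReal.rpow_ne_top_of_nonneg (by positivity) hIt
    have := ENNReal.rpow_le_rpow hI4 hq0.le
    rw [ENNReal.mul_rpow_of_nonneg _ _ hq0.le, ← ENNReal.rpow_mul, ← ENNReal.rpow_mul, ← ENNReal.rpow_mul, one_div_mul_cancel hq0.ne',
      ENNReal.rpow_one, ENNReal.rpow_one, mul_comm] at this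
    rwa [show q / p = 1 / p * q by ring]

/-- partial derivative -/
def pd (i : Fin n) (f : En n → ℝ) (x : En n) : ℝ := fderiv ℝ f x (basisVec i)

lemma param_deriv {Y : Type*} [TopologicalSpace Y] [SecondCountableTopology Y] [MeasurableSpace Y]
    [OpensMeasurableSpace Y] (ν : Measure Y) [IsFiniteMeasure ν] {S : Set Y} (hS : IsCompact S)
    (hν : ∀ᵐ y ∂ν, y ∈ S) (F : En n → Y → ℝ) (F' : En n → Y → En n →L[ℝ] ℝ)
    (hF : Continuous (Function.uncurry F)) (hF' : Continuous (Function.uncurry F'))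
    (hd : ∀ x y, HasFDerivAt (fun x => F x y) (F' x y) x) (x0 : En n) :
    HasFDerivAt (fun x => ∫ y, F x y ∂ν) (∫ y, F' x0 y ∂ν) x0 := by
  have hc : IsCompact (closedBall x0 1 ×ˢ S) := (isCompact_closedBall x0 1).prod hS
  obtain ⟨M, hM⟩ := hc.exists_bound_of_continuousOn hF'.continuousOn
  obtain ⟨M0, hM0⟩ := hc.exists_bound_of_continuousOn hF.continuousOn
  have c1 : ∀ x, Continuous (F x) := fun x => hF.comp (Continuous.prodMk_right x)
  have c2 : ∀ x, Continuous (F' x) := fun x => hF'.comp (Continuous.prodMk_right x)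
  refine hasFDerivAt_integral_of_dominated_of_fderiv_le (bound := fun _ => M)
    (closedBall_mem_nhds x0 one_pos) (Eventually.of_forall fun x => (c1 x).aestronglyMeasurable) ?_
    (c2 x0).aestronglyMeasurable ?_ (integrable_const _) (Eventually.of_forall fun y x _ => hd x y)
  · refine Integrable.of_bound (c1 x0).aestronglyMeasurable M0 ?_
    filter_upwards [hν] with y hy
    exact hM0 (x0, y) ⟨mem_closedBall_self zero_le_one, hy⟩
  · filter_upwards [hν] with y hy x hx
    exact hM (x, y) ⟨hx, hy⟩

lemma cz_eq_restrict (K f : En n → ℝ) (x : En n) :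
    cz K f x = ∫ y in tsupport f, K (x - y) * f y := by
  rw [cz, setIntegral_eq_integral_of_forall_compl_eq_zero]
  intro y hy
  rw [image_eq_zero_of_notMem_tsupport hy, mul_zero]

lemma cz_hasFDerivAt {K f : En n → ℝ} (hK : ContDiff ℝ 1 K) (hf : Continuous f)
    (hs : HasCompactSupport f) (x : En n) :
    ∃ L : En n →L[ℝ] ℝ, HasFDerivAt (cz K f) L x ∧ ∀ v, L v = cz (fun z => fderiv ℝ K z v) f x := by
  have hK' := hK.continuous_fderiv one_ne_zero
  have hKc := hK.continuous
  have : IsFiniteMeasure (volume.restrict (tsupport f)) :=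
    ⟨by rw [Measure.restrict_apply_univ]; exact hs.isCompact.measure_lt_top⟩
  have key := param_deriv (volume.restrict (tsupport f)) hs.isCompact (ae_restrict_mem (isClosed_tsupport f).measurableSet)
    (fun x y => K (x - y) * f y) (fun x y => f y • fderiv ℝ K (x - y))
    (by simp only [Function.uncurry_def]; fun_prop) (by simp only [Function.uncurry_def]; fun_prop)
    (fun x y => by
      have h1 := ((hK.differentiable one_ne_zero) (x - y)).hasFDerivAt
      have h2 : HasFDerivAt (fun x => K (x - y)) (fderiv ℝ K (x - y)) x := by
        exact h1.comp x (f' := ContinuousLinearMap.id ℝ _) ((hasFDerivAt_id x).sub_const y)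
      exact h2.mul_const (f y)) x
  refine ⟨∫ y in tsupport f, f y • fderiv ℝ K (x - y), ?_, ?_⟩
  · rw [show cz K f = fun x => ∫ y in tsupport f, K (x - y) * f y from funext (cz_eq_restrict K f)]
    exact key
  · intro v
    have hi : Integrable (fun y => f y • fderiv ℝ K (x - y)) (volume.restrict (tsupport f)) := by
      apply Integrable.integrableOn
      apply Continuous.integrable_of_hasCompactSupport (by fun_prop)
      exact hs.smul_right
    rw [ContinuousLinearMap.integral_apply hi, cz_eq_restrict]
    congr 1; ext y; simp [mul_comm]

lemma cz_pd {K f : En n → ℝ} (hK : ContDiff ℝ 1 K) (hf : Continuous f)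
    (hs : HasCompactSupport f) (j : Fin n) (x : En n) : pd j (cz K f) x = cz (pd j K) f x := by
  obtain ⟨L, h1, h2⟩ := cz_hasFDerivAt hK hf hs x
  rw [pd, h1.fderiv, h2]; rfl

lemma cz_diff {K f : En n → ℝ} (hK : ContDiff ℝ 1 K) (hf : Continuous f)
    (hs : HasCompactSupport f) : Differentiable ℝ (cz K f) := fun x => by
  obtain ⟨L, h1, _⟩ := cz_hasFDerivAt hK hf hs x
  exact h1.differentiableAt

lemma cz_conv (K f : En n → ℝ) :
    cz K f = convolution f K (ContinuousLinearMap.mul ℝ ℝ) volume := by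
  ext x
  simp only [cz, convolution, ContinuousLinearMap.mul_apply']
  congr 1; ext y; ring

lemma cz_smooth {K f : En n → ℝ} {m : ℕ∞} (hK : LocallyIntegrable K) (hf : ContDiff ℝ m f)
    (hs : HasCompactSupport f) : ContDiff ℝ m (cz K f) := by
  rw [cz_conv]
  exact hs.contDiff_convolution_left _ hf hK

lemma pd_cs {f : En n → ℝ} (hs : HasCompactSupport f) (j : Fin n) : HasCompactSupport (pd j f) := by
  exact hs.fderiv_apply (𝕜 := ℝ) (basisVec j)

lemma pd_smooth {f : En n → ℝ} (hf : ContDiff ℝ (⊤ : ℕ∞) f) (j : Fin n) : ContDiff ℝ (⊤ : ℕ∞) (pd j f) := by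
  unfold pd
  exact (hf.fderiv_right (m := (⊤ : ℕ∞)) (by simp)).clm_apply contDiff_const

lemma pd_cont {f : En n → ℝ} (hf : ContDiff ℝ 1 f) (j : Fin n) : Continuous (pd j f) := by
  unfold pd
  exact (hf.continuous_fderiv one_ne_zero).clm_apply continuous_const

lemma cz_pd_right {K f : En n → ℝ} (hK : LocallyIntegrable K) (hf : ContDiff ℝ 1 f)
    (hs : HasCompactSupport f) (j : Fin n) (x : En n) : pd j (cz K f) x = cz K (pd j f) x := by
  have h := hs.hasFDerivAt_convolution_left (ContinuousLinearMap.mul ℝ ℝ) hf hK x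
  rw [pd, cz_conv, h.fderiv, cz_conv]
  simp only [convolution]
  rw [ContinuousLinearMap.integral_apply]
  · rfl
  · have := (hs.fderiv ℝ).convolutionExists_left ((ContinuousLinearMap.mul ℝ ℝ).precompL (En n))
      (hf.continuous_fderiv one_ne_zero) hK x
    exact this

/-- the base -/
def bk (ε : ℝ) (x : En n) : ℝ := ‖x‖ ^ 2 + ε ^ 2
def kk (ε : ℝ) (i : Fin n) (x : En n) : ℝ := x i * bk ε x ^ (-(n:ℝ) / 2)
def KK (ε : ℝ) (i j : Fin n) (x : En n) : ℝ :=
  (if i = j then 1 else 0) * bk ε x ^ (-(n:ℝ) / 2) - n * (x i * x j) * bk ε x ^ (-(n:ℝ) / 2 - 1)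
def TT (ε : ℝ) (i j m : Fin n) (x : En n) : ℝ :=
  -n * ((if i = j then x m else 0) + (if i = m then x j else 0) + (if j = m then x i else 0)) * bk ε x ^ (-(n:ℝ) / 2 - 1)
   + n * (n + 2) * (x i * x j * x m) * bk ε x ^ (-(n:ℝ) / 2 - 2)
def PP (ε : ℝ) (x : En n) : ℝ := n * ε ^ 2 * bk ε x ^ (-(n:ℝ) / 2 - 1)

lemma bk_pos {ε : ℝ} (hε : 0 < ε) (x : En n) : 0 < bk ε x := by unfold bk; positivity

lemma coord_le (x : En n) (i : Fin n) : |x i| ≤ ‖x‖ := by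
  have := PiLp.norm_apply_le x i; simpa using this

lemma pd_bk (ε : ℝ) (x : En n) :
    HasFDerivAt (bk ε) (2 • innerSL ℝ x) x := by
  have := (hasStrictFDerivAt_norm_sq x).hasFDerivAt
  exact this.add_const (ε ^ 2)

lemma bk_contDiff (ε : ℝ) : ContDiff ℝ (⊤ : ℕ∞) (bk ε : En n → ℝ) := by
  unfold bk
  exact (contDiff_norm_sq ℝ).add contDiff_const

lemma bkr_contDiff {ε : ℝ} (hε : 0 < ε) (s : ℝ) : ContDiff ℝ (⊤ : ℕ∞) (fun x : En n => bk ε x ^ s) :=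
  (bk_contDiff ε).rpow_const_of_ne fun x => (bk_pos hε x).ne'

lemma coord_contDiff (i : Fin n) : ContDiff ℝ (⊤ : ℕ∞) (fun x : En n => x i) :=
  (EuclideanSpace.proj (𝕜 := ℝ) i).contDiff

lemma kk_contDiff {ε : ℝ} (hε : 0 < ε) (i : Fin n) : ContDiff ℝ (⊤ : ℕ∞) (kk ε i) :=
  (coord_contDiff i).mul (bkr_contDiff hε _)

lemma KK_contDiff {ε : ℝ} (hε : 0 < ε) (i j : Fin n) : ContDiff ℝ (⊤ : ℕ∞) (KK ε i j) :=
  (contDiff_const.mul (bkr_contDiff hε _)).sub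
    ((contDiff_const.mul ((coord_contDiff i).mul (coord_contDiff j))).mul (bkr_contDiff hε _))

lemma hasFD_coord (i : Fin n) (x : En n) : HasFDerivAt (fun x : En n => x i) (EuclideanSpace.proj (𝕜 := ℝ) i) x :=
  (EuclideanSpace.proj (𝕜 := ℝ) i).hasFDerivAt

lemma hasFD_bkr {ε : ℝ} (hε : 0 < ε) (s : ℝ) (x : En n) :
    HasFDerivAt (fun x : En n => bk ε x ^ s) ((s * bk ε x ^ (s - 1)) • (2 • innerSL ℝ x)) x :=
  (pd_bk ε x).rpow_const (Or.inl (bk_pos hε x).ne')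

lemma proj_basis (i j : Fin n) : (EuclideanSpace.proj (𝕜 := ℝ) i) (basisVec j : En n) = if i = j then 1 else 0 := by
  simp [basisVec]

lemma inner_basis (x : En n) (j : Fin n) : inner ℝ x (basisVec j) = x j := by
  simp [basisVec, EuclideanSpace.inner_single_right]

lemma pd_kk {ε : ℝ} (hε : 0 < ε) (i j : Fin n) (x : En n) : pd j (kk ε i) x = KK ε i j x := by
  have h := (hasFD_coord i x).mul (hasFD_bkr hε (-(n:ℝ)/2) x)
  unfold pd
  have h' : HasFDerivAt (kk ε i) _ x := h
  rw [h'.fderiv]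
  simp only [add_apply, smul_apply, proj_basis, innerSL_apply_apply, inner_basis, KK, smul_eq_mul, nsmul_eq_mul]
  push_cast; ring

lemma pd_KK {ε : ℝ} (hε : 0 < ε) (i j m : Fin n) (x : En n) : pd m (KK ε i j) x = TT ε i j m x := by
  have h := ((hasFD_bkr hε (-(n:ℝ)/2) x).const_mul (if i = j then (1:ℝ) else 0)).sub
    ((((hasFD_coord i x).mul (hasFD_coord j x)).const_mul (n:ℝ)).mul (hasFD_bkr hε (-(n:ℝ)/2 - 1) x))
  unfold pd
  have h' : HasFDerivAt (KK ε i j) _ x := h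
  rw [h'.fderiv]
  simp only [add_apply, sub_apply, smul_apply, proj_basis, innerSL_apply_apply, inner_basis, TT, Pi.mul_apply, smul_eq_mul, nsmul_eq_mul]
  rw [show -(n:ℝ)/2 - 1 - 1 = -(n:ℝ)/2 - 2 by ring]
  push_cast
  split_ifs <;> ring

lemma KK_symm (ε : ℝ) (i j : Fin n) : KK ε i j = KK ε j i := by
  ext x; simp only [KK, eq_comm (a := i)]; ring

lemma TT_symm (ε : ℝ) (i l : Fin n) : TT ε l i l = TT ε l l i := by
  ext x; simp only [TT, eq_comm (a := i) (b := l)]; ring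

lemma KK_trace {ε : ℝ} (hε : 0 < ε) (x : En n) : ∑ i, KK ε i i x = PP ε x := by
  simp only [KK, PP, if_true, Finset.sum_sub_distrib, Finset.sum_const, ← Finset.sum_mul, ← Finset.mul_sum]
  have h1 : ∑ i, x i * x i = ‖x‖ ^ 2 := by
    rw [EuclideanSpace.norm_sq_eq]; congr 1; ext i; rw [Real.norm_eq_abs, sq_abs]; ring
  have h2 : bk ε x ^ (-(n:ℝ) / 2) = bk ε x * bk ε x ^ (-(n:ℝ) / 2 - 1) := by
    rw [Real.rpow_sub_one (bk_pos hε x).ne']; field_simp [(bk_pos hε x).ne']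
  rw [h1, h2]
  simp only [bk, Finset.card_univ, Fintype.card_fin, nsmul_eq_mul]; ring

lemma coord_le_bk (ε : ℝ) (x : En n) (i : Fin n) : |x i| ≤ bk ε x ^ (1/2 : ℝ) := by
  rw [← Real.sqrt_eq_rpow]
  apply Real.le_sqrt_of_sq_le
  have := coord_le x i
  unfold bk
  have h2 := pow_le_pow_left₀ (abs_nonneg _) this 2
  nlinarith [sq_nonneg ε]

lemma kk_bd {ε : ℝ} (hε : 0 < ε) (i : Fin n) (x : En n) : |kk ε i x| ≤ 1 * bk ε x ^ (-((n - 1 : ℝ) / 2)) := by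
  have hb := bk_pos hε x
  unfold kk
  rw [abs_mul, abs_of_pos (Real.rpow_pos_of_pos hb _), one_mul]
  calc _ ≤ bk ε x ^ (1/2 : ℝ) * bk ε x ^ (-(n:ℝ) / 2) := by gcongr; exact coord_le_bk ε x i
    _ = _ := by rw [← Real.rpow_add hb]; congr 1; ring

lemma KK_bd {ε : ℝ} (hε : 0 < ε) (i j : Fin n) (x : En n) : |KK ε i j x| ≤ (1 + n) * bk ε x ^ (-((n : ℝ) / 2)) := by
  have hb := bk_pos hε x
  have h1 := coord_le_bk ε x i
  have h2 := coord_le_bk ε x j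
  have h3 : bk ε x ^ (1/2 : ℝ) * bk ε x ^ (1/2 : ℝ) * bk ε x ^ (-(n:ℝ) / 2 - 1) = bk ε x ^ (-((n : ℝ) / 2)) := by
    rw [← Real.rpow_add hb, ← Real.rpow_add hb]; congr 1; ring
  have h0 : -(n:ℝ)/2 = -((n:ℝ)/2) := by ring
  unfold KK
  refine (abs_sub _ _).trans ?_
  rw [add_mul, one_mul]
  apply add_le_add
  · rw [abs_mul, abs_of_pos (Real.rpow_pos_of_pos hb _), h0]
    refine mul_le_of_le_one_left (by positivity) ?_
    split_ifs <;> simp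
  · rw [abs_mul, abs_mul, abs_mul, abs_of_pos (Real.rpow_pos_of_pos hb _), Nat.abs_cast, ← h3, mul_assoc]
    gcongr

lemma TT_bd {ε : ℝ} (hε : 0 < ε) (i j m : Fin n) (x : En n) : |TT ε i j m x| ≤ (n * (3 + (n + 2))) * bk ε x ^ (-((n + 1 : ℝ) / 2)) := by
  have hb := bk_pos hε x
  have h1 := coord_le_bk ε x i
  have h2 := coord_le_bk ε x j
  have hm := coord_le_bk ε x m
  have e3 : bk ε x ^ (1/2 : ℝ) * bk ε x ^ (1/2 : ℝ) * bk ε x ^ (1/2 : ℝ) * bk ε x ^ (-(n:ℝ) / 2 - 2) = bk ε x ^ (-((n + 1 : ℝ) / 2)) := by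
    rw [← Real.rpow_add hb, ← Real.rpow_add hb, ← Real.rpow_add hb]; congr 1; ring
  have e1 : bk ε x ^ (1/2 : ℝ) * bk ε x ^ (-(n:ℝ) / 2 - 1) = bk ε x ^ (-((n + 1 : ℝ) / 2)) := by
    rw [← Real.rpow_add hb]; congr 1; ring
  unfold TT
  refine (abs_add_le _ _).trans ?_
  have hS : |((if i = j then x m else 0) + (if i = m then x j else 0) + (if j = m then x i else 0))| ≤ 3 * bk ε x ^ (1/2 : ℝ) := by
    have hz : (0:ℝ) ≤ bk ε x ^ (1/2 : ℝ) := by positivity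
    have a1 : |if i = j then x m else 0| ≤ bk ε x ^ (1/2 : ℝ) := by split_ifs <;> simp_all
    have a2 : |if i = m then x j else 0| ≤ bk ε x ^ (1/2 : ℝ) := by split_ifs <;> simp_all
    have a3 : |if j = m then x i else 0| ≤ bk ε x ^ (1/2 : ℝ) := by split_ifs <;> simp_all
    have := abs_add_three (if i = j then x m else 0) (if i = m then x j else 0) (if j = m then x i else 0)
    linarith
  have hR : (n * (3 + (n + 2)) : ℝ) * bk ε x ^ (-((n + 1 : ℝ) / 2)) = n * 3 * bk ε x ^ (-((n + 1 : ℝ) / 2)) + n * (n + 2) * bk ε x ^ (-((n + 1 : ℝ) / 2)) := by ring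
  rw [hR]
  apply add_le_add
  · rw [abs_mul, abs_mul, abs_neg, Nat.abs_cast, abs_of_pos (Real.rpow_pos_of_pos hb _), ← e1]
    calc _ ≤ (n:ℝ) * (3 * bk ε x ^ (1/2 : ℝ)) * bk ε x ^ (-(n:ℝ) / 2 - 1) := by gcongr
      _ = _ := by ring
  · rw [abs_mul, abs_mul, abs_mul, abs_mul, abs_mul, Nat.abs_cast, abs_of_pos (Real.rpow_pos_of_pos hb _), abs_of_nonneg (by positivity : (0:ℝ) ≤ n + 2), ← e3, mul_assoc]
    gcongr

lemma bk_cont (ε : ℝ) : Continuous (bk ε : En n → ℝ) := (bk_contDiff ε).continuous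

lemma bkr_cont {ε : ℝ} (hε : 0 < ε) (s : ℝ) : Continuous (fun x : En n => bk ε x ^ s) := (bkr_contDiff hε s).continuous

lemma bk_int {ε : ℝ} (hε : 0 < ε) (s : ℝ) (hs : (n:ℝ) < 2 * s) (hs0 : 0 < s) :
    Integrable (fun x : En n => bk ε x ^ (-s)) := by
  have h := integrable_rpow_neg_one_add_norm_sq (E := En n) (μ := volume) (r := 2 * s) (by simpa using hs)
  set m := min 1 (ε ^ 2) with hm
  have hm0 : 0 < m := lt_min one_pos (by positivity)
  refine (h.const_mul (m ^ (-s))).mono' (bkr_cont hε _).aestronglyMeasurable (Eventually.of_forall fun x => ?_)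
  have hb := bk_pos hε x
  rw [Real.norm_eq_abs, abs_of_pos (Real.rpow_pos_of_pos hb _), show -(2 * s) / 2 = -s by ring, ← Real.mul_rpow hm0.le (by positivity)]
  apply Real.rpow_le_rpow_of_nonpos (by positivity) _ (by linarith)
  unfold bk
  have h1 : m ≤ 1 := min_le_left _ _
  have h2 : m ≤ ε ^ 2 := min_le_right _ _
  nlinarith [sq_nonneg ‖x‖]

lemma cz_decay {ε : ℝ} (hε : 0 < ε) {g f : En n → ℝ} {s C : ℝ} (hs : 0 ≤ s) (hC : 0 ≤ C) (hg : Continuous g)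
    (hgb : ∀ x, |g x| ≤ C * bk ε x ^ (-s)) (hf : Continuous f) (hfs : HasCompactSupport f) :
    ∃ C', 0 ≤ C' ∧ ∀ x, |cz g f x| ≤ C' * bk ε x ^ (-s) := by
  obtain ⟨R, hR⟩ := hfs.isCompact.isBounded.subset_closedBall (0 : En n)
  set c0 := 2 + 2 * R ^ 2 / ε ^ 2 with hc0
  have hc0p : 0 < c0 := by positivity
  have hi : Integrable f := hf.integrable_of_hasCompactSupport hfs
  refine ⟨C * c0 ^ s * ∫ y, |f y|, mul_nonneg (by positivity) (integral_nonneg fun _ => abs_nonneg _), fun x => ?_⟩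
  have hb := bk_pos hε x
  rw [← Real.norm_eq_abs, cz]
  refine (norm_integral_le_integral_norm _).trans ?_
  rw [mul_right_comm, ← integral_const_mul]
  refine integral_mono (cz_integrable hg hf hfs x).norm (hi.abs.const_mul _) fun y => ?_
  simp only [norm_mul, Real.norm_eq_abs]
  by_cases hy : y ∈ tsupport f
  · have hyR : ‖y‖ ≤ R := by simpa using hR hy
    have hbb := bk_pos hε (x - y)
    gcongr
    refine (hgb _).trans ?_
    rw [mul_assoc]
    gcongr
    have h1 : bk ε x / c0 ≤ bk ε (x - y) := by
      rw [div_le_iff₀ hc0p]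
      have hn : ‖x‖ ≤ ‖x - y‖ + ‖y‖ := by simpa using norm_add_le (x - y) y
      have h2 : ‖x‖ ^ 2 ≤ 2 * ‖x - y‖ ^ 2 + 2 * R ^ 2 := by
        have : ‖x‖ ^ 2 ≤ (‖x - y‖ + ‖y‖) ^ 2 := by gcongr
        have h4 : ‖y‖ ^ 2 ≤ R ^ 2 := by gcongr
        nlinarith [sq_add_le ‖x - y‖ ‖y‖]
      have h5 : 2 * R ^ 2 / ε ^ 2 * ε ^ 2 = 2 * R ^ 2 := by field_simp
      have h6 : 0 ≤ ‖x - y‖ ^ 2 * (2 * R ^ 2 / ε ^ 2) := by positivity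
      have h7 := sq_nonneg ‖x - y‖
      have h8 := sq_nonneg ε
      simp only [bk, hc0]
      nlinarith
    calc _ ≤ (bk ε x / c0) ^ (-s) := Real.rpow_le_rpow_of_nonpos (by positivity) h1 (by linarith)
      _ = _ := by rw [Real.div_rpow hb.le hc0p.le, Real.rpow_neg hc0p.le, div_inv_eq_mul, mul_comm]
  · rw [image_eq_zero_of_notMem_tsupport hy]; simp

lemma decay_int {ε : ℝ} (hε : 0 < ε) {u v : En n → ℝ} (hu : Continuous u) (hv : Continuous v) {a b : ℝ}
    (hu' : ∃ C, 0 ≤ C ∧ ∀ x, |u x| ≤ C * bk ε x ^ (-a)) (hv' : ∃ C, 0 ≤ C ∧ ∀ x, |v x| ≤ C * bk ε x ^ (-b))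
    (hab : (n:ℝ) < 2 * (a + b)) (h0 : 0 < a + b) : Integrable (fun x => u x * v x) := by
  obtain ⟨C, hC, hu'⟩ := hu'
  obtain ⟨D, hD, hv'⟩ := hv'
  refine ((bk_int hε (a + b) hab h0).const_mul (C * D)).mono' (hu.mul hv).aestronglyMeasurable
    (Eventually.of_forall fun x => ?_)
  have hb := bk_pos hε x
  rw [norm_mul, Real.norm_eq_abs, Real.norm_eq_abs, neg_add, Real.rpow_add hb]
  calc _ ≤ (C * bk ε x ^ (-a)) * (D * bk ε x ^ (-b)) := by
        gcongr
        · exact hu' x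
        · exact hv' x
    _ = _ := by ring

lemma L2_identity (hn : 1 < n) {ε : ℝ} (hε : 0 < ε) {f : En n → ℝ} (hf : Continuous f) (hfs : HasCompactSupport f)
    (i l : Fin n) :
    Integrable (fun x => cz (KK ε i l) f x ^ 2) ∧ Integrable (fun x => cz (KK ε i i) f x * cz (KK ε l l) f x) ∧
    ∫ x, cz (KK ε i l) f x ^ 2 = ∫ x, cz (KK ε i i) f x * cz (KK ε l l) f x := by
  have hn1 : (1:ℝ) < n := by exact_mod_cast hn
  have ck : ∀ i, ContDiff ℝ 1 (kk ε i : En n → ℝ) := fun i => (kk_contDiff hε i).of_le (by norm_cast)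
  have cK : ∀ i j, ContDiff ℝ 1 (KK ε i j : En n → ℝ) := fun i j => (KK_contDiff hε i j).of_le (by norm_cast)
  have pk : ∀ i j, pd j (cz (kk ε i) f) = cz (KK ε i j) f := fun i j => by
    ext x; rw [cz_pd (ck i) hf hfs]; congr 1; ext y; exact pd_kk hε i j y
  have pK : ∀ i j m, pd m (cz (KK ε i j) f) = cz (TT ε i j m) f := fun i j m => by
    ext x; rw [cz_pd (cK i j) hf hfs]; congr 1; ext y; exact pd_KK hε i j m y
  have cT : ∀ i j m, Continuous (TT ε i j m : En n → ℝ) := fun i j m => by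
    rw [show TT ε i j m = pd m (KK ε i j) from funext fun y => (pd_KK hε i j m y).symm]
    exact pd_cont (cK i j) m
  have ctk := fun i => cz_cont (ck i).continuous hf hfs
  have ctK := fun i j => cz_cont (cK i j).continuous hf hfs
  have ctT := fun i j m => cz_cont (cT i j m) hf hfs
  have dk := fun i => cz_decay hε (by linarith) (by norm_num) (ck i).continuous (kk_bd hε i) hf hfs
  have dK := fun i j => cz_decay hε (by positivity) (by positivity) (cK i j).continuous (KK_bd hε i j) hf hfs
  have dT := fun i j m => cz_decay hε (by positivity) (by positivity) (cT i j m) (TT_bd hε i j m) hf hfs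
  have I1 : ∀ i j i' j', Integrable (fun x => cz (KK ε i j) f x * cz (KK ε i' j') f x) := fun i j i' j' =>
    decay_int hε (ctK i j) (ctK i' j') (dK i j) (dK i' j') (by linarith) (by linarith)
  have I2 : ∀ i i' j' m, Integrable (fun x => cz (kk ε i) f x * cz (TT ε i' j' m) f x) := fun i i' j' m =>
    decay_int hε (ctk i) (ctT i' j' m) (dk i) (dT i' j' m) (by linarith) (by linarith)
  have I3 : ∀ i i' j', Integrable (fun x => cz (kk ε i) f x * cz (KK ε i' j') f x) := fun i i' j' =>
    decay_int hε (ctk i) (ctK i' j') (dk i) (dK i' j') (by linarith) (by linarith)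
  have hbp : ∀ i i' j' m, ∫ x, cz (KK ε i m) f x * cz (KK ε i' j') f x = - ∫ x, cz (kk ε i) f x * cz (TT ε i' j' m) f x := by
    intro i i' j' m
    have e1 : ∀ x, fderiv ℝ (cz (kk ε i) f) x (basisVec m) = cz (KK ε i m) f x := fun x => congrFun (pk i m) x
    have e2 : ∀ x, fderiv ℝ (cz (KK ε i' j') f) x (basisVec m) = cz (TT ε i' j' m) f x := fun x => congrFun (pK i' j' m) x
    have := integral_mul_fderiv_eq_neg_fderiv_mul_of_integrable (μ := (volume : Measure (En n)))
      (f := cz (kk ε i) f) (g := cz (KK ε i' j') f) (v := basisVec m)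
      (by simp_rw [e1]; exact I1 _ _ _ _) (by simp_rw [e2]; exact I2 _ _ _ _) (I3 _ _ _)
      (fun x _ => cz_diff (ck i) hf hfs x) (fun x _ => cz_diff (cK i' j') hf hfs x)
    simp_rw [e1, e2] at this
    rw [this, neg_neg]
  refine ⟨?_, I1 _ _ _ _, ?_⟩
  · simpa only [sq] using I1 i l i l
  · have : ∀ x, cz (KK ε i l) f x ^ 2 = cz (KK ε i l) f x * cz (KK ε l i) f x := fun x => by
      rw [sq, KK_symm ε l i]
    simp_rw [this]
    rw [hbp i l i l, hbp i l l i, TT_symm]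

lemma PP_nonneg (ε : ℝ) (x : En n) : 0 ≤ PP ε x := by
  have : 0 ≤ bk ε x := by unfold bk; positivity
  unfold PP; positivity

lemma PP_int {ε : ℝ} (hε : 0 < ε) : Integrable (PP ε : En n → ℝ) := by
  have := (bk_int (n := n) hε ((n:ℝ)/2 + 1) (by linarith) (by positivity)).const_mul ((n:ℝ) * ε ^ 2)
  convert this using 2 with x
  unfold PP; congr 2; ring

lemma PP_cont {ε : ℝ} (hε : 0 < ε) : Continuous (PP ε : En n → ℝ) :=
  continuous_const.mul (bkr_cont hε _)

/-- the constant -/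
def cst (n : ℕ) : ℝ := ∫ x : En n, PP 1 x

lemma PP_scale {ε : ℝ} (hε : 0 < ε) (z : En n) : ε ^ n * PP ε (ε • z) = PP 1 z := by
  unfold PP bk
  have h1 : ‖ε • z‖ ^ 2 + ε ^ 2 = ε ^ 2 * (‖z‖ ^ 2 + 1 ^ 2) := by rw [norm_smul, Real.norm_eq_abs, abs_of_pos hε]; ring
  rw [h1, Real.mul_rpow (by positivity) (by positivity), ← Real.rpow_natCast ε 2, ← Real.rpow_mul hε.le, ← Real.rpow_natCast ε n]
  have h2 : ε ^ (n:ℝ) * (ε ^ (((2:ℕ):ℝ)) * ε ^ (((2:ℕ):ℝ) * (-(n:ℝ) / 2 - 1))) = 1 := by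
    rw [← Real.rpow_add hε, ← Real.rpow_add hε]
    rw [show (n:ℝ) + (((2:ℕ):ℝ) + ((2:ℕ):ℝ) * (-(n:ℝ) / 2 - 1)) = 0 by push_cast; ring, Real.rpow_zero]
  linear_combination (n * (‖z‖ ^ 2 + 1 ^ 2) ^ (-(n:ℝ) / 2 - 1)) * h2

lemma PP_integral {ε : ℝ} (hε : 0 < ε) : ∫ x : En n, PP ε x = cst n := by
  have := Measure.integral_comp_smul (volume : Measure (En n)) (PP ε) ε
  unfold cst
  simp_rw [← PP_scale hε, integral_const_mul, this]
  simp only [finrank_euclideanSpace, Fintype.card_fin, smul_eq_mul]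
  rw [abs_of_pos (by positivity), ← mul_assoc, mul_inv_cancel₀ (by positivity), one_mul]

lemma cst_pos (hn : 0 < n) : 0 < cst n := by
  unfold cst
  rw [integral_pos_iff_support_of_nonneg (PP_nonneg 1) (PP_int one_pos)]
  have : Function.support (PP 1 : En n → ℝ) = Set.univ := by
    ext x; simp only [Function.mem_support, Set.mem_univ, iff_true]
    have := bk_pos one_pos x
    unfold PP; positivity
  rw [this]; exact isOpen_univ.measure_pos volume Set.univ_nonempty

lemma L2_PP {ε : ℝ} (hε : 0 < ε) {f : En n → ℝ} (hf : Continuous f) (hfs : HasCompactSupport f) :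
    ∫⁻ x, ENNReal.ofReal (cz (PP ε) f x ^ 2) ≤ ENNReal.ofReal (cst n ^ 2) * ∫⁻ x, ENNReal.ofReal (f x ^ 2) := by
  have hc0 : 0 ≤ cst n := integral_nonneg (PP_nonneg 1)
  have hPc := PP_cont (n := n) hε
  have hf2 : HasCompactSupport (fun y => f y ^ 2) := by
    have := hfs.mul_left (f := f); simp only [sq]; exact this
  have pt : ∀ x, cz (PP ε) f x ^ 2 ≤ cst n * cz (PP ε) (fun y => f y ^ 2) x := by
    intro x
    set m := cz (PP ε) f x
    have i0 : Integrable (fun y => PP ε (x - y)) := (PP_int hε).comp_sub_left x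
    have i1 := cz_integrable hPc hf hfs x
    have i2 := cz_integrable hPc (f := fun y => f y ^ 2) (by fun_prop) hf2 x
    have h : 0 ≤ ∫ y, PP ε (x - y) * (cst n * f y - m) ^ 2 := integral_nonneg fun y => mul_nonneg (PP_nonneg _ _) (sq_nonneg _)
    have e : ∫ y, PP ε (x - y) * (cst n * f y - m) ^ 2 = cst n ^ 2 * cz (PP ε) (fun y => f y ^ 2) x - 2 * m * cst n * m + m ^ 2 * cst n := by
      have : ∀ y, PP ε (x - y) * (cst n * f y - m) ^ 2 = cst n ^ 2 * (PP ε (x - y) * f y ^ 2) - 2 * m * cst n * (PP ε (x - y) * f y) + m ^ 2 * PP ε (x - y) := fun y => by ring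
      simp_rw [this]
      have j1 : Integrable (fun y => cst n ^ 2 * (PP ε (x - y) * f y ^ 2)) := i2.const_mul _
      have j2 : Integrable (fun y => 2 * m * cst n * (PP ε (x - y) * f y)) := i1.const_mul _
      have j12 : Integrable (fun y => cst n ^ 2 * (PP ε (x - y) * f y ^ 2) - 2 * m * cst n * (PP ε (x - y) * f y)) := j1.sub j2
      have j3 : Integrable (fun y => m ^ 2 * PP ε (x - y)) := i0.const_mul _
      rw [integral_add j12 j3, integral_sub j1 j2,
        integral_const_mul, integral_const_mul, integral_const_mul, integral_sub_left_eq_self (PP ε) volume x, PP_integral hε]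
      rfl
    rw [e] at h
    rcases hc0.eq_or_lt with h0 | h0
    · have : m = 0 := by
        have hP0 : PP ε =ᵐ[volume] (0 : En n → ℝ) := by
          rw [← integral_eq_zero_iff_of_nonneg (PP_nonneg ε) (PP_int hε), PP_integral hε, ← h0]
        have hP1 : ∀ᵐ y, PP ε (x - y) = 0 := by
          have := (Measure.measurePreserving_sub_left (volume : Measure (En n)) x).quasiMeasurePreserving.ae hP0
          exact this
        show ∫ y, _ = 0
        apply integral_eq_zero_of_ae
        filter_upwards [hP1] with y hy
        simp [hy]
      rw [this, ← h0]; simp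
    · have : 0 ≤ cst n * (cst n * cz (PP ε) (fun y => f y ^ 2) x - m ^ 2) := by nlinarith
      have := nonneg_of_mul_nonneg_right this h0
      linarith
  calc _ ≤ ∫⁻ x, ENNReal.ofReal (cst n) * ∫⁻ y, ENNReal.ofReal (PP ε (x - y)) * ENNReal.ofReal (f y ^ 2) := by
        refine lintegral_mono fun x => ?_
        refine (ENNReal.ofReal_le_ofReal (pt x)).trans ?_
        rw [ENNReal.ofReal_mul hc0]
        gcongr
        rw [cz, ofReal_integral_eq_lintegral_ofReal (cz_integrable hPc (f := fun y => f y ^ 2) (by fun_prop) hf2 x)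
          (Eventually.of_forall fun y => mul_nonneg (PP_nonneg _ _) (sq_nonneg _))]
        refine lintegral_mono fun y => ?_
        rw [ENNReal.ofReal_mul (PP_nonneg _ _)]
    _ = ENNReal.ofReal (cst n) * ∫⁻ y, ∫⁻ x, ENNReal.ofReal (PP ε (x - y)) * ENNReal.ofReal (f y ^ 2) := by
        rw [lintegral_const_mul' _ _ (by simp), lintegral_lintegral_swap]
        have hm := hPc.measurable
        have hm2 := hf.measurable
        simp only [Function.uncurry_def]
        fun_prop
    _ = ENNReal.ofReal (cst n) * ∫⁻ y, ENNReal.ofReal (cst n) * ENNReal.ofReal (f y ^ 2) := by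
        congr 2; ext y
        rw [lintegral_mul_const' _ _ (by simp), lintegral_sub_right_eq_self (fun x => ENNReal.ofReal (PP ε x)) y,
          ← ofReal_integral_eq_lintegral_ofReal (PP_int hε) (Eventually.of_forall (PP_nonneg ε)), PP_integral hε]
    _ = _ := by
        rw [lintegral_const_mul' _ _ (by simp), ← mul_assoc, ← ENNReal.ofReal_mul hc0, sq]

lemma vec_sum (v : En n) : v = ∑ j, v j • (basisVec j : En n) := by
  ext i
  simp [basisVec, Finset.sum_apply, Pi.single_apply]

lemma fderiv_vsum (f : En n → ℝ) (x v : En n) : fderiv ℝ f x v = ∑ j, v j * pd j f x := by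
  conv_lhs => rw [vec_sum v]
  simp [map_sum, pd]

lemma fderiv_norm_le {f : En n → ℝ} {x : En n} {M : ℝ} (hM : 0 ≤ M) (h : ∀ j, |pd j f x| ≤ M) : ‖fderiv ℝ f x‖ ≤ n * M := by
  refine ContinuousLinearMap.opNorm_le_bound _ (by positivity) fun v => ?_
  rw [fderiv_vsum, Real.norm_eq_abs]
  refine (Finset.abs_sum_le_sum_abs _ _).trans ?_
  calc _ ≤ ∑ j : Fin n, ‖v‖ * M := by
        refine Finset.sum_le_sum fun j _ => ?_
        rw [abs_mul]
        exact mul_le_mul (coord_le v j) (h j) (abs_nonneg _) (norm_nonneg _)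
    _ = _ := by simp; ring

lemma cz_KK_trace {ε : ℝ} (hε : 0 < ε) {f : En n → ℝ} (hf : Continuous f) (hfs : HasCompactSupport f) (x : En n) :
    ∑ i, cz (KK ε i i) f x = cz (PP ε) f x := by
  simp only [cz]
  rw [← integral_finset_sum _ fun i _ => cz_integrable (KK_contDiff hε i i).continuous hf hfs x]
  congr 1; ext y
  rw [← Finset.sum_mul, KK_trace hε]

lemma KK_l2 (hn : 1 < n) {ε : ℝ} (hε : 0 < ε) {f : En n → ℝ} (hf : Continuous f) (hfs : HasCompactSupport f)
    (i l : Fin n) : ∫⁻ x, ENNReal.ofReal (cz (KK ε i l) f x ^ 2) ≤ ENNReal.ofReal (cst n ^ 2) * ∫⁻ x, ENNReal.ofReal (f x ^ 2) := by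
  refine le_trans ?_ (L2_PP hε hf hfs)
  have hI := fun i l => (L2_identity hn hε hf hfs i l).1
  have hJ := fun i l => (L2_identity hn hε hf hfs i l).2.1
  have hs : ∀ x, cz (PP ε) f x ^ 2 = ∑ i, ∑ l, cz (KK ε i i) f x * cz (KK ε l l) f x := fun x => by
    rw [← cz_KK_trace hε hf hfs, sq, Finset.sum_mul_sum]
  have hP : Integrable (fun x => cz (PP ε) f x ^ 2) := by
    simp_rw [hs]
    exact integrable_finset_sum _ fun i _ => integrable_finset_sum _ fun l _ => hJ i l
  rw [← ofReal_integral_eq_lintegral_ofReal (hI i l) (Eventually.of_forall fun _ => sq_nonneg _),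
    ← ofReal_integral_eq_lintegral_ofReal hP (Eventually.of_forall fun _ => sq_nonneg _)]
  apply ENNReal.ofReal_le_ofReal
  simp_rw [hs]
  rw [integral_finset_sum _ fun i _ => integrable_finset_sum _ fun l _ => hJ i l]
  have : ∀ i, ∫ x, ∑ l, cz (KK ε i i) f x * cz (KK ε l l) f x = ∑ l, ∫ x, cz (KK ε i l) f x ^ 2 := fun i => by
    rw [integral_finset_sum _ fun l _ => hJ i l]
    exact Finset.sum_congr rfl fun l _ => ((L2_identity hn hε hf hfs i l).2.2).symm
  simp_rw [this]
  have h0 : ∀ i l, 0 ≤ ∫ x, cz (KK ε i l) f x ^ 2 := fun i l => integral_nonneg fun _ => sq_nonneg _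
  refine le_trans ?_ (Finset.single_le_sum (f := fun i => ∑ l, ∫ x, cz (KK ε i l) f x ^ 2) (fun i _ => Finset.sum_nonneg fun l _ => h0 i l) (Finset.mem_univ i))
  exact Finset.single_le_sum (f := fun l => ∫ x, cz (KK ε i l) f x ^ 2) (fun l _ => h0 i l) (Finset.mem_univ l)

lemma bk_rpow_le {ε : ℝ} (hε : 0 < ε) (x : En n) (hx : x ≠ 0) {s : ℝ} (hs : 0 ≤ s) : bk ε x ^ (-(s / 2)) ≤ ‖x‖ ^ (-s) := by
  have hx0 : 0 < ‖x‖ := norm_pos_iff.2 hx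
  have : ‖x‖ ^ (-s) = (‖x‖ ^ 2) ^ (-(s/2)) := by
    rw [← Real.rpow_natCast, ← Real.rpow_mul hx0.le]; congr 1; push_cast; ring
  rw [this]
  apply Real.rpow_le_rpow_of_nonpos (by positivity) _ (by linarith)
  unfold bk; nlinarith [sq_nonneg ε]

/-- uniform CZ constant -/
def cA (n : ℕ) : ℝ := cst n ^ 2 + n * (n * (3 + (n + 2))) * 2 ^ (n + 1)

lemma cA_nonneg (n : ℕ) : 0 ≤ cA n := by unfold cA; positivity

lemma KK_czk (hn : 1 < n) {ε : ℝ} (hε : 0 < ε) (i j : Fin n) : CZK (KK ε i j) (cA n) where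
  cont := (KK_contDiff hε i j).continuous
  bdd := by
    refine ⟨(1 + n) * (ε ^ 2) ^ (-((n : ℝ) / 2)), fun x => (KK_bd hε i j x).trans ?_⟩
    refine mul_le_mul_of_nonneg_left ?_ (by positivity)
    apply Real.rpow_le_rpow_of_nonpos (by positivity) _ (by linarith [(Nat.cast_nonneg n : (0:ℝ) ≤ n)])
    unfold bk; nlinarith [sq_nonneg ‖x‖]
  even := fun x => by simp [KK, bk]
  reg := fun x h hh hx => by
    have hx0 : 0 < ‖x‖ := norm_pos_iff.2 hx
    have hd : ∀ z, DifferentiableAt ℝ (KK ε i j : En n → ℝ) z := fun z =>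
      ((KK_contDiff hε i j).differentiable (by simp)) z
    set M : ℝ := n * (n * (3 + (n + 2)) * (2 ^ (n + 1) / ‖x‖ ^ (n + 1)))
    have hb : ∀ z ∈ closedBall x ‖h‖, ‖fderiv ℝ (KK ε i j) z‖ ≤ M := by
      intro z hz
      have hz2 : ‖x‖ / 2 ≤ ‖z‖ := by
        have : ‖x‖ ≤ ‖z‖ + ‖z - x‖ := by
          have := norm_sub_le z (z - x); simpa using this
        have h2 : ‖z - x‖ ≤ ‖h‖ := by simpa [dist_eq_norm] using hz
        linarith
      have hz0 : 0 < ‖z‖ := by linarith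
      refine fderiv_norm_le (by positivity) fun m => ?_
      rw [pd_KK hε]
      refine (TT_bd hε i j m z).trans ?_
      gcongr
      refine (bk_rpow_le hε z (norm_pos_iff.1 hz0) (by positivity)).trans ?_
      calc ‖z‖ ^ (-((n:ℝ) + 1)) ≤ (‖x‖ / 2) ^ (-((n:ℝ) + 1)) := Real.rpow_le_rpow_of_nonpos (by positivity) hz2 (by linarith [(Nat.cast_nonneg n : (0:ℝ) ≤ n)])
        _ = _ := by
          rw [Real.rpow_neg (by positivity), ← Nat.cast_add_one, Real.rpow_natCast, div_pow, inv_div]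
    have := (convex_closedBall x ‖h‖).norm_image_sub_le_of_norm_fderiv_le (fun z _ => hd z) hb (mem_closedBall_self (norm_nonneg _))
      (show x + h ∈ closedBall x ‖h‖ by simp)
    rw [Real.norm_eq_abs] at this
    refine this.trans ?_
    rw [add_sub_cancel_left]
    have h1 : M * ‖h‖ = n * (n * (3 + (n + 2))) * 2 ^ (n + 1) * (‖h‖ / ‖x‖ ^ (n + 1)) := by simp only [M]; ring
    rw [h1]; gcongr
    unfold cA; nlinarith [sq_nonneg (cst n)]
  l2 := fun f hf hfs => (KK_l2 hn hε hf hfs i j).trans (by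
    gcongr; unfold cA; have : (0:ℝ) ≤ n * (n * (3 + (n + 2))) * 2 ^ (n + 1) := by positivity
    linarith)

lemma kk_abs_le (hn : 1 < n) (ε : ℝ) (i : Fin n) (x : En n) : |kk ε i x| ≤ ‖x‖ ^ (-((n:ℝ) - 1)) := by
  have hn' : (1:ℝ) < n := by exact_mod_cast hn
  by_cases hx : x = 0
  · subst hx; simp [kk]; positivity
  have hx0 : 0 < ‖x‖ := norm_pos_iff.2 hx
  unfold kk
  rw [abs_mul]
  calc _ ≤ ‖x‖ * (‖x‖ ^ 2) ^ (-(n:ℝ) / 2) := by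
        gcongr
        · exact coord_le x i
        · have : 0 < bk ε x := by unfold bk; positivity
          rw [abs_of_pos (by positivity)]
          apply Real.rpow_le_rpow_of_nonpos (by positivity) _ (by linarith)
          unfold bk; nlinarith [sq_nonneg ε]
    _ = _ := by
      rw [← Real.rpow_natCast, ← Real.rpow_mul hx0.le]
      nth_rewrite 1 [← Real.rpow_one ‖x‖]
      rw [← Real.rpow_add hx0]; congr 1; push_cast; ring

lemma kk_meas (ε : ℝ) (i : Fin n) : Measurable (kk ε i : En n → ℝ) := by
  unfold kk
  have h1 := (bk_cont (n := n) ε).measurable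
  have h2 := (coord_contDiff (n := n) i).continuous.measurable
  exact h2.mul (h1.pow_const _)

lemma kd_li (hn : 1 < n) : LocallyIntegrable (fun x : En n => ‖x‖ ^ (-((n:ℝ) - 1))) := by
  refine locallyIntegrable_of_norm_le_rpow (μ := volume) (C := 1) (α := (n:ℝ) - 1) ?_ ?_ ?_ ?_
  · simp; omega
  · simp
  · refine Eventually.of_forall fun x => ?_
    rw [one_mul, Real.norm_eq_abs, abs_of_nonneg (by positivity)]
  · have : Measurable (fun x : En n => ‖x‖ ^ (-((n:ℝ) - 1))) := by fun_prop
    exact this.aestronglyMeasurable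

lemma kk_li (hn : 1 < n) (ε : ℝ) (i : Fin n) : LocallyIntegrable (kk ε i : En n → ℝ) := by
  refine (kd_li hn).mono (kk_meas ε i).aestronglyMeasurable (Eventually.of_forall fun x => ?_)
  rw [Real.norm_eq_abs, Real.norm_eq_abs]
  exact (kk_abs_le hn ε i x).trans (le_abs_self _)

lemma cz_integrable' {K f : En n → ℝ} (hK : LocallyIntegrable K) (hf : Continuous f)
    (hs : HasCompactSupport f) (x : En n) : Integrable (fun y => K (x - y) * f y) := by
  have := hs.convolutionExists_left (ContinuousLinearMap.mul ℝ ℝ) hf hK x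
  have h2 : Integrable (fun y => f y * K (x - y)) := this
  simpa only [mul_comm] using h2

lemma kk_lim (i : Fin n) (z : En n) {ε : ℕ → ℝ} (hε : Tendsto ε atTop (nhds 0)) :
    Tendsto (fun m => kk (ε m) i z) atTop (nhds (kk 0 i z)) := by
  by_cases hz : z = 0
  · subst hz; simp [kk]
  have h1 : Tendsto (fun m => bk (ε m) z) atTop (nhds (bk 0 z)) := by
    unfold bk; exact (hε.pow 2).const_add _
  have h0 : bk 0 z ≠ 0 := by unfold bk; simpa using hz
  exact (h1.rpow_const (Or.inl h0)).const_mul _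

lemma cz_kk_lim (hn : 1 < n) (i : Fin n) {f : En n → ℝ} (hf : Continuous f) (hs : HasCompactSupport f) (x : En n)
    {ε : ℕ → ℝ} (hε : Tendsto ε atTop (nhds 0)) :
    Tendsto (fun m => cz (kk (ε m) i) f x) atTop (nhds (cz (kk 0 i) f x)) := by
  refine tendsto_integral_of_dominated_convergence (fun y => ‖x - y‖ ^ (-((n:ℝ) - 1)) * |f y|) ?_ ?_ ?_ ?_
  · intro m; exact (cz_integrable' (kk_li hn _ i) hf hs x).aestronglyMeasurable
  · exact cz_integrable' (kd_li hn) hf.abs (by simpa using hs.norm) x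
  · intro m; refine Eventually.of_forall fun y => ?_
    rw [norm_mul, Real.norm_eq_abs, Real.norm_eq_abs]
    gcongr; exact kk_abs_le hn _ i _
  · refine Eventually.of_forall fun y => ?_
    exact (kk_lim i (x - y) hε).mul_const _

lemma cz_PP_lim {f : En n → ℝ} (hf : Continuous f) (hs : HasCompactSupport f) (x : En n)
    {ε : ℕ → ℝ} (hp : ∀ m, 0 < ε m) (hε : Tendsto ε atTop (nhds 0)) :
    Tendsto (fun m => cz (PP (ε m)) f x) atTop (nhds (cst n * f x)) := by
  have e : ∀ m, cz (PP (ε m)) f x = ∫ z : En n, PP 1 z * f (x - ε m • z) := fun m => by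
    have h1 : cz (PP (ε m)) f x = ∫ w, PP (ε m) w * f (x - w) := by
      rw [cz, ← integral_sub_left_eq_self _ volume x]
      simp
    have h2 := Measure.integral_comp_smul (volume : Measure (En n)) (fun w => PP (ε m) w * f (x - w)) (ε m)
    simp only [finrank_euclideanSpace, Fintype.card_fin, smul_eq_mul] at h2
    have hpm := hp m
    rw [abs_of_pos (by positivity), ← h1] at h2
    have h3 : cz (PP (ε m)) f x = ε m ^ n * ∫ z, PP (ε m) (ε m • z) * f (x - ε m • z) := by
      rw [h2, ← mul_assoc, mul_inv_cancel₀ (by positivity), one_mul]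
    rw [h3, ← integral_const_mul]
    congr 1; ext z; rw [← PP_scale hpm z]; ring
  simp_rw [e]
  obtain ⟨M, hM⟩ := hs.exists_bound_of_continuous hf
  have h0 : cst n * f x = ∫ z : En n, PP 1 z * f x := by rw [integral_mul_const]; rfl
  rw [h0]
  refine tendsto_integral_of_dominated_convergence (fun z => PP 1 z * M) ?_ ((PP_int one_pos).mul_const _) ?_ ?_
  · intro m
    have h1 := PP_cont (n := n) one_pos
    exact Continuous.aestronglyMeasurable (by fun_prop)
  · intro m; refine Eventually.of_forall fun z => ?_
    rw [norm_mul, Real.norm_eq_abs, abs_of_nonneg (PP_nonneg _ _)]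
    exact mul_le_mul_of_nonneg_left (hM _) (PP_nonneg _ _)
  · refine Eventually.of_forall fun z => ?_
    apply Tendsto.const_mul
    have : Tendsto (fun m => x - ε m • z) atTop (nhds (x - (0:ℝ) • z)) := (hε.smul_const z).const_sub x
    rw [zero_smul, sub_zero] at this
    exact (hf.tendsto x).comp this

lemma kk_eq_KK (hn : 1 < n) {ε : ℝ} (hε : 0 < ε) (i j : Fin n) {f : En n → ℝ} (hf : ContDiff ℝ (⊤ : ℕ∞) f)
    (hs : HasCompactSupport f) (x : En n) : cz (kk ε i) (pd j f) x = cz (KK ε i j) f x := by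
  rw [← cz_pd_right (kk_li hn ε i) (hf.of_le (by norm_cast)) hs, cz_pd ((kk_contDiff hε i).of_le (by norm_cast)) hf.continuous hs]
  congr 1; ext y; exact pd_kk hε i j y

/-- a sequence tending to zero -/
def es (m : ℕ) : ℝ := 1 / ((m:ℝ) + 1)
lemma es_pos (m : ℕ) : 0 < es m := by unfold es; positivity
lemma es_lim : Tendsto es atTop (nhds 0) := tendsto_one_div_add_atTop_nhds_zero_nat

/-- The vector potential -/
def VV (i : Fin n) (f : En n → ℝ) : En n → ℝ := cz (kk 0 i) f

lemma VV_smooth (hn : 1 < n) (i : Fin n) {f : En n → ℝ} (hf : ContDiff ℝ (⊤ : ℕ∞) f) (hs : HasCompactSupport f) :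
    ContDiff ℝ (⊤ : ℕ∞) (VV i f) := cz_smooth (kk_li hn 0 i) hf hs

lemma VV_pd (hn : 1 < n) (i j : Fin n) {f : En n → ℝ} (hf : ContDiff ℝ (⊤ : ℕ∞) f) (hs : HasCompactSupport f) (x : En n) :
    pd j (VV i f) x = VV i (pd j f) x := cz_pd_right (kk_li hn 0 i) (hf.of_le (by norm_cast)) hs j x

lemma VV_lim (hn : 1 < n) (i j : Fin n) {f : En n → ℝ} (hf : ContDiff ℝ (⊤ : ℕ∞) f) (hs : HasCompactSupport f) (x : En n) :
    Tendsto (fun m => cz (KK (es m) i j) f x) atTop (nhds (VV i (pd j f) x)) := by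
  simp_rw [← kk_eq_KK hn (es_pos _) i j hf hs]
  exact cz_kk_lim hn i (pd_smooth hf j).continuous (pd_cs hs j) x es_lim

lemma VV_symm (hn : 1 < n) (i j : Fin n) {f : En n → ℝ} (hf : ContDiff ℝ (⊤ : ℕ∞) f) (hs : HasCompactSupport f) (x : En n) :
    VV i (pd j f) x = VV j (pd i f) x := by
  have h := VV_lim hn i j hf hs x
  simp_rw [KK_symm _ i j] at h
  exact tendsto_nhds_unique h (VV_lim hn j i hf hs x)

lemma VV_trace (hn : 1 < n) {f : En n → ℝ} (hf : ContDiff ℝ (⊤ : ℕ∞) f) (hs : HasCompactSupport f) (x : En n) :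
    ∑ i, VV i (pd i f) x = cst n * f x := by
  have h := tendsto_finset_sum Finset.univ fun i _ => VV_lim hn i i hf hs x
  simp_rw [cz_KK_trace (es_pos _) hf.continuous hs] at h
  exact tendsto_nhds_unique h (cz_PP_lim hf.continuous hs x es_pos es_lim)

lemma VV_Lq (n : ℕ) (hn : 1 < n) (p q : ℝ) (hp : 2 < p) (hpq : q.HolderConjugate p) : ∃ C : ℝ≥0∞, C ≠ ⊤ ∧
    ∀ (i j : Fin n) (f : En n → ℝ), ContDiff ℝ (⊤ : ℕ∞) f → HasCompactSupport f →
    ∫⁻ x, ENNReal.ofReal (|VV i (pd j f) x| ^ p) ≤ C * ∫⁻ x, ENNReal.ofReal (|f x| ^ p) ∧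
    ∫⁻ x, ENNReal.ofReal (|VV i (pd j f) x| ^ q) ≤ C * ∫⁻ x, ENNReal.ofReal (|f x| ^ q) := by
  obtain ⟨C1, h1, H1⟩ := cz_Lp n (by omega) (cA n) (cA_nonneg n) p hp
  obtain ⟨C2, h2, H2⟩ := cz_Lq n (by omega) (cA n) (cA_nonneg n) p q hp hpq
  refine ⟨max C1 C2, by simp [h1, h2], fun i j f hf hs => ⟨?_, ?_⟩⟩
  · refine fatou_rpow (by linarith) volume (fun m => cz (KK (es m) i j) f) _ (fun m => (cz_cont (KK_contDiff (es_pos m) i j).continuous hf.continuous hs).measurable)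
      (fun x => VV_lim hn i j hf hs x) _ fun m => (H1 _ (KK_czk hn (es_pos m) i j) f hf.continuous hs).trans ?_
    gcongr; exact le_max_left _ _
  · refine fatou_rpow hpq.pos volume (fun m => cz (KK (es m) i j) f) _ (fun m => (cz_cont (KK_contDiff (es_pos m) i j).continuous hf.continuous hs).measurable)
      (fun x => VV_lim hn i j hf hs x) _ fun m => (H2 _ (KK_czk hn (es_pos m) i j) f hf.continuous hs).trans ?_
    gcongr; exact le_max_right _ _

lemma polar_lint (hn : 0 < n) (F : En n → ℝ≥0∞) (hF : Measurable F) :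
    ∫⁻ y, F y = ∫⁻ ζ, (∫⁻ r in Set.Ioi (0:ℝ), ENNReal.ofReal (r ^ (n - 1)) * F (r • (ζ : En n))) ∂(volume : Measure (En n)).toSphere := by
  haveI : Nonempty (Fin n) := ⟨⟨0, hn⟩⟩
  haveI : Nontrivial (En n) := inferInstance
  have hmp := (volume : Measure (En n)).measurePreserving_homeomorphUnitSphereProd
  have h1 : ∫⁻ y, F y = ∫⁻ y : ({0}ᶜ : Set (En n)), F y ∂(Measure.comap (Subtype.val : ({0}ᶜ : Set (En n)) → En n) volume) := by
    rw [lintegral_subtype_comap (measurableSet_singleton _).compl, restrict_compl_singleton]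
  have h2 : ∫⁻ y : ({0}ᶜ : Set (En n)), F y ∂(Measure.comap (Subtype.val : ({0}ᶜ : Set (En n)) → En n) volume) =
      ∫⁻ p, F ((p.2 : ℝ) • (p.1 : En n)) ∂((volume : Measure (En n)).toSphere.prod (Measure.volumeIoiPow (Module.finrank ℝ (En n) - 1))) := by
    rw [← hmp.lintegral_comp]
    · refine lintegral_congr fun y => ?_
      congr 1
      have hy : ‖(y : En n)‖ ≠ 0 := norm_ne_zero_iff.2 (fun h => y.2 (by rw [h]; rfl))
      simp [smul_smul, hy]
    · refine hF.comp ?_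
      fun_prop
  rw [h1, h2, lintegral_prod]
  · refine lintegral_congr fun ζ => ?_
    rw [Measure.volumeIoiPow, lintegral_withDensity_eq_lintegral_mul]
    · have := lintegral_subtype_comap (μ := (volume : Measure ℝ)) (measurableSet_Ioi : MeasurableSet (Set.Ioi (0:ℝ))) (fun r => ENNReal.ofReal (r ^ (n - 1)) * F (r • (ζ : En n)))
      rw [← this]
      simp
    · fun_prop
    · refine hF.comp ?_
      fun_prop
  · refine (hF.comp ?_).aemeasurable
    fun_prop

/-- the reflected distance -/
def DD (x y : En n) : ℝ := 1 - 2 * inner ℝ x y + ‖x‖ ^ 2 * ‖y‖ ^ 2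

lemma DD_symm (x y : En n) : DD x y = DD y x := by
  unfold DD; rw [real_inner_comm]; ring

lemma inner_sq_le (x y : En n) : inner ℝ x y ^ 2 ≤ ‖x‖ ^ 2 * ‖y‖ ^ 2 := by
  have := abs_real_inner_le_norm x y
  have h2 := pow_le_pow_left₀ (abs_nonneg _) this 2
  rw [sq_abs] at h2; nlinarith

lemma DD_lb (x y : En n) {s : ℝ} (hs : ‖x‖ * ‖y‖ ≤ s) (hs1 : s ≤ 1) : (1 - s) ^ 2 ≤ DD x y := by
  have h1 := inner_sq_le x y
  have h2 := real_inner_le_norm x y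
  have h3 : 0 ≤ ‖x‖ * ‖y‖ := by positivity
  unfold DD
  nlinarith

lemma DD_sphere (x y : En n) (hy : ‖y‖ = 1) : DD x y = ‖x - y‖ ^ 2 := by
  unfold DD; rw [norm_sub_sq_real, hy]; ring

lemma DD_t_lb {x y : En n} (hx : ‖x‖ ≤ 1) (hy : ‖y‖ ≤ 1) {t : ℝ} (h0 : 0 ≤ t) (h1 : t ≤ 1) :
    (1 - t) ^ 2 ≤ DD x (t • y) ∧ DD x y ≤ 4 * DD x (t • y) := by
  have hl : (1 - t) ^ 2 ≤ DD x (t • y) := by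
    apply DD_lb _ _ _ h1
    rw [norm_smul, Real.norm_eq_abs, abs_of_nonneg h0]
    have : ‖x‖ * ‖y‖ ≤ 1 := mul_le_one₀ hx (norm_nonneg _) hy
    nlinarith
  refine ⟨hl, ?_⟩
  have h2 := inner_sq_le x y
  have ha : ‖x‖ ^ 2 * ‖y‖ ^ 2 ≤ 1 := mul_le_one₀ (pow_le_one₀ (norm_nonneg _) hx) (by positivity) (pow_le_one₀ (norm_nonneg _) hy)
  have hn : ‖t • y‖ ^ 2 = t ^ 2 * ‖y‖ ^ 2 := by rw [norm_smul, mul_pow, Real.norm_eq_abs, sq_abs]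
  unfold DD at hl ⊢
  rw [hn, real_inner_smul_right] at hl
  rw [hn, real_inner_smul_right]
  obtain ⟨a, hae⟩ : ∃ a, a = ‖x‖ ^ 2 * ‖y‖ ^ 2 := ⟨_, rfl⟩
  obtain ⟨p, hpe⟩ : ∃ p, p = inner ℝ x y := ⟨_, rfl⟩
  have e : ‖x‖ ^ 2 * (t ^ 2 * ‖y‖ ^ 2) = t ^ 2 * a := by rw [hae]; ring
  rw [e, ← hpe] at hl
  rw [e, ← hpe, ← hae]
  rw [← hae] at ha
  rw [← hae, ← hpe] at h2
  have k1 : 0 ≤ (2 * t - 1) ^ 2 * a - 2 * (2 * t - 1) * p + 1 := by nlinarith [sq_nonneg ((2 * t - 1) * p - 1), mul_le_mul_of_nonneg_left h2 (sq_nonneg (2 * t - 1))]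
  have k2 : 0 ≤ (1 - t) ^ 2 * (1 - a) := mul_nonneg (sq_nonneg _) (by linarith)
  nlinarith

lemma lint_rpow_near {b d : ℝ} (hb1 : b < 1) (hd : 0 < d) :
    ∫⁻ u in Set.Ioc (0:ℝ) d, ENNReal.ofReal (u ^ (-b)) = ENNReal.ofReal (d ^ (1 - b) / (1 - b)) := by
  have hi := (intervalIntegral.intervalIntegrable_rpow' (a := 0) (b := d) (r := -b) (by linarith)).1
  rw [← ofReal_integral_eq_lintegral_ofReal hi]
  · rw [← intervalIntegral.integral_of_le hd.le, integral_rpow (Or.inl (by linarith))]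
    rw [Real.zero_rpow (by linarith), sub_zero]; congr 2 <;> ring_nf
  · filter_upwards [ae_restrict_mem measurableSet_Ioc] with u hu
    exact Real.rpow_nonneg hu.1.le _

lemma lint_rpow_far {s d : ℝ} (hs : 1 < s) (hd : 0 < d) :
    ∫⁻ u in Set.Ioi d, ENNReal.ofReal (u ^ (-s)) = ENNReal.ofReal (d ^ (1 - s) / (s - 1)) := by
  have hi := integrableOn_Ioi_rpow_of_lt (show -s < -1 by linarith) hd
  rw [← ofReal_integral_eq_lintegral_ofReal hi]
  · rw [integral_Ioi_rpow_of_lt (by linarith) hd]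
    congr 1
    rw [show -s + 1 = -(s - 1) by ring, neg_div_neg_eq, show -(s-1) = 1 - s by ring]
  · filter_upwards [ae_restrict_mem measurableSet_Ioi] with u hu
    exact Real.rpow_nonneg (hd.le.trans (le_of_lt hu)) _

/-- one-dimensional inner integral -/
lemma inner_1d {b d : ℝ} {s : ℝ} (hb0 : 0 ≤ b) (hb1 : b < 1) (hs : 1 < s) (hd : 0 < d) (φ : ℝ → ℝ)
    (h1 : ∀ u, 0 < u → u ≤ 1 → u ^ 2 ≤ φ u) (h2 : ∀ u, 0 < u → u ≤ 1 → d ^ 2 ≤ 4 * φ u) :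
    ∫⁻ u in Set.Ioc (0:ℝ) 1, ENNReal.ofReal (φ u ^ (-(s/2)) * u ^ (-b)) ≤
      ENNReal.ofReal ((2 ^ s / (1 - b) + 1 / (s + b - 1)) * d ^ (1 - s - b)) := by
  have hsplit : Set.Ioc (0:ℝ) 1 ⊆ Set.Ioc 0 d ∪ (Set.Ioi d ∩ Set.Ioc 0 1) := by
    intro u hu
    rcases le_or_gt u d with h | h
    · exact Or.inl ⟨hu.1, h⟩
    · exact Or.inr ⟨h, hu⟩
  have hsq : ∀ v : ℝ, 0 < v → (v ^ 2) ^ (-(s/2)) = v ^ (-s) := fun v hv => by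
    rw [← Real.rpow_natCast, ← Real.rpow_mul hv.le]; congr 1; push_cast; ring
  have hs2 : -(s/2) ≤ 0 := by linarith
  have hA : ∫⁻ u in Set.Ioc (0:ℝ) d ∩ Set.Ioc 0 1, ENNReal.ofReal (φ u ^ (-(s/2)) * u ^ (-b)) ≤ ENNReal.ofReal (2 ^ s / (1 - b) * d ^ (1 - s - b)) := by
    calc _ ≤ ∫⁻ u in Set.Ioc (0:ℝ) d ∩ Set.Ioc 0 1, ENNReal.ofReal (2 ^ s * d ^ (-s)) * ENNReal.ofReal (u ^ (-b)) := by
          refine setLIntegral_mono' (measurableSet_Ioc.inter measurableSet_Ioc) fun u hu => ?_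
          rw [← ENNReal.ofReal_mul (by positivity)]
          apply ENNReal.ofReal_le_ofReal
          have hu0 := hu.1.1
          gcongr
          have h3 : (d/2) ^ 2 ≤ φ u := by have := h2 u hu0 hu.2.2; nlinarith
          refine (Real.rpow_le_rpow_of_nonpos (by positivity) h3 hs2).trans ?_
          rw [hsq _ (by positivity), Real.div_rpow hd.le (by norm_num), Real.rpow_neg (by norm_num : (0:ℝ) ≤ 2), div_inv_eq_mul, mul_comm]
      _ ≤ ∫⁻ u in Set.Ioc (0:ℝ) d, ENNReal.ofReal (2 ^ s * d ^ (-s)) * ENNReal.ofReal (u ^ (-b)) := lintegral_mono_set Set.inter_subset_left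
      _ = _ := by
        rw [lintegral_const_mul' _ _ (by simp), lint_rpow_near hb1 hd, ← ENNReal.ofReal_mul (by positivity)]
        congr 1
        rw [show 1 - s - b = -s + (1 - b) by ring, Real.rpow_add hd]; ring
  have hB : ∫⁻ u in Set.Ioi d ∩ Set.Ioc 0 1, ENNReal.ofReal (φ u ^ (-(s/2)) * u ^ (-b)) ≤ ENNReal.ofReal (1 / (s + b - 1) * d ^ (1 - s - b)) := by
    calc _ ≤ ∫⁻ u in Set.Ioi d ∩ Set.Ioc 0 1, ENNReal.ofReal (u ^ (-(s + b))) := by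
          refine setLIntegral_mono' (measurableSet_Ioi.inter measurableSet_Ioc) fun u hu => ?_
          apply ENNReal.ofReal_le_ofReal
          have hu0 := hu.2.1
          rw [neg_add, Real.rpow_add hu0]
          gcongr
          refine (Real.rpow_le_rpow_of_nonpos (by positivity) (h1 u hu0 hu.2.2) hs2).trans ?_
          rw [hsq _ hu0]
      _ ≤ ∫⁻ u in Set.Ioi d, ENNReal.ofReal (u ^ (-(s + b))) := lintegral_mono_set Set.inter_subset_left
      _ = _ := by
        rw [lint_rpow_far (by linarith) hd]
        congr 1; rw [show 1 - (s + b) = 1 - s - b by ring]; ring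
  calc _ ≤ ∫⁻ u in (Set.Ioc (0:ℝ) d ∩ Set.Ioc 0 1) ∪ (Set.Ioi d ∩ Set.Ioc 0 1), ENNReal.ofReal (φ u ^ (-(s/2)) * u ^ (-b)) := by
        refine lintegral_mono_set fun u hu => ?_
        rcases hsplit hu with h | h
        · exact Or.inl ⟨h, hu⟩
        · exact Or.inr h
    _ ≤ _ := lintegral_union_le _ _ _
    _ ≤ _ := add_le_add hA hB
    _ = _ := by
      rw [← ENNReal.ofReal_add]
      · congr 1; ring
      · have : 0 < 1 - b := by linarith
        positivity
      · have : 0 < s + b - 1 := by linarith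
        positivity

lemma DD_cont : Continuous (fun p : En n × En n => DD p.1 p.2) := by
  unfold DD; fun_prop

lemma outer_int (hn : 1 < n) {b : ℝ} (hb0 : 0 < b) : ∃ C : ℝ≥0∞, C ≠ ⊤ ∧ ∀ x : En n, ‖x‖ < 1 →
    ∫⁻ y, (if 1 ≤ ‖y‖ then ENNReal.ofReal (‖x - y‖ ^ (-((n:ℝ) + b))) else 0) ≤ C * ENNReal.ofReal ((1 - ‖x‖) ^ (-b)) := by
  have hi : Integrable (fun z : En n => (1 + ‖z‖) ^ (-((n:ℝ) + b))) := integrable_one_add_norm (by simp [hb0])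
  refine ⟨ENNReal.ofReal (2 ^ ((n:ℝ) + b)) * ENNReal.ofReal (∫ z : En n, (1 + ‖z‖) ^ (-((n:ℝ) + b))), ENNReal.mul_ne_top (by simp) (by simp), fun x hx => ?_⟩
  set δ := 1 - ‖x‖
  have hδ : 0 < δ := by simp only [δ]; linarith
  have hs : (0:ℝ) < n + b := by positivity
  have key : ∀ z : En n, ENNReal.ofReal ((δ + ‖z‖) ^ (-((n:ℝ) + b))) = ENNReal.ofReal (δ ^ (-((n:ℝ) + b))) * ENNReal.ofReal ((1 + ‖δ⁻¹ • z‖) ^ (-((n:ℝ) + b))) := fun z => by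
    rw [← ENNReal.ofReal_mul (by positivity), ← Real.mul_rpow hδ.le (by positivity), norm_smul, norm_inv, Real.norm_eq_abs, abs_of_pos hδ]
    congr 2; field_simp
  calc _ ≤ ∫⁻ y, ENNReal.ofReal (2 ^ ((n:ℝ) + b)) * ENNReal.ofReal ((δ + ‖x - y‖) ^ (-((n:ℝ) + b))) := by
        refine lintegral_mono fun y => ?_
        split_ifs with h
        · rw [← ENNReal.ofReal_mul (by positivity)]
          apply ENNReal.ofReal_le_ofReal
          have h1 : δ ≤ ‖x - y‖ := by
            have := norm_sub_norm_le y x; rw [norm_sub_rev] at this; simp only [δ]; linarith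
          have h2 : (2:ℝ) ^ ((n:ℝ) + b) = (1/2 : ℝ) ^ (-((n:ℝ) + b)) := by
            rw [one_div, Real.inv_rpow (by norm_num), Real.rpow_neg (by norm_num), inv_inv]
          rw [h2, ← Real.mul_rpow (by norm_num) (by positivity)]
          apply Real.rpow_le_rpow_of_nonpos (by positivity) _ (by linarith)
          linarith
        · simp
    _ = ENNReal.ofReal (2 ^ ((n:ℝ) + b)) * ∫⁻ z : En n, ENNReal.ofReal ((δ + ‖z‖) ^ (-((n:ℝ) + b))) := by
        rw [lintegral_const_mul' _ _ (by simp), lintegral_sub_left_eq_self (fun z => ENNReal.ofReal ((δ + ‖z‖) ^ (-((n:ℝ) + b)))) x]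
    _ = ENNReal.ofReal (2 ^ ((n:ℝ) + b)) * (ENNReal.ofReal (δ ^ (-((n:ℝ) + b))) * (ENNReal.ofReal (δ ^ n) * ENNReal.ofReal (∫ z : En n, (1 + ‖z‖) ^ (-((n:ℝ) + b))))) := by
        simp_rw [key]
        rw [lintegral_const_mul' _ _ (by simp)]
        congr 2
        have := Measure.integral_comp_smul (volume : Measure (En n)) (fun z => (1 + ‖z‖) ^ (-((n:ℝ) + b))) δ⁻¹
        have hintegr : Integrable (fun z : En n => (1 + ‖δ⁻¹ • z‖) ^ (-((n:ℝ) + b))) := hi.comp_smul (by positivity)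
        rw [← ofReal_integral_eq_lintegral_ofReal hintegr (Eventually.of_forall fun z => by positivity), this, ← ENNReal.ofReal_mul (by positivity)]
        simp only [finrank_euclideanSpace, Fintype.card_fin, smul_eq_mul, inv_pow, inv_inv]
        rw [abs_of_pos (by positivity)]
    _ = _ := by
        have : ENNReal.ofReal (δ ^ (-b)) = ENNReal.ofReal (δ ^ (-((n:ℝ) + b))) * ENNReal.ofReal (δ ^ n) := by
          rw [← ENNReal.ofReal_mul (by positivity), ← Real.rpow_natCast, ← Real.rpow_add hδ]; congr 2; ring
        rw [this]; ring

lemma schur_int (hn : 1 < n) {b : ℝ} (hb0 : 0 < b) (hb1 : b < 1) : ∃ C : ℝ≥0∞, C ≠ ⊤ ∧ ∀ x : En n, ‖x‖ < 1 →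
    ∫⁻ y in ball (0 : En n) 1, ENNReal.ofReal (DD x y ^ (-((n:ℝ)/2)) * (1 - ‖y‖) ^ (-b)) ≤ C * ENNReal.ofReal ((1 - ‖x‖) ^ (-b)) := by
  obtain ⟨C, hC, H⟩ := outer_int hn hb0
  have hn1 : (1:ℝ) < n := by exact_mod_cast hn
  have hb1' : 0 < 1 - b := by linarith
  have hnb : 0 < (n:ℝ) + b - 1 := by linarith
  set c1 : ℝ := 2 ^ (n:ℝ) / (1 - b) + 1 / ((n:ℝ) + b - 1)
  have hc1 : 0 < c1 := by positivity
  refine ⟨ENNReal.ofReal (c1 * 2 ^ ((n:ℝ) + b)) * C, ENNReal.mul_ne_top (by simp) hC, fun x hx => ?_⟩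
  have hDm : Measurable (fun y : En n => DD x y) := (DD_cont.comp (by fun_prop : Continuous fun y : En n => (x, y))).measurable
  rw [mul_assoc]
  refine le_trans ?_ (mul_le_mul_right (H x hx) _)
  rw [← lintegral_indicator measurableSet_ball, polar_lint (by omega), polar_lint (by omega)]
  rotate_left
  · exact Measurable.ite (measurableSet_le measurable_const measurable_norm) (by fun_prop) measurable_const
  · exact Measurable.indicator (by fun_prop) measurableSet_ball
  rw [← lintegral_const_mul' _ _ (by simp)]
  refine lintegral_mono fun ζ => ?_
  have hζ : ‖(ζ : En n)‖ = 1 := by simpa using ζ.2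
  set d := ‖x - ζ‖
  have hd : 0 < d := by
    have : ‖(ζ : En n)‖ - ‖x‖ ≤ ‖(ζ : En n) - x‖ := norm_sub_norm_le _ _
    rw [norm_sub_rev] at this; simp only [d]; linarith
  have hnr : ∀ r : ℝ, 0 < r → ‖r • (ζ : En n)‖ = r := fun r hr => by rw [norm_smul, hζ, mul_one, Real.norm_eq_abs, abs_of_pos hr]
  calc _ ≤ ∫⁻ r in Set.Ico (0:ℝ) 1, ENNReal.ofReal (DD x (r • (ζ : En n)) ^ (-((n:ℝ)/2)) * (1 - r) ^ (-b)) := by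
        rw [← lintegral_indicator measurableSet_Ioi, ← lintegral_indicator measurableSet_Ico]
        refine lintegral_mono fun r => ?_
        by_cases h0 : 0 < r
        · rw [Set.indicator_of_mem (show r ∈ Set.Ioi 0 from h0)]
          by_cases h1 : r < 1
          · rw [Set.indicator_of_mem (show r • (ζ : En n) ∈ ball 0 1 by simpa [hnr r h0] using h1),
              Set.indicator_of_mem (show r ∈ Set.Ico 0 1 from ⟨h0.le, h1⟩), hnr r h0]
            refine (mul_le_of_le_one_left' ?_)
            rw [ENNReal.ofReal_le_one]
            exact pow_le_one₀ h0.le h1.le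
          · rw [Set.indicator_of_notMem (show r • (ζ : En n) ∉ ball 0 1 by simpa [hnr r h0] using h1)]; simp
        · rw [Set.indicator_of_notMem (show r ∉ Set.Ioi 0 from h0)]; exact zero_le
    _ = ∫⁻ u in Set.Ioc (0:ℝ) 1, ENNReal.ofReal (DD x ((1 - u) • (ζ : En n)) ^ (-((n:ℝ)/2)) * u ^ (-b)) := by
        rw [← lintegral_indicator measurableSet_Ico, ← lintegral_indicator measurableSet_Ioc, ← lintegral_sub_left_eq_self _ (1:ℝ)]
        refine lintegral_congr fun u => ?_
        by_cases h : u ∈ Set.Ioc (0:ℝ) 1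
        · rw [Set.indicator_of_mem h, Set.indicator_of_mem (by constructor <;> linarith [h.1, h.2]), sub_sub_cancel]
        · rw [Set.indicator_of_notMem h, Set.indicator_of_notMem]
          rintro ⟨h1, h2⟩; exact h ⟨by linarith, by linarith⟩
    _ ≤ ENNReal.ofReal (c1 * d ^ (1 - (n:ℝ) - b)) := by
        refine inner_1d hb0.le hb1 hn1 hd _ (fun u h0 h1 => ?_) (fun u h0 h1 => ?_)
        · have := (DD_t_lb hx.le hζ.le (t := 1 - u) (by linarith) (by linarith)).1
          simpa using this
        · have := (DD_t_lb hx.le hζ.le (t := 1 - u) (by linarith) (by linarith)).2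
          rwa [DD_sphere x _ hζ] at this
    _ = ENNReal.ofReal (c1 * 2 ^ ((n:ℝ) + b)) * ∫⁻ r in Set.Ioo (1:ℝ) (1 + d), ENNReal.ofReal ((2 * d) ^ (-((n:ℝ) + b))) := by
        rw [setLIntegral_const, Real.volume_Ioo, ← ENNReal.ofReal_mul (by positivity), ← ENNReal.ofReal_mul (by positivity)]
        congr 1
        rw [Real.mul_rpow (by norm_num) hd.le, Real.rpow_neg (by norm_num : (0:ℝ) ≤ 2), show 1 - (n:ℝ) - b = -((n:ℝ) + b) + 1 by ring, Real.rpow_add hd, Real.rpow_one]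
        field_simp; ring
    _ ≤ _ := by
        refine mul_le_mul_right ?_ _
        rw [← lintegral_indicator measurableSet_Ioi, ← lintegral_indicator measurableSet_Ioo]
        refine lintegral_mono fun r => ?_
        by_cases h : r ∈ Set.Ioo 1 (1 + d)
        · have h0 : 0 < r := by linarith [h.1]
          rw [Set.indicator_of_mem h, Set.indicator_of_mem (show r ∈ Set.Ioi 0 from h0), hnr r h0, if_pos h.1.le]
          have h1 : (1:ℝ≥0∞) ≤ ENNReal.ofReal (r ^ (n - 1)) := by
            rw [ENNReal.one_le_ofReal]; exact one_le_pow₀ h.1.le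
          refine le_trans ?_ (le_mul_of_one_le_left' h1)
          apply ENNReal.ofReal_le_ofReal
          have e : x - r • (ζ : En n) = (x - ζ) - (r - 1) • (ζ : En n) := by rw [sub_smul, one_smul]; abel
          have h2 : ‖x - r • (ζ : En n)‖ ≤ 2 * d := by
            rw [e]; refine (norm_sub_le _ _).trans ?_
            rw [norm_smul, hζ, Real.norm_eq_abs, abs_of_pos (by linarith [h.1])]
            linarith [h.2]
          have h3 : 0 < ‖x - r • (ζ : En n)‖ := by
            have := norm_sub_norm_le (r • (ζ : En n)) x
            rw [norm_sub_rev, hnr r h0] at this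
            linarith [h.1]
          exact Real.rpow_le_rpow_of_nonpos h3 h2 (by linarith)
        · rw [Set.indicator_of_notMem h]; exact zero_le

lemma DD_nonneg (x y : En n) : 0 ≤ DD x y := by
  have h1 := real_inner_le_norm x y
  unfold DD
  nlinarith [sq_nonneg (1 - ‖x‖ * ‖y‖)]

/-- the Schur kernel -/
def Kd (x y : En n) : ℝ≥0∞ := ENNReal.ofReal (DD x y ^ (-((n:ℝ)/2)))

lemma Kd_symm (x y : En n) : Kd x y = Kd y x := by unfold Kd; rw [DD_symm]

lemma Kd_meas : Measurable (fun p : En n × En n => Kd p.1 p.2) := by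
  unfold Kd
  exact ((DD_cont.measurable).pow_const _).ennreal_ofReal

lemma Kd_meas' (x : En n) : Measurable (fun y => Kd x y) := by
  unfold Kd DD
  fun_prop

lemma schur_test (hn : 1 < n) {q : ℝ} (hq : 1 < q) : ∃ C : ℝ≥0∞, C ≠ ⊤ ∧ ∀ f : En n → ℝ≥0∞, Measurable f →
    ∫⁻ x in ball (0 : En n) 1, (∫⁻ y in ball (0 : En n) 1, Kd x y * f y) ^ q ≤ C * ∫⁻ y in ball (0 : En n) 1, f y ^ q := by
  obtain ⟨b, hb⟩ : ∃ b : ℝ, b = 1 / (q + 1) := ⟨_, rfl⟩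
  have hb0 : 0 < b := by rw [hb]; positivity
  have hb1 : b < 1 := by rw [hb, div_lt_one (by linarith)]; linarith
  have hc0 : 0 < b * (q - 1) := mul_pos hb0 (by linarith)
  have hc1 : b * (q - 1) < 1 := by rw [hb, one_div_mul_eq_div, div_lt_one (by linarith)]; linarith
  obtain ⟨C1, hC1, H1⟩ := schur_int hn hb0 hb1
  obtain ⟨C2, hC2, H2⟩ := schur_int hn hc0 hc1
  refine ⟨C1 ^ (q - 1) * C2, ENNReal.mul_ne_top (ENNReal.rpow_ne_top_of_nonneg (by linarith) hC1) hC2, fun f hf => ?_⟩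
  obtain ⟨W, hW⟩ : ∃ W : ℝ → En n → ℝ≥0∞, W = fun c y => ENNReal.ofReal ((1 - ‖y‖) ^ c) := ⟨_, rfl⟩
  have hWm : ∀ c, Measurable (W c) := fun c => by
    simp only [hW]; fun_prop
  have hWp : ∀ c e y, ‖y‖ < 1 → (W c y) ^ e = W (c * e) y := by
    intro c e y hy
    simp only [hW]
    have : 0 < 1 - ‖y‖ := by linarith
    rw [ENNReal.ofReal_rpow_of_pos (Real.rpow_pos_of_pos this _), ← Real.rpow_mul this.le]
  have hWm2 : ∀ c e y, ‖y‖ < 1 → W c y * W e y = W (c + e) y := by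
    intro c e y hy
    simp only [hW]
    have : 0 < 1 - ‖y‖ := by linarith
    rw [← ENNReal.ofReal_mul (by positivity), ← Real.rpow_add this]
  have hW0 : ∀ y, W 0 y = 1 := by intro y; simp [hW]
  have hKW : ∀ c x y, ‖y‖ < 1 → ENNReal.ofReal (DD x y ^ (-((n:ℝ)/2)) * (1 - ‖y‖) ^ c) = Kd x y * W c y := by
    intro c x y hy
    rw [ENNReal.ofReal_mul (Real.rpow_nonneg (DD_nonneg _ _) _), hW]; rfl
  have hmK : ∀ x : En n, Measurable (fun y => Kd x y) := Kd_meas'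
  have hq0 : 0 < q := by linarith
  obtain ⟨q', hq'⟩ : ∃ q' : ℝ, q' = q / (q - 1) := ⟨_, rfl⟩
  have hconj : q'.HolderConjugate q := by rw [hq']; exact (Real.HolderConjugate.conjExponent hq).symm
  have hq'0 : 0 < q' := hconj.pos
  have hqq : q / q' = q - 1 := by
    rw [hq']; field_simp
  have key : ∀ x : En n, ‖x‖ < 1 → (∫⁻ y in ball (0 : En n) 1, Kd x y * f y) ^ q ≤
      C1 ^ (q - 1) * ∫⁻ y in ball (0 : En n) 1, W (-b * (q - 1)) x * (Kd x y * (f y ^ q * W (b * (q - 1)) y)) := by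
    intro x hx
    have e1 : ∫⁻ y in ball (0 : En n) 1, Kd x y * f y = ∫⁻ y in ball (0 : En n) 1,
        ((fun y => (Kd x y * W (-b) y) ^ (1/q')) * (fun y => (Kd x y * (f y ^ q * W (b * (q - 1)) y)) ^ (1/q))) y := by
      refine setLIntegral_congr_fun measurableSet_ball fun y hy => ?_
      have hy' : ‖y‖ < 1 := by simpa using hy
      simp only [Pi.mul_apply]
      rw [ENNReal.mul_rpow_of_nonneg _ _ (by positivity), ENNReal.mul_rpow_of_nonneg _ _ (by positivity), ENNReal.mul_rpow_of_nonneg _ _ (by positivity),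
        hWp _ _ _ hy', hWp _ _ _ hy', ← ENNReal.rpow_mul, mul_one_div_cancel hq0.ne', ENNReal.rpow_one]
      have e2 : Kd x y = Kd x y ^ (1/q') * Kd x y ^ (1/q) := by
        rw [← ENNReal.rpow_add_of_nonneg _ _ (by positivity) (by positivity), one_div, one_div, hconj.inv_add_inv_eq_one, ENNReal.rpow_one]
      have e3 : W (-b * (1/q')) y * W (b * (q-1) * (1/q)) y = 1 := by
        rw [hWm2 _ _ _ hy', ← hW0 y]; congr 1
        rw [hq']; field_simp; ring
      calc Kd x y * f y = (Kd x y ^ (1/q') * Kd x y ^ (1/q)) * f y * 1 := by rw [← e2, mul_one]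
        _ = _ := by rw [← e3]; ring
    have hm1 : Measurable (fun y => (Kd x y * W (-b) y) ^ (1/q')) := ((hmK x).mul (hWm _)).pow_const _
    have hm2 : Measurable (fun y => (Kd x y * (f y ^ q * W (b * (q - 1)) y)) ^ (1/q)) :=
      ((hmK x).mul ((hf.pow_const _).mul (hWm _))).pow_const _
    have ho := ENNReal.lintegral_mul_le_Lp_mul_Lq (volume.restrict (ball (0 : En n) 1)) hconj hm1.aemeasurable hm2.aemeasurable
    rw [← e1] at ho
    simp only [← ENNReal.rpow_mul, one_div_mul_cancel hq0.ne', one_div_mul_cancel hq'0.ne', ENNReal.rpow_one] at ho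
    have ho2 := ENNReal.rpow_le_rpow ho hq0.le
    rw [ENNReal.mul_rpow_of_nonneg _ _ hq0.le, ← ENNReal.rpow_mul, ← ENNReal.rpow_mul, one_div_mul_cancel hq0.ne', ENNReal.rpow_one,
      one_div_mul_eq_div, hqq] at ho2
    have h3 : ∫⁻ y in ball (0 : En n) 1, Kd x y * W (-b) y ≤ C1 * W (-b) x := by
      rw [← setLIntegral_congr_fun measurableSet_ball (fun y hy => hKW (-b) x y (by simpa using hy))]
      rw [hW]; exact H1 x hx
    refine ho2.trans ?_
    rw [lintegral_const_mul]
    · rw [← mul_assoc, ← hWp _ _ _ hx, ← ENNReal.mul_rpow_of_nonneg _ _ (by linarith)]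
      exact mul_le_mul_left (ENNReal.rpow_le_rpow h3 (by linarith)) _
    · exact (hmK x).mul ((hf.pow_const _).mul (hWm _))
  calc ∫⁻ x in ball (0 : En n) 1, (∫⁻ y in ball (0 : En n) 1, Kd x y * f y) ^ q
      ≤ ∫⁻ x in ball (0 : En n) 1, C1 ^ (q - 1) * ∫⁻ y in ball (0 : En n) 1, W (-b * (q - 1)) x * (Kd x y * (f y ^ q * W (b * (q - 1)) y)) :=
        setLIntegral_mono' measurableSet_ball fun x hx => key x (by simpa using hx)
    _ = C1 ^ (q - 1) * ∫⁻ x in ball (0 : En n) 1, ∫⁻ y in ball (0 : En n) 1, W (-b * (q - 1)) x * (Kd x y * (f y ^ q * W (b * (q - 1)) y)) :=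
        lintegral_const_mul' _ _ (ENNReal.rpow_ne_top_of_nonneg (by linarith) hC1)
    _ = C1 ^ (q - 1) * ∫⁻ y in ball (0 : En n) 1, ∫⁻ x in ball (0 : En n) 1, W (-b * (q - 1)) x * (Kd x y * (f y ^ q * W (b * (q - 1)) y)) := by
        rw [lintegral_lintegral_swap]
        refine Measurable.aemeasurable ?_
        exact ((hWm _).comp measurable_fst).mul (Kd_meas.mul (((hf.pow_const _).mul (hWm _)).comp measurable_snd))
    _ ≤ C1 ^ (q - 1) * ∫⁻ y in ball (0 : En n) 1, C2 * f y ^ q := by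
        refine mul_le_mul_right (setLIntegral_mono' measurableSet_ball fun y hy => ?_) _
        have hy' : ‖y‖ < 1 := by simpa using hy
        calc ∫⁻ x in ball (0 : En n) 1, W (-b * (q - 1)) x * (Kd x y * (f y ^ q * W (b * (q - 1)) y))
            = ∫⁻ x in ball (0 : En n) 1, (Kd y x * W (-(b * (q - 1))) x) * (f y ^ q * W (b * (q - 1)) y) := by
              refine lintegral_congr fun x => ?_
              rw [Kd_symm, neg_mul]; ring
          _ = (∫⁻ x in ball (0 : En n) 1, Kd y x * W (-(b * (q - 1))) x) * (f y ^ q * W (b * (q - 1)) y) :=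
              lintegral_mul_const _ ((hmK y).mul (hWm _))
          _ ≤ (C2 * W (-(b * (q-1))) y) * (f y ^ q * W (b * (q - 1)) y) := by
              refine mul_le_mul_left ?_ _
              rw [← setLIntegral_congr_fun measurableSet_ball (fun x hx => hKW (-(b * (q-1))) y x (by simpa using hx))]
              rw [hW]; exact H2 y hy'
          _ = C2 * f y ^ q * (W (-(b * (q-1))) y * W (b * (q - 1)) y) := by ring
          _ = C2 * f y ^ q := by rw [hWm2 _ _ _ hy', neg_add_cancel, hW0, mul_one]
    _ = _ := by rw [lintegral_const_mul' _ _ hC2, mul_assoc]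

section par
variable {Z : Type*} [NormedAddCommGroup Z] [NormedSpace ℝ Z] [SecondCountableTopology Z] [MeasurableSpace Z]
    [BorelSpace Z]

lemma par_smooth_aux (ν : Measure Z) [IsFiniteMeasure ν] {S : Set Z} (hS : IsCompact S)
    (hν : ∀ᵐ y ∂ν, y ∈ S) (Φ : En n × Z → ℝ) (hΦ : ContDiff ℝ (⊤ : ℕ∞) Φ) (x v : En n) :
    DifferentiableAt ℝ (fun x => ∫ z, Φ (x, z) ∂ν) x ∧
    fderiv ℝ (fun x => ∫ z, Φ (x, z) ∂ν) x v = ∫ z, fderiv ℝ Φ (x, z) (v, 0) ∂ν := by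
  have hc : Continuous (fderiv ℝ Φ) := (hΦ.of_le (by norm_cast) : ContDiff ℝ 1 Φ).continuous_fderiv one_ne_zero
  set F' : En n → Z → En n →L[ℝ] ℝ := fun x z => (fderiv ℝ Φ (x, z)).comp (ContinuousLinearMap.inl ℝ (En n) Z) with hF'
  have hcF : Continuous (Function.uncurry F') := by
    have : Function.uncurry F' = fun p => (fderiv ℝ Φ p).comp (ContinuousLinearMap.inl ℝ (En n) Z) := by ext p; rfl
    rw [this]; exact hc.clm_comp continuous_const
  have h := param_deriv ν hS hν (fun x z => Φ (x, z)) F' hΦ.continuous hcF (fun x z => by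
    have h1 : HasFDerivAt Φ (fderiv ℝ Φ (x, z)) (x, z) := (hΦ.differentiable (by simp) _).hasFDerivAt
    exact h1.comp x (hasFDerivAt_prodMk_left x z)) x
  refine ⟨h.differentiableAt, ?_⟩
  rw [h.fderiv, ContinuousLinearMap.integral_apply]
  · simp [hF']
  · have hcx : Continuous (F' x) := hcF.comp (by fun_prop : Continuous fun z => (x, z))
    have := hcx.continuousOn.integrableOn_compact (μ := ν) hS
    rw [IntegrableOn, Measure.restrict_eq_self_of_ae_mem hν] at this
    exact this

lemma par_smooth (ν : Measure Z) [IsFiniteMeasure ν] {S : Set Z} (hS : IsCompact S)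
    (hν : ∀ᵐ y ∂ν, y ∈ S) (Φ : En n × Z → ℝ) (hΦ : ContDiff ℝ (⊤ : ℕ∞) Φ) :
    ContDiff ℝ (⊤ : ℕ∞) (fun x => ∫ z, Φ (x, z) ∂ν) := by
  rw [contDiff_infty]
  intro m
  induction m generalizing Φ with
  | zero =>
    simp only [Nat.cast_zero]
    rw [contDiff_zero]
    exact Differentiable.continuous fun x => (par_smooth_aux ν hS hν Φ hΦ x 0).1
  | succ m ih =>
    push_cast
    rw [contDiff_succ_iff_fderiv_apply]
    refine ⟨fun x => (par_smooth_aux ν hS hν Φ hΦ x 0).1, by simp, fun v => ?_⟩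
    simp only [fun x => (par_smooth_aux ν hS hν Φ hΦ x v).2]
    apply ih (fun p => fderiv ℝ Φ p (v, 0))
    exact (hΦ.fderiv_right (m := (⊤ : ℕ∞)) (by simp)).clm_apply contDiff_const

lemma par_pd (ν : Measure Z) [IsFiniteMeasure ν] {S : Set Z} (hS : IsCompact S)
    (hν : ∀ᵐ y ∂ν, y ∈ S) (Φ : En n × Z → ℝ) (hΦ : ContDiff ℝ (⊤ : ℕ∞) Φ) (j : Fin n) (x : En n) :
    pd j (fun x => ∫ z, Φ (x, z) ∂ν) x = ∫ z, pd j (fun x => Φ (x, z)) x ∂ν := by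
  rw [pd, (par_smooth_aux ν hS hν Φ hΦ x _).2]
  refine integral_congr_ae (ae_of_all _ fun z => ?_)
  have h1 : HasFDerivAt Φ (fderiv ℝ Φ (x, z)) (x, z) := (hΦ.differentiable (by simp) _).hasFDerivAt
  have h2 := HasFDerivAt.comp (f := fun e : En n => (e, z)) x h1 (hasFDerivAt_prodMk_left x z)
  have h3 : HasFDerivAt (fun x => Φ (x, z)) _ x := h2
  simp only [pd]
  rw [h3.fderiv]; simp

lemma par_pd_smooth (Φ : En n × Z → ℝ) (hΦ : ContDiff ℝ (⊤ : ℕ∞) Φ) (j : Fin n) :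
    ContDiff ℝ (⊤ : ℕ∞) (fun p : En n × Z => pd j (fun x => Φ (x, p.2)) p.1) := by
  have : (fun p : En n × Z => pd j (fun x => Φ (x, p.2)) p.1) = fun p => fderiv ℝ Φ p (basisVec j, 0) := by
    ext ⟨x, z⟩
    have h1 : HasFDerivAt Φ (fderiv ℝ Φ (x, z)) (x, z) := (hΦ.differentiable (by simp) _).hasFDerivAt
    have h2 := HasFDerivAt.comp (f := fun e : En n => (e, z)) x h1 (hasFDerivAt_prodMk_left x z)
    have h3 : HasFDerivAt (fun x => Φ (x, z)) _ x := h2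
    simp only [pd]
    rw [h3.fderiv]; simp
  rw [this]
  exact (hΦ.fderiv_right (m := (⊤ : ℕ∞)) (by simp)).clm_apply contDiff_const
end par

/-! pd calculus -/
lemma pd_congr {f g : En n → ℝ} {x : En n} (h : f =ᶠ[nhds x] g) (j : Fin n) : pd j f x = pd j g x := by
  unfold pd; rw [h.fderiv_eq]

lemma pd_add {f g : En n → ℝ} {x : En n} (hf : DifferentiableAt ℝ f x) (hg : DifferentiableAt ℝ g x) (j : Fin n) :
    pd j (fun x => f x + g x) x = pd j f x + pd j g x := by
  unfold pd; rw [fderiv_fun_add hf hg]; rfl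

lemma pd_sub {f g : En n → ℝ} {x : En n} (hf : DifferentiableAt ℝ f x) (hg : DifferentiableAt ℝ g x) (j : Fin n) :
    pd j (fun x => f x - g x) x = pd j f x - pd j g x := by
  unfold pd; rw [fderiv_fun_sub hf hg]; rfl

lemma pd_neg {f : En n → ℝ} {x : En n} (j : Fin n) :
    pd j (fun x => - f x) x = - pd j f x := by
  unfold pd; rw [fderiv_fun_neg]; rfl

lemma pd_mul {f g : En n → ℝ} {x : En n} (hf : DifferentiableAt ℝ f x) (hg : DifferentiableAt ℝ g x) (j : Fin n) :
    pd j (fun x => f x * g x) x = pd j f x * g x + f x * pd j g x := by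
  unfold pd; rw [fderiv_fun_mul hf hg]; simp; ring

lemma pd_const_mul {f : En n → ℝ} {x : En n} (hf : DifferentiableAt ℝ f x) (c : ℝ) (j : Fin n) :
    pd j (fun x => c * f x) x = c * pd j f x := by
  unfold pd; rw [fderiv_const_mul hf]; simp

lemma pd_mul_const {f : En n → ℝ} {x : En n} (hf : DifferentiableAt ℝ f x) (c : ℝ) (j : Fin n) :
    pd j (fun x => f x * c) x = pd j f x * c := by
  simp only [mul_comm _ c]; exact pd_const_mul hf c j

lemma pd_const {x : En n} (c : ℝ) (j : Fin n) :
    pd j (fun _ => c) x = 0 := by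
  unfold pd; simp

lemma pd_coord (i j : Fin n) (x : En n) : pd j (fun x => x i) x = if i = j then 1 else 0 := by
  unfold pd; rw [(hasFD_coord i x).fderiv, proj_basis]

lemma pd_nsq (j : Fin n) (x : En n) : pd j (fun x => ‖x‖ ^ 2) x = 2 * x j := by
  have := (hasStrictFDerivAt_norm_sq x).hasFDerivAt
  have h : HasFDerivAt (fun x : En n => ‖x‖ ^ 2) _ x := this
  unfold pd; rw [h.fderiv]; simp [inner_basis]

lemma pd_inner (j : Fin n) (x y : En n) : pd j (fun x => inner ℝ x y) x = y j := by
  unfold pd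
  have : HasFDerivAt (fun x : En n => inner ℝ x y) (innerSL ℝ y) x := by
    have := (innerSL ℝ y).hasFDerivAt (x := x)
    refine this.congr_of_eventuallyEq (Eventually.of_forall fun z => ?_)
    simp [real_inner_comm]
  rw [this.fderiv]; simp [inner_basis]

lemma pd_rpow {f : En n → ℝ} {x : En n} (hf : DifferentiableAt ℝ f x) (h0 : 0 < f x) (p : ℝ) (j : Fin n) :
    pd j (fun x => f x ^ p) x = p * f x ^ (p - 1) * pd j f x := by
  unfold pd
  rw [(hf.hasFDerivAt.rpow_const (Or.inl h0.ne')).fderiv]; simp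

lemma pd_sum {ι : Type*} (s : Finset ι) {f : ι → En n → ℝ} {x : En n} (hf : ∀ i ∈ s, DifferentiableAt ℝ (f i) x) (j : Fin n) :
    pd j (fun x => ∑ i ∈ s, f i x) x = ∑ i ∈ s, pd j (f i) x := by
  unfold pd
  rw [fderiv_fun_sum hf]; simp

lemma coord_diff (i : Fin n) (x : En n) : DifferentiableAt ℝ (fun x : En n => x i) x := (hasFD_coord i x).differentiableAt
lemma nsq_diff (x : En n) : DifferentiableAt ℝ (fun x : En n => ‖x‖ ^ 2) x :=
  (hasStrictFDerivAt_norm_sq x).hasFDerivAt.differentiableAt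

lemma inner_diff (x y : En n) : DifferentiableAt ℝ (fun x : En n => inner ℝ x y) x :=
  DifferentiableAt.inner ℝ differentiableAt_id (differentiableAt_const y)

lemma DD_diff (x y : En n) : DifferentiableAt ℝ (fun x => DD x y) x := by
  unfold DD
  have := nsq_diff x
  have h5 : DifferentiableAt ℝ (fun x : En n => inner ℝ x y) x := inner_diff x y
  fun_prop

lemma pd_DD (j : Fin n) (x y : En n) : pd j (fun x => DD x y) x = -2 * (y j - ‖y‖ ^ 2 * x j) := by
  unfold DD
  have := nsq_diff x
  have h5 : DifferentiableAt ℝ (fun x : En n => inner ℝ x y) x := inner_diff x y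
  rw [pd_add (by fun_prop) (by fun_prop), pd_sub (by fun_prop) (by fun_prop), pd_const_mul (by fun_prop), pd_mul_const this,
    pd_nsq, pd_inner, pd_const]
  ring

lemma pd_DD' (j : Fin n) (x y : En n) : pd j (fun y => DD x y) y = -2 * (x j - ‖x‖ ^ 2 * y j) := by
  simp only [fun y => DD_symm x y]
  exact pd_DD j y x

def AA (i : Fin n) (x y : En n) : ℝ := x i - ‖x‖ ^ 2 * y i
def kap (i : Fin n) (x y : En n) : ℝ := AA i x y * DD x y ^ (-((n:ℝ)/2))
def kap1 (i j : Fin n) (x y : En n) : ℝ :=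
  ((if i = j then 1 else 0) - 2 * x j * y i) * DD x y ^ (-((n:ℝ)/2)) + n * (AA i x y * AA j y x) * DD x y ^ (-((n:ℝ)/2) - 1)
def kap2 (i l : Fin n) (x y : En n) : ℝ :=
  -(‖x‖ ^ 2 * (if i = l then 1 else 0)) * DD x y ^ (-((n:ℝ)/2)) + n * (AA i x y * AA l x y) * DD x y ^ (-((n:ℝ)/2) - 1)
def kap3 (i j l : Fin n) (x y : En n) : ℝ :=
  (n * (if i = j then 1 else 0) * AA l x y - 2 * x j * y i * n * AA l x y + n * (-(‖x‖ ^ 2 * (if i = l then 1 else 0)) * AA j y x +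
    AA i x y * ((if j = l then 1 else 0) - 2 * y l * x j))) * DD x y ^ (-((n:ℝ)/2) - 1)
  - 2 * x j * (if i = l then 1 else 0) * DD x y ^ (-((n:ℝ)/2))
  + n * (n + 2) * (AA i x y * AA j y x * AA l x y) * DD x y ^ (-((n:ℝ)/2) - 2)

lemma AA_diff (i : Fin n) (x y : En n) : DifferentiableAt ℝ (fun x => AA i x y) x := by
  unfold AA
  have h1 := coord_diff i x
  have h2 := nsq_diff x
  fun_prop

lemma AA_diff' (i : Fin n) (x y : En n) : DifferentiableAt ℝ (fun x => AA i y x) x := by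
  unfold AA
  have h1 := coord_diff i x
  fun_prop

lemma DDp_diff {x y : En n} (h : 0 < DD x y) (p : ℝ) : DifferentiableAt ℝ (fun x => DD x y ^ p) x :=
  (DD_diff x y).rpow_const (Or.inl h.ne')

lemma DDp_diff' {x y : En n} (h : 0 < DD x y) (p : ℝ) : DifferentiableAt ℝ (fun y => DD x y ^ p) y := by
  simp only [fun y => DD_symm x y]
  rw [DD_symm] at h
  exact DDp_diff h p

lemma pd_AA (i j : Fin n) (x y : En n) : pd j (fun x => AA i x y) x = (if i = j then 1 else 0) - 2 * x j * y i := by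
  unfold AA
  have h1 := coord_diff i x
  have h2 := nsq_diff x
  rw [pd_sub h1 (by fun_prop), pd_mul_const h2, pd_nsq, pd_coord]

lemma pd_AA' (i j : Fin n) (x y : En n) : pd j (fun x => AA i y x) x = -(‖y‖ ^ 2 * (if i = j then 1 else 0)) := by
  unfold AA
  have h1 := coord_diff i x
  rw [pd_sub (by fun_prop) (by fun_prop), pd_const_mul h1, pd_const, pd_coord]; ring

lemma pd_DDp {x y : En n} (h : 0 < DD x y) (p : ℝ) (j : Fin n) :
    pd j (fun x => DD x y ^ p) x = -2 * p * AA j y x * DD x y ^ (p - 1) := by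
  rw [pd_rpow (DD_diff x y) h, pd_DD]; unfold AA; ring

lemma pd_DDp' {x y : En n} (h : 0 < DD x y) (p : ℝ) (j : Fin n) :
    pd j (fun y => DD x y ^ p) y = -2 * p * AA j x y * DD x y ^ (p - 1) := by
  have h' := h
  rw [DD_symm] at h'
  have := pd_DDp h' p j
  simp only [fun y => DD_symm x y]
  exact this

lemma pd_kap {x y : En n} (h : 0 < DD x y) (i j : Fin n) : pd j (fun x => kap i x y) x = kap1 i j x y := by
  unfold kap
  rw [pd_mul (AA_diff i x y) (DDp_diff h _), pd_AA, pd_DDp h, kap1]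
  ring

lemma pd_kap' {x y : En n} (h : 0 < DD x y) (i l : Fin n) : pd l (fun y => kap i x y) y = kap2 i l x y := by
  unfold kap
  rw [pd_mul (AA_diff' i y x) (DDp_diff' h _), pd_AA', pd_DDp' h, kap2]
  ring

lemma pd_kap1' {x y : En n} (h : 0 < DD x y) (i j l : Fin n) : pd l (fun y => kap1 i j x y) y = kap3 i j l x y := by
  unfold kap1
  have h1 := coord_diff i y
  have h2 := AA_diff' i y x
  have h3 := AA_diff j y x
  have h4 := DDp_diff' h
  rw [pd_add (DifferentiableAt.fun_mul (by fun_prop) (h4 _)) (DifferentiableAt.fun_mul (by fun_prop) (h4 _)), pd_mul (by fun_prop) (h4 _),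
    pd_mul (by fun_prop) (h4 _), pd_const_mul (by fun_prop), pd_mul h2 h3, pd_sub (by fun_prop) (by fun_prop), pd_const, pd_const_mul h1,
    pd_coord, pd_DDp' h, pd_DDp' h, pd_AA, pd_AA', kap3]
  rw [show -((n:ℝ)/2) - 1 - 1 = -((n:ℝ)/2) - 2 by ring]
  ring

lemma pd_kap1 {x y : En n} (h : 0 < DD x y) (i j : Fin n) : pd j (fun x => kap1 i j x y) x =
    -2 * y i * DD x y ^ (-((n:ℝ)/2)) + (2 * n * ((if i = j then 1 else 0) - 2 * x j * y i) * AA j y x - n * ‖y‖ ^ 2 * AA i x y) * DD x y ^ (-((n:ℝ)/2) - 1)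
      + n * (n + 2) * AA i x y * AA j y x ^ 2 * DD x y ^ (-((n:ℝ)/2) - 2) := by
  unfold kap1
  have h1 := coord_diff j x
  have h2 := AA_diff i x y
  have h3 := AA_diff' j x y
  have h4 := DDp_diff h
  rw [pd_add (DifferentiableAt.fun_mul (by fun_prop) (h4 _)) (DifferentiableAt.fun_mul (by fun_prop) (h4 _)), pd_mul (by fun_prop) (h4 _),
    pd_mul (by fun_prop) (h4 _), pd_const_mul (by fun_prop), pd_mul h2 h3, pd_sub (by fun_prop) (by fun_prop), pd_const, pd_mul_const (by fun_prop),
    pd_const_mul h1, pd_coord, pd_DDp h, pd_DDp h, pd_AA, pd_AA']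
  rw [show -((n:ℝ)/2) - 1 - 1 = -((n:ℝ)/2) - 2 by ring]
  simp only [if_true]
  ring

lemma inner_eq_sum (x y : En n) : inner ℝ x y = ∑ j, x j * y j := by
  simp [PiLp.inner_apply, mul_comm]

lemma nsq_eq_sum (x : En n) : ‖x‖ ^ 2 = ∑ j, x j * x j := by
  rw [← inner_eq_sum, real_inner_self_eq_norm_sq]

lemma sum_AA (x y : En n) : ∑ j, x j * AA j y x = inner ℝ x y - ‖y‖ ^ 2 * ‖x‖ ^ 2 := by
  rw [inner_eq_sum, nsq_eq_sum x, Finset.mul_sum, ← Finset.sum_sub_distrib]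
  refine Finset.sum_congr rfl fun j _ => ?_
  unfold AA; ring

lemma sum_AAsq (x y : En n) : ∑ j, AA j x y ^ 2 = ‖x‖ ^ 2 * DD x y := by
  have e : ∀ j, AA j x y ^ 2 = x j * x j - 2 * ‖x‖ ^ 2 * (x j * y j) + ‖x‖ ^ 4 * (y j * y j) := fun j => by unfold AA; ring
  simp only [e]
  rw [Finset.sum_add_distrib, Finset.sum_sub_distrib, ← Finset.mul_sum, ← Finset.mul_sum, ← nsq_eq_sum, ← nsq_eq_sum, ← inner_eq_sum]
  unfold DD; ring

lemma lap_kap {x y : En n} (h : 0 < DD x y) (i : Fin n) : ∑ j, pd j (fun x => kap1 i j x y) x = 0 := by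
  simp only [pd_kap1 h]
  set E := DD x y ^ (-((n:ℝ)/2) - 1)
  have e1 : DD x y ^ (-((n:ℝ)/2)) = DD x y * E := by
    simp only [E]; rw [Real.rpow_sub_one h.ne']; field_simp
  have e2 : DD x y * DD x y ^ (-((n:ℝ)/2) - 2) = E := by
    simp only [E]; rw [show -((n:ℝ)/2) - 2 = -((n:ℝ)/2) - 1 - 1 by ring, Real.rpow_sub_one h.ne' (-((n:ℝ)/2) - 1)]; field_simp
  set E2 := DD x y ^ (-((n:ℝ)/2) - 2)
  rw [e1]
  have s1 : ∀ j, -2 * y i * (DD x y * E) + (2 * n * ((if i = j then 1 else 0) - 2 * x j * y i) * AA j y x - n * ‖y‖ ^ 2 * AA i x y) * E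
      + n * (n + 2) * AA i x y * AA j y x ^ 2 * E2 = (-2 * y i * (DD x y * E) - n * ‖y‖ ^ 2 * AA i x y * E) + (if i = j then 2 * n * AA j y x * E else 0)
      - 4 * n * y i * E * (x j * AA j y x) + n * (n+2) * AA i x y * E2 * AA j y x ^ 2 := by
    intro j; split_ifs <;> ring
  simp only [s1]
  rw [Finset.sum_add_distrib, Finset.sum_sub_distrib, Finset.sum_add_distrib, ← Finset.mul_sum, ← Finset.mul_sum, sum_AA, sum_AAsq, Finset.sum_ite_eq,
    Finset.sum_const, DD_symm y x]
  simp only [Finset.mem_univ, if_true, Finset.card_univ, Fintype.card_fin, nsmul_eq_mul]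
  have : (n:ℝ) * (n + 2) * AA i x y * E2 * (‖y‖ ^ 2 * DD x y) = n * (n + 2) * AA i x y * ‖y‖ ^ 2 * E := by rw [← e2]; ring
  rw [this]
  unfold AA DD; ring

lemma kap_euler (e : ℕ) (i : Fin n) (x y : En n) (t : ℝ) (h : 0 < DD x (t • y)) :
    HasDerivAt (fun t : ℝ => t ^ (e + 1) * kap i x (t • y)) (t ^ e * (∑ j, x j * kap1 i j x (t • y) + e * kap i x (t • y))) t := by
  have hD : ∀ t : ℝ, DD x (t • y) = 1 - 2 * t * inner ℝ x y + t ^ 2 * (‖x‖ ^ 2 * ‖y‖ ^ 2) := by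
    intro t; unfold DD; rw [norm_smul, real_inner_smul_right, mul_pow, Real.norm_eq_abs, sq_abs]; ring
  have hA : ∀ t : ℝ, AA i x (t • y) = x i - t * (‖x‖ ^ 2 * y i) := by intro t; simp [AA]; ring
  have h1 : HasDerivAt (fun t : ℝ => DD x (t • y)) (-2 * inner ℝ x y + 2 * t * (‖x‖ ^ 2 * ‖y‖ ^ 2)) t := by
    simp only [hD]
    have := (((hasDerivAt_id t).const_mul 2).mul_const (inner ℝ x y)).const_sub 1 |>.add ((hasDerivAt_pow 2 t).mul_const (‖x‖ ^ 2 * ‖y‖ ^ 2))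
    exact this.congr_deriv (by simp)
  have h2 : HasDerivAt (fun t : ℝ => AA i x (t • y)) (-(‖x‖ ^ 2 * y i)) t := by
    simp only [hA]
    have := ((hasDerivAt_id t).mul_const (‖x‖ ^ 2 * y i)).const_sub (x i)
    exact this.congr_deriv (by simp)
  have h3 := (hasDerivAt_pow (e+1) t).mul (h2.mul (h1.rpow_const (p := -((n:ℝ)/2)) (Or.inl h.ne')))
  refine h3.congr_deriv ?_
  have s : ∑ j, x j * kap1 i j x (t • y) = (x i - 2 * ‖x‖ ^ 2 * (t * y i)) * DD x (t • y) ^ (-((n:ℝ)/2)) + n * AA i x (t • y) *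
      (t * inner ℝ x y - t ^ 2 * (‖x‖ ^ 2 * ‖y‖ ^ 2)) * DD x (t • y) ^ (-((n:ℝ)/2) - 1) := by
    have e1 : ∀ j, x j * kap1 i j x (t • y) = (if i = j then x j else 0) * DD x (t • y) ^ (-((n:ℝ)/2)) - 2 * (t * y i) * DD x (t • y) ^ (-((n:ℝ)/2)) * (x j * x j)
       + n * AA i x (t • y) * DD x (t • y) ^ (-((n:ℝ)/2) - 1) * (x j * AA j (t • y) x) := by
      intro j; unfold kap1; simp only [PiLp.smul_apply, smul_eq_mul]; split_ifs <;> ring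
    simp only [e1]
    rw [Finset.sum_add_distrib, Finset.sum_sub_distrib, ← Finset.sum_mul, ← Finset.mul_sum, ← Finset.mul_sum, Finset.sum_ite_eq, sum_AA, ← nsq_eq_sum,
      norm_smul, real_inner_smul_right, mul_pow, Real.norm_eq_abs, sq_abs]
    simp only [Finset.mem_univ, if_true]
    ring
  rw [s]
  unfold kap
  simp only [Pi.mul_apply, Nat.add_sub_cancel, hA]
  push_cast
  ring

lemma AA_le {x y : En n} (hx : ‖x‖ ≤ 1) (i : Fin n) : |AA i x y| ≤ √(DD x y) := by
  refine Real.abs_le_sqrt ?_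
  calc AA i x y ^ 2 ≤ ∑ j, AA j x y ^ 2 := Finset.single_le_sum (f := fun j => AA j x y ^ 2) (fun j _ => sq_nonneg _) (Finset.mem_univ i)
    _ = ‖x‖ ^ 2 * DD x y := sum_AAsq x y
    _ ≤ 1 * DD x y := mul_le_mul_of_nonneg_right (pow_le_one₀ (norm_nonneg _) hx) (DD_nonneg _ _)
    _ = _ := one_mul _

lemma AA_le' {x y : En n} (hy : ‖y‖ ≤ 1) (i : Fin n) : |AA i y x| ≤ √(DD x y) := by
  rw [DD_symm]; exact AA_le hy i

lemma DD_le_four {x y : En n} (hx : ‖x‖ ≤ 1) (hy : ‖y‖ ≤ 1) : DD x y ≤ 4 := by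
  have h := abs_le.1 (abs_real_inner_le_norm x y)
  have h2 : ‖x‖ * ‖y‖ ≤ 1 := mul_le_one₀ hx (norm_nonneg _) hy
  have h3 : 0 ≤ ‖x‖ * ‖y‖ := by positivity
  unfold DD
  nlinarith

lemma DD_pows {x y : En n} (hD : 0 < DD x y) : ∃ d X : ℝ, 0 < d ∧ 0 < X ∧ √(DD x y) = d ∧ DD x y = d ^ 2 ∧
    DD x y ^ (-((n:ℝ)/2)) = d ^ 2 * X ∧ DD x y ^ (-((n:ℝ)/2) - 1) = X ∧ d ^ 2 * DD x y ^ (-((n:ℝ)/2) - 2) = X ∧ DD x y ^ (-(((n:ℝ)+1)/2)) = d * X := by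
  refine ⟨√(DD x y), DD x y ^ (-((n:ℝ)/2) - 1), Real.sqrt_pos.2 hD, Real.rpow_pos_of_pos hD _, rfl, (Real.sq_sqrt hD.le).symm, ?_, rfl, ?_, ?_⟩
  · rw [Real.sq_sqrt hD.le, Real.rpow_sub_one hD.ne']; field_simp
  · rw [Real.sq_sqrt hD.le, show -((n:ℝ)/2) - 2 = -((n:ℝ)/2) - 1 - 1 by ring, Real.rpow_sub_one hD.ne' (-((n:ℝ)/2) - 1)]; field_simp
  · rw [Real.sqrt_eq_rpow, ← Real.rpow_add hD]; congr 1; ring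

lemma kap2_le {x y : En n} (hx : ‖x‖ ≤ 1) (hy : ‖y‖ ≤ 1) (hD : 0 < DD x y) (i l : Fin n) :
    |kap2 i l x y| ≤ (2 + 2 * n) * DD x y ^ (-(((n:ℝ)+1)/2)) := by
  obtain ⟨d, X, hd, hX, e1, e2, e3, e4, e5, e6⟩ := DD_pows hD
  have hd2 : d ≤ 2 := by have := DD_le_four hx hy; nlinarith
  have a1 := AA_le (y := y) hx i
  have a2 := AA_le (y := y) hx l
  rw [e1] at a1 a2
  unfold kap2
  rw [e3, e4, e6]
  have hx2 : ‖x‖ ^ 2 ≤ 1 := pow_le_one₀ (norm_nonneg _) hx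
  have hite : |(if i = l then (1:ℝ) else 0)| ≤ 1 := by split_ifs <;> simp
  have b1 : |-(‖x‖ ^ 2 * (if i = l then (1:ℝ) else 0)) * (d ^ 2 * X)| ≤ 1 * 1 * (d ^ 2 * X) := by
    rw [abs_mul, abs_neg, abs_mul, abs_of_nonneg (sq_nonneg ‖x‖), abs_of_pos (by positivity : 0 < d ^ 2 * X)]
    gcongr
  have b2 : |(n:ℝ) * (AA i x y * AA l x y) * X| ≤ n * (d * d) * X := by
    rw [abs_mul, abs_mul, abs_mul, abs_of_pos hX, Nat.abs_cast]
    gcongr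
  refine (abs_add_le _ _).trans ((add_le_add b1 b2).trans ?_)
  have : d * d * X ≤ 2 * (d * X) := by nlinarith [mul_pos hd hX]
  have hn0 : (0:ℝ) ≤ n := by positivity
  nlinarith [mul_le_mul_of_nonneg_left this hn0]

lemma kap3_le {x y : En n} (hx : ‖x‖ ≤ 1) (hy : ‖y‖ ≤ 1) (hD : 0 < DD x y) (i j l : Fin n) :
    |kap3 i j l x y| ≤ (n ^ 2 + 9 * n + 4) * DD x y ^ (-(((n:ℝ)+1)/2)) := by
  obtain ⟨d, X, hd, hX, e1, e2, e3, e4, e5, e6⟩ := DD_pows hD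
  have hd2 : d ≤ 2 := by have := DD_le_four hx hy; nlinarith
  have a1 := AA_le (y := y) hx i
  have a2 := AA_le (y := y) hx l
  have a3 := AA_le' (x := x) hy j
  rw [e1] at a1 a2 a3
  have hX2 : 0 < DD x y ^ (-((n:ℝ)/2) - 2) := Real.rpow_pos_of_pos hD _
  unfold kap3
  rw [e3, e4, e6]
  set X2 := DD x y ^ (-((n:ℝ)/2) - 2)
  have hx2 : ‖x‖ ^ 2 ≤ 1 := pow_le_one₀ (norm_nonneg _) hx
  have hite : ∀ i l : Fin n, |(if i = l then (1:ℝ) else 0)| ≤ 1 := by intro i l; split_ifs <;> simp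
  have hxj : |x j| ≤ 1 := (coord_le x j).trans hx
  have hyi : |y i| ≤ 1 := (coord_le y i).trans hy
  have hyl : |y l| ≤ 1 := (coord_le y l).trans hy
  have b1 : |(n:ℝ) * (if i = j then 1 else 0) * AA l x y| ≤ n * 1 * d := by
    rw [abs_mul, abs_mul, Nat.abs_cast]; have := hite i j; gcongr
  have b2 : |2 * x j * y i * n * AA l x y| ≤ 2 * 1 * 1 * n * d := by
    rw [abs_mul, abs_mul, abs_mul, abs_mul, Nat.abs_cast, abs_two]; gcongr
  have b3 : |-(‖x‖ ^ 2 * (if i = l then (1:ℝ) else 0)) * AA j y x| ≤ 1 * 1 * d := by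
    rw [abs_mul, abs_neg, abs_mul, abs_of_nonneg (sq_nonneg ‖x‖)]; have := hite i l; gcongr
  have b4 : |AA i x y * ((if j = l then (1:ℝ) else 0) - 2 * y l * x j)| ≤ d * (1 + 2 * 1 * 1) := by
    rw [abs_mul]
    refine mul_le_mul a1 ((abs_sub _ _).trans (add_le_add (hite j l) ?_)) (abs_nonneg _) hd.le
    rw [abs_mul, abs_mul, abs_two]; gcongr
  have b5 : |2 * x j * (if i = l then (1:ℝ) else 0) * (d ^ 2 * X)| ≤ 2 * 1 * 1 * (d ^ 2 * X) := by
    rw [abs_mul, abs_mul, abs_mul, abs_two, abs_of_pos (by positivity : 0 < d ^ 2 * X)]; have := hite i l; gcongr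
  have b6 : |(n:ℝ) * (n + 2) * (AA i x y * AA j y x * AA l x y) * X2| ≤ n * (n + 2) * (d * d * d) * X2 := by
    rw [abs_mul, abs_mul, abs_mul, abs_mul (AA i x y * AA j y x), abs_mul (AA i x y), Nat.abs_cast, abs_of_pos (by positivity : (0:ℝ) < n + 2), abs_of_pos hX2]
    gcongr
  have b7 : |((n:ℝ) * (if i = j then 1 else 0) * AA l x y - 2 * x j * y i * n * AA l x y + n * (-(‖x‖ ^ 2 * (if i = l then 1 else 0)) * AA j y x +
    AA i x y * ((if j = l then 1 else 0) - 2 * y l * x j))) * X| ≤ (n * 1 * d + 2 * 1 * 1 * n * d + n * (1 * 1 * d + d * (1 + 2 * 1 * 1))) * X := by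
    rw [abs_mul, abs_of_pos hX]
    refine mul_le_mul_of_nonneg_right ((abs_add_le _ _).trans (add_le_add ((abs_sub _ _).trans (add_le_add b1 b2)) ?_)) hX.le
    rw [abs_mul, Nat.abs_cast]
    exact mul_le_mul_of_nonneg_left ((abs_add_le _ _).trans (add_le_add b3 b4)) (by positivity)
  refine (abs_add_le _ _).trans ((add_le_add ((abs_sub _ _).trans (add_le_add b7 b5)) b6).trans ?_)
  have h1 : d * d * X ≤ 2 * (d * X) := by nlinarith [mul_pos hd hX]
  have h2 : (n:ℝ) * (n + 2) * (d * d * d) * X2 = n * (n + 2) * (d * X) := by rw [← e5]; ring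
  rw [h2]
  nlinarith

/-- smooth positive cutoff -/
def sg (ε s : ℝ) : ℝ := ε / 2 + (s - ε / 2) * Real.smoothTransition ((s - ε / 2) / (ε / 2))

lemma sg_pos {ε : ℝ} (hε : 0 < ε) (s : ℝ) : 0 < sg ε s := by
  unfold sg
  rcases le_or_gt s (ε / 2) with h | h
  · rw [Real.smoothTransition.zero_of_nonpos (div_nonpos_of_nonpos_of_nonneg (by linarith) (by linarith))]
    linarith
  · have := Real.smoothTransition.nonneg ((s - ε / 2) / (ε / 2))
    have h3 : 0 ≤ (s - ε / 2) * Real.smoothTransition ((s - ε / 2) / (ε / 2)) := mul_nonneg (by linarith) this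
    linarith

lemma sg_eq {ε s : ℝ} (hε : 0 < ε) (h : ε ≤ s) : sg ε s = s := by
  unfold sg
  rw [Real.smoothTransition.one_of_one_le (by rw [le_div_iff₀ (by linarith)]; linarith)]
  ring

lemma sg_smooth (ε : ℝ) : ContDiff ℝ (⊤ : ℕ∞) (sg ε) := by
  unfold sg
  exact contDiff_const.add ((contDiff_id.sub contDiff_const).mul (Real.smoothTransition.contDiff.comp ((contDiff_id.sub contDiff_const).div_const _)))

def kapc (ε : ℝ) (i : Fin n) (x y : En n) : ℝ := AA i x y * sg ε (DD x y) ^ (-((n:ℝ)/2))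

lemma kapc_eq {ε : ℝ} (hε : 0 < ε) (i : Fin n) {x y : En n} (h : ε ≤ DD x y) : kapc ε i x y = kap i x y := by
  unfold kapc kap; rw [sg_eq hε h]

lemma kapc_smooth {ε : ℝ} (hε : 0 < ε) (i : Fin n) {E : Type*} [NormedAddCommGroup E] [NormedSpace ℝ E] {X Y : E → En n}
    (hX : ContDiff ℝ (⊤ : ℕ∞) X) (hY : ContDiff ℝ (⊤ : ℕ∞) Y) : ContDiff ℝ (⊤ : ℕ∞) (fun p => kapc ε i (X p) (Y p)) := by
  unfold kapc AA DD
  have h1 := (coord_contDiff i).comp hX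
  have h2 := (coord_contDiff i).comp hY
  have h3 : ContDiff ℝ (⊤ : ℕ∞) (fun p => ‖X p‖ ^ 2) := hX.norm_sq ℝ
  have h4 : ContDiff ℝ (⊤ : ℕ∞) (fun p => ‖Y p‖ ^ 2) := hY.norm_sq ℝ
  have h5 : ContDiff ℝ (⊤ : ℕ∞) (fun p => inner ℝ (X p) (Y p)) := hX.inner ℝ hY
  refine (h1.sub (h3.mul h2)).mul ?_
  refine ContDiff.rpow_const_of_ne ?_ (fun p => (sg_pos hε _).ne')
  exact (sg_smooth ε).comp ((contDiff_const.sub (contDiff_const.mul h5)).add (h3.mul h4))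

def hS (n : ℕ) : Set (En n × ℝ) := closedBall 0 1 ×ˢ Set.Icc 0 1

lemma hS_compact : IsCompact (hS n) := (isCompact_closedBall _ _).prod isCompact_Icc

lemma hS_meas : MeasurableSet (hS n) := hS_compact.isClosed.measurableSet

instance hS_fin : IsFiniteMeasure ((volume : Measure (En n × ℝ)).restrict (hS n)) :=
  ⟨by rw [Measure.restrict_apply_univ]; exact hS_compact.measure_lt_top⟩

lemma hS_ae : ∀ᵐ z ∂((volume : Measure (En n × ℝ)).restrict (hS n)), z ∈ hS n := ae_restrict_mem hS_meas

lemma hS_int {F : En n × ℝ → ℝ} (hF : Continuous F) : Integrable F ((volume : Measure (En n × ℝ)).restrict (hS n)) :=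
  hF.continuousOn.integrableOn_compact hS_compact

def Ph (ε : ℝ) (e : ℕ) (i : Fin n) (ρ : En n → ℝ) (p : En n × (En n × ℝ)) : ℝ :=
  p.2.2 ^ e * kapc ε i p.1 (p.2.2 • p.2.1) * ρ p.2.1

lemma Ph_smooth {ε : ℝ} (hε : 0 < ε) (e : ℕ) (i : Fin n) {ρ : En n → ℝ} (hρ : ContDiff ℝ (⊤ : ℕ∞) ρ) :
    ContDiff ℝ (⊤ : ℕ∞) (Ph ε e i ρ) := by
  unfold Ph
  have h1 : ContDiff ℝ (⊤ : ℕ∞) (fun p : En n × (En n × ℝ) => p.2.2) := contDiff_snd.comp contDiff_snd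
  have h2 : ContDiff ℝ (⊤ : ℕ∞) (fun p : En n × (En n × ℝ) => p.2.1) := contDiff_fst.comp contDiff_snd
  exact ((h1.pow e).mul (kapc_smooth hε i contDiff_fst (h1.smul h2))).mul (hρ.comp h2)

def hh (ε : ℝ) (e : ℕ) (i : Fin n) (ρ : En n → ℝ) (x : En n) : ℝ := ∫ z in hS n, Ph ε e i ρ (x, z)

lemma hh_smooth {ε : ℝ} (hε : 0 < ε) (e : ℕ) (i : Fin n) {ρ : En n → ℝ} (hρ : ContDiff ℝ (⊤ : ℕ∞) ρ) :
    ContDiff ℝ (⊤ : ℕ∞) (hh ε e i ρ) :=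
  par_smooth _ hS_compact hS_ae _ (Ph_smooth hε e i hρ)

lemma hh_pd {ε : ℝ} (hε : 0 < ε) (e : ℕ) (i : Fin n) {ρ : En n → ℝ} (hρ : ContDiff ℝ (⊤ : ℕ∞) ρ) (j : Fin n) (x : En n) :
    pd j (hh ε e i ρ) x = ∫ z in hS n, pd j (fun x => Ph ε e i ρ (x, z)) x :=
  par_pd _ hS_compact hS_ae _ (Ph_smooth hε e i hρ) j x

lemma hh_pd2 {ε : ℝ} (hε : 0 < ε) (e : ℕ) (i : Fin n) {ρ : En n → ℝ} (hρ : ContDiff ℝ (⊤ : ℕ∞) ρ) (j : Fin n) (x : En n) :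
    pd j (pd j (hh ε e i ρ)) x = ∫ z in hS n, pd j (fun x' => pd j (fun x => Ph ε e i ρ (x, z)) x') x := by
  have : pd j (hh ε e i ρ) = fun x => ∫ z in hS n, pd j (fun x => Ph ε e i ρ (x, z)) x := by
    ext x; exact hh_pd hε e i hρ j x
  rw [this]
  exact par_pd _ hS_compact hS_ae (fun p : En n × (En n × ℝ) => pd j (fun x => Ph ε e i ρ (x, p.2)) p.1)
    (par_pd_smooth _ (Ph_smooth hε e i hρ) j) j x

lemma region {δ : ℝ} (h1 : δ < 1) {x y : En n} (hx : δ * ‖x‖ < (1 + δ) / 2) (hy : ‖y‖ ≤ δ) {t : ℝ} (ht : t ∈ Set.Icc (0:ℝ) 1) :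
    ((1 - δ) / 2) ^ 2 ≤ DD x (t • y) := by
  have : (1 - (1 + δ) / 2) ^ 2 ≤ DD x (t • y) := by
    apply DD_lb _ _ _ (by linarith)
    rw [norm_smul, Real.norm_eq_abs, abs_of_nonneg ht.1]
    have a1 : t * ‖y‖ ≤ 1 * δ := mul_le_mul ht.2 hy (norm_nonneg _) zero_le_one
    have := mul_le_mul_of_nonneg_left a1 (norm_nonneg x)
    linarith
  convert this using 1; ring

lemma regU_open (δ : ℝ) : IsOpen {x : En n | δ * ‖x‖ < (1 + δ) / 2} := isOpen_lt (by fun_prop) (by fun_prop)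

section

lemma eps_pos {δ ε : ℝ} (hδ1 : δ < 1) (hε : ε = ((1 - δ) / 2) ^ 2) {ρ : En n → ℝ} (h0 : ∀ y, δ ≤ ‖y‖ → ρ y = 0) : 0 < ε := by
  rw [hε]
  have : 0 < (1 - δ) / 2 := by linarith
  positivity

lemma Ph_eq {δ ε : ℝ} (hδ1 : δ < 1) (hε : ε = ((1 - δ) / 2) ^ 2) {ρ : En n → ℝ} (h0 : ∀ y, δ ≤ ‖y‖ → ρ y = 0) (e : ℕ) (i : Fin n) {x : En n} (hx : δ * ‖x‖ < (1 + δ) / 2) {z : En n × ℝ} (hz : z ∈ hS n) :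
    Ph ε e i ρ (x, z) = z.2 ^ e * kap i x (z.2 • z.1) * ρ z.1 := by
  unfold Ph
  rcases le_or_gt δ ‖z.1‖ with h | h
  · simp [h0 _ h]
  · simp only
    rw [kapc_eq (eps_pos hδ1 hε h0)]
    rw [hε]; exact region hδ1 hx h.le hz.2

lemma Ph_pd {δ ε : ℝ} (hδ1 : δ < 1) (hε : ε = ((1 - δ) / 2) ^ 2) {ρ : En n → ℝ} (h0 : ∀ y, δ ≤ ‖y‖ → ρ y = 0) (e : ℕ) (i j : Fin n) {x : En n} (hx : δ * ‖x‖ < (1 + δ) / 2) {z : En n × ℝ} (hz : z ∈ hS n) :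
    pd j (fun x => Ph ε e i ρ (x, z)) x = z.2 ^ e * kap1 i j x (z.2 • z.1) * ρ z.1 := by
  have he : (fun x => Ph ε e i ρ (x, z)) =ᶠ[nhds x] fun x => z.2 ^ e * kap i x (z.2 • z.1) * ρ z.1 := by
    filter_upwards [(regU_open δ).mem_nhds hx] with x' hx'
    exact Ph_eq hδ1 hε h0 e i hx' hz
  rw [pd_congr he]
  rcases le_or_gt δ ‖z.1‖ with h | h
  · simp [h0 _ h, pd_const]
  · have hD : 0 < DD x (z.2 • z.1) := (eps_pos hδ1 hε h0).trans_le (by rw [hε]; exact region hδ1 hx h.le hz.2)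
    have hd : DifferentiableAt ℝ (fun x => kap i x (z.2 • z.1)) x := by
      unfold kap; exact (AA_diff _ _ _).fun_mul (DDp_diff hD _)
    rw [pd_mul_const (by fun_prop), pd_const_mul hd, pd_kap hD]

lemma Ph_lap {δ ε : ℝ} (hδ1 : δ < 1) (hε : ε = ((1 - δ) / 2) ^ 2) {ρ : En n → ℝ} (h0 : ∀ y, δ ≤ ‖y‖ → ρ y = 0) (e : ℕ) (i : Fin n) {x : En n} (hx : δ * ‖x‖ < (1 + δ) / 2) {z : En n × ℝ} (hz : z ∈ hS n) :
    ∑ j, pd j (fun x' => pd j (fun x => Ph ε e i ρ (x, z)) x') x = 0 := by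
  rcases le_or_gt δ ‖z.1‖ with h | h
  · have : ∀ j, (fun x' => pd j (fun x => Ph ε e i ρ (x, z)) x') = fun _ => 0 := by
      intro j; ext x'; simp [Ph, h0 _ h, pd_const]
    simp [this, pd_const]
  have hD : 0 < DD x (z.2 • z.1) := (eps_pos hδ1 hε h0).trans_le (by rw [hε]; exact region hδ1 hx h.le hz.2)
  have he : ∀ j, pd j (fun x' => pd j (fun x => Ph ε e i ρ (x, z)) x') x = z.2 ^ e * pd j (fun x => kap1 i j x (z.2 • z.1)) x * ρ z.1 := by
    intro j
    have he : (fun x' => pd j (fun x => Ph ε e i ρ (x, z)) x') =ᶠ[nhds x] fun x => z.2 ^ e * kap1 i j x (z.2 • z.1) * ρ z.1 := by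
      filter_upwards [(regU_open δ).mem_nhds hx] with x' hx'
      exact Ph_pd hδ1 hε h0 e i j hx' hz
    rw [pd_congr he]
    have hd : DifferentiableAt ℝ (fun x => kap1 i j x (z.2 • z.1)) x := by
      unfold kap1
      have h1 := coord_diff j x
      have h2 := AA_diff i x (z.2 • z.1)
      have h3 := AA_diff' j x (z.2 • z.1)
      have h4 := DDp_diff hD
      exact (DifferentiableAt.fun_mul (by fun_prop) (h4 _)).fun_add (DifferentiableAt.fun_mul (by fun_prop) (h4 _))
    rw [pd_mul_const (by fun_prop), pd_const_mul hd]
  simp only [he]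
  rw [← Finset.sum_mul, ← Finset.mul_sum, lap_kap hD]; simp

lemma hh_lap {δ ε : ℝ} (hδ1 : δ < 1) (hε : ε = ((1 - δ) / 2) ^ 2) {ρ : En n → ℝ} (h0 : ∀ y, δ ≤ ‖y‖ → ρ y = 0) (hρ : ContDiff ℝ (⊤ : ℕ∞) ρ) (e : ℕ) (i : Fin n) {x : En n} (hx : δ * ‖x‖ < (1 + δ) / 2) :
    ∑ j, pd j (pd j (hh ε e i ρ)) x = 0 := by
  have hεp := eps_pos hδ1 hε h0
  simp only [hh_pd2 hεp e i hρ]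
  rw [← integral_finset_sum]
  · rw [setIntegral_congr_fun hS_meas (g := fun _ => (0:ℝ))]
    · simp
    · intro z hz; exact Ph_lap hδ1 hε h0 e i hx hz
  · intro j _
    apply hS_int
    have := (par_pd_smooth _ (par_pd_smooth _ (Ph_smooth hεp e i hρ) j) j).continuous
    exact this.comp (by fun_prop : Continuous fun z : En n × ℝ => (x, z))

lemma hh_bdry {δ ε : ℝ} (hδ1 : δ < 1) (hε : ε = ((1 - δ) / 2) ^ 2) {ρ : En n → ℝ} (h0 : ∀ y, δ ≤ ‖y‖ → ρ y = 0) (hn : 1 < n) (hρ : ContDiff ℝ (⊤ : ℕ∞) ρ) (e : ℕ) (i : Fin n) {x : En n} (hx1 : ‖x‖ = 1) :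
    ∑ j, x j * pd j (hh ε e i ρ) x + e * hh ε e i ρ x = VV i ρ x := by
  have hεp := eps_pos hδ1 hε h0
  have hx : δ * ‖x‖ < (1 + δ) / 2 := by rw [hx1]; linarith
  have hc1 : Continuous (fun z : En n × ℝ => Ph ε e i ρ (x, z)) :=
    (Ph_smooth hεp e i hρ).continuous.comp (by fun_prop : Continuous fun z : En n × ℝ => (x, z))
  have hc2 : ∀ j, Continuous (fun z : En n × ℝ => pd j (fun x => Ph ε e i ρ (x, z)) x) := fun j =>
    (par_pd_smooth _ (Ph_smooth hεp e i hρ) j).continuous.comp (by fun_prop : Continuous fun z : En n × ℝ => (x, z))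
  set g : En n × ℝ → ℝ := fun z => ∑ j, x j * pd j (fun x => Ph ε e i ρ (x, z)) x + e * Ph ε e i ρ (x, z) with hg
  have hgc : Continuous g := by
    simp only [hg]
    exact (continuous_finset_sum _ fun j _ => continuous_const.mul (hc2 j)).add (continuous_const.mul hc1)
  have e1 : ∑ j, x j * pd j (hh ε e i ρ) x + e * hh ε e i ρ x = ∫ z in hS n, g z := by
    simp only [hh_pd hεp e i hρ, hh, hg]
    rw [integral_add, integral_finset_sum]
    · simp only [integral_const_mul]
    · intro j _; exact hS_int (continuous_const.mul (hc2 j))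
    · exact hS_int (continuous_finset_sum _ fun j _ => continuous_const.mul (hc2 j))
    · exact hS_int (continuous_const.mul hc1)
  rw [e1]
  have e2 : ∫ z in hS n, g z = ∫ y in closedBall (0 : En n) 1, ∫ t in Set.Icc (0:ℝ) 1, g (y, t) := by
    unfold hS
    exact setIntegral_prod g (hgc.continuousOn.integrableOn_compact hS_compact)
  have e3 : ∫ y in closedBall (0 : En n) 1, kk 0 i (x - y) * ρ y = ∫ y, kk 0 i (x - y) * ρ y := by
    apply setIntegral_eq_integral_of_forall_compl_eq_zero
    intro y hy
    have : δ ≤ ‖y‖ := by simp at hy; linarith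
    rw [h0 _ this, mul_zero]
  rw [e2, VV, cz, ← e3]
  refine setIntegral_congr_fun measurableSet_closedBall fun y hy => ?_
  rcases le_or_gt δ ‖y‖ with h | h
  · have : ∀ t, g (y, t) = 0 := by intro t; simp [hg, Ph, h0 _ h, pd_const]
    simp [this, h0 _ h]
  · have hz : ∀ t ∈ Set.Icc (0:ℝ) 1, (y, t) ∈ hS n := fun t ht => ⟨hy, ht⟩
    have hgt : ∀ t ∈ Set.Icc (0:ℝ) 1, g (y, t) = t ^ e * (∑ j, x j * kap1 i j x (t • y) + e * kap i x (t • y)) * ρ y := by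
      intro t ht
      simp only [hg]
      simp only [Ph_pd hδ1 hε h0 e i _ hx (hz t ht), Ph_eq hδ1 hε h0 e i hx (hz t ht)]
      rw [mul_add, add_mul, Finset.mul_sum, Finset.sum_mul]
      congr 1
      · refine Finset.sum_congr rfl fun j _ => ?_
        ring
      · ring
    have hgc' : Continuous (fun t => g (y, t)) := hgc.comp (by fun_prop)
    rw [integral_Icc_eq_integral_Ioc, ← intervalIntegral.integral_of_le zero_le_one]
    rw [intervalIntegral.integral_eq_sub_of_hasDerivAt (f := fun t => t ^ (e + 1) * kap i x (t • y) * ρ y)]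
    · simp only [one_pow, one_mul, one_smul, ne_eq, Nat.add_eq_zero_iff, one_ne_zero, and_false, not_false_eq_true, zero_pow, zero_mul, sub_zero]
      congr 1
      unfold kap kk bk AA
      rw [DD_symm, DD_sphere _ _ hx1, hx1, ← norm_neg (y - x), neg_sub]
      simp only [one_pow, one_mul, PiLp.sub_apply]
      congr 2
      · ring
      · ring
    · intro t ht
      rw [Set.uIcc_of_le zero_le_one] at ht
      rw [hgt t ht]
      exact (kap_euler e i x y t ((eps_pos hδ1 hε h0).trans_le (by rw [hε]; exact region hδ1 hx h.le ht))).mul_const _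
    · exact hgc'.intervalIntegrable _ _
end

lemma ibp_slice {K ψ : En n → ℝ} (hK : ContDiff ℝ (⊤ : ℕ∞) K) (hψ : ContDiff ℝ (⊤ : ℕ∞) ψ) (hs : HasCompactSupport ψ) (l : Fin n) :
    ∫ y, K y * pd l ψ y = -∫ y, pd l K y * ψ y := by
  unfold pd
  apply integral_mul_fderiv_eq_neg_fderiv_mul_of_integrable
  · exact Continuous.integrable_of_hasCompactSupport ((pd_smooth hK l).continuous.mul hψ.continuous) hs.mul_left
  · exact Continuous.integrable_of_hasCompactSupport (hK.continuous.mul (pd_smooth hψ l).continuous) (pd_cs hs l).mul_left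
  · exact Continuous.integrable_of_hasCompactSupport (hK.continuous.mul hψ.continuous) hs.mul_left
  · exact fun x _ => hK.differentiable (by simp) x
  · exact fun x _ => hψ.differentiable (by simp) x

lemma t_int (hn : 1 < n) {x y : En n} (hx : ‖x‖ ≤ 1) (hy : ‖y‖ < 1) :
    ∫⁻ t in Set.Icc (0:ℝ) 1, ENNReal.ofReal (DD x (t • y) ^ (-(((n:ℝ)+1)/2))) ≤
      ENNReal.ofReal (2 ^ ((n:ℝ)+1) + 1) * Kd x y := by
  have hD : 0 < DD x y := by
    have h1 : ‖x‖ * ‖y‖ < 1 := by nlinarith [norm_nonneg x, norm_nonneg y]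
    have := DD_lb x y le_rfl h1.le
    have : 0 < (1 - ‖x‖ * ‖y‖) ^ 2 := by have : 0 < 1 - ‖x‖ * ‖y‖ := by linarith
                                         positivity
    linarith
  have hn0 : (1:ℝ) < n := by exact_mod_cast hn
  have h := inner_1d (b := 0) (d := √(DD x y)) (s := (n:ℝ)+1) le_rfl (by norm_num) (by linarith) (Real.sqrt_pos.2 hD)
    (fun u => DD x ((1 - u) • y)) (fun u hu hu1 => by
      have := (DD_t_lb hx hy.le (t := 1 - u) (by linarith) (by linarith)).1; simpa using this)
    (fun u hu hu1 => by
      have := (DD_t_lb hx hy.le (t := 1 - u) (by linarith) (by linarith)).2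
      rw [Real.sq_sqrt hD.le]; exact this)
  have e1 : ∫⁻ t in Set.Icc (0:ℝ) 1, ENNReal.ofReal (DD x (t • y) ^ (-(((n:ℝ)+1)/2))) =
      ∫⁻ u in Set.Ioc (0:ℝ) 1, ENNReal.ofReal (DD x ((1 - u) • y) ^ (-(((n:ℝ)+1)/2)) * u ^ (-(0:ℝ))) := by
    rw [← restrict_Ico_eq_restrict_Icc]
    rw [← lintegral_indicator measurableSet_Ico, ← lintegral_indicator measurableSet_Ioc,
      ← lintegral_sub_left_eq_self _ (1:ℝ)]
    congr 1; ext u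
    by_cases hu : u ∈ Set.Ioc (0:ℝ) 1
    · rw [Set.indicator_of_mem hu, Set.indicator_of_mem (by constructor <;> linarith [hu.1, hu.2])]; simp
    · rw [Set.indicator_of_notMem hu, Set.indicator_of_notMem]
      intro h; exact hu ⟨by linarith [h.2], by linarith [h.1]⟩
  rw [e1]
  refine h.trans ?_
  have hn1 : 0 < (n:ℝ) + 1 + 0 - 1 := by linarith
  rw [ENNReal.ofReal_mul (by simp only [sub_zero]; positivity), Kd]
  have e2 : √(DD x y) ^ (1 - ((n:ℝ) + 1) - 0) = DD x y ^ (-((n:ℝ)/2)) := by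
    rw [Real.sqrt_eq_rpow, ← Real.rpow_mul hD.le]; congr 1; ring
  rw [e2]
  refine mul_le_mul' (ENNReal.ofReal_le_ofReal ?_) le_rfl
  have : 1 / ((n:ℝ) + 1 + 0 - 1) ≤ 1 := by rw [div_le_one (by linarith)]; linarith
  simp only [sub_zero, div_one]; linarith

lemma slice_bound (hn : 1 < n) {ψ : En n → ℝ} (hψ : ContDiff ℝ (⊤ : ℕ∞) ψ) (hs : HasCompactSupport ψ)
    {δ : ℝ} (hδ : δ < 1) (h0 : ∀ y, δ ≤ ‖y‖ → ψ y = 0) (l : Fin n) (hp0 : ∀ y, δ ≤ ‖y‖ → pd l ψ y = 0)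
    {x : En n} (hx : ‖x‖ ≤ 1) (e : ℕ) (M : En n × ℝ → ℝ) (hM : ContDiff ℝ (⊤ : ℕ∞) M) (c : ℝ)
    (hc : ∀ t ∈ Set.Icc (0:ℝ) 1, ∀ y, ‖y‖ < δ → |pd l (fun y => M (y, t)) y| ≤ c * DD x (t • y) ^ (-(((n:ℝ)+1)/2))) :
    ENNReal.ofReal |∫ z in hS n, z.2 ^ e * M z * pd l ψ z.1| ≤
      ENNReal.ofReal c * ENNReal.ofReal (2 ^ ((n:ℝ)+1) + 1) * ∫⁻ y in ball 0 1, Kd x y * ENNReal.ofReal |ψ y| := by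
  have hcont : Continuous (fun z : En n × ℝ => z.2 ^ e * M z * pd l ψ z.1) :=
    ((continuous_snd.pow e).mul hM.continuous).mul ((pd_smooth hψ l).continuous.comp continuous_fst)
  have hMt : ∀ t, ContDiff ℝ (⊤ : ℕ∞) (fun y : En n => M (y, t)) := fun t => hM.comp (by fun_prop)
  have e1 : ∫ z in hS n, z.2 ^ e * M z * pd l ψ z.1 =
      ∫ t in Set.Icc (0:ℝ) 1, ∫ y in closedBall (0 : En n) 1, t ^ e * M (y, t) * pd l ψ y := by
    have hi := hS_int hcont
    unfold hS at hi ⊢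
    rw [Measure.volume_eq_prod, ← Measure.prod_restrict] at hi ⊢
    rw [integral_prod_symm _ hi]
  have e2 : ∀ t, ∫ y in closedBall (0 : En n) 1, t ^ e * M (y, t) * pd l ψ y = -(t ^ e * ∫ y, pd l (fun y => M (y, t)) y * ψ y) := by
    intro t
    rw [setIntegral_eq_integral_of_forall_compl_eq_zero]
    · simp only [mul_assoc, integral_const_mul]
      rw [ibp_slice (hMt t) hψ hs l]; ring
    · intro y hy
      have : δ ≤ ‖y‖ := by simp at hy; linarith
      rw [hp0 _ this, mul_zero]
  rw [e1, ← Real.enorm_eq_ofReal_abs]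
  refine (enorm_integral_le_lintegral_enorm _).trans ?_
  have e3 : ∀ t ∈ Set.Icc (0:ℝ) 1, ‖∫ y in closedBall (0 : En n) 1, t ^ e * M (y, t) * pd l ψ y‖ₑ ≤
      ENNReal.ofReal c * ∫⁻ y in ball (0 : En n) 1, ENNReal.ofReal (DD x (t • y) ^ (-(((n:ℝ)+1)/2))) * ENNReal.ofReal |ψ y| := by
    intro t ht
    rw [e2 t, enorm_neg, enorm_mul]
    have h1 : ‖t ^ e‖ₑ ≤ 1 := by
      rw [Real.enorm_eq_ofReal_abs, abs_of_nonneg (pow_nonneg ht.1 _)]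
      exact ENNReal.ofReal_le_one.2 (pow_le_one₀ ht.1 ht.2)
    refine (mul_le_mul' h1 (enorm_integral_le_lintegral_enorm _)).trans ?_
    rw [one_mul, ← lintegral_const_mul' _ _ ENNReal.ofReal_ne_top, ← lintegral_indicator measurableSet_ball]
    refine lintegral_mono fun y => ?_
    rcases le_or_gt δ ‖y‖ with h | h
    · rw [h0 _ h]; simp
    · rw [Set.indicator_of_mem (by simp; linarith), enorm_mul, Real.enorm_eq_ofReal_abs, Real.enorm_eq_ofReal_abs, ← mul_assoc]
      refine mul_le_mul' ?_ le_rfl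
      have hp : 0 ≤ DD x (t • y) ^ (-(((n:ℝ)+1)/2)) := Real.rpow_nonneg (DD_nonneg _ _) _
      have hb := hc t ht y h
      rw [← ENNReal.ofReal_mul' hp]
      exact ENNReal.ofReal_le_ofReal hb
  refine (setLIntegral_mono_ae' measurableSet_Icc (ae_of_all _ e3)).trans ?_
  rw [lintegral_const_mul' _ _ ENNReal.ofReal_ne_top, mul_assoc]
  refine mul_le_mul' le_rfl ?_
  have hmeas : Measurable (fun p : ℝ × En n => ENNReal.ofReal (DD x (p.1 • p.2) ^ (-(((n:ℝ)+1)/2))) * ENNReal.ofReal |ψ p.2|) := by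
    have h1 : Continuous (fun p : ℝ × En n => DD x (p.1 • p.2)) := by unfold DD; fun_prop
    have h2 : Continuous (fun p : ℝ × En n => |ψ p.2|) := (hψ.continuous.comp continuous_snd).abs
    exact (ENNReal.measurable_ofReal.comp (h1.measurable.pow_const _)).mul (ENNReal.measurable_ofReal.comp h2.measurable)
  rw [lintegral_lintegral_swap hmeas.aemeasurable]
  rw [← lintegral_const_mul' _ _ ENNReal.ofReal_ne_top]
  refine setLIntegral_mono_ae' measurableSet_ball (ae_of_all _ fun y hy => ?_)
  rw [lintegral_mul_const' _ _ ENNReal.ofReal_ne_top, ← mul_assoc]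
  exact mul_le_mul' (t_int hn hx (by simpa using hy)) le_rfl

lemma pd_smul_comp {f : En n → ℝ} {t : ℝ} {y : En n} (hf : DifferentiableAt ℝ f (t • y)) (l : Fin n) :
    pd l (fun y => f (t • y)) y = t * pd l f (t • y) := by
  unfold pd
  have h1 : HasFDerivAt (fun y : En n => t • y) (t • ContinuousLinearMap.id ℝ (En n)) y := (hasFDerivAt_id y).const_smul t
  have := HasFDerivAt.comp (g := f) y hf.hasFDerivAt h1
  have h2 : HasFDerivAt (fun y => f (t • y)) _ y := this
  rw [h2.fderiv]; simp

lemma kap_diff' {x y : En n} (h : 0 < DD x y) (i : Fin n) : DifferentiableAt ℝ (fun y => kap i x y) y := by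
  unfold kap; exact (AA_diff' i y x).fun_mul (DDp_diff' h _)

lemma kap1_diff' {x y : En n} (h : 0 < DD x y) (i j : Fin n) : DifferentiableAt ℝ (fun y => kap1 i j x y) y := by
  unfold kap1
  have h1 := coord_diff i y
  have h2 := AA_diff' i y x
  have h3 := AA_diff j y x
  have h4 := DDp_diff' h
  exact (DifferentiableAt.fun_mul (by fun_prop) (h4 _)).fun_add (DifferentiableAt.fun_mul (by fun_prop) (h4 _))

lemma hh_ex (hn : 1 < n) (e : ℕ) : ∃ C : ℝ≥0∞, C ≠ ⊤ ∧ ∀ ψ : En n → ℝ, IsTestFun (ball 0 1) ψ → ∀ l i : Fin n,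
    ∃ h : En n → ℝ, ContDiff ℝ (⊤ : ℕ∞) h ∧ (∀ x ∈ ball (0 : En n) 1, ∑ j, pd j (pd j h) x = 0) ∧
      (∀ x : En n, ‖x‖ = 1 → ∑ j, x j * pd j h x + e * h x = VV i (pd l ψ) x) ∧
      (∀ x ∈ ball (0 : En n) 1, ENNReal.ofReal |h x| ≤ C * ∫⁻ y in ball 0 1, Kd x y * ENNReal.ofReal |ψ y|) ∧
      (∀ x ∈ ball (0 : En n) 1, ∀ j, ENNReal.ofReal |pd j h x| ≤ C * ∫⁻ y in ball 0 1, Kd x y * ENNReal.ofReal |ψ y|) := by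
  refine ⟨ENNReal.ofReal (n^2+9*n+4) * ENNReal.ofReal (2 ^ ((n:ℝ)+1) + 1), by finiteness, ?_⟩
  intro ψ hψt l i
  obtain ⟨hψ, hs, hsub⟩ := hψt
  obtain ⟨δ, hδ0, hδ1, hδs⟩ : ∃ δ : ℝ, 0 ≤ δ ∧ δ < 1 ∧ tsupport ψ ⊆ ball 0 δ := by
    obtain ⟨δ, h1, h2⟩ := exists_lt_subset_ball (isClosed_tsupport ψ) hsub
    exact ⟨max δ 0, le_max_right _ _, max_lt h1 one_pos, h2.trans (ball_subset_ball (le_max_left _ _))⟩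
  have h0 : ∀ y, δ ≤ ‖y‖ → ψ y = 0 := by
    intro y hy
    apply image_eq_zero_of_notMem_tsupport
    intro h; have := hδs h; simp at this; linarith
  have hp0 : ∀ y, δ ≤ ‖y‖ → pd l ψ y = 0 := by
    intro y hy
    have : y ∉ tsupport ψ := by intro h; have := hδs h; simp at this; linarith
    unfold pd
    rw [fderiv_of_notMem_tsupport ℝ this]; rfl
  obtain ⟨ε, hε⟩ : ∃ ε, ε = ((1 - δ) / 2) ^ 2 := ⟨_, rfl⟩
  have hεp := eps_pos hδ1 hε hp0
  have hρ := pd_smooth hψ l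
  have hreg : ∀ x : En n, ‖x‖ ≤ 1 → δ * ‖x‖ < (1 + δ) / 2 := by intro x hx; nlinarith [norm_nonneg x]
  have hnn : (0:ℝ) ≤ n := Nat.cast_nonneg n
  have hDp : ∀ x : En n, ‖x‖ ≤ 1 → ∀ t ∈ Set.Icc (0:ℝ) 1, ∀ y : En n, ‖y‖ < δ → ε ≤ DD x (t • y) := by
    intro x hx t ht y hy
    rw [hε]; exact region hδ1 (hreg x hx) hy.le ht
  have hty : ∀ t ∈ Set.Icc (0:ℝ) 1, ∀ y : En n, ‖y‖ < δ → ‖t • y‖ ≤ 1 := by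
    intro t ht y hy
    rw [norm_smul, Real.norm_eq_abs, abs_of_nonneg ht.1]
    nlinarith [norm_nonneg y, ht.1, ht.2]
  refine ⟨hh ε e i (pd l ψ), hh_smooth hεp e i hρ, ?_, ?_, ?_, ?_⟩
  · intro x hx
    exact hh_lap hδ1 hε hp0 hρ e i (hreg x (by simpa using (mem_ball.1 hx).le))
  · intro x hx
    exact hh_bdry hδ1 hε hp0 hn hρ e i hx
  · intro x hx
    have hx1 : ‖x‖ ≤ 1 := by simpa using (mem_ball.1 hx).le
    unfold hh Ph
    have := slice_bound hn hψ hs hδ1 h0 l hp0 hx1 e (fun z => kapc ε i x (z.2 • z.1))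
      (kapc_smooth hεp i contDiff_const (contDiff_snd.smul contDiff_fst)) (n^2+9*n+4) ?_
    · exact this
    intro t ht y hy
    have he : (fun y => kapc ε i x (t • y)) =ᶠ[nhds y] fun y => kap i x (t • y) := by
      filter_upwards [(isOpen_lt continuous_norm continuous_const).mem_nhds hy] with y' hy'
      exact kapc_eq hεp i (hDp x hx1 t ht y' hy')
    have hD := hεp.trans_le (hDp x hx1 t ht y hy)
    simp only
    rw [pd_congr he, pd_smul_comp (kap_diff' hD i), pd_kap' hD]
    have hb := kap2_le hx1 (hty t ht y hy) hD i l
    have hP : 0 ≤ DD x (t • y) ^ (-(((n:ℝ)+1)/2)) := Real.rpow_nonneg (DD_nonneg _ _) _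
    rw [abs_mul, abs_of_nonneg ht.1]
    calc t * |kap2 i l x (t • y)| ≤ 1 * |kap2 i l x (t • y)| := by gcongr; exact ht.2
      _ ≤ _ := by rw [one_mul]; refine hb.trans (mul_le_mul_of_nonneg_right ?_ hP); nlinarith
  · intro x hx j
    have hx1 : ‖x‖ ≤ 1 := by simpa using (mem_ball.1 hx).le
    have hks : ContDiff ℝ (⊤ : ℕ∞) (fun p : En n × (En n × ℝ) => kapc ε i p.1 (p.2.2 • p.2.1)) :=
      kapc_smooth hεp i contDiff_fst ((contDiff_snd.comp contDiff_snd).smul (contDiff_fst.comp contDiff_snd))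
    have hM : ContDiff ℝ (⊤ : ℕ∞) (fun z : En n × ℝ => pd j (fun x => kapc ε i x (z.2 • z.1)) x) := by
      have := par_pd_smooth _ hks j
      exact this.comp (by fun_prop : ContDiff ℝ (⊤ : ℕ∞) fun z : En n × ℝ => (x, z))
    have := slice_bound hn hψ hs hδ1 h0 l hp0 hx1 e _ hM (n^2+9*n+4) ?_
    · rw [hh_pd hεp e i hρ]
      have e1 : ∀ z : En n × ℝ, pd j (fun x => Ph ε e i (pd l ψ) (x, z)) x = z.2 ^ e * pd j (fun x => kapc ε i x (z.2 • z.1)) x * pd l ψ z.1 := by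
        intro z
        have hd : DifferentiableAt ℝ (fun x => kapc ε i x (z.2 • z.1)) x := by
          have : ContDiff ℝ (⊤ : ℕ∞) (fun x => kapc ε i x (z.2 • z.1)) := kapc_smooth hεp i contDiff_id contDiff_const
          exact this.differentiable (by simp) x
        unfold Ph
        simp only
        rw [pd_mul_const (by fun_prop), pd_const_mul hd]
      simp only [e1]
      exact this
    intro t ht y hy
    have he : (fun y => pd j (fun x => kapc ε i x (t • y)) x) =ᶠ[nhds y] fun y => kap1 i j x (t • y) := by
      filter_upwards [(isOpen_lt continuous_norm continuous_const).mem_nhds hy] with y' hy'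
      have hD := hεp.trans_le (hDp x hx1 t ht y' hy')
      have he2 : (fun x => kapc ε i x (t • y')) =ᶠ[nhds x] fun x => kap i x (t • y') := by
        filter_upwards [(regU_open δ).mem_nhds (hreg x hx1)] with x' hx'
        apply kapc_eq hεp
        rw [hε]; exact region hδ1 hx' (le_of_lt hy') ht
      rw [pd_congr he2, pd_kap hD]
    have hD := hεp.trans_le (hDp x hx1 t ht y hy)
    simp only
    rw [pd_congr he, pd_smul_comp (kap1_diff' hD i j), pd_kap1' hD]
    have hb := kap3_le hx1 (hty t ht y hy) hD i j l
    rw [abs_mul, abs_of_nonneg ht.1]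
    calc t * |kap3 i j l x (t • y)| ≤ 1 * |kap3 i j l x (t • y)| := by gcongr; exact ht.2
      _ ≤ _ := by rw [one_mul]; exact hb

abbrev Fk (n : ℕ) : Type := Finset (Fin n) → ℝ

def fsg (i : Fin n) (S : Finset (Fin n)) : ℝ := (-1 : ℝ) ^ (S.filter (fun j => j < i)).card

lemma fsg_sq (i : Fin n) (S : Finset (Fin n)) : fsg i S * fsg i S = 1 := by
  unfold fsg; rw [← pow_add, ← two_mul, pow_mul]; norm_num

lemma fsg_abs (i : Fin n) (S : Finset (Fin n)) : |fsg i S| = 1 := by unfold fsg; simp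

lemma fsg_insert {i j : Fin n} {S : Finset (Fin n)} (h : i ∉ S) :
    fsg j (insert i S) = if i < j then - fsg j S else fsg j S := by
  unfold fsg
  rw [Finset.filter_insert]
  split_ifs with h1
  · rw [Finset.card_insert_of_notMem (by simp [h]), pow_succ]; ring
  · rfl

lemma fsg_erase {i j : Fin n} {S : Finset (Fin n)} (h : i ∈ S) :
    fsg j (S.erase i) = if i < j then - fsg j S else fsg j S := by
  have := fsg_insert (i := i) (j := j) (S := S.erase i) (by simp)
  rw [Finset.insert_erase h] at this
  rw [this]; split_ifs <;> simp

def fw (i : Fin n) : Fk n →ₗ[ℝ] Fk n where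
  toFun v S := if i ∈ S then fsg i S * v (S.erase i) else 0
  map_add' v w := by ext S; simp only [Pi.add_apply]; split_ifs <;> ring
  map_smul' a v := by ext S; simp only [Pi.smul_apply, smul_eq_mul, RingHom.id_apply]; split_ifs <;> ring

def fc (i : Fin n) : Fk n →ₗ[ℝ] Fk n where
  toFun v S := if i ∈ S then 0 else fsg i S * v (insert i S)
  map_add' v w := by ext S; simp only [Pi.add_apply]; split_ifs <;> ring
  map_smul' a v := by ext S; simp only [Pi.smul_apply, smul_eq_mul, RingHom.id_apply]; split_ifs <;> ring

lemma fw_apply (i : Fin n) (v : Fk n) (S) : fw i v S = if i ∈ S then fsg i S * v (S.erase i) else 0 := rfl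
lemma fc_apply (i : Fin n) (v : Fk n) (S) : fc i v S = if i ∈ S then 0 else fsg i S * v (insert i S) := rfl

lemma fw_fw_self (i : Fin n) (v : Fk n) : fw i (fw i v) = 0 := by
  ext S; simp [fw_apply]

lemma fw_anti (i j : Fin n) (v : Fk n) : fw i (fw j v) = - fw j (fw i v) := by
  rcases eq_or_ne i j with rfl | hij
  · simp [fw_fw_self]
  ext S
  simp only [fw_apply, Pi.neg_apply, Finset.mem_erase]
  by_cases hi : i ∈ S <;> by_cases hj : j ∈ S <;> simp [hi, hj, hij, hij.symm]
  rw [fsg_erase hi, fsg_erase hj, Finset.erase_right_comm]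
  rcases lt_or_gt_of_ne hij with h | h
  · simp [h, h.not_gt]; ring
  · simp [h, h.not_gt]; ring

lemma car (i j : Fin n) (v : Fk n) : fc i (fw j v) + fw j (fc i v) = if i = j then v else 0 := by
  rcases eq_or_ne i j with rfl | hij
  · ext S
    simp only [fw_apply, fc_apply, Pi.add_apply, if_true]
    by_cases hi : i ∈ S
    · simp only [hi, if_true, Finset.mem_erase]
      simp [fsg_erase hi, Finset.insert_erase hi, ← mul_assoc, fsg_sq]
    · simp only [hi, if_false]
      simp [fsg_insert hi, Finset.erase_insert hi, ← mul_assoc, fsg_sq]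
  · ext S
    simp only [fw_apply, fc_apply, Pi.add_apply, if_neg hij, Pi.zero_apply, Finset.mem_insert, Finset.mem_erase]
    by_cases hi : i ∈ S <;> by_cases hj : j ∈ S <;> simp [hi, hj, hij, hij.symm]
    rw [fsg_erase hj, fsg_insert hi, Finset.erase_insert_of_ne hij]
    rcases lt_or_gt_of_ne hij with h | h
    · simp [h, h.not_gt]; ring
    · simp [h, h.not_gt]; ring

lemma fc_fw_num (v : Fk n) (S) : ∑ i, fc i (fw i v) S = ((n:ℝ) - S.card) * v S := by
  have : ∀ i, fc i (fw i v) S = if i ∈ S then 0 else v S := by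
    intro i
    simp only [fw_apply, fc_apply]
    by_cases hi : i ∈ S
    · simp [hi]
    · simp [hi, fsg_insert hi, Finset.erase_insert hi, ← mul_assoc, fsg_sq]
  simp only [this]
  rw [Finset.sum_ite]
  simp only [Finset.sum_const_zero, zero_add, Finset.sum_const, nsmul_eq_mul]
  congr 1
  have : (Finset.univ.filter (fun i => i ∉ S)) = Sᶜ := by ext; simp
  rw [this, Finset.card_compl, Fintype.card_fin, Nat.cast_sub]
  simpa using Finset.card_le_univ S

/-- transposition -/
lemma fw_adj (i : Fin n) (v w : Fk n) : ∑ S, fc i v S * w S = ∑ S, v S * fw i w S := by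
  simp only [fw_apply, fc_apply]
  have e1 : ∀ S : Finset (Fin n), (if i ∈ S then 0 else fsg i S * v (insert i S)) * w S =
     if i ∉ S then fsg i S * v (insert i S) * w S else 0 := by intro S; split_ifs <;> simp_all
  have e2 : ∀ S : Finset (Fin n), v S * (if i ∈ S then fsg i S * w (S.erase i) else 0) =
     if i ∈ S then fsg i S * v S * w (S.erase i) else 0 := by intro S; split_ifs <;> ring
  simp only [e1, e2]
  rw [← Finset.sum_filter, ← Finset.sum_filter]
  refine Finset.sum_bij' (fun S _ => insert i S) (fun S _ => S.erase i) ?_ ?_ ?_ ?_ ?_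
  · intro S hS; simp
  · intro S hS; simp
  · intro S hS; simp at hS; simp [hS]
  · intro S hS; simp at hS; simp [hS]
  · intro S hS; simp at hS; rw [Finset.erase_insert hS, fsg_insert hS]; simp

lemma fock_main (v : Fk n) (e : ℝ) (hv : ∀ j, ∑ k, fc k (fw k (fw j v)) = (1 + e) • fw j v)
    (X H1 : Fin n → ℝ) (H2 : Fin n → Fin n → ℝ) (hsym : ∀ j k, H2 j k = H2 k j) (htr : ∑ j, H2 j j = 0) :
    ∑ k, fw k ((H1 k + ∑ p, X p * H2 p k + e * H1 k) • v - ∑ j, H1 j • fw k (fc j v) - ∑ p, ∑ j, (X p * H2 j k) • fw p (fc j v))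
      - ∑ k, fc k (∑ j, H1 j • fw k (fw j v) + ∑ p, ∑ j, (X p * H2 j k) • fw p (fw j v)) = 0 := by
  simp only [map_sub, map_add, map_sum, map_smul, fw_fw_self, smul_zero, Finset.sum_const_zero, sub_zero, Finset.sum_sub_distrib, Finset.sum_add_distrib]
  have e1 : ∑ k, ∑ j, H1 j • fc k (fw k (fw j v)) = ∑ j, ((1 + e) * H1 j) • fw j v := by
    rw [Finset.sum_comm]
    refine Finset.sum_congr rfl fun j _ => ?_
    rw [← Finset.smul_sum, hv, smul_smul, mul_comm]
  have e2 : ∀ k p j, fc k (fw p (fw j v)) = (if k = p then fw j v else 0) - fw p (fc k (fw j v)) := by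
    intro k p j; rw [← car k p (fw j v)]; abel
  have e3 : ∀ k j, fc k (fw j v) = (if k = j then v else 0) - fw j (fc k v) := by
    intro k j; rw [← car k j v]; abel
  have e4 : ∑ k, ∑ p, ∑ j, (X p * H2 j k) • fc k (fw p (fw j v)) =
      ∑ j, (∑ p, X p * H2 p j) • fw j v + ∑ k, ∑ p, ∑ j, (X p * H2 j k) • fw p (fw j (fc k v)) := by
    simp only [e2, e3, map_sub, smul_sub, Finset.sum_sub_distrib]
    have a1 : ∑ k, ∑ p, ∑ j, (X p * H2 j k) • (if k = p then fw j v else 0) = ∑ j, (∑ p, X p * H2 p j) • fw j v := by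
      simp only [smul_ite, smul_zero]
      rw [Finset.sum_comm]
      have : ∀ p, ∑ k, ∑ j, (if k = p then (X p * H2 j k) • fw j v else 0) = ∑ j, (X p * H2 p j) • fw j v := by
        intro p
        rw [Finset.sum_comm]
        refine Finset.sum_congr rfl fun j _ => ?_
        simp [hsym j p]
      simp only [this]
      rw [Finset.sum_comm]
      simp only [Finset.sum_smul]
    have a2 : ∑ k, ∑ p, ∑ j, (X p * H2 j k) • fw p (if k = j then v else 0) = 0 := by
      rw [Finset.sum_comm]
      refine Finset.sum_eq_zero fun p _ => ?_
      have : ∀ k j, (X p * H2 j k) • fw p (if k = j then v else 0) = if k = j then (X p * H2 j k) • fw p v else 0 := by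
        intro k j; split_ifs <;> simp
      simp only [this, Finset.sum_ite_eq, Finset.mem_univ, if_true]
      rw [← Finset.sum_smul, ← Finset.mul_sum, htr]; simp
    rw [a1, a2]; simp
  have e5 : ∑ k, ∑ p, ∑ j, (X p * H2 j k) • fw k (fw p (fc j v)) = - ∑ k, ∑ p, ∑ j, (X p * H2 j k) • fw p (fw j (fc k v)) := by
    rw [← Finset.sum_neg_distrib]
    have : ∑ k, ∑ p, ∑ j, (X p * H2 j k) • fw k (fw p (fc j v)) = ∑ j, ∑ p, ∑ k, (X p * H2 j k) • fw k (fw p (fc j v)) := by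
      rw [Finset.sum_comm, Finset.sum_comm (s := Finset.univ (α := Fin n)) (t := Finset.univ (α := Fin n)) (f := fun j p => ∑ k, (X p * H2 j k) • fw k (fw p (fc j v)))]
      refine Finset.sum_congr rfl fun p _ => ?_
      rw [Finset.sum_comm]
    rw [this]
    refine Finset.sum_congr rfl fun k _ => ?_
    rw [← Finset.sum_neg_distrib]
    refine Finset.sum_congr rfl fun p _ => ?_
    rw [← Finset.sum_neg_distrib]
    refine Finset.sum_congr rfl fun j _ => ?_
    rw [fw_anti j p, hsym k j]; simp
  have e6 : ∑ k, (H1 k + ∑ p, X p * H2 p k + e * H1 k) • fw k v = ∑ j, ((1 + e) * H1 j) • fw j v + ∑ j, (∑ p, X p * H2 p j) • fw j v := by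
    rw [← Finset.sum_add_distrib]
    refine Finset.sum_congr rfl fun j _ => ?_
    rw [← add_smul]; congr 1; ring
  rw [e1, e4, e5, e6]
  abel

lemma fock_first (v : Fk n) (W : Fin n → Fin n → ℝ) (hsym : ∀ i k, W i k = W k i) :
    ∑ k, fw k (∑ i, W i k • fc i v) + ∑ k, fc k (∑ i, W i k • fw i v) = (∑ i, W i i) • v := by
  simp only [map_sum, map_smul]
  have : ∑ k, ∑ i, W i k • fw k (fc i v) = ∑ k, ∑ i, W i k • fw i (fc k v) := by
    rw [Finset.sum_comm]
    refine Finset.sum_congr rfl fun k _ => Finset.sum_congr rfl fun i _ => by rw [hsym]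
  rw [this, ← Finset.sum_add_distrib]
  have : ∀ k, ∑ i, W i k • fw i (fc k v) + ∑ i, W i k • fc k (fw i v) = W k k • v := by
    intro k
    rw [← Finset.sum_add_distrib]
    have : ∀ i, W i k • fw i (fc k v) + W i k • fc k (fw i v) = if k = i then W i k • v else 0 := by
      intro i; rw [← smul_add, add_comm, car]; split_ifs <;> simp
    simp [this]
  simp only [this, Finset.sum_smul]

lemma fock_sphere (X : Fin n → ℝ) (v : Fk n) : ∑ k, ∑ p, (X k * X p) • fw k (fw p v) = 0 := by
  have : ∑ k, ∑ p, (X k * X p) • fw k (fw p v) = - ∑ k, ∑ p, (X k * X p) • fw k (fw p v) := by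
    conv_lhs => rw [Finset.sum_comm]
    rw [← Finset.sum_neg_distrib]
    refine Finset.sum_congr rfl fun k _ => ?_
    rw [← Finset.sum_neg_distrib]
    refine Finset.sum_congr rfl fun p _ => ?_
    rw [fw_anti p k, mul_comm]; simp
  exact self_eq_neg.1 this

lemma fw_bd {v : Fk n} {c : ℝ} (hv : ∀ S, |v S| ≤ c) (i : Fin n) (S) : |fw i v S| ≤ c := by
  have hc : 0 ≤ c := (abs_nonneg _).trans (hv ∅)
  rw [fw_apply]; split_ifs
  · rw [abs_mul, fsg_abs, one_mul]; exact hv _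
  · simpa
lemma fc_bd {v : Fk n} {c : ℝ} (hv : ∀ S, |v S| ≤ c) (i : Fin n) (S) : |fc i v S| ≤ c := by
  have hc : 0 ≤ c := (abs_nonneg _).trans (hv ∅)
  rw [fc_apply]; split_ifs
  · simpa
  · rw [abs_mul, fsg_abs, one_mul]; exact hv _

lemma fw_deg {v : Fk n} {d : ℕ} (hv : ∀ S, S.card ≠ d → v S = 0) (i : Fin n) : ∀ S, S.card ≠ d + 1 → fw i v S = 0 := by
  intro S hS
  rw [fw_apply]; split_ifs with h
  · have := Finset.card_erase_add_one h
    rw [hv _ (by omega), mul_zero]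
  · rfl
lemma fc_deg {v : Fk n} {d : ℕ} (hv : ∀ S, S.card ≠ d + 1 → v S = 0) (i : Fin n) : ∀ S, S.card ≠ d → fc i v S = 0 := by
  intro S hS
  rw [fc_apply]; split_ifs with h
  · rfl
  · have := Finset.card_insert_of_notMem h
    rw [hv _ (by omega), mul_zero]

lemma fock_num {v : Fk n} {d : ℕ} (hv : ∀ S, S.card ≠ d → v S = 0) (a : ℝ) (ha : (n:ℝ) = a + d) :
    ∑ k, fc k (fw k v) = a • v := by
  ext S
  rw [Finset.sum_apply, fc_fw_num]
  simp only [Pi.smul_apply, smul_eq_mul]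
  by_cases h : S.card = d
  · rw [h, ha]; ring
  · rw [hv S h]; simp

lemma pd_comm {f : En n → ℝ} (hf : ContDiff ℝ (⊤ : ℕ∞) f) (i j : Fin n) (x : En n) : pd i (pd j f) x = pd j (pd i f) x := by
  have hd : DifferentiableAt ℝ (fderiv ℝ f) x :=
    (hf.fderiv_right (m := (⊤ : ℕ∞)) (by simp)).differentiable (by simp) x
  have key : ∀ i j, pd i (pd j f) x = fderiv ℝ (fderiv ℝ f) x (basisVec i) (basisVec j) := by
    intro i j
    unfold pd
    have : HasFDerivAt (fun y => fderiv ℝ f y (basisVec j)) _ x := hd.hasFDerivAt.clm_apply (hasFDerivAt_const (basisVec j) x)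
    rw [this.fderiv]; simp
  rw [key, key]
  have hs : IsSymmSndFDerivAt ℝ f x := (hf.contDiffAt).isSymmSndFDerivAt (by simp; norm_cast)
  exact hs _ _

def evh (e : ℝ) (h : En n → ℝ) (x : En n) : ℝ := ∑ p, x p * pd p h x + e * h x

def al (e : ℝ) (V h : Fin n → En n → ℝ) (e0 : Fk n) (x : En n) : Fk n :=
  ∑ i, ((evh e (h i) x - V i x) • fc i e0 - ∑ p, ∑ j, (x p * pd j (h i) x) • fw p (fc j (fc i e0)))

def be (V h : Fin n → En n → ℝ) (e0 : Fk n) (x : En n) : Fk n :=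
  ∑ i, (V i x • fw i e0 + ∑ p, ∑ j, (x p * pd j (h i) x) • fw p (fw j (fc i e0)))

lemma evh_smooth (e : ℝ) {h : En n → ℝ} (hh : ContDiff ℝ (⊤ : ℕ∞) h) : ContDiff ℝ (⊤ : ℕ∞) (evh e h) := by
  unfold evh
  exact (ContDiff.sum fun p _ => (coord_contDiff p).mul (pd_smooth hh p)).add (contDiff_const.mul hh)

section

lemma al_smooth {V h : Fin n → En n → ℝ} (hV : ∀ i, ContDiff ℝ (⊤ : ℕ∞) (V i)) (hh : ∀ i, ContDiff ℝ (⊤ : ℕ∞) (h i)) (e : ℝ) (e0 : Fk n) (S : Finset (Fin n)) : ContDiff ℝ (⊤ : ℕ∞) (fun x => al e V h e0 x S) := by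
  unfold al
  simp only [Finset.sum_apply, Pi.sub_apply, Pi.smul_apply, smul_eq_mul]
  refine ContDiff.sum fun i _ => ?_
  refine (((evh_smooth e (hh i)).sub (hV i)).mul contDiff_const).sub ?_
  refine ContDiff.sum fun p _ => ContDiff.sum fun j _ => ?_
  exact ((coord_contDiff p).mul (pd_smooth (hh i) j)).mul contDiff_const

lemma be_smooth {V h : Fin n → En n → ℝ} (hV : ∀ i, ContDiff ℝ (⊤ : ℕ∞) (V i)) (hh : ∀ i, ContDiff ℝ (⊤ : ℕ∞) (h i)) (e0 : Fk n) (S : Finset (Fin n)) : ContDiff ℝ (⊤ : ℕ∞) (fun x => be V h e0 x S) := by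
  unfold be
  simp only [Finset.sum_apply, Pi.add_apply, Pi.smul_apply, smul_eq_mul]
  refine ContDiff.sum fun i _ => ?_
  refine ((hV i).mul contDiff_const).add ?_
  refine ContDiff.sum fun p _ => ContDiff.sum fun j _ => ?_
  exact ((coord_contDiff p).mul (pd_smooth (hh i) j)).mul contDiff_const
end

lemma sm_diff {f : En n → ℝ} (hf : ContDiff ℝ (⊤ : ℕ∞) f) (x : En n) : DifferentiableAt ℝ f x := hf.differentiable (by simp) x

lemma pd_evh (e : ℝ) {h : En n → ℝ} (hh : ContDiff ℝ (⊤ : ℕ∞) h) (k : Fin n) (x : En n) :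
    pd k (evh e h) x = pd k h x + ∑ p, x p * pd k (pd p h) x + e * pd k h x := by
  unfold evh
  have h1 : ∀ p, ContDiff ℝ (⊤ : ℕ∞) (fun x => x p * pd p h x) := fun p => (coord_contDiff p).mul (pd_smooth hh p)
  rw [pd_add (sm_diff (ContDiff.sum fun p _ => h1 p) x) (sm_diff (contDiff_const.mul hh) x), pd_const_mul (sm_diff hh x),
    pd_sum _ (fun p _ => sm_diff (h1 p) x)]
  simp only [fun p => pd_mul (coord_diff p x) (sm_diff (pd_smooth hh p) x) k, pd_coord, Finset.sum_add_distrib]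
  simp

lemma pd_xp {h : En n → ℝ} (hh : ContDiff ℝ (⊤ : ℕ∞) h) (v : Fin n → Fin n → ℝ) (k : Fin n) (x : En n) :
    pd k (fun x => ∑ p, ∑ j, x p * pd j h x * v p j) x =
      ∑ j, pd j h x * v k j + ∑ p, ∑ j, x p * pd k (pd j h) x * v p j := by
  have h1 : ∀ p j, ContDiff ℝ (⊤ : ℕ∞) (fun x : En n => x p * pd j h x) := fun p j => (coord_contDiff p).mul (pd_smooth hh j)
  rw [pd_sum _ (fun p _ => sm_diff (ContDiff.sum fun j _ => (h1 p j).mul contDiff_const) x)]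
  have : ∀ p, pd k (fun x => ∑ j, x p * pd j h x * v p j) x = ∑ j, ((if p = k then pd j h x * v p j else 0) + x p * pd k (pd j h) x * v p j) := by
    intro p
    rw [pd_sum _ (fun j _ => sm_diff ((h1 p j).mul contDiff_const) x)]
    refine Finset.sum_congr rfl fun j _ => ?_
    rw [pd_mul_const (sm_diff (h1 p j) x), pd_mul (coord_diff p x) (sm_diff (pd_smooth hh j) x), pd_coord]
    split_ifs <;> ring
  simp only [this, Finset.sum_add_distrib]
  congr 1
  rw [Finset.sum_comm]
  simp

section

lemma pd_al {V h : Fin n → En n → ℝ} (hV : ∀ i, ContDiff ℝ (⊤ : ℕ∞) (V i)) (hh : ∀ i, ContDiff ℝ (⊤ : ℕ∞) (h i)) (e : ℝ) (e0 : Fk n) (k : Fin n) (x : En n) :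
    (fun S => pd k (fun x => al e V h e0 x S) x) = ∑ i, ((pd k (h i) x + ∑ p, x p * pd k (pd p (h i)) x + e * pd k (h i) x) • fc i e0
      - ∑ j, pd j (h i) x • fw k (fc j (fc i e0)) - ∑ p, ∑ j, (x p * pd k (pd j (h i)) x) • fw p (fc j (fc i e0)))
      - ∑ i, pd k (V i) x • fc i e0 := by
  ext S
  unfold al
  simp only [Finset.sum_apply, Pi.sub_apply, Pi.smul_apply, smul_eq_mul]
  have h1 : ∀ i, ContDiff ℝ (⊤ : ℕ∞) (fun x => (evh e (h i) x - V i x) * fc i e0 S) := fun i =>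
    ((evh_smooth e (hh i)).sub (hV i)).mul contDiff_const
  have h2 : ∀ i, ContDiff ℝ (⊤ : ℕ∞) (fun x : En n => ∑ p, ∑ j, x p * pd j (h i) x * fw p (fc j (fc i e0)) S) := fun i =>
    ContDiff.sum fun p _ => ContDiff.sum fun j _ => ((coord_contDiff p).mul (pd_smooth (hh i) j)).mul contDiff_const
  rw [pd_sum _ (fun i _ => sm_diff ((h1 i).sub (h2 i)) x), ← Finset.sum_sub_distrib]
  refine Finset.sum_congr rfl fun i _ => ?_
  rw [pd_sub (sm_diff (h1 i) x) (sm_diff (h2 i) x), pd_mul_const (sm_diff ((evh_smooth e (hh i)).sub (hV i)) x),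
    pd_sub (sm_diff (evh_smooth e (hh i)) x) (sm_diff (hV i) x), pd_evh e (hh i), pd_xp (hh i) (fun p j => fw p (fc j (fc i e0)) S)]
  ring

lemma pd_be {V h : Fin n → En n → ℝ} (hV : ∀ i, ContDiff ℝ (⊤ : ℕ∞) (V i)) (hh : ∀ i, ContDiff ℝ (⊤ : ℕ∞) (h i)) (e0 : Fk n) (k : Fin n) (x : En n) :
    (fun S => pd k (fun x => be V h e0 x S) x) = ∑ i, (
      ∑ j, pd j (h i) x • fw k (fw j (fc i e0)) + ∑ p, ∑ j, (x p * pd k (pd j (h i)) x) • fw p (fw j (fc i e0)))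
      + ∑ i, pd k (V i) x • fw i e0 := by
  ext S
  unfold be
  simp only [Finset.sum_apply, Pi.add_apply, Pi.smul_apply, smul_eq_mul]
  have h1 : ∀ i, ContDiff ℝ (⊤ : ℕ∞) (fun x => V i x * fw i e0 S) := fun i => (hV i).mul contDiff_const
  have h2 : ∀ i, ContDiff ℝ (⊤ : ℕ∞) (fun x : En n => ∑ p, ∑ j, x p * pd j (h i) x * fw p (fw j (fc i e0)) S) := fun i =>
    ContDiff.sum fun p _ => ContDiff.sum fun j _ => ((coord_contDiff p).mul (pd_smooth (hh i) j)).mul contDiff_const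
  rw [pd_sum _ (fun i _ => sm_diff ((h1 i).add (h2 i)) x), ← Finset.sum_add_distrib]
  refine Finset.sum_congr rfl fun i _ => ?_
  rw [pd_add (sm_diff (h1 i) x) (sm_diff (h2 i) x), pd_mul_const (sm_diff (hV i) x), pd_xp (hh i) (fun p j => fw p (fw j (fc i e0)) S)]
  ring

lemma al_be_id {V h : Fin n → En n → ℝ} (hV : ∀ i, ContDiff ℝ (⊤ : ℕ∞) (V i)) (hh : ∀ i, ContDiff ℝ (⊤ : ℕ∞) (h i)) {m : ℕ} {e : ℝ} (hne : (n:ℝ) = m + 2 + e) {e0 : Fk n} (he0 : ∀ S, S.card ≠ m + 1 → e0 S = 0) {x : En n}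
    (hVs : ∀ i k, pd k (V i) x = pd i (V k) x) (hlap : ∀ i, ∑ j, pd j (pd j (h i)) x = 0) :
    ∑ k, fw k (fun S => pd k (fun x => al e V h e0 x S) x) - ∑ k, fc k (fun S => pd k (fun x => be V h e0 x S) x) =
      -(∑ i, pd i (V i) x) • e0 := by
  simp only [pd_al hV hh, pd_be hV hh]
  have h1 := fock_first e0 (fun i k => pd k (V i) x) hVs
  have h2 : ∀ i, _ := fun i => fock_main (fc i e0) e (fun j => fock_num (d := m + 1) (fw_deg (fc_deg he0 i) j) (1 + e) (by rw [hne]; push_cast; ring)) (fun p => x p)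
    (fun j => pd j (h i) x) (fun j k => pd k (pd j (h i)) x) (fun j k => pd_comm (hh i) k j x) (hlap i)
  have h3 := Finset.sum_eq_zero (fun i (_ : i ∈ Finset.univ) => h2 i)
  simp only [map_sub (fw _) (Finset.sum _ _), map_add (fc _) (Finset.sum _ _), Finset.sum_sub_distrib, Finset.sum_add_distrib] at *
  simp only [map_sum, map_sub, map_add, Finset.sum_sub_distrib, Finset.sum_add_distrib] at *
  rw [neg_smul, ← h1]
  have hc : ∀ F : Fin n → Fin n → Fk n, ∑ i, ∑ k, F i k = ∑ k, ∑ i, F i k := fun F => Finset.sum_comm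
  have hc3 : ∀ F : Fin n → Fin n → Fin n → Fk n, ∑ i, ∑ k, ∑ p, F i k p = ∑ k, ∑ i, ∑ p, F i k p := fun F => Finset.sum_comm
  rw [hc, hc3, hc (fun i k => ∑ p, ∑ j, fw k _), hc (fun i k => ∑ j, fc k _), hc (fun i k => ∑ p, ∑ j, fc k _)] at h3
  rw [← sub_eq_zero]
  rw [← h3]
  abel

lemma al_sphere {V h : Fin n → En n → ℝ} {e : ℝ} (e0 : Fk n) {x : En n} (hb : ∀ i, evh e (h i) x = V i x) :
    ∑ k, x k • fw k (al e V h e0 x) = 0 := by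
  unfold al
  simp only [hb, sub_self, zero_smul, zero_sub, map_sum, map_neg, map_smul, Finset.smul_sum, smul_neg, Finset.sum_neg_distrib, neg_eq_zero, smul_smul]
  rw [Finset.sum_comm]
  refine Finset.sum_eq_zero fun i _ => ?_
  have := fock_sphere (fun k => x k) (∑ j, pd j (h i) x • fc j (fc i e0))
  simp only [map_sum, map_smul, Finset.smul_sum, smul_smul] at this
  rw [← this]
  refine Finset.sum_congr rfl fun i _ => Finset.sum_congr rfl fun i _ => Finset.sum_congr rfl fun i _ => ?_
  congr 1; ring

lemma al_bd {V h : Fin n → En n → ℝ} {e : ℝ} (he : 0 ≤ e) {e0 : Fk n} (h1 : ∀ S, |e0 S| ≤ 1) {x : En n} (hx : ‖x‖ ≤ 1) (S) :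
    |al e V h e0 x S| ≤ ∑ i, (|V i x| + e * |h i x| + ((n:ℝ) + 1) * ∑ j, |pd j (h i) x|) := by
  unfold al
  simp only [Finset.sum_apply, Pi.sub_apply, Pi.smul_apply, smul_eq_mul]
  refine (Finset.abs_sum_le_sum_abs _ _).trans (Finset.sum_le_sum fun i _ => ?_)
  have hxp : ∀ p, |x p| ≤ 1 := fun p => (coord_le x p).trans hx
  have a1 : |evh e (h i) x| ≤ e * |h i x| + ∑ j, |pd j (h i) x| := by
    unfold evh
    refine (abs_add_le _ _).trans ?_
    rw [abs_mul, abs_of_nonneg he, add_comm]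
    refine add_le_add le_rfl ((Finset.abs_sum_le_sum_abs _ _).trans (Finset.sum_le_sum fun p _ => ?_))
    rw [abs_mul]; exact mul_le_of_le_one_left (abs_nonneg _) (hxp p)
  have a2 : |∑ p, ∑ j, x p * pd j (h i) x * fw p (fc j (fc i e0)) S| ≤ n * ∑ j, |pd j (h i) x| := by
    refine (Finset.abs_sum_le_sum_abs _ _).trans ?_
    have : ∀ p ∈ Finset.univ, |∑ j, x p * pd j (h i) x * fw p (fc j (fc i e0)) S| ≤ ∑ j, |pd j (h i) x| := by
      intro p _
      refine (Finset.abs_sum_le_sum_abs _ _).trans (Finset.sum_le_sum fun j _ => ?_)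
      rw [abs_mul, abs_mul]
      have b1 := fw_bd (fun S => fc_bd (fun S => fc_bd h1 i S) j S) p S
      refine (mul_le_of_le_one_right (by positivity) b1).trans (mul_le_of_le_one_left (abs_nonneg _) (hxp p))
    refine (Finset.sum_le_sum this).trans ?_
    simp
  have a3 : |(evh e (h i) x - V i x) * fc i e0 S| ≤ |evh e (h i) x| + |V i x| := by
    rw [abs_mul]
    exact (mul_le_of_le_one_right (abs_nonneg _) (fc_bd h1 i S)).trans (abs_sub _ _)
  have := abs_sub ((evh e (h i) x - V i x) * fc i e0 S) (∑ p, ∑ j, x p * pd j (h i) x * fw p (fc j (fc i e0)) S)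
  linarith

lemma be_bd {V h : Fin n → En n → ℝ} {e : ℝ} (he : 0 ≤ e) {e0 : Fk n} (h1 : ∀ S, |e0 S| ≤ 1) {x : En n} (hx : ‖x‖ ≤ 1) (S) :
    |be V h e0 x S| ≤ ∑ i, (|V i x| + e * |h i x| + ((n:ℝ) + 1) * ∑ j, |pd j (h i) x|) := by
  unfold be
  simp only [Finset.sum_apply, Pi.add_apply, Pi.smul_apply, smul_eq_mul]
  refine (Finset.abs_sum_le_sum_abs _ _).trans (Finset.sum_le_sum fun i _ => ?_)
  have hxp : ∀ p, |x p| ≤ 1 := fun p => (coord_le x p).trans hx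
  have a2 : |∑ p, ∑ j, x p * pd j (h i) x * fw p (fw j (fc i e0)) S| ≤ n * ∑ j, |pd j (h i) x| := by
    refine (Finset.abs_sum_le_sum_abs _ _).trans ?_
    have : ∀ p ∈ Finset.univ, |∑ j, x p * pd j (h i) x * fw p (fw j (fc i e0)) S| ≤ ∑ j, |pd j (h i) x| := by
      intro p _
      refine (Finset.abs_sum_le_sum_abs _ _).trans (Finset.sum_le_sum fun j _ => ?_)
      rw [abs_mul, abs_mul]
      have b1 := fw_bd (fun S => fw_bd (fun S => fc_bd h1 i S) j S) p S
      refine (mul_le_of_le_one_right (by positivity) b1).trans (mul_le_of_le_one_left (abs_nonneg _) (hxp p))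
    refine (Finset.sum_le_sum this).trans ?_
    simp
  have a3 : |V i x * fw i e0 S| ≤ |V i x| := by
    rw [abs_mul]
    exact mul_le_of_le_one_right (abs_nonneg _) (fw_bd h1 i S)
  have := abs_add_le (V i x * fw i e0 S) (∑ p, ∑ j, x p * pd j (h i) x * fw p (fw j (fc i e0)) S)
  have h5 : 0 ≤ e * |h i x| := by positivity
  have h6 : 0 ≤ ∑ j, |pd j (h i) x| := Finset.sum_nonneg fun _ _ => abs_nonneg _
  linarith
end

lemma st_smooth : ContDiff ℝ (⊤ : ℕ∞) Real.smoothTransition := Real.smoothTransition.contDiff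

lemma st_deriv_out {s : ℝ} (h : s ∉ Set.Icc (0:ℝ) 1) : deriv Real.smoothTransition s = 0 := by
  rw [Set.mem_Icc, not_and_or, not_le, not_le] at h
  rcases h with h | h
  · have : Real.smoothTransition =ᶠ[nhds s] fun _ => 0 := by
      filter_upwards [Iio_mem_nhds h] with y hy
      exact Real.smoothTransition.zero_of_nonpos (le_of_lt hy)
    rw [this.deriv_eq]; simp
  · have : Real.smoothTransition =ᶠ[nhds s] fun _ => 1 := by
      filter_upwards [Ioi_mem_nhds h] with y hy
      exact Real.smoothTransition.one_of_one_le (le_of_lt hy)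
    rw [this.deriv_eq]; simp

lemma st_deriv_bd : ∃ M, 0 ≤ M ∧ ∀ s, |deriv Real.smoothTransition s| ≤ M := by
  have hc : Continuous (deriv Real.smoothTransition) :=
    (st_smooth.of_le (by norm_cast) : ContDiff ℝ 1 _).continuous_deriv le_rfl
  obtain ⟨M, hM⟩ := isCompact_Icc.exists_bound_of_continuousOn (s := Set.Icc (0:ℝ) 1) hc.continuousOn
  refine ⟨max M 0, le_max_right _ _, fun s => ?_⟩
  by_cases hs : s ∈ Set.Icc (0:ℝ) 1
  · exact (hM s hs).trans (le_max_left _ _)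
  · rw [st_deriv_out hs]; simp

def chi (j : ℕ) (x : En n) : ℝ := Real.smoothTransition ((1 - ‖x‖ ^ 2) * j - 1)

lemma chi_smooth (j : ℕ) : ContDiff ℝ (⊤ : ℕ∞) (chi j : En n → ℝ) := by
  unfold chi
  exact st_smooth.comp (((contDiff_const.sub (contDiff_norm_sq ℝ)).mul contDiff_const).sub contDiff_const)

lemma chi_pd (j : ℕ) (i : Fin n) (x : En n) :
    pd i (chi j) x = -2 * j * deriv Real.smoothTransition ((1 - ‖x‖ ^ 2) * j - 1) * x i := by
  have h1 := nsq_diff x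
  have h2 : DifferentiableAt ℝ (fun x : En n => (1 - ‖x‖ ^ 2) * j - 1) x := by fun_prop
  have h3 : DifferentiableAt ℝ Real.smoothTransition ((1 - ‖x‖ ^ 2) * j - 1) := st_smooth.differentiable (by simp) _
  have h4 : HasFDerivAt (chi j) _ x := HasFDerivAt.comp (f := fun x : En n => (1 - ‖x‖ ^ 2) * j - 1) x h3.hasFDerivAt h2.hasFDerivAt
  have h5 : pd i (fun x : En n => (1 - ‖x‖ ^ 2) * j - 1) x = -2 * x i * j := by
    rw [pd_sub (by fun_prop) (by fun_prop), pd_mul_const (by fun_prop), pd_sub (by fun_prop) h1, pd_const, pd_nsq]; ring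
  unfold pd at h5 ⊢
  rw [h4.fderiv, ContinuousLinearMap.comp_apply, h5, ← toSpanSingleton_deriv]
  simp; ring

lemma chi_bd (j : ℕ) (x : En n) : |chi j x| ≤ 1 := by
  unfold chi; rw [abs_of_nonneg (Real.smoothTransition.nonneg _)]; exact Real.smoothTransition.le_one _

lemma chi_zero {j : ℕ} {x : En n} (h : (1 - ‖x‖ ^ 2) * j ≤ 1) : chi j x = 0 := by
  unfold chi; exact Real.smoothTransition.zero_of_nonpos (by linarith)

lemma chi_supp {j : ℕ} (hj : 0 < j) : tsupport (chi j : En n → ℝ) ⊆ {x | ‖x‖ ^ 2 ≤ 1 - 1 / j} := by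
  have hj' : (0:ℝ) < j := by exact_mod_cast hj
  apply closure_minimal _ (isClosed_le (by fun_prop) (by fun_prop))
  intro x hx
  by_contra hc
  apply hx
  apply chi_zero
  simp at hc
  have : (1 - ‖x‖ ^ 2) ≤ 1 / j := by rw [one_div]; linarith
  calc (1 - ‖x‖ ^ 2) * j ≤ 1 / j * j := by gcongr
    _ = 1 := by field_simp

lemma chi_supp_ball {j : ℕ} (hj : 0 < j) : tsupport (chi j : En n → ℝ) ⊆ ball 0 1 := by
  intro x hx
  have h := chi_supp hj hx
  have hj' : (0:ℝ) < j := by exact_mod_cast hj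
  have : (0:ℝ) < 1 / j := by positivity
  simp only [Set.mem_setOf_eq] at h
  rw [mem_ball_zero_iff]
  nlinarith [norm_nonneg x]

lemma chi_cs {j : ℕ} (hj : 0 < j) : HasCompactSupport (chi j : En n → ℝ) :=
  (isCompact_closedBall (0 : En n) 1).of_isClosed_subset (isClosed_tsupport _) ((chi_supp_ball hj).trans ball_subset_closedBall)

lemma chi_ev {x : En n} (hx : x ∈ ball (0 : En n) 1) : ∀ᶠ j : ℕ in atTop, 2 < (1 - ‖x‖ ^ 2) * j := by
  have h : 0 < 1 - ‖x‖ ^ 2 := by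
    rw [mem_ball_zero_iff] at hx
    nlinarith [norm_nonneg x]
  exact (tendsto_natCast_atTop_atTop.const_mul_atTop h).eventually_gt_atTop 2

/-- a smooth function vanishing on the sphere is `O(1 - |x|)`. -/
lemma sphere_lip {P : En n → ℝ} (hP : ContDiff ℝ (⊤ : ℕ∞) P) (h0 : P 0 = 0) (h1 : ∀ x : En n, ‖x‖ = 1 → P x = 0) :
    ∃ C, 0 ≤ C ∧ ∀ x ∈ ball (0 : En n) 1, |P x| ≤ C * (1 - ‖x‖ ^ 2) := by
  have hc : Continuous (fderiv ℝ P) := (hP.of_le (by norm_cast) : ContDiff ℝ 1 P).continuous_fderiv one_ne_zero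
  obtain ⟨C, hC⟩ := (isCompact_closedBall (0 : En n) 1).exists_bound_of_continuousOn hc.continuousOn
  have hC0 : 0 ≤ C := (norm_nonneg _).trans (hC 0 (by simp))
  refine ⟨C, hC0, fun x hx => ?_⟩
  rw [mem_ball_zero_iff] at hx
  rcases eq_or_ne x 0 with rfl | hx0
  · simp [h0, hC0]
  have hnx : 0 < ‖x‖ := norm_pos_iff.2 hx0
  have hy : ‖(‖x‖⁻¹ • x : En n)‖ = 1 := by rw [norm_smul, norm_inv, norm_norm, inv_mul_cancel₀ hnx.ne']
  have := (convex_closedBall (0 : En n) 1).norm_image_sub_le_of_norm_fderiv_le (𝕜 := ℝ) (f := P) (C := C)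
    (fun z _ => sm_diff hP z) hC (x := ‖x‖⁻¹ • x) (y := x) (by rw [mem_closedBall_zero_iff, hy]) (by simpa using hx.le)
  rw [h1 _ hy, sub_zero, Real.norm_eq_abs] at this
  have e : ‖x - ‖x‖⁻¹ • x‖ = 1 - ‖x‖ := by
    have : x - ‖x‖⁻¹ • x = (1 - ‖x‖⁻¹) • x := by rw [sub_smul, one_smul]
    rw [this, norm_smul, Real.norm_eq_abs, abs_of_nonpos]
    · field_simp; ring
    · have := one_le_inv₀ hnx |>.2 hx.le; linarith
  rw [e] at this
  refine this.trans ?_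
  gcongr
  nlinarith

lemma cont_bdd_ball {P : En n → ℝ} (hP : Continuous P) : ∃ C, ∀ x ∈ ball (0 : En n) 1, ‖P x‖ ≤ C := by
  obtain ⟨C, hC⟩ := (isCompact_closedBall (0 : En n) 1).exists_bound_of_continuousOn hP.continuousOn
  exact ⟨C, fun x hx => hC x (ball_subset_closedBall hx)⟩

lemma int_mul_cont {u P : En n → ℝ} (hu : IntegrableOn u (ball 0 1)) (hP : Continuous P) :
    IntegrableOn (fun x => u x * P x) (ball 0 1) := by
  obtain ⟨C, hC⟩ := cont_bdd_ball hP
  refine Integrable.mul_bdd (c := C) hu hP.aestronglyMeasurable ?_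
  exact (ae_restrict_mem measurableSet_ball).mono fun x hx => hC x hx

lemma weak_bdry {u : En n → ℝ} {G W : Fin n → En n → ℝ} (hu : IntegrableOn u (ball 0 1)) (hG : ∀ i, IntegrableOn (G i) (ball 0 1))
    (hw : ∀ i, HasWeakPartial (ball 0 1) u (G i) i) (hW : ∀ i, ContDiff ℝ (⊤ : ℕ∞) (W i))
    (hb : ∀ x : En n, ‖x‖ = 1 → ∑ i, x i * W i x = 0) :
    ∑ i, ∫ x in ball (0 : En n) 1, G i x * W i x = -∫ x in ball (0 : En n) 1, u x * ∑ i, pd i (W i) x := by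
  obtain ⟨P, hPd⟩ : ∃ P : En n → ℝ, P = fun x => ∑ i, x i * W i x := ⟨_, rfl⟩
  have hP : ContDiff ℝ (⊤ : ℕ∞) P := by rw [hPd]; exact ContDiff.sum fun i _ => (coord_contDiff i).mul (hW i)
  obtain ⟨C, hC0, hC⟩ := sphere_lip hP (by simp [hPd]) (by simpa [hPd] using hb)
  obtain ⟨M, hM0, hM⟩ := st_deriv_bd
  have hQ : Continuous (fun x => ∑ i, pd i (W i) x) := continuous_finset_sum _ fun i _ => (pd_smooth (hW i) i).continuous
  obtain ⟨D, hD⟩ := cont_bdd_ball hQ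
  -- the identity at level j
  have hstep : ∀ j : ℕ, 0 < j → ∑ i, ∫ x in ball (0 : En n) 1, G i x * W i x * chi j x =
      -∫ x in ball (0 : En n) 1, u x * (chi j x * ∑ i, pd i (W i) x + (-2 * j * deriv Real.smoothTransition ((1 - ‖x‖ ^ 2) * j - 1)) * P x) := by
    intro j hj
    have e1 : ∀ i, ∫ x in ball (0 : En n) 1, G i x * W i x * chi j x = -∫ x in ball (0 : En n) 1, u x * pd i (fun x => W i x * chi j x) x := by
      intro i
      have := hw i (fun x => W i x * chi j x) ⟨(hW i).mul (chi_smooth j), (chi_cs hj).mul_left, (tsupport_mul_subset_right).trans (chi_supp_ball hj)⟩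
      unfold pd
      rw [this, neg_neg]
      simp only [mul_assoc]
    simp only [e1]
    rw [Finset.sum_neg_distrib, ← integral_finset_sum]
    · congr 1
      refine integral_congr_ae (ae_of_all _ fun x => ?_)
      simp only
      rw [← Finset.mul_sum]
      congr 1
      simp only [fun i => pd_mul (sm_diff (hW i) x) (sm_diff (chi_smooth j) x) i, chi_pd, Finset.sum_add_distrib]
      rw [← Finset.sum_mul, hPd, mul_comm]
      congr 1
      rw [Finset.mul_sum]
      refine Finset.sum_congr rfl fun i _ => ?_
      ring
    · intro i _
      exact int_mul_cont hu (pd_smooth ((hW i).mul (chi_smooth j)) i).continuous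
  -- pass to the limit
  have hl1 : Tendsto (fun j : ℕ => ∑ i, ∫ x in ball (0 : En n) 1, G i x * W i x * chi j x) atTop
      (nhds (∑ i, ∫ x in ball (0 : En n) 1, G i x * W i x)) := by
    refine tendsto_finset_sum _ fun i _ => ?_
    have hintegr := int_mul_cont (hG i) (hW i).continuous
    refine tendsto_integral_of_dominated_convergence (fun x => ‖G i x * W i x‖) (fun j => ?_) hintegr.norm (fun j => ?_) ?_
    · exact (int_mul_cont hintegr (chi_smooth j).continuous).aestronglyMeasurable
    · refine ae_of_all _ fun x => ?_
      rw [norm_mul]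
      exact mul_le_of_le_one_right (norm_nonneg _) (chi_bd j x)
    · refine (ae_restrict_mem measurableSet_ball).mono fun x hx => ?_
      apply tendsto_const_nhds.congr'
      filter_upwards [chi_ev hx] with j hj
      unfold chi
      rw [Real.smoothTransition.one_of_one_le (by linarith), mul_one]
  have hl2 : Tendsto (fun j : ℕ => -∫ x in ball (0 : En n) 1, u x * (chi j x * ∑ i, pd i (W i) x + (-2 * j * deriv Real.smoothTransition ((1 - ‖x‖ ^ 2) * j - 1)) * P x)) atTop
      (nhds (-∫ x in ball (0 : En n) 1, u x * ∑ i, pd i (W i) x)) := by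
    refine Tendsto.neg ?_
    refine tendsto_integral_of_dominated_convergence (fun x => ‖u x‖ * (D + 4 * M * C)) (fun j => ?_) (hu.norm.mul_const _) (fun j => ?_) ?_
    · refine (int_mul_cont hu ?_).aestronglyMeasurable
      have hc : Continuous (deriv Real.smoothTransition) :=
        (st_smooth.of_le (by norm_cast) : ContDiff ℝ 1 _).continuous_deriv le_rfl
      have h2 : Continuous (fun x : En n => deriv Real.smoothTransition ((1 - ‖x‖ ^ 2) * j - 1)) := hc.comp (by fun_prop)
      exact ((chi_smooth j).continuous.mul hQ).add ((continuous_const.mul h2).mul hP.continuous)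
    · refine (ae_restrict_mem measurableSet_ball).mono fun x hx => ?_
      rw [norm_mul]
      refine mul_le_mul_of_nonneg_left ?_ (norm_nonneg _)
      refine (norm_add_le _ _).trans (add_le_add ?_ ?_)
      · rw [norm_mul]
        refine (mul_le_of_le_one_left (norm_nonneg _) (chi_bd j x)).trans (hD x hx)
      · by_cases hs : (1 - ‖x‖ ^ 2) * j - 1 ∈ Set.Icc (0:ℝ) 1
        · rw [norm_mul, norm_mul, norm_mul, Real.norm_eq_abs, Real.norm_eq_abs, Real.norm_eq_abs, Real.norm_eq_abs]
          have h1 := hC x hx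
          have h2 := hM ((1 - ‖x‖ ^ 2) * j - 1)
          rw [abs_neg, abs_two, Nat.abs_cast]
          have hj0 : (0:ℝ) ≤ j := Nat.cast_nonneg j
          calc 2 * (j:ℝ) * |deriv Real.smoothTransition ((1 - ‖x‖ ^ 2) * j - 1)| * |P x| ≤ 2 * j * M * (C * (1 - ‖x‖ ^ 2)) := by gcongr
            _ = 2 * M * C * ((1 - ‖x‖ ^ 2) * j) := by ring
            _ ≤ 2 * M * C * 2 := by
              refine mul_le_mul_of_nonneg_left ?_ (by positivity)
              linarith [hs.2]
            _ = 4 * M * C := by ring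
        · rw [st_deriv_out hs]; simp; positivity
    · refine (ae_restrict_mem measurableSet_ball).mono fun x hx => ?_
      apply tendsto_const_nhds.congr'
      filter_upwards [chi_ev hx] with j hj
      have hs : (1 - ‖x‖ ^ 2) * j - 1 ∉ Set.Icc (0:ℝ) 1 := fun h => by linarith [h.2]
      unfold chi
      rw [Real.smoothTransition.one_of_one_le (by linarith), st_deriv_out hs]
      simp
  refine tendsto_nhds_unique hl1 (hl2.congr' ?_)
  filter_upwards [eventually_gt_atTop 0] with j hj
  exact (hstep j hj).symm

def emb (v : Form n N k) (a : Fin N) : Fk n := fun S => if h : S.card = k then v (⟨S, h⟩, a) else 0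
def lft (k : ℕ) (a : Fin N) (w : Fk n) : Form n N k := fun q => if q.2 = a then w q.1.1 else 0

lemma coef_le (v : Form n N k) (q) : |v q| ≤ fnorm v := by
  unfold fnorm
  apply Real.abs_le_sqrt
  exact Finset.single_le_sum (f := fun q => v q ^ 2) (fun _ _ => sq_nonneg _) (Finset.mem_univ q)

lemma emb_le (v : Form n N k) (a) (S) : |emb v a S| ≤ fnorm v := by
  unfold emb; split_ifs
  · exact coef_le _ _
  · rw [abs_zero]; exact Real.sqrt_nonneg _

lemma emb_deg (v : Form n N k) (a : Fin N) : ∀ S, S.card ≠ k → emb v a S = 0 := by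
  intro S h; simp [emb, h]

lemma finner_lft (v : Form n N k) (a : Fin N) (w : Fk n) : finner v (lft k a w) = ∑ S, emb v a S * w S := by
  unfold finner lft emb
  rw [Fintype.sum_prod_type]
  simp only [mul_ite, mul_zero, Finset.sum_ite_eq', Finset.mem_univ, if_true]
  have : ∀ S : Finset (Fin n), (if h : S.card = k then v (⟨S, h⟩, a) else 0) * w S = if h : S.card = k then v (⟨S, h⟩, a) * w S else 0 := by
    intro S; split_ifs <;> simp
  simp only [this]
  rw [← Finset.sum_filter_add_sum_filter_not _ (fun S : Finset (Fin n) => S.card = k)]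
  rw [Finset.sum_eq_zero (s := Finset.univ.filter (fun S : Finset (Fin n) => ¬ S.card = k)), add_zero]
  · rw [Finset.sum_subtype (p := fun S : Finset (Fin n) => S.card = k) (Finset.univ.filter (fun S : Finset (Fin n) => S.card = k)) (by simp)
      (fun S => if h : S.card = k then v (⟨S, h⟩, a) * w S else 0)] 
    refine Finset.sum_congr rfl fun S _ => ?_
    simp [S.2]
  · intro S hS; simp at hS; simp [hS]

lemma emb_extD (G : Fin n → Form n N k) (a : Fin N) : emb (extD G) a = ∑ i, fw i (emb (G i) a) := by
  ext S
  rw [Finset.sum_apply]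
  by_cases h : S.card = k + 1
  · rw [emb, dif_pos h]; simp only [extD]
    refine Finset.sum_congr rfl fun i _ => ?_
    rw [fw_apply]
    by_cases hi : i ∈ S
    · have : emb (G i) a (S.erase i) = G i (⟨S.erase i, by rw [Finset.card_erase_of_mem hi, h]; rfl⟩, a) := by
        rw [emb, dif_pos]
      simp [hi, fsg, this]
    · simp [hi]
  · rw [emb_deg _ _ _ h, Finset.sum_eq_zero fun i _ => fw_deg (emb_deg (G i) a) i S h]

lemma emb_codiff (G : Fin n → Form n N (k + 1)) (a : Fin N) : emb (codiff G) a = - ∑ i, fc i (emb (G i) a) := by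
  ext S
  rw [Pi.neg_apply, Finset.sum_apply]
  by_cases h : S.card = k
  · rw [emb, dif_pos h]; simp only [codiff, neg_inj]
    refine Finset.sum_congr rfl fun i _ => ?_
    rw [fc_apply]
    by_cases hi : i ∈ S
    · simp [hi]
    · have : emb (G i) a (insert i S) = G i (⟨insert i S, by rw [Finset.card_insert_of_notMem hi, h]⟩, a) := by
        rw [emb, dif_pos]
      simp [hi, fsg, this]
  · rw [emb_deg _ _ _ h, Finset.sum_eq_zero fun i _ => fc_deg (emb_deg (G i) a) i S h, neg_zero]

lemma codiff_lft (a : Fin N) (w : Fin n → Fk n) : codiff (fun i => lft (k + 1) a (w i)) = lft k a (-∑ i, fc i (w i)) := by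
  ext q
  simp only [codiff, lft, Pi.neg_apply, Finset.sum_apply, fc_apply]
  by_cases hq : q.2 = a
  · simp [hq, fsg]
  · simp [hq]

lemma smoothGrad_lft (a : Fin N) (w : En n → Fk n) (x : En n) :
    smoothGrad (fun x => lft k a (w x)) x = fun i => lft k a (fun S => pd i (fun x => w x S) x) := by
  ext i q
  simp only [smoothGrad, lft]
  by_cases hq : q.2 = a
  · simp [hq, pd]
  · simp [hq]

lemma finner_lft_le (v : Form n N k) (a : Fin N) (w : Fk n) {A : ℝ} (hA : ∀ S, |w S| ≤ A) :
    |finner v (lft k a w)| ≤ 2 ^ n * (fnorm v * A) := by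
  rw [finner_lft]
  refine (Finset.abs_sum_le_sum_abs _ _).trans ?_
  have : ∀ S ∈ Finset.univ, |emb v a S * w S| ≤ fnorm v * A := by
    intro S _
    rw [abs_mul]
    exact mul_le_mul (emb_le v a S) (hA S) (abs_nonneg _) (Real.sqrt_nonneg _)
  refine (Finset.sum_le_sum this).trans ?_
  simp [Fintype.card_finset]

lemma memW_int {s : ℝ} (hs : 1 < s) {u : En n → Form n N k} {G : En n → Fin n → Form n N k} {x0 : En n} {R : ℝ} (h : MemW1p (ball x0 R) s u G) :
    (∀ q, IntegrableOn (fun x => u x q) (ball x0 R)) ∧ (∀ i q, IntegrableOn (fun x => G x i q) (ball x0 R)) := by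
  obtain ⟨-, h1, h2, h3, h4⟩ := h
  have hfin : IsFiniteMeasure ((volume : Measure (En n)).restrict (ball x0 R)) := ⟨by simpa using measure_ball_lt_top⟩
  have key : ∀ t : ℝ, 0 ≤ t → t ≤ 1 + t ^ s := by
    intro t ht
    rcases le_or_gt t 1 with h | h
    · have := Real.rpow_nonneg ht s; linarith
    · have : t ^ (1:ℝ) ≤ t ^ s := Real.rpow_le_rpow_of_exponent_le h.le hs.le
      rw [Real.rpow_one] at this; linarith
  constructor
  · intro q
    refine Integrable.mono' ((integrable_const (1:ℝ)).add h3) (h1 q) (ae_of_all _ fun x => ?_)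
    exact (coef_le (u x) q).trans (key _ (Real.sqrt_nonneg _))
  · intro i q
    refine Integrable.mono' ((integrable_const (1:ℝ)).add h4) (h2 i q) (ae_of_all _ fun x => ?_)
    have : |G x i q| ≤ gnorm (G x) := by
      unfold gnorm
      apply Real.abs_le_sqrt
      refine (Finset.single_le_sum (f := fun q => G x i q ^ 2) (fun _ _ => sq_nonneg _) (Finset.mem_univ q)).trans ?_
      exact Finset.single_le_sum (f := fun i => ∑ q, G x i q ^ 2) (fun _ _ => Finset.sum_nonneg fun _ _ => sq_nonneg _) (Finset.mem_univ i)
    exact this.trans (key _ (Real.sqrt_nonneg _))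

lemma emb_int {u : En n → Form n N k} {D : Set (En n)} (h : ∀ q, IntegrableOn (fun x => u x q) D) (a S) :
    IntegrableOn (fun x => emb (u x) a S) D := by
  unfold emb
  by_cases hS : S.card = k
  · simp only [hS, dif_pos]; exact h _
  · simp only [hS]; exact integrable_zero _ _ _

lemma emb_weak {u : En n → Form n N k} {G : En n → Fin n → Form n N k} {D : Set (En n)} (h : HasWeakGrad D u G) (a S i) :
    HasWeakPartial D (fun x => emb (u x) a S) (fun x => emb (G x i) a S) i := by
  unfold emb
  by_cases hS : S.card = k
  · simp only [hS, dif_pos]; exact h _ _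
  · simp only [hS]; intro φ _; simp

/-- weak form for the codifferential part -/
lemma weak_al {u : En n → Form n N (k+1)} {G : En n → Fin n → Form n N (k+1)} (hw : HasWeakGrad (ball 0 1) u G)
    (hu : ∀ q, IntegrableOn (fun x => u x q) (ball 0 1)) (hG : ∀ i q, IntegrableOn (fun x => G x i q) (ball 0 1))
    (a : Fin N) (w : En n → Fk n) (hwS : ∀ S, ContDiff ℝ (⊤ : ℕ∞) (fun x => w x S))
    (hb : ∀ x : En n, ‖x‖ = 1 → ∑ i, x i • fw i (w x) = 0) :
    ∫ x in ball (0 : En n) 1, finner (codiff (G x)) (lft k a (w x)) =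
      ∫ x in ball (0 : En n) 1, ∑ T, emb (u x) a T * (∑ i, fw i (fun S => pd i (fun x => w x S) x)) T := by
  have hfw : ∀ i T, ContDiff ℝ (⊤ : ℕ∞) (fun x => fw i (w x) T) := by
    intro i T; simp only [fw_apply]; split_ifs
    · exact contDiff_const.mul (hwS _)
    · exact contDiff_const
  have hpd : ∀ i T x, pd i (fun x => fw i (w x) T) x = fw i (fun S => pd i (fun x => w x S) x) T := by
    intro i T x; simp only [fw_apply]; split_ifs
    · rw [pd_const_mul (sm_diff (hwS _) x)]
    · rw [pd_const]
  have hI : ∀ T i, IntegrableOn (fun x => emb (G x i) a T * fw i (w x) T) (ball 0 1) := fun T i =>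
    int_mul_cont (emb_int (hG i) a T) (hfw i T).continuous
  have e1 : ∀ x, finner (codiff (G x)) (lft k a (w x)) = -∑ T, ∑ i, emb (G x i) a T * fw i (w x) T := by
    intro x
    rw [finner_lft, emb_codiff]
    simp only [Pi.neg_apply, Finset.sum_apply, neg_mul, Finset.sum_neg_distrib, Finset.sum_mul]
    rw [Finset.sum_comm]
    simp only [fw_adj]
    rw [Finset.sum_comm]
  simp only [e1]
  rw [integral_neg, integral_finset_sum _ (fun T _ => integrable_finset_sum _ fun i _ => hI T i), integral_finset_sum]
  · rw [← Finset.sum_neg_distrib]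
    refine Finset.sum_congr rfl fun T _ => ?_
    rw [integral_finset_sum _ fun i _ => hI T i]
    rw [weak_bdry (u := fun x => emb (u x) a T) (G := fun i x => emb (G x i) a T) (W := fun i x => fw i (w x) T) (emb_int hu a T) (fun i => emb_int (hG i) a T)
      (fun i => emb_weak hw a T i) (fun i => hfw i T) ?_]
    · simp only [neg_neg, hpd, Finset.sum_apply]
    · intro x hx
      have := congrFun (hb x hx) T
      simpa using this
  · intro T _
    simp only [Finset.sum_apply, ← hpd]
    exact int_mul_cont (emb_int hu a T) (continuous_finset_sum _ fun i _ => (pd_smooth (hfw i T) i).continuous)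

lemma weak_be {u : En n → Form n N k} {G : En n → Fin n → Form n N k} (ht : TangentialZero (ball 0 1) u G)
    (a : Fin N) (w : En n → Fk n) (hwS : ∀ S, ContDiff ℝ (⊤ : ℕ∞) (fun x => w x S)) :
    ∫ x in ball (0 : En n) 1, finner (extD (G x)) (lft (k+1) a (w x)) =
      ∫ x in ball (0 : En n) 1, ∑ T, emb (u x) a T * (-∑ i, fc i (fun S => pd i (fun x => w x S) x)) T := by
  rw [ht (fun x => lft (k+1) a (w x))]
  · refine integral_congr_ae (ae_of_all _ fun x => ?_)
    simp only
    rw [smoothGrad_lft, codiff_lft, finner_lft]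
  · intro q
    simp only [lft]; split_ifs
    · exact hwS _
    · exact contDiff_const

def bnd (l : Fin n) (ψ : En n → ℝ) (x : En n) : ℝ≥0∞ :=
  ∑ i, ENNReal.ofReal |VV i (pd l ψ) x| + ∫⁻ y in ball 0 1, Kd x y * ENNReal.ofReal |ψ y|

lemma key_bound (N : ℕ) {m e : ℕ} (hne : n = m + 2 + e) : ∃ C : ℝ≥0∞, C ≠ ⊤ ∧
    ∀ (s : ℝ), 1 < s → ∀ (u : En n → Form n N (m+1)) (G : En n → Fin n → Form n N (m+1)), MemW1p (ball 0 1) s u G → TangentialZero (ball 0 1) u G →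
    ∀ (ψ : En n → ℝ), IsTestFun (ball 0 1) ψ → ∀ l q,
      ENNReal.ofReal |∫ x in ball (0 : En n) 1, G x l q * ψ x| ≤
        C * ∫⁻ x in ball 0 1, (ENNReal.ofReal (fnorm (extD (G x))) + ENNReal.ofReal (fnorm (codiff (G x)))) * bnd l ψ x := by
  have hn : 1 < n := by omega
  obtain ⟨C0, hC0, H⟩ := hh_ex hn e
  have hcst := cst_pos (n := n) (by omega)
  refine ⟨(ENNReal.ofReal (cst n))⁻¹ * (2 ^ n * (1 + n * (e * C0 + (n + 1) * (n * C0)))), ?_, ?_⟩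
  · refine ENNReal.mul_ne_top (ENNReal.inv_ne_top.2 (by simpa using hcst)) ?_
    finiteness
  intro s hs u G hW ht ψ hψ l q
  obtain ⟨hu, hG⟩ := memW_int hs hW
  have hρs := pd_smooth hψ.1 l
  have hρc := pd_cs hψ.2.1 l
  choose h hh hlap hbd hb1 hb2 using H ψ hψ l
  obtain ⟨V, hVdef⟩ : ∃ V : Fin n → En n → ℝ, V = fun i => VV i (pd l ψ) := ⟨_, rfl⟩
  have hV : ∀ i, ContDiff ℝ (⊤ : ℕ∞) (V i) := fun i => by rw [hVdef]; exact VV_smooth hn i hρs hρc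
  obtain ⟨T0, a0⟩ := q
  obtain ⟨e0, he0⟩ : ∃ e0 : Fk n, e0 = Pi.single T0.1 1 := ⟨_, rfl⟩
  have he0d : ∀ S, S.card ≠ m + 1 → e0 S = 0 := by
    intro S hS; rw [he0, Pi.single_eq_of_ne]; rintro rfl; exact hS T0.2
  have he0b : ∀ S, |e0 S| ≤ 1 := by
    intro S; rw [he0, Pi.single_apply]; split_ifs <;> simp
  have hal := al_smooth hV hh e e0
  have hbe := be_smooth hV hh e0
  have i1 := weak_al hW.1 hu hG a0 (al e V h e0) hal (fun x hx => al_sphere e0 (fun i => by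
    have := hbd i x hx; rw [evh, this, hVdef]))
  have i2 := weak_be ht a0 (be V h e0) hbe
  have hcal : ∀ T, Continuous (fun x => (∑ i, fw i (fun S => pd i (fun x => al e V h e0 x S) x)) T) := by
    intro T
    simp only [Finset.sum_apply, fw_apply]
    refine continuous_finset_sum _ fun i _ => ?_
    split_ifs
    · exact continuous_const.mul (pd_smooth (hal _) i).continuous
    · exact continuous_const
  have hcbe : ∀ T, Continuous (fun x => (-∑ i, fc i (fun S => pd i (fun x => be V h e0 x S) x)) T) := by
    intro T
    simp only [Pi.neg_apply, Finset.sum_apply, fc_apply]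
    refine (continuous_finset_sum _ fun i _ => ?_).neg
    split_ifs
    · exact continuous_const
    · exact continuous_const.mul (pd_smooth (hbe _) i).continuous
  have i3 : (∫ x in ball (0 : En n) 1, finner (codiff (G x)) (lft m a0 (al e V h e0 x))) + ∫ x in ball (0 : En n) 1, finner (extD (G x)) (lft (m+2) a0 (be V h e0 x))
      = cst n * ∫ x in ball (0 : En n) 1, G x l (T0, a0) * ψ x := by
    rw [i1, i2, ← integral_add (integrable_finset_sum _ fun T _ => int_mul_cont (emb_int hu a0 T) (hcal T))
      (integrable_finset_sum _ fun T _ => int_mul_cont (emb_int hu a0 T) (hcbe T))]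
    have := hW.1 l (T0, a0) ψ hψ
    rw [← neg_eq_iff_eq_neg.2 this.symm.symm, ← integral_neg, ← integral_const_mul]
    refine setIntegral_congr_fun measurableSet_ball fun x hx => ?_
    simp only
    rw [← Finset.sum_add_distrib]
    have hid := al_be_id hV hh (m := m) (e := e) (by rw [hne]; push_cast; ring) he0d (x := x) (fun i k => by
      rw [hVdef]; simp only; rw [VV_pd hn i k hρs hρc, VV_pd hn k i hρs hρc, VV_symm hn i k hρs hρc]) (fun i => hlap i x hx)
    have htr : ∑ i, pd i (V i) x = cst n * pd l ψ x := by
      rw [hVdef, ← VV_trace hn hρs hρc]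
      exact Finset.sum_congr rfl fun i _ => VV_pd hn i i hρs hρc x
    rw [htr] at hid
    have : ∀ T, emb (u x) a0 T * (∑ i, fw i (fun S => pd i (fun x => al e V h e0 x S) x)) T + emb (u x) a0 T * (-∑ i, fc i (fun S => pd i (fun x => be V h e0 x S) x)) T
        = emb (u x) a0 T * (-(cst n * pd l ψ x) * e0 T) := by
      intro T
      rw [← mul_add, ← Pi.add_apply, ← sub_eq_add_neg, hid]; simp
    simp only [this]
    rw [he0, Finset.sum_eq_single T0.1]
    · simp only [Pi.single_eq_same, emb, T0.2, dif_pos, Subtype.coe_eta, pd]; ring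
    · intro T _ hT; rw [Pi.single_eq_of_ne hT]; ring
    · simp
  -- bounds
  obtain ⟨A, hA⟩ : ∃ A : En n → ℝ, A = fun x => ∑ i, (|V i x| + e * |h i x| + ((n:ℝ) + 1) * ∑ j, |pd j (h i) x|) := ⟨_, rfl⟩
  have hAb : ∀ x ∈ ball (0 : En n) 1, ENNReal.ofReal (A x) ≤ (1 + n * (e * C0 + (n + 1) * (n * C0))) * bnd l ψ x := by
    intro x hx
    rw [hA]
    simp only
    rw [ENNReal.ofReal_sum_of_nonneg (fun i _ => by positivity)]
    have hK : ∀ i, ENNReal.ofReal (|V i x| + e * |h i x| + ((n:ℝ) + 1) * ∑ j, |pd j (h i) x|) ≤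
        ENNReal.ofReal |V i x| + (e * C0 + (n + 1) * (n * C0)) * ∫⁻ y in ball 0 1, Kd x y * ENNReal.ofReal |ψ y| := by
      intro i
      rw [ENNReal.ofReal_add (by positivity) (by positivity), ENNReal.ofReal_add (by positivity) (by positivity), add_assoc]
      rw [add_mul ((e : ℝ≥0∞) * C0)]
      refine add_le_add (le_refl (ENNReal.ofReal |V i x|)) ?_
      refine add_le_add (α := ℝ≥0∞) ?_ ?_
      · rw [ENNReal.ofReal_mul (by positivity), ENNReal.ofReal_natCast, mul_assoc]
        exact mul_le_mul' le_rfl (hb1 i x hx)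
      · rw [ENNReal.ofReal_mul (by positivity), ENNReal.ofReal_add (by positivity) (by positivity), ENNReal.ofReal_natCast, ENNReal.ofReal_one, mul_assoc]
        refine mul_le_mul' le_rfl ?_
        rw [ENNReal.ofReal_sum_of_nonneg (fun i _ => by positivity)]
        refine (Finset.sum_le_sum fun j _ => hb2 i x hx j).trans ?_
        simp [mul_assoc]
    refine (Finset.sum_le_sum fun i _ => hK i).trans ?_
    rw [Finset.sum_add_distrib]
    simp only [Finset.sum_const, Finset.card_univ, Fintype.card_fin, nsmul_eq_mul]
    rw [bnd, hVdef, add_mul (1 : ℝ≥0∞), one_mul]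
    simp only
    rw [← mul_assoc]
    refine add_le_add le_self_add (mul_le_mul' le_rfl le_add_self)
  have hfin : ENNReal.ofReal (cst n) * ENNReal.ofReal |∫ x in ball (0 : En n) 1, G x l (T0, a0) * ψ x| ≤
      (2 ^ n * (1 + n * (e * C0 + (n + 1) * (n * C0)))) * ∫⁻ x in ball 0 1, (ENNReal.ofReal (fnorm (extD (G x))) + ENNReal.ofReal (fnorm (codiff (G x)))) * bnd l ψ x := by
    rw [← ENNReal.ofReal_mul hcst.le]
    nth_rewrite 1 [← abs_of_pos hcst]
    rw [← abs_mul, ← i3]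
    refine (ENNReal.ofReal_le_ofReal (abs_add_le _ _)).trans ?_
    rw [ENNReal.ofReal_add (abs_nonneg _) (abs_nonneg _), ← Real.enorm_eq_ofReal_abs, ← Real.enorm_eq_ofReal_abs]
    refine (add_le_add (enorm_integral_le_lintegral_enorm _) (enorm_integral_le_lintegral_enorm _)).trans ?_
    have hB : ∀ (k' : ℕ) (v : Form n N k') (w : Fk n) (x : En n), x ∈ ball (0 : En n) 1 → (∀ S, |w S| ≤ A x) →
        ‖finner v (lft k' a0 w)‖ₑ ≤ (2 ^ n * (1 + n * (e * C0 + (n + 1) * (n * C0)))) * (ENNReal.ofReal (fnorm v) * bnd l ψ x) := by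
      intro k' v w x hx hw
      rw [Real.enorm_eq_ofReal_abs]
      refine (ENNReal.ofReal_le_ofReal (finner_lft_le v a0 w hw)).trans ?_
      rw [ENNReal.ofReal_mul (by positivity), ENNReal.ofReal_mul (show 0 ≤ fnorm v from Real.sqrt_nonneg _), ENNReal.ofReal_pow (by norm_num)]
      rw [mul_assoc, show ENNReal.ofReal 2 = 2 by simp]
      refine mul_le_mul' le_rfl ?_
      rw [mul_left_comm]
      exact mul_le_mul' le_rfl (hAb x hx)
    have hnt : (2 ^ n * (1 + n * (e * C0 + (n + 1) * (n * C0))) : ℝ≥0∞) ≠ ⊤ := by finiteness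
    have hx1 : ∀ x ∈ ball (0 : En n) 1, ‖x‖ ≤ 1 := fun x hx => by simpa using (mem_ball.1 hx).le
    have b1 := setLIntegral_mono_ae' (μ := volume) (measurableSet_ball (x := (0 : En n)) (ε := 1)) (ae_of_all _ fun x hx =>
      hB m (codiff (G x)) (al e V h e0 x) x hx (by rw [hA]; exact al_bd (Nat.cast_nonneg e) he0b (hx1 x hx)))
    have b2 := setLIntegral_mono_ae' (μ := volume) (measurableSet_ball (x := (0 : En n)) (ε := 1)) (ae_of_all _ fun x hx =>
      hB (m+2) (extD (G x)) (be V h e0 x) x hx (by rw [hA]; exact be_bd (Nat.cast_nonneg e) he0b (hx1 x hx)))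
    refine (add_le_add b1 b2).trans ?_
    rw [lintegral_const_mul' _ _ hnt, lintegral_const_mul' _ _ hnt, ← mul_add]
    refine mul_le_mul' le_rfl ?_
    refine (le_lintegral_add _ _).trans ?_
    refine lintegral_mono fun x => ?_
    simp only
    rw [add_mul, add_comm]
  rw [mul_assoc]
  rw [← ENNReal.div_eq_inv_mul]
  rw [ENNReal.le_div_iff_mul_le (Or.inl (by simpa using hcst)) (Or.inl ENNReal.ofReal_ne_top), mul_comm]
  exact hfin

lemma ofReal_abs_rpow (a : ℝ) {p : ℝ} (hp : 0 ≤ p) : ENNReal.ofReal (|a| ^ p) = ENNReal.ofReal |a| ^ p :=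
  (ENNReal.ofReal_rpow_of_nonneg (abs_nonneg a) hp).symm

lemma bnd_meas (hn : 1 < n) (l : Fin n) {ψ : En n → ℝ} (hψ : IsTestFun (ball 0 1) ψ) : Measurable (bnd l ψ) := by
  unfold bnd
  refine Measurable.add ?_ ?_
  · refine Finset.measurable_fun_sum _ fun i _ => ?_
    exact (VV_smooth hn i (pd_smooth hψ.1 l) (pd_cs hψ.2.1 l)).continuous.abs.measurable.ennreal_ofReal
  · refine Measurable.lintegral_prod_right' (f := fun z : En n × En n => Kd z.1 z.2 * ENNReal.ofReal |ψ z.2|) ?_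
    exact Kd_meas.mul (hψ.1.continuous.comp continuous_snd).abs.measurable.ennreal_ofReal

lemma bnd_Lq_aux (hn : 1 < n) {p : ℝ} (hp : 1 < p) {C : ℝ≥0∞} (hC : C ≠ ⊤)
    (H : ∀ (i j : Fin n) (f : En n → ℝ), ContDiff ℝ (⊤ : ℕ∞) f → HasCompactSupport f →
    ∫⁻ x, ENNReal.ofReal (|VV i (pd j f) x| ^ p) ≤ C * ∫⁻ x, ENNReal.ofReal (|f x| ^ p)) :
    ∃ C' : ℝ≥0∞, C' ≠ ⊤ ∧ ∀ (l : Fin n) (ψ : En n → ℝ), IsTestFun (ball 0 1) ψ →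
      ∫⁻ x in ball 0 1, bnd l ψ x ^ p ≤ C' * ∫⁻ x, ENNReal.ofReal |ψ x| ^ p := by
  obtain ⟨C2, hC2, H2⟩ := schur_test hn hp
  refine ⟨2 ^ (p - 1) * (((n : ℝ≥0∞) ^ (p - 1)) * (n * C) + C2), ?_, ?_⟩
  · have h1 : (2 : ℝ≥0∞) ^ (p - 1) ≠ ⊤ := ENNReal.rpow_ne_top_of_nonneg (by linarith) (by simp)
    have h2 : (n : ℝ≥0∞) ^ (p - 1) ≠ ⊤ := ENNReal.rpow_ne_top_of_nonneg (by linarith) (by simp)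
    finiteness
  intro l ψ hψ
  have hp0 : 0 ≤ p := by linarith
  have hVm : ∀ i, Measurable fun x => ENNReal.ofReal |VV i (pd l ψ) x| ^ p := fun i =>
    ((VV_smooth hn i (pd_smooth hψ.1 l) (pd_cs hψ.2.1 l)).continuous.abs.measurable.ennreal_ofReal).pow_const p
  have hpt : ∀ x, bnd l ψ x ^ p ≤ 2 ^ (p - 1) * ((n : ℝ≥0∞) ^ (p - 1) * (∑ i, ENNReal.ofReal |VV i (pd l ψ) x| ^ p) +
      (∫⁻ y in ball 0 1, Kd x y * ENNReal.ofReal |ψ y|) ^ p) := by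
    intro x
    refine (ENNReal.rpow_add_le_mul_rpow_add_rpow _ _ hp.le).trans ?_
    refine mul_le_mul' le_rfl (add_le_add ?_ le_rfl)
    simpa using ENNReal.rpow_sum_le_const_mul_sum_rpow Finset.univ (fun i => ENNReal.ofReal |VV i (pd l ψ) x|) hp.le
  refine (lintegral_mono hpt).trans ?_
  rw [lintegral_const_mul' _ _ (ENNReal.rpow_ne_top_of_nonneg (by linarith) (by simp)), mul_assoc]
  refine mul_le_mul' le_rfl ?_
  rw [lintegral_add_left ((Finset.measurable_fun_sum _ fun i _ => hVm i).const_mul _), lintegral_const_mul _ (Finset.measurable_fun_sum _ fun i _ => hVm i),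
    lintegral_finset_sum _ (fun i _ => hVm i), add_mul]
  refine add_le_add ?_ ?_
  · rw [mul_assoc]
    refine mul_le_mul' le_rfl ?_
    refine (Finset.sum_le_sum (g := fun _ => C * ∫⁻ x, ENNReal.ofReal |ψ x| ^ p) fun i _ => ?_).trans ?_
    · refine (setLIntegral_le_lintegral _ _).trans ?_
      simpa only [ofReal_abs_rpow _ hp0] using H i l ψ hψ.1 hψ.2.1
    · simp [mul_assoc]
  · refine (H2 (fun y => ENNReal.ofReal |ψ y|) hψ.1.continuous.abs.measurable.ennreal_ofReal).trans ?_
    exact mul_le_mul' le_rfl (setLIntegral_le_lintegral _ _)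

lemma bnd_Lq (hn : 1 < n) (p q : ℝ) (hp : 2 < p) (hpq : q.HolderConjugate p) :
    ∃ C' : ℝ≥0∞, C' ≠ ⊤ ∧ ∀ (l : Fin n) (ψ : En n → ℝ), IsTestFun (ball 0 1) ψ →
      ∫⁻ x in ball 0 1, bnd l ψ x ^ p ≤ C' * ∫⁻ x, ENNReal.ofReal |ψ x| ^ p ∧
      ∫⁻ x in ball 0 1, bnd l ψ x ^ q ≤ C' * ∫⁻ x, ENNReal.ofReal |ψ x| ^ q := by
  obtain ⟨C, hC, H⟩ := VV_Lq n hn p q hp hpq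
  obtain ⟨C1, hC1, H1⟩ := bnd_Lq_aux hn (p := p) (by linarith) hC (fun i j f h1 h2 => (H i j f h1 h2).1)
  obtain ⟨C2, hC2, H2⟩ := bnd_Lq_aux hn (p := q) hpq.lt hC (fun i j f h1 h2 => (H i j f h1 h2).2)
  refine ⟨max C1 C2, by simp [hC1, hC2], fun l ψ hψ => ⟨(H1 l ψ hψ).trans ?_, (H2 l ψ hψ).trans ?_⟩⟩
  · exact mul_le_mul' (le_max_left _ _) le_rfl
  · exact mul_le_mul' (le_max_right _ _) le_rfl

lemma young_one {p q ε : ℝ} (hpq : p.HolderConjugate q) (he : 0 < ε) (he1 : ε ≤ 1) (φ : ℝ) (hφ : 0 ≤ φ) (b : ℝ≥0∞) :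
    ENNReal.ofReal φ * b ≤ ENNReal.ofReal ((1 / ε) ^ p) * ENNReal.ofReal (φ ^ p) + ENNReal.ofReal ε * b ^ q := by
  have h := ENNReal.young_inequality (ENNReal.ofReal (1 / ε * φ)) (ENNReal.ofReal ε * b) hpq
  have e1 : ENNReal.ofReal (1 / ε * φ) * (ENNReal.ofReal ε * b) = ENNReal.ofReal φ * b := by
    rw [← mul_assoc, ← ENNReal.ofReal_mul (by positivity)]
    congr 2; field_simp
  rw [e1] at h
  refine h.trans (add_le_add ?_ ?_)
  · refine (ENNReal.div_le_of_le_mul ?_ : _ ≤ ENNReal.ofReal ((1 / ε) ^ p) * ENNReal.ofReal (φ ^ p))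
    rw [ENNReal.ofReal_rpow_of_nonneg (by positivity) hpq.nonneg, ← ENNReal.ofReal_mul (by positivity), Real.mul_rpow (by positivity) hφ]
    refine le_mul_of_one_le_right (by simp) ?_
    simpa using hpq.lt.le
  · refine ENNReal.div_le_of_le_mul ?_
    rw [ENNReal.mul_rpow_of_nonneg _ _ hpq.symm.nonneg, ENNReal.ofReal_rpow_of_nonneg he.le hpq.symm.nonneg]
    refine (le_mul_of_one_le_right (by simp) (by simpa using hpq.symm.lt.le)).trans' ?_
    refine mul_le_mul' (ENNReal.ofReal_le_ofReal ?_) le_rfl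
    simpa using Real.rpow_le_rpow_of_exponent_ge he he1 hpq.symm.lt.le

lemma young_min {p q ε : ℝ} (hpq : q.HolderConjugate p) (hqp : q ≤ p) (he : 0 < ε) (he1 : ε ≤ 1) {t : ℝ} (ht : 0 < t) (Φ : ℝ) (b : ℝ≥0∞) :
    ENNReal.ofReal Φ * b ≤ ENNReal.ofReal t * (ENNReal.ofReal ((1 / ε) ^ p) * ENNReal.ofReal (min ((|Φ| / t) ^ q) ((|Φ| / t) ^ p))
      + ENNReal.ofReal ε * (b ^ q + b ^ p)) := by
  obtain ⟨φ, hφ⟩ : ∃ φ, φ = |Φ| / t := ⟨_, rfl⟩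
  have hφ0 : 0 ≤ φ := by rw [hφ]; positivity
  have h1 : ENNReal.ofReal Φ ≤ ENNReal.ofReal t * ENNReal.ofReal φ := by
    rw [← ENNReal.ofReal_mul ht.le]
    apply ENNReal.ofReal_le_ofReal
    rw [hφ, mul_div_cancel₀ _ ht.ne']; exact le_abs_self _
  refine (mul_le_mul' h1 le_rfl).trans ?_
  rw [mul_assoc, ← hφ]
  refine mul_le_mul' le_rfl ?_
  rcases le_total φ 1 with h | h
  · refine (young_one hpq.symm he he1 φ hφ0 b).trans ?_
    rw [min_eq_right]
    · exact add_le_add le_rfl (mul_le_mul' le_rfl le_self_add)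
    · rcases hφ0.eq_or_lt with h0 | h0
      · rw [← h0, Real.zero_rpow hpq.pos.ne', Real.zero_rpow hpq.symm.pos.ne']
      · exact Real.rpow_le_rpow_of_exponent_ge h0 h hqp
  · refine (young_one hpq he he1 φ hφ0 b).trans ?_
    rw [min_eq_left (Real.rpow_le_rpow_of_exponent_le h hqp)]
    refine add_le_add (mul_le_mul' (ENNReal.ofReal_le_ofReal ?_) le_rfl) (mul_le_mul' le_rfl le_add_self)
    exact Real.rpow_le_rpow_of_exponent_le (by rw [le_div_iff₀ he]; simpa using he1) hqp

lemma smooth_urysohn {K U : Set (En n)} (hK : IsCompact K) (hU : IsOpen U) (hKU : K ⊆ U) :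
    ∃ ψ : En n → ℝ, IsTestFun U ψ ∧ (∀ x, 0 ≤ ψ x) ∧ (∀ x, ψ x ≤ 1) ∧ ∀ x ∈ K, ψ x = 1 := by
  obtain ⟨V, hV, hKV, hVU⟩ := exists_compact_between hK hU hKU
  obtain ⟨f, f0, f1, f2⟩ := exists_contMDiffMap_zero_one_of_isClosed (n := (⊤ : ℕ∞)) (modelWithCornersSelf ℝ (En n)) (s := (interior V)ᶜ) (t := K)
    isOpen_interior.isClosed_compl hK.isClosed (by rw [Set.disjoint_compl_left_iff_subset]; exact hKV)
  have hs : tsupport f ⊆ V := by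
    refine closure_minimal ?_ hV.isClosed
    intro x hx
    by_contra h
    exact hx (f0 (fun h' => h (interior_subset h')))
  refine ⟨f, ⟨f.contMDiff.contDiff, ?_, hs.trans hVU⟩, fun x => (f2 x).1, fun x => (f2 x).2, fun x hx => f1 hx⟩
  exact hV.of_isClosed_subset (isClosed_tsupport _) hs

lemma psi_int {U : Set (En n)} (hU : MeasurableSet U) {ψ : En n → ℝ} (hψ : IsTestFun U ψ) (h0 : ∀ x, 0 ≤ ψ x) (h1 : ∀ x, ψ x ≤ 1) {p : ℝ} (hp : 0 < p) :
    ∫⁻ x, ENNReal.ofReal |ψ x| ^ p ≤ volume U := by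
  rw [← lintegral_indicator_one hU]
  refine lintegral_mono fun x => ?_
  by_cases hx : x ∈ U
  · simp only [Set.indicator_of_mem hx, Pi.one_apply]
    refine ENNReal.rpow_le_one ?_ hp.le
    simpa [abs_of_nonneg (h0 x)] using h1 x
  · have : ψ x = 0 := by
      by_contra h
      exact hx (hψ.2.2 (subset_tsupport _ h))
    simp [hx, this, hp]

lemma KI_meas {μ : Measure (En n)} {Φ : En n → ℝ} (hΦ : AEMeasurable Φ μ) (p q t : ℝ) :
    AEMeasurable (fun x => ENNReal.ofReal (min ((|Φ x| / t) ^ q) ((|Φ x| / t) ^ p))) μ := by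
  have h : Measurable (fun y : ℝ => ENNReal.ofReal (min ((|y| / t) ^ q) ((|y| / t) ^ p))) := by fun_prop
  exact h.comp_aemeasurable hΦ

lemma stepA {p q : ℝ} (hpq : q.HolderConjugate p) (hqp : q ≤ p) {C2 : ℝ≥0∞} {b : (En n → ℝ) → En n → ℝ≥0∞}
    (hbm : ∀ ψ, IsTestFun (ball 0 1) ψ → Measurable (b ψ))
    (H2 : ∀ ψ, IsTestFun (ball 0 1) ψ → ∫⁻ x in ball 0 1, b ψ x ^ p ≤ C2 * ∫⁻ x, ENNReal.ofReal |ψ x| ^ p ∧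
      ∫⁻ x in ball 0 1, b ψ x ^ q ≤ C2 * ∫⁻ x, ENNReal.ofReal |ψ x| ^ q)
    {Φ1 Φ2 : En n → ℝ} (hΦ1 : AEMeasurable Φ1 (volume.restrict (ball 0 1))) (hΦ2 : AEMeasurable Φ2 (volume.restrict (ball 0 1)))
    {ε : ℝ} (he : 0 < ε) (he1 : ε ≤ 1) {t : ℝ} (ht : 0 < t) {U : Set (En n)} (hU : MeasurableSet U) (hUB : U ⊆ ball 0 1)
    {ψ : En n → ℝ} (hψ : IsTestFun U ψ) (h0 : ∀ x, 0 ≤ ψ x) (h1 : ∀ x, ψ x ≤ 1) :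
    ∫⁻ x in ball 0 1, (ENNReal.ofReal (Φ1 x) + ENNReal.ofReal (Φ2 x)) * b ψ x ≤
      ENNReal.ofReal t * (ENNReal.ofReal ((1 / ε) ^ p) * (KI (volume.restrict (ball 0 1)) q p Φ1 t + KI (volume.restrict (ball 0 1)) q p Φ2 t)
        + 4 * ENNReal.ofReal ε * C2 * volume U) := by
  have hψB : IsTestFun (ball 0 1) ψ := ⟨hψ.1, hψ.2.1, hψ.2.2.trans hUB⟩
  obtain ⟨E, hE⟩ : ∃ E, E = ENNReal.ofReal ε := ⟨_, rfl⟩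
  obtain ⟨A, hA⟩ : ∃ A, A = ENNReal.ofReal ((1 / ε) ^ p) := ⟨_, rfl⟩
  obtain ⟨m, hm⟩ : ∃ m : (En n → ℝ) → En n → ℝ≥0∞, m = fun Φ x => ENNReal.ofReal (min ((|Φ x| / t) ^ q) ((|Φ x| / t) ^ p)) := ⟨_, rfl⟩
  have hm1 : AEMeasurable (m Φ1) (volume.restrict (ball 0 1)) := by rw [hm]; exact KI_meas hΦ1 p q t
  have hm2 : AEMeasurable (m Φ2) (volume.restrict (ball 0 1)) := by rw [hm]; exact KI_meas hΦ2 p q t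
  have hpt : ∀ x, (ENNReal.ofReal (Φ1 x) + ENNReal.ofReal (Φ2 x)) * b ψ x ≤
      ENNReal.ofReal t * (A * (m Φ1 x + m Φ2 x) + 2 * E * (b ψ x ^ q + b ψ x ^ p)) := by
    intro x
    rw [add_mul]
    refine (add_le_add (young_min hpq hqp he he1 ht (Φ1 x) (b ψ x)) (young_min hpq hqp he he1 ht (Φ2 x) (b ψ x))).trans (le_of_eq ?_)
    rw [hm, ← hE, ← hA]; ring
  refine (lintegral_mono hpt).trans ?_
  have hA' : A ≠ ⊤ := by rw [hA]; simp
  have hE' : 2 * E ≠ ⊤ := by rw [hE]; finiteness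
  rw [lintegral_const_mul' _ _ ENNReal.ofReal_ne_top, lintegral_add_left' (show AEMeasurable (fun x => A * (m Φ1 x + m Φ2 x)) (volume.restrict (ball 0 1)) from (hm1.add hm2).const_mul _), lintegral_const_mul' _ _ hA',
    lintegral_const_mul' _ _ hE', lintegral_add_left' hm1, lintegral_add_left (((hbm ψ hψB).pow_const q))]
  refine mul_le_mul' le_rfl ?_
  have i1 := (H2 ψ hψB).1.trans (mul_le_mul' le_rfl (psi_int hU hψ h0 h1 hpq.symm.pos))
  have i2 := (H2 ψ hψB).2.trans (mul_le_mul' le_rfl (psi_int hU hψ h0 h1 hpq.pos))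
  rw [← hE, ← hA]
  refine add_le_add (le_of_eq ?_) ?_
  · rw [hm]; rfl
  · calc 2 * E * ((∫⁻ x in ball 0 1, b ψ x ^ q) + ∫⁻ x in ball 0 1, b ψ x ^ p) ≤ 2 * E * (C2 * volume U + C2 * volume U) :=
          mul_le_mul' le_rfl (add_le_add i2 i1)
      _ = 4 * E * C2 * volume U := by ring

lemma dist_K {F : En n → ℝ} (hF : IntegrableOn F (ball 0 1)) {t : ℝ} (ht : 0 < t)
    {C : ℝ≥0∞} {D κ : ℝ≥0∞} (hκ : κ ≤ 1 / 2)
    (H : ∀ U : Set (En n), IsOpen U → U ⊆ ball 0 1 → ∀ ψ, IsTestFun U ψ → (∀ x, 0 ≤ ψ x) → (∀ x, ψ x ≤ 1) →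
      ENNReal.ofReal |∫ x in ball 0 1, F x * ψ x| ≤ ENNReal.ofReal t * (D + κ * volume U))
    {K : Set (En n)} (hK : IsCompact K) (hKB : K ⊆ ball 0 1) (hKF : ∀ x ∈ K, t ≤ F x) : volume K ≤ 2 * D := by
  have hKfin : volume K ≠ ⊤ := hK.measure_lt_top.ne
  suffices h : volume K ≤ D + 1 / 2 * volume K by
    rcases eq_or_ne D ⊤ with hD | hD
    · rw [hD]; simp
    lift D to ℝ≥0 using hD
    lift volume K to ℝ≥0 using hKfin with v
    have e : (1 / 2 : ℝ≥0∞) = ((1 / 2 : ℝ≥0) : ℝ≥0∞) := by norm_num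
    rw [e] at h
    norm_cast at h ⊢
    rw [← NNReal.coe_le_coe] at h ⊢
    push_cast at h ⊢
    linarith
  refine ENNReal.le_of_forall_pos_le_add fun δ hδ _ => ?_
  obtain ⟨ν, hν⟩ : ∃ ν : Measure (En n), ν = (volume.restrict (ball 0 1)).withDensity (fun x => 1 + ‖F x‖ₑ) := ⟨_, rfl⟩
  have hνf : IsFiniteMeasure ν := by
    rw [hν]
    refine isFiniteMeasure_withDensity ?_
    rw [lintegral_add_left measurable_const]
    refine ENNReal.add_ne_top.2 ⟨?_, hF.2.ne⟩
    simpa using measure_ball_lt_top.ne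
  obtain ⟨η, hη⟩ : ∃ η : ℝ, η = min 1 t * δ / 2 := ⟨_, rfl⟩
  have hδ' : (0 : ℝ) < δ := by exact_mod_cast hδ
  have hη0 : 0 < η := by rw [hη]; positivity
  have hη1 : η ≤ δ / 2 := by rw [hη]; have := min_le_left 1 t; nlinarith
  have hη2 : η ≤ t * (δ / 2) := by rw [hη]; have := min_le_right 1 t; nlinarith
  obtain ⟨U0, hKU0, hU0, -, hνU⟩ := hK.measurableSet.exists_isOpen_diff_lt (μ := ν) (measure_ne_top _ _) (ε := ENNReal.ofReal η) (by simpa using hη0)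
  obtain ⟨U, hUdef⟩ : ∃ U, U = U0 ∩ ball 0 1 := ⟨_, rfl⟩
  have hU : IsOpen U := by rw [hUdef]; exact hU0.inter isOpen_ball
  have hUB : U ⊆ ball 0 1 := by rw [hUdef]; exact Set.inter_subset_right
  have hKU : K ⊆ U := by rw [hUdef]; exact Set.subset_inter hKU0 hKB
  have hdm : MeasurableSet (U \ K) := hU.measurableSet.diff hK.measurableSet
  have hd : ∫⁻ x in U \ K, (1 + ‖F x‖ₑ) ≤ ENNReal.ofReal η := by
    refine le_trans (le_of_eq ?_) (hνU.le.trans' (measure_mono (Set.diff_subset_diff_left (t := K) (hUdef ▸ Set.inter_subset_left : U ⊆ U0))))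
    rw [hν, withDensity_apply _ hdm, Measure.restrict_restrict hdm, Set.inter_eq_left.2 (Set.diff_subset.trans hUB)]
  obtain ⟨ψ, hψ, h0, h1, hψ1⟩ := smooth_urysohn hK hU hKU
  have hintegr : IntegrableOn (fun x => F x * ψ x) (ball 0 1) := int_mul_cont hF hψ.1.continuous
  have hvU : volume U ≤ volume K + ENNReal.ofReal η := by
    rw [← Set.union_diff_cancel hKU]
    refine (measure_union_le _ _).trans (add_le_add le_rfl (hd.trans' ?_))
    rw [← setLIntegral_one]
    exact lintegral_mono fun x => le_self_add
  have hsplit : ∫ x in ball 0 1, F x * ψ x = (∫ x in K, F x) + ∫ x in ball 0 1 \ K, F x * ψ x := by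
    rw [← setIntegral_congr_fun (f := fun x => F x * ψ x) hK.measurableSet (fun x hx => by simp [hψ1 x hx]),
      ← setIntegral_union Set.disjoint_sdiff_right (measurableSet_ball.diff hK.measurableSet) (hintegr.mono_set hKB) (hintegr.mono_set Set.diff_subset),
      Set.union_diff_cancel hKB]
  have hr : ENNReal.ofReal |∫ x in ball 0 1 \ K, F x * ψ x| ≤ ENNReal.ofReal η := by
    rw [← Real.enorm_eq_ofReal_abs]
    refine (enorm_integral_le_lintegral_enorm _).trans (hd.trans' ?_)
    rw [← lintegral_indicator (measurableSet_ball.diff hK.measurableSet), ← lintegral_indicator hdm]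
    refine lintegral_mono fun x => ?_
    by_cases hx : x ∈ U \ K
    · have hx3 : x ∈ ball (0 : En n) 1 \ K := ⟨hUB hx.1, hx.2⟩
      rw [Set.indicator_of_mem hx, Set.indicator_of_mem hx3, enorm_mul]
      refine (mul_le_of_le_one_right (by simp) ?_).trans le_add_self
      rw [Real.enorm_eq_ofReal_abs, abs_of_nonneg (h0 x)]
      simpa using h1 x
    · by_cases hx2 : x ∈ ball 0 1 \ K
      · have : ψ x = 0 := by
          by_contra h
          exact hx ⟨hψ.2.2 (subset_tsupport _ h), hx2.2⟩
        rw [Set.indicator_of_mem hx2, this]; simp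
      · rw [Set.indicator_of_notMem hx2]; simp
  have hlow : ENNReal.ofReal t * volume K ≤ ENNReal.ofReal |∫ x in ball 0 1, F x * ψ x| + ENNReal.ofReal η := by
    refine le_trans ?_ (add_le_add le_rfl hr)
    rw [← ENNReal.ofReal_add (abs_nonneg _) (abs_nonneg _), ← ENNReal.ofReal_toReal hKfin, ← ENNReal.ofReal_mul ht.le]
    apply ENNReal.ofReal_le_ofReal
    have : t * (volume K).toReal ≤ ∫ x in K, F x := by
      have := setIntegral_mono_on (f := fun _ => t) (g := F) (μ := volume) (s := K) (integrableOn_const hKfin) (hF.mono_set hKB) hK.measurableSet hKF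
      simpa [Measure.real, mul_comm] using this
    have h3 := le_abs_self (∫ x in ball 0 1, F x * ψ x)
    have h4 := neg_abs_le (∫ x in ball 0 1 \ K, F x * ψ x)
    linarith
  have hH := H U hU hUB ψ hψ h0 h1
  have h5 : ENNReal.ofReal t * volume K ≤ ENNReal.ofReal t * (D + 1 / 2 * volume K + δ) := by
    refine hlow.trans ((add_le_add hH le_rfl).trans ?_)
    have a1 : κ * volume U ≤ 1 / 2 * volume K + ENNReal.ofReal (δ / 2) := by
      refine (mul_le_mul' hκ hvU).trans ?_
      rw [mul_add]
      refine add_le_add le_rfl ((mul_le_of_le_one_left (by simp) (by simp)).trans (ENNReal.ofReal_le_ofReal hη1))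
    have a2 : ENNReal.ofReal η ≤ ENNReal.ofReal t * ENNReal.ofReal (δ / 2) := by
      rw [← ENNReal.ofReal_mul ht.le]; exact ENNReal.ofReal_le_ofReal hη2
    refine (add_le_add (mul_le_mul' le_rfl (add_le_add le_rfl a1)) a2).trans (le_of_eq ?_)
    have a3 : (δ : ℝ≥0∞) = ENNReal.ofReal (δ / 2) + ENNReal.ofReal (δ / 2) := by
      rw [← ENNReal.ofReal_add (by positivity) (by positivity), add_halves, ENNReal.ofReal_coe_nnreal]
    rw [a3]; ring
  exact (ENNReal.mul_le_mul_iff_right (by simpa using ht) ENNReal.ofReal_ne_top).1 h5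

lemma distr_pos {F : En n → ℝ} (hFm : Measurable F) (hF : IntegrableOn F (ball 0 1)) {t : ℝ} (ht : 0 < t)
    {D κ : ℝ≥0∞} (hκ : κ ≤ 1 / 2)
    (H : ∀ U : Set (En n), IsOpen U → U ⊆ ball 0 1 → ∀ ψ, IsTestFun U ψ → (∀ x, 0 ≤ ψ x) → (∀ x, ψ x ≤ 1) →
      ENNReal.ofReal |∫ x in ball 0 1, F x * ψ x| ≤ ENNReal.ofReal t * (D + κ * volume U)) :
    volume.restrict (ball 0 1) {x | t < F x} ≤ 2 * D := by
  have hm : MeasurableSet {x | t < F x} := measurableSet_lt measurable_const hFm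
  rw [Measure.restrict_apply hm, (hm.inter measurableSet_ball).measure_eq_iSup_isCompact]
  refine iSup_le fun K => iSup_le fun hKs => iSup_le fun hK => ?_
  exact dist_K (C := 0) hF ht hκ H hK (fun x hx => (hKs hx).2) fun x hx => (hKs hx).1.le

lemma dist_abs {F : En n → ℝ} (hF : IntegrableOn F (ball 0 1)) {t : ℝ} (ht : 0 < t)
    {D κ : ℝ≥0∞} (hκ : κ ≤ 1 / 2)
    (H : ∀ U : Set (En n), IsOpen U → U ⊆ ball 0 1 → ∀ ψ, IsTestFun U ψ → (∀ x, 0 ≤ ψ x) → (∀ x, ψ x ≤ 1) →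
      ENNReal.ofReal |∫ x in ball 0 1, F x * ψ x| ≤ ENNReal.ofReal t * (D + κ * volume U)) :
    volume.restrict (ball 0 1) {x | t < |F x|} ≤ 4 * D := by
  obtain ⟨F', hF'm, hFF'⟩ := hF.1.aemeasurable
  have hF' : IntegrableOn F' (ball 0 1) := Integrable.congr hF hFF'
  have H' : ∀ U : Set (En n), IsOpen U → U ⊆ ball 0 1 → ∀ ψ, IsTestFun U ψ → (∀ x, 0 ≤ ψ x) → (∀ x, ψ x ≤ 1) →
      ENNReal.ofReal |∫ x in ball 0 1, F' x * ψ x| ≤ ENNReal.ofReal t * (D + κ * volume U) := by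
    intro U hU hUB ψ h1 h2 h3
    have := H U hU hUB ψ h1 h2 h3
    rwa [integral_congr_ae (g := fun x => F' x * ψ x)] at this
    filter_upwards [hFF'] with x hx
    rw [hx]
  have p1 := distr_pos hF'm hF' ht hκ H'
  have p2 := distr_pos hF'm.neg hF'.neg ht hκ (fun U hU hUB ψ h1 h2 h3 => by
    simp only [Pi.neg_apply, neg_mul, integral_neg, abs_neg]
    exact H' U hU hUB ψ h1 h2 h3)
  calc volume.restrict (ball 0 1) {x | t < |F x|} = volume.restrict (ball 0 1) {x | t < |F' x|} := by
        refine measure_congr ?_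
        filter_upwards [hFF'] with x hx
        change (t < |F x|) = (t < |F' x|)
        rw [hx]
    _ ≤ volume.restrict (ball 0 1) ({x | t < F' x} ∪ {x | t < (-F') x}) := by
        refine measure_mono fun x hx => ?_
        exact (lt_abs.1 (show t < |F' x| from hx) : t < F' x ∨ t < -F' x)
    _ ≤ 2 * D + 2 * D := (measure_union_le _ _).trans (add_le_add p1 p2)
    _ = 4 * D := by ring

/-- The distribution estimate on the unit ball. -/
lemma dist_unit (N : ℕ) {m e : ℕ} (hne : n = m + 2 + e) (p q : ℝ) (hp : 2 < p) (hpq : q.HolderConjugate p) : ∃ C : ℝ≥0∞, C ≠ ⊤ ∧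
    ∀ (s : ℝ), 1 < s → ∀ (u : En n → Form n N (m+1)) (G : En n → Fin n → Form n N (m+1)), MemW1p (ball 0 1) s u G → TangentialZero (ball 0 1) u G →
    AEMeasurable (fun x => fnorm (extD (G x))) (volume.restrict (ball 0 1)) → AEMeasurable (fun x => fnorm (codiff (G x))) (volume.restrict (ball 0 1)) →
    ∀ l a, ∀ t > 0, volume.restrict (ball 0 1) {x | t < |G x l a|} ≤
      C * (KI (volume.restrict (ball 0 1)) q p (fun x => fnorm (extD (G x))) t + KI (volume.restrict (ball 0 1)) q p (fun x => fnorm (codiff (G x))) t) := by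
  have hn : 1 < n := by omega
  obtain ⟨C1, hC1, H1⟩ := key_bound (n := n) N hne
  obtain ⟨C2, hC2, H2⟩ := bnd_Lq hn p q hp hpq
  obtain ⟨d, hd⟩ : ∃ d, d = (C1 * C2).toReal := ⟨_, rfl⟩
  have hd0 : 0 ≤ d := by rw [hd]; exact ENNReal.toReal_nonneg
  obtain ⟨ε, hε⟩ : ∃ ε : ℝ, ε = 1 / (8 * d + 8) := ⟨_, rfl⟩
  have he : 0 < ε := by rw [hε]; positivity
  have he1 : ε ≤ 1 := by rw [hε, div_le_one (by positivity)]; linarith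
  have hqp : q ≤ p := by
    have := hpq.inv_add_inv_eq_one
    have h2 : p⁻¹ ≤ 2⁻¹ := inv_anti₀ (by norm_num) hp.le
    have h3 : (2:ℝ)⁻¹ ≤ q⁻¹ := by linarith
    have := (inv_le_inv₀ (by norm_num) hpq.pos).1 h3
    linarith
  have hκ : C1 * (4 * ENNReal.ofReal ε * C2) ≤ 1 / 2 := by
    have : C1 * (4 * ENNReal.ofReal ε * C2) = 4 * ENNReal.ofReal ε * (C1 * C2) := by ring
    rw [this, ← ENNReal.ofReal_toReal (ENNReal.mul_ne_top hC1 hC2), ← hd, show (4 : ℝ≥0∞) = ENNReal.ofReal 4 by simp, ← ENNReal.ofReal_mul (by norm_num),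
      ← ENNReal.ofReal_mul (by positivity), show (1 / 2 : ℝ≥0∞) = ENNReal.ofReal (1 / 2) by
        rw [ENNReal.ofReal_div_of_pos (by norm_num)]; simp]
    apply ENNReal.ofReal_le_ofReal
    rw [hε, mul_one_div, div_mul_eq_mul_div, div_le_iff₀ (by positivity)]
    linarith
  refine ⟨4 * (C1 * ENNReal.ofReal ((1 / ε) ^ p)), by finiteness, ?_⟩
  intro s hs u G hW hT hm1 hm2 l a t ht
  obtain ⟨hu, hG⟩ := memW_int hs hW
  rw [mul_assoc, mul_assoc]
  refine dist_abs (hG l a) ht hκ fun U hU hUB ψ hψ h0 h1 => ?_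
  have hψB : IsTestFun (ball 0 1) ψ := ⟨hψ.1, hψ.2.1, hψ.2.2.trans hUB⟩
  refine (H1 s hs u G hW hT ψ hψB l a).trans ?_
  refine (mul_le_mul' le_rfl (stepA hpq hqp (b := bnd l) (fun ψ hψ => bnd_meas hn l hψ) (H2 l) hm1 hm2 he he1 ht hU.measurableSet hUB hψ h0 h1)).trans (le_of_eq ?_)
  ring

def Tsc (x₀ : En n) (R : ℝ) (y : En n) : En n := x₀ + R • y
def Tin (x₀ : En n) (R : ℝ) (x : En n) : En n := R⁻¹ • (x - x₀)

lemma Tin_Tsc (x₀ : En n) {R : ℝ} (hR : 0 < R) (y : En n) : Tin x₀ R (Tsc x₀ R y) = y := by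
  unfold Tin Tsc; rw [add_sub_cancel_left, smul_smul, inv_mul_cancel₀ hR.ne', one_smul]

lemma Tsc_Tin (x₀ : En n) {R : ℝ} (hR : 0 < R) (y : En n) : Tsc x₀ R (Tin x₀ R y) = y := by
  unfold Tin Tsc; rw [smul_smul, mul_inv_cancel₀ hR.ne', one_smul]; abel

lemma Tin_smooth (x₀ : En n) (R : ℝ) : ContDiff ℝ (⊤ : ℕ∞) (Tin x₀ R) := by unfold Tin; fun_prop
lemma Tsc_cont (x₀ : En n) (R : ℝ) : Continuous (Tsc x₀ R) := by unfold Tsc; fun_prop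

def Thom (x₀ : En n) {R : ℝ} (hR : 0 < R) : En n ≃ₜ En n where
  toFun := Tsc x₀ R
  invFun := Tin x₀ R
  left_inv := Tin_Tsc x₀ hR
  right_inv := Tsc_Tin x₀ hR
  continuous_toFun := Tsc_cont x₀ R
  continuous_invFun := (Tin_smooth x₀ R).continuous

lemma Tsc_emb (x₀ : En n) {R : ℝ} (hR : 0 < R) : MeasurableEmbedding (Tsc x₀ R) := (Thom x₀ hR).measurableEmbedding

lemma Tsc_pre (x₀ : En n) {R : ℝ} (hR : 0 < R) : Tsc x₀ R ⁻¹' ball x₀ R = ball 0 1 := by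
  ext y
  simp only [Set.mem_preimage, mem_ball, Tsc, dist_self_add_left, norm_smul, Real.norm_eq_abs, abs_of_pos hR, dist_zero_right]
  constructor
  · intro h; nlinarith
  · intro h; nlinarith

lemma Tsc_map (x₀ : En n) {R : ℝ} (hR : 0 < R) :
    Measure.map (Tsc x₀ R) (volume.restrict (ball 0 1)) = ENNReal.ofReal ((R ^ n)⁻¹) • volume.restrict (ball x₀ R) := by
  rw [← Tsc_pre x₀ hR, ← (Tsc_emb x₀ hR).restrict_map, ← Measure.restrict_smul]
  congr 1
  have : Tsc x₀ R = (fun y => x₀ + y) ∘ (fun y => R • y) := rfl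
  rw [this, ← Measure.map_map (by fun_prop) (by fun_prop), Measure.map_addHaar_smul _ hR.ne', Measure.map_smul, map_add_left_eq_self]
  simp [abs_of_pos hR]

lemma Tsc_map' (x₀ : En n) {R : ℝ} (hR : 0 < R) :
    volume.restrict (ball x₀ R) = ENNReal.ofReal (R ^ n) • Measure.map (Tsc x₀ R) (volume.restrict (ball 0 1)) := by
  rw [Tsc_map x₀ hR, smul_smul, ← ENNReal.ofReal_mul (by positivity), mul_inv_cancel₀ (by positivity), ENNReal.ofReal_one, one_smul]

lemma sc_lint (x₀ : En n) {R : ℝ} (hR : 0 < R) (f : En n → ℝ≥0∞) :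
    ∫⁻ x in ball x₀ R, f x = ENNReal.ofReal (R ^ n) * ∫⁻ y in ball 0 1, f (Tsc x₀ R y) := by
  rw [Tsc_map' x₀ hR, lintegral_smul_measure, (Tsc_emb x₀ hR).lintegral_map, smul_eq_mul]

lemma sc_meas (x₀ : En n) {R : ℝ} (hR : 0 < R) (S : Set (En n)) :
    volume.restrict (ball x₀ R) S = ENNReal.ofReal (R ^ n) * volume.restrict (ball 0 1) (Tsc x₀ R ⁻¹' S) := by
  rw [Tsc_map' x₀ hR, Measure.smul_apply, (Tsc_emb x₀ hR).map_apply, smul_eq_mul]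

lemma sc_int (x₀ : En n) {R : ℝ} (hR : 0 < R) (f : En n → ℝ) :
    ∫ x in ball x₀ R, f x = R ^ n * ∫ y in ball 0 1, f (Tsc x₀ R y) := by
  rw [Tsc_map' x₀ hR, integral_smul_measure, (Tsc_emb x₀ hR).integral_map, smul_eq_mul, ENNReal.toReal_ofReal (by positivity)]

lemma sc_int' (x₀ : En n) {R : ℝ} (hR : 0 < R) (f : En n → ℝ) :
    ∫ y in ball 0 1, f (Tsc x₀ R y) = (R ^ n)⁻¹ * ∫ x in ball x₀ R, f x := by
  rw [sc_int x₀ hR, ← mul_assoc, inv_mul_cancel₀ (by positivity), one_mul]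

lemma sc_integrable (x₀ : En n) {R : ℝ} (hR : 0 < R) {f : En n → ℝ} (hf : IntegrableOn f (ball x₀ R)) :
    IntegrableOn (fun y => f (Tsc x₀ R y)) (ball 0 1) := by
  have := (Tsc_emb x₀ hR).integrable_map_iff (μ := volume.restrict (ball 0 1)) (g := f)
  rw [Tsc_map x₀ hR] at this
  exact this.1 (Integrable.smul_measure hf ENNReal.ofReal_ne_top)

lemma sc_aesm (x₀ : En n) {R : ℝ} (hR : 0 < R) {f : En n → ℝ} (hf : AEStronglyMeasurable f (volume.restrict (ball x₀ R))) :
    AEStronglyMeasurable (fun y => f (Tsc x₀ R y)) (volume.restrict (ball 0 1)) := by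
  have := (Tsc_emb x₀ hR).aestronglyMeasurable_map_iff (μ := volume.restrict (ball 0 1)) (g := f)
  rw [Tsc_map x₀ hR] at this
  exact this.1 (hf.smul_measure _)

lemma KI_sc (x₀ : En n) {R : ℝ} (hR : 0 < R) (p q t : ℝ) (Φ : En n → ℝ) :
    KI (volume.restrict (ball x₀ R)) q p Φ t = ENNReal.ofReal (R ^ n) * KI (volume.restrict (ball 0 1)) q p (fun y => Φ (Tsc x₀ R y)) t := by
  unfold KI; rw [sc_lint x₀ hR]

lemma fnorm_smul (c : ℝ) (hc : 0 ≤ c) (v : Form n N k) : fnorm (c • v) = c * fnorm v := by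
  unfold fnorm
  simp only [Pi.smul_apply, smul_eq_mul, mul_pow, ← Finset.mul_sum]
  rw [Real.sqrt_mul (by positivity), Real.sqrt_sq hc]

lemma Tin_tsupp (x₀ : En n) {R : ℝ} (hR : 0 < R) {φ : En n → ℝ} (hφ : IsTestFun (ball 0 1) φ) :
    IsTestFun (ball x₀ R) (fun x => φ (Tin x₀ R x)) := by
  refine ⟨hφ.1.comp (Tin_smooth x₀ R), hφ.2.1.comp_homeomorph (Thom x₀ hR).symm, ?_⟩
  refine (tsupport_comp_subset_preimage φ (Tin_smooth x₀ R).continuous).trans ?_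
  intro x hx
  have h := hφ.2.2 hx
  rw [← Tsc_pre x₀ hR] at h
  simpa [Tsc_Tin x₀ hR] using h

lemma pd_Tin (x₀ : En n) {R : ℝ} (hR : 0 < R) {φ : En n → ℝ} (hφ : ContDiff ℝ (⊤ : ℕ∞) φ) (i : Fin n) (y : En n) :
    fderiv ℝ (fun x => φ (Tin x₀ R x)) (Tsc x₀ R y) (basisVec i) = R⁻¹ * fderiv ℝ φ y (basisVec i) := by
  have h1 : HasFDerivAt (Tin x₀ R) (R⁻¹ • ContinuousLinearMap.id ℝ (En n)) (Tsc x₀ R y) := by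
    unfold Tin
    exact ((hasFDerivAt_id (𝕜 := ℝ) (Tsc x₀ R y)).sub_const x₀).const_smul R⁻¹
  have h2 : HasFDerivAt φ (fderiv ℝ φ y) (Tin x₀ R (Tsc x₀ R y)) := by
    rw [Tin_Tsc x₀ hR]; exact (sm_diff hφ y).hasFDerivAt
  have h3 := HasFDerivAt.comp (f := Tin x₀ R) (Tsc x₀ R y) h2 h1
  have h4 : fderiv ℝ (fun x => φ (Tin x₀ R x)) (Tsc x₀ R y) = _ := h3.fderiv
  rw [h4]; simp

lemma sc_W {x₀ : En n} {R s : ℝ} (hR : 0 < R) {u : En n → Form n N k} {G : En n → Fin n → Form n N k} (h : MemW1p (ball x₀ R) s u G) :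
    MemW1p (ball 0 1) s (fun y => R⁻¹ • u (Tsc x₀ R y)) (fun y => G (Tsc x₀ R y)) := by
  obtain ⟨h1, h2, h3, h4, h5⟩ := h
  refine ⟨?_, fun q => (sc_aesm x₀ hR (h2 q)).const_mul R⁻¹, fun i q => sc_aesm x₀ hR (h3 i q), ?_, sc_integrable x₀ hR h5⟩
  · intro i q φ hφ
    have := h1 i q _ (Tin_tsupp x₀ hR hφ)
    rw [sc_int x₀ hR, sc_int x₀ hR] at this
    simp only [pd_Tin x₀ hR hφ.1, Tin_Tsc x₀ hR] at this
    rw [← mul_neg] at this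
    have := mul_left_cancel₀ (by positivity) this
    rw [← this]
    congr 1; ext y
    simp only [Pi.smul_apply, smul_eq_mul]; ring
  · refine ((sc_integrable x₀ hR h4).const_mul (R⁻¹ ^ s)).congr (ae_of_all _ fun y => ?_)
    simp only
    rw [fnorm_smul _ (by positivity), Real.mul_rpow (by positivity) (show 0 ≤ fnorm (u (Tsc x₀ R y)) from Real.sqrt_nonneg _)]

lemma codiff_smul (c : ℝ) (H : Fin n → Form n N (k+1)) : codiff (fun i => c • H i) = c • codiff H := by
  ext q
  simp only [codiff, Pi.smul_apply, smul_eq_mul, mul_neg, Finset.mul_sum]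
  congr 1
  refine Finset.sum_congr rfl fun i _ => ?_
  split_ifs <;> ring

lemma sc_T {x₀ : En n} {R : ℝ} (hR : 0 < R) {u : En n → Form n N k} {G : En n → Fin n → Form n N k} (h : TangentialZero (ball x₀ R) u G) :
    TangentialZero (ball 0 1) (fun y => R⁻¹ • u (Tsc x₀ R y)) (fun y => G (Tsc x₀ R y)) := by
  intro ψ hψ
  have := h (fun x => ψ (Tin x₀ R x)) (fun q => (hψ q).comp (Tin_smooth x₀ R))
  rw [sc_int x₀ hR, sc_int x₀ hR] at this
  have := mul_left_cancel₀ (by positivity) this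
  simp only [Tin_Tsc x₀ hR] at this
  rw [this]
  congr 1; ext y
  have e : smoothGrad (fun x => ψ (Tin x₀ R x)) (Tsc x₀ R y) = fun i => R⁻¹ • smoothGrad ψ y i := by
    ext i q
    simp only [smoothGrad, Pi.smul_apply, smul_eq_mul]
    exact pd_Tin x₀ hR (hψ q) i y
  rw [e, codiff_smul]
  unfold finner
  refine Finset.sum_congr rfl fun q _ => ?_
  simp only [Pi.smul_apply, smul_eq_mul]; ring

def Mc (n N k : ℕ) : ℝ := n * Fintype.card (FormIdx n k × Fin N) + 1

lemma Mc_one : 1 ≤ Mc n N k := by unfold Mc; have : (0:ℝ) ≤ n * Fintype.card (FormIdx n k × Fin N) := by positivity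
                                  linarith

lemma gnorm_le {H : Fin n → Form n N k} {A : ℝ} (hA : 0 ≤ A) (h : ∀ i q, |H i q| ≤ A) : gnorm H ≤ Mc n N k * A := by
  unfold gnorm
  have hM := Mc_one (n := n) (N := N) (k := k)
  rw [Real.sqrt_le_left (by positivity)]
  calc ∑ i, ∑ q, H i q ^ 2 ≤ ∑ i : Fin n, ∑ q : FormIdx n k × Fin N, A ^ 2 := by
        refine Finset.sum_le_sum fun i _ => Finset.sum_le_sum fun q _ => ?_
        rw [← sq_abs]; exact pow_le_pow_left₀ (abs_nonneg _) (h i q) 2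
    _ = (Mc n N k - 1) * A ^ 2 := by
        simp only [Finset.sum_const, Finset.card_univ, nsmul_eq_mul, Fintype.card_fin, Mc]; ring
    _ ≤ (Mc n N k * A) ^ 2 := by
        rw [mul_pow]
        refine mul_le_mul_of_nonneg_right ?_ (sq_nonneg A)
        nlinarith

lemma triv_le {m : ℕ} (hn : n ≤ m + 1) (H : Fin n → Form n N (m+1)) (i : Fin n) (q) : |H i q| ≤ fnorm (codiff H) := by
  obtain ⟨⟨S, hS⟩, a⟩ := q
  have hu : S = Finset.univ := by
    apply Finset.eq_univ_of_card
    have := Finset.card_le_univ S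
    simp at this ⊢; omega
  have hc : (S.erase i).card = m := by
    rw [Finset.card_erase_of_mem (by rw [hu]; exact Finset.mem_univ i), hS]; rfl
  refine le_trans (le_of_eq ?_) (coef_le (codiff H) (⟨S.erase i, hc⟩, a))
  unfold codiff
  simp only
  rw [abs_neg, Finset.sum_eq_single i]
  · rw [dif_neg (by simp), abs_mul, abs_pow, abs_neg, abs_one, one_pow, one_mul]
    congr 4
    rw [Finset.insert_erase]; rw [hu]; exact Finset.mem_univ i
  · intro j _ hj
    rw [dif_pos]; rw [hu]; simp [hj]
  · simp

lemma KI_markov {μ : Measure (En n)} {Φ : En n → ℝ} (hΦ : AEMeasurable Φ μ) {p q t : ℝ} (ht : 0 < t) (hp : 0 ≤ p) (hq : 0 ≤ q) :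
    μ {x | t < |Φ x|} ≤ KI μ q p Φ t := by
  have := mul_meas_ge_le_lintegral₀ (KI_meas hΦ p q t) 1
  rw [one_mul] at this
  refine le_trans (measure_mono fun x hx => ?_) this
  have h1 : 1 ≤ |Φ x| / t := by rw [le_div_iff₀ ht, one_mul]; exact (show t < |Φ x| from hx).le
  change 1 ≤ ENNReal.ofReal _
  rw [ENNReal.one_le_ofReal]
  exact le_min (Real.one_le_rpow h1 hq) (Real.one_le_rpow h1 hp)

lemma KI_div {μ : Measure (En n)} (Φ : En n → ℝ) {p q t M : ℝ} (ht : 0 < t) (hq : 0 ≤ q) (hqp : q ≤ p) (hM : 1 ≤ M) :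
    KI μ q p Φ (t / M) ≤ ENNReal.ofReal (M ^ p) * KI μ q p Φ t := by
  unfold KI
  rw [← lintegral_const_mul' _ _ ENNReal.ofReal_ne_top]
  refine lintegral_mono fun x => ?_
  rw [← ENNReal.ofReal_mul (by positivity)]
  apply ENNReal.ofReal_le_ofReal
  have e : |Φ x| / (t / M) = M * (|Φ x| / t) := by field_simp
  rw [e, Real.mul_rpow (by positivity) (by positivity), Real.mul_rpow (by positivity) (by positivity), mul_min_of_nonneg _ _ (by positivity)]
  refine min_le_min (mul_le_mul_of_nonneg_right ?_ (by positivity)) le_rfl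
  exact Real.rpow_le_rpow_of_exponent_le hM hqp

/-- The componentwise distribution estimate on arbitrary balls. -/
lemma dist_ball (n N m : ℕ) (p q : ℝ) (hp : 2 < p) (hpq : q.HolderConjugate p) : ∃ C : ℝ≥0∞, C ≠ ⊤ ∧
    ∀ (s : ℝ), 1 < s → ∀ (R : ℝ) (x₀ : En n), 0 < R → ∀ (u : En n → Form n N (m+1)) (G : En n → Fin n → Form n N (m+1)),
      MemW1p (ball x₀ R) s u G → TangentialZero (ball x₀ R) u G →
    AEStronglyMeasurable (fun x => fnorm (extD (G x))) (volume.restrict (ball x₀ R)) →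
    AEStronglyMeasurable (fun x => fnorm (codiff (G x))) (volume.restrict (ball x₀ R)) →
    ∀ l a, ∀ t > 0, volume.restrict (ball x₀ R) {x | t < |G x l a|} ≤
      C * (KI (volume.restrict (ball x₀ R)) q p (fun x => fnorm (extD (G x))) t + KI (volume.restrict (ball x₀ R)) q p (fun x => fnorm (codiff (G x))) t) := by
  rcases le_or_gt n (m + 1) with hn | hn
  · refine ⟨1, by simp, ?_⟩
    intro s hs R x₀ hR u G hW hT hm1 hm2 l a t ht
    rw [one_mul]
    refine le_trans ?_ le_add_self
    refine le_trans (measure_mono fun x hx => ?_) (KI_markov hm2.aemeasurable ht hpq.symm.nonneg hpq.nonneg)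
    exact lt_of_lt_of_le (show t < |G x l a| from hx) ((triv_le hn (G x) l a).trans (le_abs_self _))
  · obtain ⟨e, he⟩ : ∃ e, n = m + 2 + e := ⟨n - (m + 2), by omega⟩
    obtain ⟨C, hC, H⟩ := dist_unit (n := n) N he p q hp hpq
    refine ⟨C, hC, ?_⟩
    intro s hs R x₀ hR u G hW hT hm1 hm2 l a t ht
    have := H s hs _ _ (sc_W hR hW) (sc_T hR hT) (sc_aesm x₀ hR hm1).aemeasurable (sc_aesm x₀ hR hm2).aemeasurable l a t ht
    rw [KI_sc x₀ hR, KI_sc x₀ hR, sc_meas x₀ hR, ← mul_add, mul_left_comm]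
    exact mul_le_mul' le_rfl this

lemma dist_gnorm (n N m : ℕ) (p q : ℝ) (hp : 2 < p) (hpq : q.HolderConjugate p) (hqp : q ≤ p) : ∃ C : ℝ≥0∞, C ≠ ⊤ ∧
    ∀ (s : ℝ), 1 < s → ∀ (R : ℝ) (x₀ : En n), 0 < R → ∀ (u : En n → Form n N (m+1)) (G : En n → Fin n → Form n N (m+1)),
      MemW1p (ball x₀ R) s u G → TangentialZero (ball x₀ R) u G →
    AEStronglyMeasurable (fun x => fnorm (extD (G x))) (volume.restrict (ball x₀ R)) →
    AEStronglyMeasurable (fun x => fnorm (codiff (G x))) (volume.restrict (ball x₀ R)) →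
    ∀ t > 0, volume.restrict (ball x₀ R) {x | t < |gnorm (G x)|} ≤
      C * (KI (volume.restrict (ball x₀ R)) q p (fun x => fnorm (extD (G x))) t + KI (volume.restrict (ball x₀ R)) q p (fun x => fnorm (codiff (G x))) t) := by
  obtain ⟨C, hC, H⟩ := dist_ball n N m p q hp hpq
  obtain ⟨M, hMd⟩ : ∃ M, M = Mc n N (m+1) := ⟨_, rfl⟩
  have hM : 1 ≤ M := by rw [hMd]; exact Mc_one
  refine ⟨(n * Fintype.card (FormIdx n (m+1) × Fin N) : ℕ) * (C * ENNReal.ofReal (M ^ p)), by finiteness, ?_⟩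
  intro s hs R x₀ hR u G hW hT hm1 hm2 t ht
  have hsub : {x | t < |gnorm (G x)|} ⊆ ⋃ z : Fin n × (FormIdx n (m+1) × Fin N), {x | t / M < |G x z.1 z.2|} := by
    intro x hx
    by_contra hc
    simp only [Set.mem_iUnion, Set.mem_setOf_eq, not_exists, not_lt] at hc
    have := gnorm_le (H := G x) (A := t / M) (by positivity) (fun i q => hc (i, q))
    rw [← hMd, mul_div_cancel₀ _ (by positivity)] at this
    have h2 : t < |gnorm (G x)| := hx
    rw [abs_of_nonneg (show 0 ≤ gnorm (G x) from Real.sqrt_nonneg _)] at h2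
    linarith
  refine (measure_mono hsub).trans ((measure_iUnion_fintype_le _ _).trans ?_)
  refine (Finset.sum_le_sum fun z _ => (H s hs R x₀ hR u G hW hT hm1 hm2 z.1 z.2 (t / M) (by positivity)).trans
    (mul_le_mul' le_rfl (add_le_add (KI_div _ ht hpq.nonneg hqp hM) (KI_div _ ht hpq.nonneg hqp hM)))).trans (le_of_eq ?_)
  rw [Finset.sum_const, Finset.card_univ, Fintype.card_prod, Fintype.card_fin, nsmul_eq_mul]
  ring

lemma KI_congr {μ : Measure (En n)} {Φ Ψ : En n → ℝ} (h : Φ =ᵐ[μ] Ψ) (p q t : ℝ) : KI μ q p Φ t = KI μ q p Ψ t := by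
  unfold KI
  refine lintegral_congr_ae ?_
  filter_upwards [h] with x hx
  rw [hx]

/-- **Boundary Lorentz estimates for the linear `d`–`δ` system.** Let `u ∈ W^{1,s}(B_R)`
solve `du = f`, `δu = g` in `B_R` with vanishing tangential part `ν ∧ u = 0` on `∂B_R`
(here `u` has degree `m+1`, `f` degree `m+2` and `g` degree `m`). If
`f, g ∈ L^{(r,θ)}(B_R)`, then `u ∈ W^{1,(r,θ)}(B_R)` and
`‖∇u‖_{L^{(r,θ)}(B_R)} ≤ c (‖f‖_{L^{(r,θ)}(B_R)} + ‖g‖_{L^{(r,θ)}(B_R)})` with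
`c = c(n,N,k,θ)` and no term in `u` on the right-hand side. -/
theorem boundary_lorentz_estimates_linear_system
    (n N m : ℕ) (r s : ℝ) (θ : ℝ≥0∞) (hr : 1 < r) (hs : 1 < s) (hθ : 0 < θ) :
    ∃ C : ℝ, 0 < C ∧
      ∀ (R : ℝ) (x₀ : En n), 0 < R →
        ∀ (u : En n → Form n N (m + 1)) (G : En n → Fin n → Form n N (m + 1))
          (f : En n → Form n N (m + 2)) (g : En n → Form n N m),
          MemW1p (ball x₀ R) s u G →
          TangentialZero (ball x₀ R) u G →
          (∀ᵐ x ∂volume.restrict (ball x₀ R), extD (G x) = f x) →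
          (∀ᵐ x ∂volume.restrict (ball x₀ R), codiff (G x) = g x) →
          MemLorentzOn volume r θ (fun x => fnorm (f x)) (ball x₀ R) →
          MemLorentzOn volume r θ (fun x => fnorm (g x)) (ball x₀ R) →
          MemLorentzOn volume r θ (fun x => gnorm (G x)) (ball x₀ R) ∧
            lorentzNorm (volume.restrict (ball x₀ R)) r θ (fun y => gnorm (G y)) ≤
              ENNReal.ofReal C *
                (lorentzNorm (volume.restrict (ball x₀ R)) r θ (fun y => fnorm (f y)) +
                  lorentzNorm (volume.restrict (ball x₀ R)) r θ (fun y => fnorm (g y))) := by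
  obtain ⟨p, hpd⟩ : ∃ p : ℝ, p = r + r / (r - 1) + 2 := ⟨_, rfl⟩
  have hr0 : 0 < r - 1 := by linarith
  have hrr : 0 < r / (r - 1) := by positivity
  have hp : 2 < p := by rw [hpd]; linarith
  have hrp : r < p := by rw [hpd]; linarith
  have hpq : (p / (p - 1)).HolderConjugate p := (Real.HolderConjugate.conjExponent (by linarith)).symm
  have hqr : p / (p - 1) < r := by
    have : r / (r - 1) < p := by rw [hpd]; linarith
    rw [div_lt_iff₀ hr0] at this
    rw [div_lt_iff₀ (by linarith)]
    linarith
  obtain ⟨q, hq⟩ : ∃ q, q = p / (p - 1) := ⟨_, rfl⟩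
  rw [← hq] at hpq hqr
  obtain ⟨C1, hC1, H1⟩ := dist_gnorm n N m p q hp hpq (by linarith)
  obtain ⟨C2, hC2, H2⟩ := lorentz_interp q p r hpq.pos hqr hrp θ hθ C1 hC1
  refine ⟨C2.toReal + 1, by positivity, ?_⟩
  intro R x₀ hR u G f g hW hT hf hg hfL hgL
  have hf' : (fun x => fnorm (extD (G x))) =ᵐ[volume.restrict (ball x₀ R)] fun x => fnorm (f x) := by
    filter_upwards [hf] with x hx
    rw [hx]
  have hg' : (fun x => fnorm (codiff (G x))) =ᵐ[volume.restrict (ball x₀ R)] fun x => fnorm (g x) := by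
    filter_upwards [hg] with x hx
    rw [hx]
  have hmain := H2 (volume.restrict (ball x₀ R)) (fun x => gnorm (G x)) (fun x => fnorm (f x)) (fun x => fnorm (g x))
    hfL.1.aemeasurable hgL.1.aemeasurable (fun t ht => by
      have := H1 s hs R x₀ hR u G hW hT (hfL.1.congr hf'.symm) (hgL.1.congr hg'.symm) t ht
      rwa [KI_congr hf', KI_congr hg'] at this)
  have hmain2 : lorentzNorm (volume.restrict (ball x₀ R)) r θ (fun y => gnorm (G y)) ≤
              ENNReal.ofReal (C2.toReal + 1) *
                (lorentzNorm (volume.restrict (ball x₀ R)) r θ (fun y => fnorm (f y)) +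
                  lorentzNorm (volume.restrict (ball x₀ R)) r θ (fun y => fnorm (g y))) := by
    refine hmain.trans (mul_le_mul' ?_ le_rfl)
    nth_rewrite 1 [← ENNReal.ofReal_toReal hC2]
    exact ENNReal.ofReal_le_ofReal (by linarith)
  refine ⟨⟨?_, ?_⟩, hmain2⟩
  · unfold gnorm
    refine Real.continuous_sqrt.comp_aestronglyMeasurable ?_
    refine Finset.aestronglyMeasurable_fun_sum _ fun i _ => Finset.aestronglyMeasurable_fun_sum _ fun q _ => ?_
    exact (hW.2.2.1 i q).pow 2
  · exact ne_top_of_le_ne_top (ENNReal.mul_ne_top ENNReal.ofReal_ne_top (ENNReal.add_ne_top.2 ⟨hfL.2, hgL.2⟩)) hmain2
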